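/- There exists an exponent β ∈ (0,1/2), depending only on (d,γ,λ,Λ), such that: (i) for every ξ ∈ ℝ^d the limit σ(ξ) := lim_{L→∞} σ_L(ξ) exists; (ii) σ is twice continuously differentiable on ℝ^d; (iii) for every R ∈ [1,∞) there exists a constant C < ∞, depending only on (R,M,d,γ,λ,Λ), such that for every ξ, ξ' in the closed ball B_R = {ζ ∈ ℝ^d : |ζ| ≤ R} and every integer L ≥ 2, one has |D²σ(ξ) − D²σ(ξ')| ≤ C|ξ − ξ'|^β and sup_{ξ∈B_R} |D²σ_L(ξ) − D²σ(ξ)| ≤ C L^{−β}. -/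

import Mathlib

/- Theorem 1.1 (C² regularity of the surface tension): there is an exponent
`β ∈ (0,1/2)` depending only on `(d,γ,λ,Λ)` such that for every admissible
potential `V` (with Hölder constant `M` for `V''`) the finite-volume surface
tensions `σ_L` converge pointwise to a `C²` function `σ`, and for every `R ≥ 1`
there is `C = C(R,M,d,γ,λ,Λ)` with, for all `ξ,ξ' ∈ B_R` and `L ≥ 2`:
`|D²σ(ξ) − D²σ(ξ')| ≤ C|ξ−ξ'|^β` and `|D²σ_L(ξ) − D²σ(ξ)| ≤ C L^{−β}`. -/

open MeasureTheory Real Filter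

noncomputable section

abbrev Zd (d : ℕ) := Fin d → ℤ

/-- nearest-neighbour adjacency on ℤ^d -/
def adj {d : ℕ} (x y : Zd d) : Prop := (∑ i, |x i - y i|) = 1

/-- the cube Q_L = [-L,L]^d ∩ ℤ^d -/
def cube (d : ℕ) (L : ℤ) : Finset (Zd d) :=
  Fintype.piFinset fun _ => Finset.Icc (-L) L

open Classical in
/-- interior of U -/
def intr {d : ℕ} (U : Finset (Zd d)) : Finset (Zd d) :=
  U.filter fun x => ∀ y : Zd d, adj x y → y ∈ U

/-- the neighbour x ± e_i of x -/
def step {d : ℕ} (x : Zd d) (i : Fin d) (s : Bool) : Zd d :=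
  Function.update x i (x i + (if s then 1 else -1))

/-- configurations Ω₀(Q_L) ≅ ℝ^{Q_L°} -/
abbrev Conf (d : ℕ) (L : ℤ) := (↥(intr (cube d L))) → ℝ

/-- extension by zero -/
def extD {d : ℕ} {L : ℤ} (φ : Conf d L) : Zd d → ℝ :=
  fun x => if h : x ∈ intr (cube d L) then φ ⟨x, h⟩ else 0

/-- ξ·(y-x) -/
def xiDot {d : ℕ} (ξ : EuclideanSpace ℝ (Fin d)) (x y : Zd d) : ℝ :=
  ∑ i, ξ i * ((y i - x i : ℤ) : ℝ)

/-- the Hamiltonian Σ_{x∈Q_L°} Σ_{y∼x} V(ψ(y)-ψ(x)-ξ·(y-x)) -/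
def hamil {d : ℕ} (V : ℝ → ℝ) (L : ℤ) (ξ : EuclideanSpace ℝ (Fin d)) (ψ : Zd d → ℝ) : ℝ :=
  ∑ x ∈ intr (cube d L), ∑ i : Fin d, ∑ s : Bool,
    V (ψ (step x i s) - ψ x - xiDot ξ x (step x i s))

/-- the partition function Z_{L,ξ} -/
def Zpart (d : ℕ) (V : ℝ → ℝ) (L : ℤ) (ξ : EuclideanSpace ℝ (Fin d)) : ℝ :=
  ∫ φ : Conf d L, Real.exp (-(hamil V L ξ (extD φ)))

/-- the finite-volume surface tension σ_L(ξ) := −|Q_L|⁻¹ log(Z_{L,ξ}/Z_{L,0}) -/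
def sigmaL (d : ℕ) (V : ℝ → ℝ) (L : ℕ) (ξ : EuclideanSpace ℝ (Fin d)) : ℝ :=
  -(1 / ((cube d (L : ℤ)).card : ℝ)) * Real.log (Zpart d V (L : ℤ) ξ / Zpart d V (L : ℤ) 0)

set_option linter.unusedSectionVars false

/-- Gibbs average -/
def avg {X : Type*} [MeasureSpace X] (H f : X → ℝ) : ℝ :=
  (∫ x, f x * Real.exp (-H x)) / ∫ x, Real.exp (-H x)

section Chain

variable {E : Type*} [NormedAddCommGroup E] [InnerProductSpace ℝ E] [FiniteDimensional ℝ E]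
  [MeasurableSpace E] [BorelSpace E]

/-- `D` behaves like the gradient of a confining Hamiltonian `H`, with quantitative constants. -/
structure IsHam (H : E → ℝ) (D : E → E) (K c τ₀ a b : ℝ) : Prop where
  contH : Continuous H
  K_nonneg : 0 ≤ K
  c_pos : 0 < c
  τ_pos : 0 < τ₀
  τ_le : τ₀ ≤ 1
  cτ_le : c * τ₀ ≤ 1
  a_pos : 0 < a
  taylor : ∀ x y, |H y - H x - inner ℝ (D x + D y) (y - x) / 2| ≤ K * ‖y - x‖ ^ 2
  lip : ∀ x y, ‖D x - D y‖ ≤ K * ‖x - y‖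
  contr : ∀ τ, 0 < τ → τ ≤ τ₀ → ∀ x y, ‖(x - τ • D x) - (y - τ • D y)‖ ≤ (1 - c * τ) * ‖x - y‖
  lower : ∀ x, a * ‖x‖ ^ 2 - b ≤ H x

/-- unnormalised Gaussian weight -/
def gw (τ : ℝ) (z : E) : ℝ := Real.exp (-(1 / (4 * τ)) * ‖z‖ ^ 2)

/-- one step of the Langevin chain -/
def lstep (D : E → E) (τ : ℝ) (f : E → ℝ) (x : E) : ℝ :=
  (∫ z, f (x - τ • D x + z) * gw τ z) / ∫ z : E, gw τ z


theorem integrable_gauss {b : ℝ} (hb : 0 < b) :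
    Integrable (fun z : E => Real.exp (-b * ‖z‖ ^ 2)) := by
  have h := (GaussianFourier.integrable_cexp_neg_mul_sq_norm_add (V := E) (b := (b : ℂ))
    (by simpa using hb) 0 0).norm
  refine h.congr (ae_of_all _ fun z => ?_)
  simp only [Complex.norm_exp]
  congr 1
  have : (-(b : ℂ) * (‖z‖ : ℂ) ^ 2 + 0 * ((inner ℝ (0 : E) z : ℝ) : ℂ)) = ((-b * ‖z‖ ^ 2 : ℝ) : ℂ) := by
    push_cast; ring
  rw [this, Complex.ofReal_re]

theorem integrable_poly_gauss {b : ℝ} (hb : 0 < b) :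
    Integrable (fun z : E => (1 + ‖z‖ ^ 4) * Real.exp (-b * ‖z‖ ^ 2)) := by
  have h := (integrable_gauss (E := E) (half_pos hb)).const_mul (1 + 8 / b ^ 2)
  refine h.mono' (by fun_prop) (ae_of_all _ fun z => ?_)
  rw [Real.norm_of_nonneg (by positivity)]
  have h1 : Real.exp (-b * ‖z‖ ^ 2) = Real.exp (-(b / 2) * ‖z‖ ^ 2) * Real.exp (-(b / 2) * ‖z‖ ^ 2) := by
    rw [← Real.exp_add]; congr 1; ring
  have h2 : (b / 2 * ‖z‖ ^ 2) ^ 2 / 2 ≤ Real.exp (b / 2 * ‖z‖ ^ 2) := by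
    have := Real.quadratic_le_exp_of_nonneg (x := b / 2 * ‖z‖ ^ 2) (by positivity)
    nlinarith [show 0 ≤ b / 2 * ‖z‖ ^ 2 by positivity]
  have h3 : (1 + ‖z‖ ^ 4) * Real.exp (-(b / 2) * ‖z‖ ^ 2) ≤ 1 + 8 / b ^ 2 := by
    have e1 : Real.exp (-(b / 2) * ‖z‖ ^ 2) ≤ 1 := by
      rw [Real.exp_le_one_iff]; have : 0 ≤ b / 2 * ‖z‖ ^ 2 := by positivity
      linarith
    have e2 : ‖z‖ ^ 4 ≤ 8 / b ^ 2 * Real.exp (b / 2 * ‖z‖ ^ 2) := by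
      rw [div_mul_eq_mul_div, le_div_iff₀ (by positivity)]; nlinarith
    have e3 : Real.exp (b / 2 * ‖z‖ ^ 2) * Real.exp (-(b / 2) * ‖z‖ ^ 2) = 1 := by
      rw [← Real.exp_add, ← Real.exp_zero]; congr 1; ring
    have e4 := mul_le_mul_of_nonneg_right e2 (Real.exp_pos (-(b / 2) * ‖z‖ ^ 2)).le
    rw [mul_assoc, e3] at e4
    nlinarith
  rw [h1, ← mul_assoc]
  exact mul_le_mul_of_nonneg_right h3 (Real.exp_pos _).le

theorem gw_eq_integrable_poly {τ : ℝ} (hτ : 0 < τ) :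
    Integrable (fun z : E => (1 + ‖z‖ ^ 4) * gw τ z) :=
  integrable_poly_gauss (by positivity)

theorem gw_integrable {τ : ℝ} (hτ : 0 < τ) : Integrable (fun z : E => gw τ z) :=
  integrable_gauss (by positivity)

theorem gw_pos (τ : ℝ) (z : E) : 0 < gw τ z := Real.exp_pos _

theorem gw_cont (τ : ℝ) : Continuous (fun z : E => gw τ z) := by unfold gw; fun_prop

theorem integral_gw_pos {τ : ℝ} (hτ : 0 < τ) : 0 < ∫ z : E, gw τ z := by
  have := integral_exp_pos (μ := (volume : Measure E)) (f := fun z : E => -(1 / (4 * τ)) * ‖z‖ ^ 2)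
    (gw_integrable hτ)
  simpa [gw] using this

theorem le_one_add_pow4 {t : ℝ} (_ : 0 ≤ t) : t ≤ 1 + t ^ 4 ∧ t ^ 2 ≤ 1 + t ^ 4 ∧ t ^ 3 ≤ 1 + t ^ 4 := by
  refine ⟨?_, ?_, ?_⟩ <;> nlinarith [sq_nonneg (t^2 - 1), sq_nonneg (t - 1), sq_nonneg (t^2-t), sq_nonneg t]

/-- continuous functions of polynomial growth are integrable against `exp (-b‖x‖²)`-type weights -/
theorem integrable_of_poly {w f : E → ℝ} (hw : Integrable (fun z : E => (1 + ‖z‖ ^ 4) * w z))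
    (hwc : Continuous w) (hw0 : ∀ z, 0 ≤ w z) (hf : Continuous f) {C : ℝ}
    (hC : ∀ z, |f z| ≤ C * (1 + ‖z‖ ^ 4)) : Integrable (fun z => f z * w z) := by
  refine (hw.const_mul C).mono' (by fun_prop) (ae_of_all _ fun z => ?_)
  rw [Real.norm_eq_abs, abs_mul, abs_of_nonneg (hw0 z), ← mul_assoc]
  exact mul_le_mul_of_nonneg_right (hC z) (hw0 z)

theorem lip_continuous {F : Type*} [SeminormedAddCommGroup F] {f : E → F} {L : ℝ}
    (hf : ∀ x y, ‖f x - f y‖ ≤ L * ‖x - y‖) : Continuous f := by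
  have : LipschitzWith (Real.toNNReal L) f := LipschitzWith.of_dist_le_mul fun x y => by
    rw [dist_eq_norm, dist_eq_norm]
    exact (hf x y).trans (mul_le_mul_of_nonneg_right (Real.le_coe_toNNReal L) (norm_nonneg _))
  exact this.continuous

theorem lip_growth {f : E → ℝ} {L : ℝ} (hL : 0 ≤ L) (hf : ∀ x y, |f x - f y| ≤ L * ‖x - y‖) (x : E) :
    |f x| ≤ (|f 0| + L) * (1 + ‖x‖ ^ 4) := by
  have h1 := hf x 0
  rw [sub_zero] at h1
  have h2 : |f x| ≤ |f 0| + L * ‖x‖ := by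
    have := abs_add_le (f x - f 0) (f 0); rw [sub_add_cancel] at this; linarith
  obtain ⟨h3, -, -⟩ := le_one_add_pow4 (norm_nonneg x)
  have := mul_le_mul_of_nonneg_left h3 hL
  have h5 : 0 ≤ |f 0| * ‖x‖ ^ 4 := by positivity
  nlinarith

namespace IsHam
variable {H : E → ℝ} {D : E → E} {K c τ₀ a b : ℝ}

theorem contD (h : IsHam H D K c τ₀ a b) : Continuous D := lip_continuous h.lip

theorem integrable_poly (h : IsHam H D K c τ₀ a b) :
    Integrable (fun x : E => (1 + ‖x‖ ^ 4) * Real.exp (-H x)) := by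
  have h1 := (integrable_poly_gauss (E := E) h.a_pos).const_mul (Real.exp b)
  have := h.contH
  refine h1.mono' (by fun_prop) (ae_of_all _ fun z => ?_)
  rw [Real.norm_of_nonneg (by positivity), mul_left_comm, ← Real.exp_add]
  refine mul_le_mul_of_nonneg_left (Real.exp_le_exp.2 ?_) (by positivity)
  have := h.lower z
  linarith

theorem integrable_mul (h : IsHam H D K c τ₀ a b) {f : E → ℝ} (hf : Continuous f) {C : ℝ}
    (hC : ∀ z, |f z| ≤ C * (1 + ‖z‖ ^ 4)) : Integrable (fun z => f z * Real.exp (-H z)) :=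
  integrable_of_poly h.integrable_poly (by have := h.contH; fun_prop) (fun _ => (Real.exp_pos _).le) hf hC

theorem integrable_exp (h : IsHam H D K c τ₀ a b) : Integrable (fun z => Real.exp (-H z)) := by
  have := h.integrable_mul (f := fun _ => 1) continuous_const (C := 1) (fun z => by
    simp)
  simpa using this

theorem integral_pos (h : IsHam H D K c τ₀ a b) : 0 < ∫ z, Real.exp (-H z) :=
  integral_exp_pos h.integrable_exp

theorem integrable_lip (h : IsHam H D K c τ₀ a b) {f : E → ℝ} {L : ℝ} (hL : 0 ≤ L)
    (hf : ∀ x y, |f x - f y| ≤ L * ‖x - y‖) : Integrable (fun z => f z * Real.exp (-H z)) :=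
  h.integrable_mul (lip_continuous hf) (lip_growth hL hf)

end IsHam

theorem integrable_lip_gw {τ : ℝ} (hτ : 0 < τ) {f : E → ℝ} {L : ℝ} (hL : 0 ≤ L)
    (hf : ∀ x y, |f x - f y| ≤ L * ‖x - y‖) (v : E) :
    Integrable (fun z => f (v + z) * gw τ z) := by
  have hg : ∀ x y, |f (v + x) - f (v + y)| ≤ L * ‖x - y‖ := fun x y => by
    simpa using hf (v + x) (v + y)
  exact integrable_of_poly (gw_eq_integrable_poly hτ) (gw_cont τ) (fun z => (gw_pos τ z).le)
    (lip_continuous hg) (lip_growth (f := fun z => f (v + z)) hL hg)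

theorem lstep_lip {D : E → E} {τ : ℝ} (hτ : 0 < τ) {f : E → ℝ} {L q : ℝ} (hL : 0 ≤ L)
    (hf : ∀ x y, |f x - f y| ≤ L * ‖x - y‖)
    (hD : ∀ x y, ‖(x - τ • D x) - (y - τ • D y)‖ ≤ q * ‖x - y‖) (x y : E) :
    |lstep D τ f x - lstep D τ f y| ≤ q * L * ‖x - y‖ := by
  have hN := integral_gw_pos (E := E) hτ
  rw [lstep, lstep, ← sub_div, abs_div, abs_of_pos hN, div_le_iff₀ hN,
    ← integral_sub (integrable_lip_gw hτ hL hf _) (integrable_lip_gw hτ hL hf _),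
    ← integral_const_mul]
  refine (abs_integral_le_integral_abs).trans (integral_mono_of_nonneg (ae_of_all _ fun z => abs_nonneg _)
    ((gw_integrable hτ).const_mul _) (ae_of_all _ fun z => ?_))
  simp only
  rw [← sub_mul, abs_mul, abs_of_pos (gw_pos τ z)]
  refine mul_le_mul_of_nonneg_right ?_ (gw_pos τ z).le
  refine (hf _ _).trans ?_
  rw [add_sub_add_right_eq_sub]
  calc _ ≤ L * (q * ‖x - y‖) := mul_le_mul_of_nonneg_left (hD x y) hL
    _ = _ := by ring

end Chain

section Chain

variable {E : Type*} [NormedAddCommGroup E] [InnerProductSpace ℝ E] [FiniteDimensional ℝ E]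
  [MeasurableSpace E] [BorelSpace E]

theorem abs_exp_sub_le (p q : ℝ) :
    |Real.exp p - Real.exp q| ≤ |p - q| * (Real.exp p + Real.exp q) := by
  have key : ∀ p q : ℝ, q ≤ p → |Real.exp p - Real.exp q| ≤ |p - q| * (Real.exp p + Real.exp q) := by
    intro p q h
    rw [abs_of_nonneg (sub_nonneg.2 (Real.exp_le_exp.2 h)), abs_of_nonneg (sub_nonneg.2 h)]
    have h1 : Real.exp q = Real.exp p * Real.exp (q - p) := by rw [← Real.exp_add]; congr 1; ring
    have h2 := Real.add_one_le_exp (q - p)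
    have := mul_le_mul_of_nonneg_left h2 (Real.exp_pos p).le
    nlinarith [mul_nonneg (sub_nonneg.2 h) (Real.exp_pos q).le]
  rcases le_total q p with h | h
  · exact key p q h
  · rw [abs_sub_comm, abs_sub_comm p q, add_comm]; exact key q p h

theorem gw_smul {τ : ℝ} (hτ : 0 < τ) (z : E) : gw τ (Real.sqrt τ • z) = gw 1 z := by
  unfold gw
  rw [norm_smul, mul_pow, Real.norm_of_nonneg (Real.sqrt_nonneg _), Real.sq_sqrt hτ.le]
  congr 1; field_simp

theorem gw_third_moment {τ : ℝ} (hτ : 0 < τ) :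
    ∫ z : E, ‖z‖ ^ 3 * gw τ z
      = τ * Real.sqrt τ * ((∫ z : E, ‖z‖ ^ 3 * gw 1 z) / ∫ z : E, gw 1 z) * ∫ z : E, gw τ z := by
  have hs : 0 < Real.sqrt τ := Real.sqrt_pos.2 hτ
  have h1 := Measure.integral_comp_smul (volume : Measure E) (fun z : E => ‖z‖ ^ 3 * gw τ z) (Real.sqrt τ)
  have h2 := Measure.integral_comp_smul (volume : Measure E) (fun z : E => gw τ z) (Real.sqrt τ)
  simp only [gw_smul hτ, smul_eq_mul] at h1 h2
  have h3 : ∀ z : E, ‖Real.sqrt τ • z‖ ^ 3 * gw 1 z = (τ * Real.sqrt τ) * (‖z‖ ^ 3 * gw 1 z) := by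
    intro z
    rw [norm_smul, mul_pow, Real.norm_of_nonneg hs.le, pow_succ, Real.sq_sqrt hτ.le]; ring
  simp only [h3, integral_const_mul] at h1
  set r := |((Real.sqrt τ) ^ Module.finrank ℝ E)⁻¹| with hr
  have hr0 : 0 < r := by rw [hr]; positivity
  have hN := integral_gw_pos (E := E) hτ
  rw [h2]
  set A := ∫ z : E, ‖z‖ ^ 3 * gw 1 z
  set B := ∫ z : E, ‖z‖ ^ 3 * gw τ z
  set N := ∫ z : E, gw τ z
  have hrN : r * N ≠ 0 := by positivity
  have : B = r⁻¹ * (τ * Real.sqrt τ * A) := by rw [h1]; field_simp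
  rw [this]; field_simp

/-- the shear `(x, z) ↦ (x, T x + z)` -/
def shear (T : E → E) (hT : Continuous T) : E × E ≃ₜ E × E where
  toFun p := (p.1, T p.1 + p.2)
  invFun p := (p.1, p.2 - T p.1)
  left_inv p := by simp
  right_inv p := by simp
  continuous_toFun := by fun_prop
  continuous_invFun := by fun_prop

theorem shear_mp (T : E → E) (hT : Continuous T) :
    MeasurePreserving (shear T hT) ((volume : Measure E).prod volume) ((volume : Measure E).prod volume) := by
  have := (MeasurePreserving.id (volume : Measure E)).skew_product (μc := (volume : Measure E))
    (μd := (volume : Measure E)) (g := fun x z => T x + z)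
    (by unfold Function.uncurry; fun_prop)
    (ae_of_all _ fun x => (measurePreserving_add_left volume (T x)).map_eq)
  exact this

theorem shear_integrable (T : E → E) (hT : Continuous T) (F : E × E → ℝ) :
    Integrable (fun p : E × E => F (p.1, T p.1 + p.2)) ((volume : Measure E).prod volume)
      ↔ Integrable F ((volume : Measure E).prod volume) :=
  (shear_mp T hT).integrable_comp_emb (shear T hT).measurableEmbedding

theorem shear_integral (T : E → E) (hT : Continuous T) (F : E × E → ℝ) :
    ∫ p, F (p.1, T p.1 + p.2) ∂((volume : Measure E).prod volume)
      = ∫ p, F p ∂((volume : Measure E).prod volume) :=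
  (shear_mp T hT).integral_comp (shear T hT).measurableEmbedding F

namespace IsHam
variable {H : E → ℝ} {D : E → E} {K c τ₀ a b : ℝ}

/-- constant in the one-step stationarity error -/
def errC (H : E → ℝ) (D : E → E) (K : ℝ) : ℝ :=
  K * (6 + K) * ((∫ z : E, ‖z‖ ^ 3 * gw 1 z) / (∫ z : E, gw 1 z) * (∫ x, Real.exp (-H x))
    + ∫ x, ‖D x‖ ^ 3 * Real.exp (-H x))

theorem growthD (h : IsHam H D K c τ₀ a b) (x : E) :
    ‖D x‖ ≤ (‖D 0‖ + K) * (1 + ‖x‖ ^ 4) ∧ ‖D x‖ ^ 3 ≤ (4 * ‖D 0‖ ^ 3 + 4 * K ^ 3) * (1 + ‖x‖ ^ 4) := by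
  have h1 := h.lip x 0
  rw [sub_zero] at h1
  have h2 : ‖D x‖ ≤ ‖D 0‖ + K * ‖x‖ := by
    have := norm_add_le (D x - D 0) (D 0); rw [sub_add_cancel] at this; linarith
  have hK := h.K_nonneg
  obtain ⟨h3, -, h4⟩ := le_one_add_pow4 (norm_nonneg x)
  have hD := norm_nonneg (D 0)
  have hx4 : 0 ≤ ‖x‖ ^ 4 := by positivity
  constructor
  · have := mul_le_mul_of_nonneg_left h3 hK
    nlinarith [mul_nonneg hD hx4]
  · have h5 : ‖D x‖ ^ 3 ≤ (‖D 0‖ + K * ‖x‖) ^ 3 := pow_le_pow_left₀ (norm_nonneg _) h2 3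
    have h6 : (‖D 0‖ + K * ‖x‖) ^ 3 ≤ 4 * ‖D 0‖ ^ 3 + 4 * (K * ‖x‖) ^ 3 := by
      have := add_pow_le hD (show 0 ≤ K * ‖x‖ by positivity) 3
      norm_num at this; linarith
    have h7 := mul_le_mul_of_nonneg_left h4 (show 0 ≤ K ^ 3 by positivity)
    have h8 : 0 ≤ ‖D 0‖ ^ 3 * ‖x‖ ^ 4 := by positivity
    rw [mul_pow] at h6
    nlinarith

theorem step_error (h : IsHam H D K c τ₀ a b) {τ : ℝ} (hτ : 0 < τ) (hτ' : τ ≤ τ₀) {f : E → ℝ} {L : ℝ}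
    (hL : 0 ≤ L) (hf : ∀ x y, |f x - f y| ≤ L * ‖x - y‖) :
    |∫ x, (lstep D τ f x - f x) * Real.exp (-H x)| ≤ errC H D K * L * (τ * Real.sqrt τ) := by
  have hK := h.K_nonneg
  have hDc := h.contD
  have hHc := h.contH
  have hfc : Continuous f := lip_continuous hf
  have hτ1 : τ ≤ 1 := hτ'.trans h.τ_le
  set N := ∫ z : E, gw τ z with hN
  have hNpos : 0 < N := integral_gw_pos (E := E) hτ
  set T : E → E := fun x => x - τ • D x with hT
  have hTc : Continuous T := by fun_prop
  have hgc := gw_cont (E := E) τ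
  set μ := (volume : Measure E).prod (volume : Measure E) with hμ
  -- the dominating function
  set W : E × E → ℝ := fun p => (‖p.2‖ ^ 3 + τ ^ 3 * ‖D p.1‖ ^ 3) * (Real.exp (-H p.1) * gw τ p.2) with hW
  have hexp := h.integrable_exp
  have hgw := gw_integrable (E := E) hτ
  have hz3 : Integrable (fun z : E => ‖z‖ ^ 3 * gw τ z) :=
    integrable_of_poly (gw_eq_integrable_poly hτ) hgc (fun z => (gw_pos τ z).le) (by fun_prop) (C := 1)
      (fun z => by rw [abs_of_nonneg (by positivity), one_mul]; exact (le_one_add_pow4 (norm_nonneg z)).2.2)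
  have hz1 : Integrable (fun z : E => ‖z‖ * gw τ z) :=
    integrable_of_poly (gw_eq_integrable_poly hτ) hgc (fun z => (gw_pos τ z).le) (by fun_prop) (C := 1)
      (fun z => by rw [abs_of_nonneg (by positivity), one_mul]; exact (le_one_add_pow4 (norm_nonneg z)).1)
  have hD3 : Integrable (fun x : E => ‖D x‖ ^ 3 * Real.exp (-H x)) :=
    h.integrable_mul (by fun_prop) (fun x => by rw [abs_of_nonneg (by positivity)]; exact (h.growthD x).2)
  have hD1 : Integrable (fun x : E => ‖D x‖ * Real.exp (-H x)) :=
    h.integrable_mul (by fun_prop) (fun x => by rw [abs_of_nonneg (by positivity)]; exact (h.growthD x).1)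
  have hWint : Integrable W μ := by
    have h1 := (hexp.mul_prod hz3).add ((hD3.mul_prod hgw).const_mul (τ ^ 3))
    refine h1.congr (ae_of_all _ fun p => ?_)
    simp only [hW, Pi.add_apply]; ring
  have hWval : ∫ p, W p ∂μ = (∫ x, Real.exp (-H x)) * (∫ z : E, ‖z‖ ^ 3 * gw τ z)
      + τ ^ 3 * ((∫ x, ‖D x‖ ^ 3 * Real.exp (-H x)) * N) := by
    rw [hN, ← integral_prod_mul, ← integral_prod_mul, ← integral_const_mul, ← integral_add (hexp.mul_prod hz3)
      ((hD3.mul_prod hgw).const_mul (τ ^ 3))]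
    refine integral_congr_ae (ae_of_all _ fun p => ?_)
    simp only [hW]; ring
  -- the pair functions
  set A : E × E → ℝ := fun p => Real.exp (-H p.1) * gw τ (p.2 - T p.1) with hA
  set Φ : E × E → ℝ := fun p => (f p.2 - f p.1) * A p with hΦ
  set ρ : E × E → ℝ := fun p => ‖p.2 - p.1‖ * (K * ‖p.2 - p.1‖ ^ 2
    + τ / 4 * (K * ‖p.2 - p.1‖ * (‖D p.1‖ + ‖D p.2‖))) with hρ
  have hAc : Continuous A := by
    have : Continuous fun p : E × E => gw τ (p.2 - T p.1) := hgc.comp (by fun_prop)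
    fun_prop
  have hA0 : ∀ p, 0 ≤ A p := fun p => mul_nonneg (Real.exp_pos _).le (gw_pos _ _).le
  have hρ0 : ∀ p, 0 ≤ ρ p := fun p => by simp only [hρ]; positivity
  have hyx : ∀ p : E × E, ‖T p.1 + p.2 - p.1‖ ≤ ‖p.2‖ + τ * ‖D p.1‖ := fun p => by
    have : T p.1 + p.2 - p.1 = p.2 - τ • D p.1 := by simp only [hT]; abel
    rw [this]; refine (norm_sub_le _ _).trans ?_
    rw [norm_smul, Real.norm_of_nonneg hτ.le]
  have hAs : ∀ p : E × E, A (p.1, T p.1 + p.2) = Real.exp (-H p.1) * gw τ p.2 := fun p => by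
    simp [hA]
  have hΦint : Integrable Φ μ := by
    rw [hμ, ← shear_integrable T hTc]
    have h1 := ((hexp.mul_prod hz1).add ((hD1.mul_prod hgw).const_mul τ)).const_mul L
    refine h1.mono' (by fun_prop) (ae_of_all _ fun p => ?_)
    simp only [hΦ, Pi.add_apply, hAs, norm_mul, Real.norm_eq_abs]
    rw [abs_of_pos (Real.exp_pos _), abs_of_pos (gw_pos _ _)]
    have h2 := (hf (T p.1 + p.2) p.1).trans (mul_le_mul_of_nonneg_left (hyx p) hL)
    calc _ ≤ L * (‖p.2‖ + τ * ‖D p.1‖) * (Real.exp (-H p.1) * gw τ p.2) :=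
          mul_le_mul_of_nonneg_right h2 (mul_nonneg (Real.exp_pos _).le (gw_pos _ _).le)
      _ = _ := by ring
  have hρW : ∀ p : E × E, ρ (p.1, T p.1 + p.2) * A (p.1, T p.1 + p.2) ≤ K * (6 + K) * W p := fun p => by
    rw [hAs]; simp only [hW, ← mul_assoc]
    rw [mul_assoc, mul_assoc _ (Real.exp _)]
    refine mul_le_mul_of_nonneg_right ?_ (mul_nonneg (Real.exp_pos _).le (gw_pos _ _).le)
    simp only [hρ]
    have h1 := hyx p
    set y := T p.1 + p.2
    set x := p.1
    set r := ‖p.2‖ + τ * ‖D x‖ with hr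
    have hr0 : 0 ≤ r := by positivity
    have hDy : ‖D y‖ ≤ ‖D x‖ + K * r := by
      have h2 := norm_add_le (D y - D x) (D x)
      rw [sub_add_cancel] at h2
      have h3 := (h.lip y x).trans (mul_le_mul_of_nonneg_left h1 hK)
      linarith
    have hτD : τ * ‖D x‖ ≤ r := by rw [hr]; linarith [norm_nonneg p.2]
    have e1 : ‖y - x‖ * (K * ‖y - x‖ ^ 2 + τ / 4 * (K * ‖y - x‖ * (‖D x‖ + ‖D y‖)))
        ≤ r * (K * r ^ 2 + τ / 4 * (K * r * (‖D x‖ + (‖D x‖ + K * r)))) := by gcongr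
    have e2 : r * (K * r ^ 2 + τ / 4 * (K * r * (‖D x‖ + (‖D x‖ + K * r))))
        = K * r ^ 3 + K / 2 * r ^ 2 * (τ * ‖D x‖) + K ^ 2 / 4 * r ^ 3 * τ := by ring
    have e3 : K / 2 * r ^ 2 * (τ * ‖D x‖) ≤ K / 2 * r ^ 2 * r := by gcongr
    have e4 : K ^ 2 / 4 * r ^ 3 * τ ≤ K ^ 2 / 4 * r ^ 3 * 1 := by gcongr
    have e5 : r ^ 3 ≤ 4 * (‖p.2‖ ^ 3 + τ ^ 3 * ‖D x‖ ^ 3) := by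
      have := add_pow_le (norm_nonneg p.2) (show 0 ≤ τ * ‖D x‖ by positivity) 3
      norm_num [mul_pow] at this; simpa [hr] using this
    have e6 := mul_le_mul_of_nonneg_left e5 (show 0 ≤ K * (3 / 2 + K / 4) by positivity)
    nlinarith
  have hρA : Integrable (fun p => ρ p * A p) μ := by
    rw [hμ, ← shear_integrable T hTc]
    refine (hWint.const_mul (K * (6 + K))).mono' (by simp only [hρ]; fun_prop) (ae_of_all _ fun p => ?_)
    rw [Real.norm_of_nonneg (mul_nonneg (hρ0 _) (hA0 _))]
    exact hρW p
  have hρAval : ∫ p, ρ p * A p ∂μ ≤ K * (6 + K) * ∫ p, W p ∂μ := by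
    rw [hμ, ← shear_integral T hTc, ← integral_const_mul]
    refine integral_mono_of_nonneg (ae_of_all _ fun p => mul_nonneg (hρ0 _) (hA0 _))
      (hWint.const_mul (K * (6 + K))) (ae_of_all _ hρW)
  -- symmetrisation
  have hswap : ∀ F : E × E → ℝ, ∫ p, F p.swap ∂μ = ∫ p, F p ∂μ := fun F => integral_prod_swap F
  have hsym : 2 * ∫ p, Φ p ∂μ = ∫ p, (Φ p + Φ p.swap) ∂μ := by
    have h1 : Integrable (fun p : E × E => Φ p.swap) μ := hΦint.swap
    rw [integral_add hΦint h1, hswap]; ring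
  have hpt : ∀ p : E × E, |Φ p + Φ p.swap| ≤ L * (ρ p * A p + ρ p.swap * A p.swap) := by
    rintro ⟨x, y⟩
    have h1 : Φ (x, y) + Φ (x, y).swap = (f y - f x) * (A (x, y) - A (y, x)) := by
      simp only [hΦ, Prod.swap]; ring
    have h2 : ρ (x, y).swap = ρ (x, y) := by
      simp only [hρ, Prod.swap]; rw [norm_sub_rev x y, add_comm ‖D y‖]
    rw [h1, h2, abs_mul, ← mul_add]
    have h3 : ∀ u v : E, A (u, v) = Real.exp (-H u - 1 / (4 * τ) * ‖v - T u‖ ^ 2) := fun u v => by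
      simp only [hA, gw]; rw [← Real.exp_add]; congr 1; ring
    have h4 := abs_exp_sub_le (-H x - 1 / (4 * τ) * ‖y - T x‖ ^ 2) (-H y - 1 / (4 * τ) * ‖x - T y‖ ^ 2)
    rw [← h3, ← h3] at h4
    have h5 : (-H x - 1 / (4 * τ) * ‖y - T x‖ ^ 2) - (-H y - 1 / (4 * τ) * ‖x - T y‖ ^ 2)
        = (H y - H x - inner ℝ (D x + D y) (y - x) / 2) - τ / 4 * (‖D x‖ ^ 2 - ‖D y‖ ^ 2) := by
      have e1 : y - T x = (y - x) + τ • D x := by simp only [hT]; abel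
      have e2 : x - T y = τ • D y - (y - x) := by simp only [hT]; abel
      rw [e1, e2, norm_add_sq_real (y - x), norm_sub_sq_real (τ • D y), norm_smul, norm_smul, Real.norm_of_nonneg hτ.le,
        inner_smul_right, inner_smul_left, inner_add_left, real_inner_comm (D x) (y - x)]
      simp only [conj_trivial]
      field_simp; ring
    have h6 : |‖D x‖ ^ 2 - ‖D y‖ ^ 2| ≤ K * ‖y - x‖ * (‖D x‖ + ‖D y‖) := by
      rw [sq_sub_sq, abs_mul, abs_of_nonneg (by positivity : 0 ≤ ‖D x‖ + ‖D y‖), mul_comm]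
      refine mul_le_mul_of_nonneg_right ?_ (by positivity)
      refine (abs_norm_sub_norm_le _ _).trans ?_
      rw [norm_sub_rev y x]; exact h.lip x y
    have h7 : |(-H x - 1 / (4 * τ) * ‖y - T x‖ ^ 2) - (-H y - 1 / (4 * τ) * ‖x - T y‖ ^ 2)|
        ≤ K * ‖y - x‖ ^ 2 + τ / 4 * (K * ‖y - x‖ * (‖D x‖ + ‖D y‖)) := by
      rw [h5]; refine (abs_sub _ _).trans (add_le_add (h.taylor x y) ?_)
      rw [abs_mul, abs_of_pos (by positivity : 0 < τ / 4)]
      exact mul_le_mul_of_nonneg_left h6 (by positivity)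
    have h8 := h4.trans (mul_le_mul_of_nonneg_right h7 (add_nonneg (hA0 _) (hA0 _)))
    have h9 := hf y x
    calc |f y - f x| * |A (x, y) - A (y, x)|
        ≤ (L * ‖y - x‖) * ((K * ‖y - x‖ ^ 2 + τ / 4 * (K * ‖y - x‖ * (‖D x‖ + ‖D y‖)))
          * (A (x, y) + A (y, x))) := mul_le_mul h9 h8 (abs_nonneg _) (by positivity)
      _ = _ := by simp only [hρ, Prod.swap]; ring
  have hmain : |∫ p, Φ p ∂μ| ≤ L * (K * (6 + K) * ∫ p, W p ∂μ) := by
    have h1 : |2 * ∫ p, Φ p ∂μ| ≤ 2 * (L * ∫ p, ρ p * A p ∂μ) := by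
      rw [hsym]
      refine abs_integral_le_integral_abs.trans ?_
      have hs2 : Integrable (fun p : E × E => ρ p.swap * A p.swap) μ := hρA.swap
      refine (integral_mono_of_nonneg (ae_of_all _ fun _ => abs_nonneg _)
        ((hρA.add hs2).const_mul L) (ae_of_all _ hpt)).trans ?_
      rw [integral_const_mul]
      have : ∫ p, ((fun p => ρ p * A p) + fun p : E × E => ρ p.swap * A p.swap) p ∂μ
          = 2 * ∫ p, ρ p * A p ∂μ := by
        simp only [Pi.add_apply]
        rw [integral_add hρA hs2, hswap (fun p => ρ p * A p)]; ring
      rw [this]; linarith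
    rw [abs_mul, abs_two] at h1
    have h2 := mul_le_mul_of_nonneg_left hρAval hL
    linarith
  -- identify the integral
  have hid : ∫ x, (lstep D τ f x - f x) * Real.exp (-H x) = (∫ p, Φ p ∂μ) / N := by
    rw [hμ, ← shear_integral T hTc, integral_prod _ ((shear_integrable T hTc Φ).2 hΦint),
      ← integral_div]
    refine integral_congr_ae (ae_of_all _ fun x => ?_)
    simp only [hΦ, hA, add_sub_cancel_left]
    have h1 : ∫ z, (f (T x + z) - f x) * (Real.exp (-H x) * gw τ z)
        = Real.exp (-H x) * ((∫ z, f (T x + z) * gw τ z) - f x * N) := by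
      rw [hN, ← integral_const_mul, ← integral_sub (integrable_lip_gw hτ hL hf _) (hgw.const_mul _),
        ← integral_const_mul]
      congr 1; ext z; ring
    rw [h1]
    change ((∫ z, f (T x + z) * gw τ z) / N - f x) * Real.exp (-H x) = _
    field_simp
  rw [hid, abs_div, abs_of_pos hNpos, div_le_iff₀ hNpos]
  refine hmain.trans ?_
  rw [hWval, gw_third_moment hτ, errC]
  have hm : 0 ≤ ∫ x, ‖D x‖ ^ 3 * Real.exp (-H x) := integral_nonneg fun x => by positivity
  have h3 : τ ^ 3 ≤ τ * Real.sqrt τ := by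
    have : τ ≤ Real.sqrt τ := by
      apply Real.le_sqrt_of_sq_le; nlinarith
    nlinarith [mul_nonneg hτ.le hτ.le]
  have h4 := mul_le_mul_of_nonneg_right h3 (mul_nonneg hm hNpos.le)
  have h5 : 0 ≤ L * (K * (6 + K)) := by positivity
  have h6 := mul_le_mul_of_nonneg_left h4 h5
  rw [← hN]
  nlinarith

end IsHam
end Chain

section Chain

variable {E : Type*} [NormedAddCommGroup E] [InnerProductSpace ℝ E] [FiniteDimensional ℝ E]
  [MeasurableSpace E] [BorelSpace E]

namespace IsHam
variable {H : E → ℝ} {D : E → E} {K c τ₀ a b : ℝ}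

theorem iter_lip (h : IsHam H D K c τ₀ a b) {τ : ℝ} (hτ : 0 < τ) (hτ' : τ ≤ τ₀) {f : E → ℝ} {L : ℝ}
    (hL : 0 ≤ L) (hf : ∀ x y, |f x - f y| ≤ L * ‖x - y‖) (k : ℕ) :
    0 ≤ (1 - c * τ) ^ k * L ∧
    ∀ x y, |(lstep D τ)^[k] f x - (lstep D τ)^[k] f y| ≤ (1 - c * τ) ^ k * L * ‖x - y‖ := by
  have hq : 0 ≤ 1 - c * τ := by
    have := mul_le_mul_of_nonneg_left hτ' h.c_pos.le
    linarith [h.cτ_le]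
  refine ⟨by positivity, ?_⟩
  induction k with
  | zero => simpa using hf
  | succ k ih =>
    intro x y
    rw [Function.iterate_succ_apply']
    refine (lstep_lip hτ (by positivity) ih (h.contr τ hτ hτ') x y).trans (le_of_eq ?_)
    rw [pow_succ]; ring

theorem iter_stationary (h : IsHam H D K c τ₀ a b) {τ : ℝ} (hτ : 0 < τ) (hτ' : τ ≤ τ₀) {f : E → ℝ}
    {L : ℝ} (hL : 0 ≤ L) (hf : ∀ x y, |f x - f y| ≤ L * ‖x - y‖) (k : ℕ) :
    |(∫ x, ((lstep D τ)^[k] f x) * Real.exp (-H x)) - ∫ x, f x * Real.exp (-H x)|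
      ≤ ∑ j ∈ Finset.range k, errC H D K * ((1 - c * τ) ^ j * L) * (τ * Real.sqrt τ) := by
  induction k with
  | zero => simp
  | succ k ih =>
    rw [Finset.sum_range_succ]
    obtain ⟨h1, h2⟩ := h.iter_lip hτ hτ' hL hf k
    obtain ⟨h3, h4⟩ := h.iter_lip hτ hτ' hL hf (k + 1)
    have h5 := h.step_error hτ hτ' h1 h2
    simp only [sub_mul] at h5
    rw [integral_sub (by simpa only [Function.iterate_succ_apply'] using h.integrable_lip h3 h4)
      (h.integrable_lip h1 h2)] at h5
    simp only [Function.iterate_succ_apply']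
    have := abs_add_le ((∫ x, lstep D τ ((lstep D τ)^[k] f) x * Real.exp (-H x))
      - ∫ x, (lstep D τ)^[k] f x * Real.exp (-H x))
      ((∫ x, (lstep D τ)^[k] f x * Real.exp (-H x)) - ∫ x, f x * Real.exp (-H x))
    rw [sub_add_sub_cancel] at this
    linarith

theorem errC_nonneg (h : IsHam H D K c τ₀ a b) : 0 ≤ errC H D K := by
  have := h.K_nonneg
  have h1 : 0 ≤ ∫ x, ‖D x‖ ^ 3 * Real.exp (-H x) := integral_nonneg fun x => by positivity
  have h2 : 0 ≤ ∫ z : E, ‖z‖ ^ 3 * gw 1 z := integral_nonneg fun x => mul_nonneg (by positivity) (gw_pos _ _).le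
  have h3 : 0 ≤ ∫ z : E, gw 1 z := integral_nonneg fun x => (gw_pos _ _).le
  have h4 := h.integral_pos
  unfold errC; positivity

/-- the chain started at `0` approaches the Gibbs average -/
theorem chain_limit (h : IsHam H D K c τ₀ a b) {f : E → ℝ} {L : ℝ}
    (hL : 0 ≤ L) (hf : ∀ x y, |f x - f y| ≤ L * ‖x - y‖) :
    ∃ C, ∀ τ, 0 < τ → τ ≤ τ₀ → ∀ k : ℕ,
      |(lstep D τ)^[k] f 0 - avg H f| ≤ C * (Real.sqrt τ + (1 - c * τ) ^ k) := by
  set Z := ∫ x, Real.exp (-H x) with hZ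
  have hZp : 0 < Z := h.integral_pos
  set m1 := ∫ x, ‖x‖ * Real.exp (-H x) with hm1
  have hm1p : 0 ≤ m1 := integral_nonneg fun x => by positivity
  have he := h.errC_nonneg
  have hc := h.c_pos
  refine ⟨errC H D K * L / c / Z + L * m1 / Z, fun τ hτ hτ' k => ?_⟩
  obtain ⟨h1, h2⟩ := h.iter_lip hτ hτ' hL hf k
  have hq : 0 ≤ 1 - c * τ := by
    have := mul_le_mul_of_nonneg_left hτ' h.c_pos.le
    linarith [h.cτ_le]
  have hq1 : 1 - c * τ < 1 := by nlinarith
  set F := (lstep D τ)^[k] f with hF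
  have hst := h.iter_stationary hτ hτ' hL hf k
  have hgeo : ∑ j ∈ Finset.range k, errC H D K * ((1 - c * τ) ^ j * L) * (τ * Real.sqrt τ)
      ≤ errC H D K * L / c * Real.sqrt τ := by
    have h3 : ∑ j ∈ Finset.range k, (1 - c * τ) ^ j ≤ (1 - (1 - c * τ))⁻¹ := by
      rw [← tsum_geometric_of_lt_one hq hq1]
      exact (summable_geometric_of_lt_one hq hq1).sum_le_tsum _ (fun i _ => by positivity)
    have h4 : ∑ j ∈ Finset.range k, errC H D K * ((1 - c * τ) ^ j * L) * (τ * Real.sqrt τ)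
        = (errC H D K * L * (τ * Real.sqrt τ)) * ∑ j ∈ Finset.range k, (1 - c * τ) ^ j := by
      rw [Finset.mul_sum]; refine Finset.sum_congr rfl fun j _ => by ring
    rw [h4]
    refine (mul_le_mul_of_nonneg_left h3 (by positivity)).trans (le_of_eq ?_)
    rw [sub_sub_cancel]; field_simp
  have h5 : |F 0 * Z - ∫ x, F x * Real.exp (-H x)| ≤ (1 - c * τ) ^ k * L * m1 := by
    rw [hZ, ← integral_const_mul, ← integral_sub (h.integrable_exp.const_mul _) (h.integrable_lip h1 h2),
      hm1, ← integral_const_mul]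
    refine abs_integral_le_integral_abs.trans (integral_mono_of_nonneg (ae_of_all _ fun _ => abs_nonneg _)
      ?_ (ae_of_all _ fun x => ?_))
    · exact (h.integrable_mul (by fun_prop) (C := 1) (fun x => by
        rw [abs_of_nonneg (norm_nonneg _), one_mul]; exact (le_one_add_pow4 (norm_nonneg x)).1)).const_mul _
    · simp only
      rw [← sub_mul, abs_mul, abs_of_pos (Real.exp_pos _), ← mul_assoc]
      refine mul_le_mul_of_nonneg_right ?_ (Real.exp_pos _).le
      have := h2 0 x
      rwa [zero_sub, norm_neg] at this
  have h6 : F 0 - avg H f = ((F 0 * Z - ∫ x, F x * Real.exp (-H x))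
      + ((∫ x, F x * Real.exp (-H x)) - ∫ x, f x * Real.exp (-H x))) / Z := by
    rw [avg, ← hZ]; field_simp; ring
  rw [h6, abs_div, abs_of_pos hZp, div_le_iff₀ hZp]
  have h7 := abs_add_le (F 0 * Z - ∫ x, F x * Real.exp (-H x))
      ((∫ x, F x * Real.exp (-H x)) - ∫ x, f x * Real.exp (-H x))
  refine h7.trans ((add_le_add h5 (hst.trans hgeo)).trans ?_)
  have e1 : (errC H D K * L / c / Z + L * m1 / Z) * (Real.sqrt τ + (1 - c * τ) ^ k) * Z
      = (errC H D K * L / c + L * m1) * (Real.sqrt τ + (1 - c * τ) ^ k) := by field_simp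
  rw [e1]
  have e2 : 0 ≤ errC H D K * L / c * (1 - c * τ) ^ k := by positivity
  have e3 : 0 ≤ L * m1 * Real.sqrt τ := by positivity
  nlinarith

end IsHam

/-- **Synchronous coupling**: an inequality that holds along a set invariant under simultaneous
Langevin steps with common noise passes to the Gibbs averages. -/
theorem coupling {m : Type*} [Fintype m] {H : m → E → ℝ} {D : m → E → E} {K c τ₀ a : ℝ}
    {b : m → ℝ} (h : ∀ i, IsHam (H i) (D i) K c τ₀ a (b i)) (S : Set (m → E)) (h0 : (0 : m → E) ∈ S)
    (hS : ∀ x ∈ S, ∀ τ, 0 < τ → τ ≤ τ₀ → ∀ z : E, (fun i => x i - τ • D i (x i) + z) ∈ S)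
    {f : m → E → ℝ} {L κ : ℝ} (hf : ∀ i x y, |f i x - f i y| ≤ L * ‖x - y‖)
    (hfS : ∀ x ∈ S, ∑ i, f i (x i) ≤ κ) :
    ∑ i, avg (H i) (f i) ≤ κ := by
  classical
  rcases isEmpty_or_nonempty m with hm | ⟨⟨i₀⟩⟩
  · simpa using hfS 0 h0
  set L' := max L 0 with hL'
  have hL0 : 0 ≤ L' := le_max_right _ _
  have hf' : ∀ i x y, |f i x - f i y| ≤ L' * ‖x - y‖ := fun i x y =>
    (hf i x y).trans (mul_le_mul_of_nonneg_right (le_max_left _ _) (norm_nonneg _))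
  have key : ∀ τ, 0 < τ → τ ≤ τ₀ → ∀ k : ℕ, ∀ x ∈ S, ∑ i, (lstep (D i) τ)^[k] (f i) (x i) ≤ κ := by
    intro τ hτ hτ' k
    induction k with
    | zero => simpa using hfS
    | succ k ih =>
      intro x hx
      have hN := integral_gw_pos (E := E) hτ
      simp only [Function.iterate_succ_apply']
      have hint : ∀ i, Integrable (fun z => (lstep (D i) τ)^[k] (f i) (x i - τ • D i (x i) + z) * gw τ z) :=
        fun i => integrable_lip_gw hτ ((h i).iter_lip hτ hτ' hL0 (hf' i) k).1
          ((h i).iter_lip hτ hτ' hL0 (hf' i) k).2 _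
      have : ∀ i, lstep (D i) τ ((lstep (D i) τ)^[k] (f i)) (x i)
          = (∫ z, (lstep (D i) τ)^[k] (f i) (x i - τ • D i (x i) + z) * gw τ z) / ∫ z : E, gw τ z :=
        fun i => rfl
      simp only [this]
      rw [← Finset.sum_div, div_le_iff₀ hN, ← integral_finsetSum _ (fun i _ => hint i),
        ← integral_const_mul]
      refine integral_mono (integrable_finsetSum _ fun i _ => hint i) ((gw_integrable hτ).const_mul _)
        fun z => ?_
      simp only
      rw [← Finset.sum_mul]
      exact mul_le_mul_of_nonneg_right (ih _ (hS x hx τ hτ hτ' z)) (gw_pos _ _).le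
  choose C hC using fun i => (h i).chain_limit hL0 (hf' i)
  have hc := (h i₀).c_pos
  have hτ₀ := (h i₀).τ_pos
  set C' := ∑ i, C i
  have h1 : ∀ τ, 0 < τ → τ ≤ τ₀ → ∀ k : ℕ,
      ∑ i, avg (H i) (f i) ≤ κ + C' * (Real.sqrt τ + (1 - c * τ) ^ k) := by
    intro τ hτ hτ' k
    have h2 := key τ hτ hτ' k 0 h0
    have h3 : ∑ i, avg (H i) (f i) ≤ ∑ i, ((lstep (D i) τ)^[k] (f i) 0
        + C i * (Real.sqrt τ + (1 - c * τ) ^ k)) := by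
      refine Finset.sum_le_sum fun i _ => ?_
      have := (abs_le.1 (hC i τ hτ hτ' k)).1
      linarith
    rw [Finset.sum_add_distrib, ← Finset.sum_mul] at h3
    simp only [Pi.zero_apply] at h2
    linarith
  have h2 : ∀ τ, 0 < τ → τ ≤ τ₀ → ∑ i, avg (H i) (f i) ≤ κ + C' * Real.sqrt τ := by
    intro τ hτ hτ'
    have hq : 0 ≤ 1 - c * τ := by
      have := mul_le_mul_of_nonneg_left hτ' hc.le
      linarith [(h i₀).cτ_le]
    have hq1 : 1 - c * τ < 1 := by nlinarith
    have hlim : Tendsto (fun k : ℕ => κ + C' * (Real.sqrt τ + (1 - c * τ) ^ k)) atTop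
        (nhds (κ + C' * (Real.sqrt τ + 0))) :=
      ((tendsto_pow_atTop_nhds_zero_of_lt_one hq hq1).const_add _).const_mul _ |>.const_add _
    rw [add_zero] at hlim
    exact ge_of_tendsto' hlim fun k => h1 τ hτ hτ' k
  have hlim : Tendsto (fun τ : ℝ => κ + C' * Real.sqrt τ) (nhdsWithin 0 (Set.Ioi 0)) (nhds (κ + C' * Real.sqrt 0)) := by
    refine Tendsto.mono_left ?_ nhdsWithin_le_nhds
    exact (Continuous.tendsto (by fun_prop) 0)
  rw [Real.sqrt_zero, mul_zero, add_zero] at hlim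
  refine ge_of_tendsto hlim ?_
  filter_upwards [Ioc_mem_nhdsGT hτ₀] with τ hτ
  exact h2 τ hτ.1 hτ.2

end Chain

/-- A uniformly convex potential `U` with derivative `u`, slopes of `u` in `[l, l']`. -/
structure Pot (l l' : ℝ) (U u : ℝ → ℝ) : Prop where
  pos : 0 < l
  hasDeriv : ∀ t, HasDerivAt U (u t) t
  lo : ∀ s t, s ≤ t → l * (t - s) ≤ u t - u s
  hi : ∀ s t, s ≤ t → u t - u s ≤ l' * (t - s)

namespace Pot
variable {l l' : ℝ} {U u : ℝ → ℝ}

theorem le (h : Pot l l' U u) : l ≤ l' := by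
  have h1 := h.lo 0 1 zero_le_one
  have h2 := h.hi 0 1 zero_le_one
  linarith

theorem pos' (h : Pot l l' U u) : 0 < l' := h.pos.trans_le h.le

/-- secant slope -/
theorem secant (h : Pot l l' U u) (s t : ℝ) :
    ∃ q, l ≤ q ∧ q ≤ l' ∧ u t - u s = q * (t - s) := by
  rcases lt_trichotomy s t with hst | hst | hst
  · refine ⟨(u t - u s) / (t - s), ?_, ?_, ?_⟩
    · rw [le_div_iff₀ (sub_pos.2 hst)]; exact h.lo s t hst.le
    · rw [div_le_iff₀ (sub_pos.2 hst)]; exact h.hi s t hst.le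
    · rw [div_mul_cancel₀ _ (sub_pos.2 hst).ne']
  · exact ⟨l, le_rfl, h.le, by simp [hst]⟩
  · refine ⟨(u s - u t) / (s - t), ?_, ?_, ?_⟩
    · rw [le_div_iff₀ (sub_pos.2 hst)]; exact h.lo t s hst.le
    · rw [div_le_iff₀ (sub_pos.2 hst)]; exact h.hi t s hst.le
    · have := (sub_pos.2 hst).ne'
      field_simp; ring

theorem lipu (h : Pot l l' U u) (s t : ℝ) : |u t - u s| ≤ l' * |t - s| := by
  obtain ⟨q, h1, h2, h3⟩ := h.secant s t
  rw [h3, abs_mul, abs_of_nonneg (h.pos.le.trans h1)]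
  exact mul_le_mul_of_nonneg_right h2 (abs_nonneg _)

theorem mvt (h : Pot l l' U u) (s t : ℝ) :
    ∃ q, |q| ≤ |t - s| ∧ |q - (t - s)| ≤ |t - s| ∧ 0 ≤ q * (t - s) ∧ U t - U s = u (s + q) * (t - s) := by
  have hc : Continuous U := continuous_iff_continuousAt.2 fun x => (h.hasDeriv x).continuousAt
  rcases lt_trichotomy s t with hst | hst | hst
  · obtain ⟨r, hr, hr2⟩ := exists_hasDerivAt_eq_slope U u hst hc.continuousOn fun x _ => h.hasDeriv x
    have := sub_pos.2 hst
    refine ⟨r - s, ?_, ?_, ?_, ?_⟩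
    · rw [abs_of_pos (by linarith [hr.1]), abs_of_pos this]; linarith [hr.2]
    · rw [abs_of_neg (by linarith [hr.2]), abs_of_pos this]; linarith [hr.1]
    · exact mul_nonneg (by linarith [hr.1]) this.le
    · rw [add_sub_cancel, hr2]; field_simp
  · exact ⟨0, by simp [hst]⟩
  · obtain ⟨r, hr, hr2⟩ := exists_hasDerivAt_eq_slope U u hst hc.continuousOn fun x _ => h.hasDeriv x
    have := sub_pos.2 hst
    refine ⟨r - s, ?_, ?_, ?_, ?_⟩
    · rw [abs_of_neg (by linarith [hr.2]), abs_of_neg (by linarith)]; linarith [hr.1]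
    · rw [abs_of_pos (by linarith [hr.1]), abs_of_neg (by linarith)]; linarith [hr.2]
    · exact mul_nonneg_of_nonpos_of_nonpos (by linarith [hr.2]) (by linarith)
    · rw [add_sub_cancel, hr2]; field_simp; ring

theorem trapezoid (h : Pot l l' U u) (s t : ℝ) :
    |U t - U s - (u s + u t) * (t - s) / 2| ≤ l' * (t - s) ^ 2 := by
  obtain ⟨q, h1, h2, -, h3⟩ := h.mvt s t
  have e1 := h.lipu s (s + q)
  have e2 := h.lipu t (s + q)
  rw [add_sub_cancel_left] at e1
  have e3 : |s + q - t| ≤ |t - s| := by rw [show s + q - t = q - (t - s) by ring]; exact h2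
  have : U t - U s - (u s + u t) * (t - s) / 2
      = ((u (s + q) - u s) / 2 + (u (s + q) - u t) / 2) * (t - s) := by rw [h3]; ring
  rw [this, abs_mul, ← sq_abs (t - s), sq, ← mul_assoc]
  refine mul_le_mul_of_nonneg_right ?_ (abs_nonneg _)
  refine (abs_add_le _ _).trans ?_
  rw [abs_div, abs_div, abs_two]
  have hp := h.pos'.le
  have := mul_le_mul_of_nonneg_left h1 hp
  have := mul_le_mul_of_nonneg_left e3 hp
  linarith

theorem upper (h : Pot l l' U u) (s t : ℝ) : U t ≤ U s + u s * (t - s) + l' * (t - s) ^ 2 := by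
  obtain ⟨q, h1, -, h2, h3⟩ := h.mvt s t
  have e1 := h.lipu s (s + q)
  rw [add_sub_cancel_left] at e1
  have e2 : (u (s + q) - u s) * (t - s) ≤ l' * |t - s| * |t - s| := by
    refine (le_abs_self _).trans ?_
    rw [abs_mul]
    refine mul_le_mul_of_nonneg_right (e1.trans ?_) (abs_nonneg _)
    exact mul_le_mul_of_nonneg_left h1 h.pos'.le
  rw [mul_assoc, abs_mul_abs_self] at e2
  nlinarith

theorem tangent (h : Pot l l' U u) (s t : ℝ) : U s + u s * (t - s) ≤ U t := by
  obtain ⟨q, -, -, h2, h3⟩ := h.mvt s t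
  obtain ⟨p, hp, -, hp2⟩ := h.secant s (s + q)
  rw [add_sub_cancel_left] at hp2
  have : (u (s + q) - u s) * (t - s) = p * (q * (t - s)) := by rw [hp2]; ring
  have h5 := mul_nonneg (h.pos.le.trans hp) h2
  linarith

theorem lower (h : Pot l l' U u) (s t : ℝ) : U s + u s * (t - s) + l / 4 * (t - s) ^ 2 ≤ U t := by
  set m := (s + t) / 2 with hm
  have h1 := h.tangent s m
  have h2 := h.tangent m t
  obtain ⟨p, hp, -, hp2⟩ := h.secant s m
  have e1 : m - s = (t - s) / 2 := by rw [hm]; ring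
  have e2 : t - m = (t - s) / 2 := by rw [hm]; ring
  rw [e1] at h1 hp2
  rw [e2] at h2
  have : u m = u s + p * ((t - s) / 2) := by linarith
  rw [this] at h2
  nlinarith [sq_nonneg (t - s)]

end Pot

section Fields

variable {ι : Type*} [Fintype ι]

/-- apply the scalar functions `u e` edgewise -/
def edgewise (u : ι → ℝ → ℝ) (g : EuclideanSpace ℝ ι) : EuclideanSpace ℝ ι :=
  WithLp.toLp 2 fun e => u e (g e)

@[simp] theorem edgewise_apply (u : ι → ℝ → ℝ) (g : EuclideanSpace ℝ ι) (e : ι) :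
    edgewise u g e = u e (g e) := rfl

theorem euclid_norm_le_of_sq {v : EuclideanSpace ℝ ι} {w : EuclideanSpace ℝ ι} {q : ℝ} (hq : 0 ≤ q)
    (h : ∀ e, |v e| ≤ q * |w e|) : ‖v‖ ≤ q * ‖w‖ := by
  rw [EuclideanSpace.norm_eq, EuclideanSpace.norm_eq]
  have : q = Real.sqrt (q ^ 2) := (Real.sqrt_sq hq).symm
  rw [this, ← Real.sqrt_mul (sq_nonneg q), Finset.mul_sum]
  refine Real.sqrt_le_sqrt (Finset.sum_le_sum fun e _ => ?_)
  rw [Real.norm_eq_abs, Real.norm_eq_abs, ← mul_pow]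
  exact pow_le_pow_left₀ (abs_nonneg _) (h e) 2

variable {l l' : ℝ} {U u : ι → ℝ → ℝ} (F : Submodule ℝ (EuclideanSpace ℝ ι))

theorem orthP_norm_le (v : EuclideanSpace ℝ ι) : ‖F.orthogonalProjectionOnto v‖ ≤ ‖v‖ := by
  have := F.norm_orthogonalProjectionOnto_apply_le v
  exact this

theorem isHam_field (hl : 0 < l) (hll : l ≤ l') (h : ∀ e, Pot l l' (U e) (u e)) :
    IsHam (E := F) (fun g => ∑ e, U e ((g : EuclideanSpace ℝ ι) e))
      (fun g => F.orthogonalProjectionOnto (edgewise u g)) l' l (min 1 (1 / l')) (l / 8)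
      (∑ e, (2 * (u e 0) ^ 2 / l - U e 0)) where
  contH := by
    refine continuous_finsetSum _ fun e _ => ?_
    have : Continuous (U e) := continuous_iff_continuousAt.2 fun x => ((h e).hasDeriv x).continuousAt
    fun_prop
  K_nonneg := hl.le.trans hll
  c_pos := hl
  τ_pos := lt_min one_pos (by have := hl.trans_le hll; positivity)
  τ_le := min_le_left _ _
  cτ_le := by
    have hl' := hl.trans_le hll
    calc l * min 1 (1 / l') ≤ l * (1 / l') := mul_le_mul_of_nonneg_left (min_le_right _ _) hl.le
      _ ≤ 1 := by rw [mul_one_div, div_le_one hl']; exact hll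
  a_pos := by positivity
  taylor x y := by
    have h1 : inner ℝ (F.orthogonalProjectionOnto (edgewise u x) + F.orthogonalProjectionOnto (edgewise u y)) (y - x)
        = ∑ e, (u e ((x : EuclideanSpace ℝ ι) e) + u e ((y : EuclideanSpace ℝ ι) e))
          * ((y : EuclideanSpace ℝ ι) e - (x : EuclideanSpace ℝ ι) e) := by
      rw [← map_add, Submodule.inner_orthogonalProjectionOnto_eq_of_mem_right, PiLp.inner_apply]
      refine Finset.sum_congr rfl fun e _ => ?_
      simp [mul_comm]
    rw [h1, ← Finset.sum_sub_distrib, Finset.sum_div, ← Finset.sum_sub_distrib]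
    refine (Finset.abs_sum_le_sum_abs _ _).trans ?_
    have h2 : ‖y - x‖ ^ 2 = ∑ e, ((y : EuclideanSpace ℝ ι) e - (x : EuclideanSpace ℝ ι) e) ^ 2 := by
      rw [Submodule.coe_norm, EuclideanSpace.norm_sq_eq]
      simp
    rw [h2, Finset.mul_sum]
    exact Finset.sum_le_sum fun e _ => (h e).trapezoid _ _
  lip x y := by
    rw [← map_sub]
    refine (orthP_norm_le F _).trans ?_
    rw [Submodule.coe_norm]
    refine euclid_norm_le_of_sq (hl.le.trans hll) fun e => ?_
    simpa using (h e).lipu _ _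
  contr τ hτ hτ' x y := by
    have hl' := hl.trans_le hll
    have hτl : τ * l' ≤ 1 := by
      have := hτ'.trans (min_le_right _ _)
      rwa [le_div_iff₀ hl'] at this
    have hq : 0 ≤ 1 - l * τ := by nlinarith
    have h1 : (x - τ • F.orthogonalProjectionOnto (edgewise u x)) - (y - τ • F.orthogonalProjectionOnto (edgewise u y))
        = F.orthogonalProjectionOnto (((x : EuclideanSpace ℝ ι) - y) - τ • (edgewise u x - edgewise u y)) := by
      rw [map_sub, map_sub, map_smul, map_sub, Submodule.orthogonalProjectionOnto_mem_subspace_eq_self,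
        Submodule.orthogonalProjectionOnto_mem_subspace_eq_self, smul_sub]
      abel
    rw [h1]
    refine (orthP_norm_le F _).trans ?_
    rw [Submodule.coe_norm]
    refine euclid_norm_le_of_sq hq fun e => ?_
    obtain ⟨q, hq1, hq2, hq3⟩ := (h e).secant ((y : EuclideanSpace ℝ ι) e) ((x : EuclideanSpace ℝ ι) e)
    simp only [PiLp.sub_apply, PiLp.smul_apply, edgewise_apply, smul_eq_mul, hq3, AddSubgroupClass.coe_sub]
    rw [← mul_assoc, ← one_sub_mul, abs_mul]
    refine mul_le_mul_of_nonneg_right ?_ (abs_nonneg _)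
    rw [abs_of_nonneg (by nlinarith)]
    nlinarith
  lower x := by
    rw [Submodule.coe_norm, EuclideanSpace.norm_sq_eq, Finset.mul_sum, ← Finset.sum_sub_distrib]
    refine Finset.sum_le_sum fun e _ => ?_
    have h1 := (h e).lower 0 ((x : EuclideanSpace ℝ ι) e)
    rw [Real.norm_eq_abs, sq_abs]
    set t := (x : EuclideanSpace ℝ ι) e
    have h2 : 0 ≤ l / 8 * (t + 4 * u e 0 / l) ^ 2 := by positivity
    have h3 : l / 8 * (t + 4 * u e 0 / l) ^ 2 = l / 8 * t ^ 2 + u e 0 * t + 2 * (u e 0) ^ 2 / l := by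
      field_simp; ring
    rw [sub_zero] at h1
    linarith

end Fields

theorem linear_change {X Y : Type*} [NormedAddCommGroup X] [NormedSpace ℝ X] [FiniteDimensional ℝ X]
    [MeasureSpace X] [BorelSpace X] [(volume : Measure X).IsAddHaarMeasure]
    [NormedAddCommGroup Y] [NormedSpace ℝ Y] [FiniteDimensional ℝ Y]
    [MeasureSpace Y] [BorelSpace Y] [(volume : Measure Y).IsAddHaarMeasure]
    (J : X ≃L[ℝ] Y) : ∃ c : ℝ, 0 < c ∧ ∀ G : Y → ℝ, (∫ x, G (J x) = c * ∫ y, G y) ∧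
      (Integrable G → Integrable (fun x => G (J x))) := by
  have : (Measure.map J (volume : Measure X)).IsAddHaarMeasure :=
    J.isAddHaarMeasure_map _
  obtain ⟨c, hc0, hctop, hc⟩ : ∃ c : ENNReal, c ≠ 0 ∧ c ≠ ⊤ ∧
      Measure.map J (volume : Measure X) = c • (volume : Measure Y) := by
    refine ⟨Measure.addHaarScalarFactor (Measure.map J (volume : Measure X)) volume, ?_, ?_, ?_⟩
    · have := Measure.addHaarScalarFactor_pos_of_isAddHaarMeasure (Measure.map J (volume : Measure X)) volume
      exact_mod_cast this.ne'
    · exact ENNReal.coe_ne_top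
    · exact Measure.isAddLeftInvariant_eq_smul _ _
  refine ⟨c.toReal, ENNReal.toReal_pos hc0 hctop, fun G => ⟨?_, fun hG => ?_⟩⟩
  · have h1 := MeasurableEmbedding.integral_map (μ := (volume : Measure X))
      (J.toHomeomorph.measurableEmbedding) G
    have h2 : ∫ x, G (J x) = ∫ y, G y ∂(Measure.map J (volume : Measure X)) := h1.symm
    rw [h2, hc, integral_smul_measure, smul_eq_mul]
  · have h1 := MeasurableEmbedding.integrable_map_iff (μ := (volume : Measure X)) (f := J) (g := G)
      (J.toHomeomorph.measurableEmbedding)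
    rw [hc] at h1
    exact h1.1 (hG.smul_measure hctop)

theorem avg_comp_equiv {X Y : Type*} [NormedAddCommGroup X] [NormedSpace ℝ X] [FiniteDimensional ℝ X]
    [MeasureSpace X] [BorelSpace X] [(volume : Measure X).IsAddHaarMeasure]
    [NormedAddCommGroup Y] [NormedSpace ℝ Y] [FiniteDimensional ℝ Y]
    [MeasureSpace Y] [BorelSpace Y] [(volume : Measure Y).IsAddHaarMeasure]
    (J : X ≃L[ℝ] Y) (H f : Y → ℝ) :
    avg (fun x => H (J x)) (fun x => f (J x)) = avg H f := by
  obtain ⟨c, hc, h⟩ := linear_change J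
  unfold avg
  rw [(h (fun y => f y * Real.exp (-H y))).1, (h (fun y => Real.exp (-H y))).1, mul_div_mul_left _ _ hc.ne']

section Gradient

variable {κ ι : Type*} [Fintype κ] [Fintype ι] (J : (κ → ℝ) →ₗ[ℝ] EuclideanSpace ℝ ι)

/-- the Hamiltonian `∑ U_e((Jφ)_e)` -/
def fieldH (U : ι → ℝ → ℝ) (φ : κ → ℝ) : ℝ := ∑ e, U e (J φ e)

/-- the identification of configurations with their gradient fields -/
def rangeEquiv (hJ : Function.Injective J) : (κ → ℝ) ≃L[ℝ] LinearMap.range J :=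
  (LinearEquiv.ofInjective J hJ).toContinuousLinearEquiv

@[simp] theorem rangeEquiv_coe (hJ : Function.Injective J) (φ : κ → ℝ) :
    (rangeEquiv J hJ φ : EuclideanSpace ℝ ι) = J φ := rfl

/-- orthogonal projection onto gradient fields -/
def gradP : EuclideanSpace ℝ ι →L[ℝ] EuclideanSpace ℝ ι := (LinearMap.range J).starProjection

variable {l l' : ℝ} {U u : ι → ℝ → ℝ}

theorem field_integrable (hJ : Function.Injective J) (hl : 0 < l) (hll : l ≤ l')
    (h : ∀ e, Pot l l' (U e) (u e)) {f : (κ → ℝ) → ℝ} (hf : Continuous f) {C : ℝ}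
    (hC : ∀ φ, |f φ| ≤ C * (1 + ‖φ‖ ^ 4)) : Integrable (fun φ => f φ * Real.exp (-fieldH J U φ)) := by
  have hH := isHam_field (LinearMap.range J) hl hll h
  set e := rangeEquiv J hJ
  obtain ⟨c, hc, hint⟩ := linear_change e
  have h1 : Continuous fun g => f (e.symm g) := hf.comp e.symm.continuous
  obtain ⟨q, hq0, hq⟩ : ∃ q : ℝ, 0 ≤ q ∧ ∀ g, ‖e.symm g‖ ≤ q * ‖g‖ := by
    obtain ⟨q, hq, h⟩ := (e.symm : LinearMap.range J →L[ℝ] (κ → ℝ)).bound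
    exact ⟨q, hq.le, h⟩
  have hC0 : 0 ≤ C := by
    have := (abs_nonneg _).trans (hC 0)
    simpa using this
  have h2 := hH.integrable_mul h1 (C := C * (1 + q ^ 4)) (fun g => by
    refine (hC _).trans ?_
    rw [mul_assoc]
    refine mul_le_mul_of_nonneg_left ?_ hC0
    have := pow_le_pow_left₀ (norm_nonneg _) (hq g) 4
    rw [mul_pow] at this
    have : 0 ≤ q ^ 4 := by positivity
    have : 0 ≤ ‖g‖ ^ 4 := by positivity
    nlinarith)
  have h3 := (hint _).2 h2
  simpa [fieldH, e] using h3

theorem field_integrable_one (hJ : Function.Injective J) (hl : 0 < l) (hll : l ≤ l')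
    (h : ∀ e, Pot l l' (U e) (u e)) : Integrable (fun φ => Real.exp (-fieldH J U φ)) := by
  have := field_integrable J hJ hl hll h (f := fun _ => 1) continuous_const (C := 1) (fun φ => by simp)
  simpa using this

theorem field_integral_pos (hJ : Function.Injective J) (hl : 0 < l) (hll : l ≤ l')
    (h : ∀ e, Pot l l' (U e) (u e)) : 0 < ∫ φ, Real.exp (-fieldH J U φ) :=
  integral_exp_pos (field_integrable_one J hJ hl hll h)

/-- synchronous coupling of several gradient models on the same graph -/
theorem field_coupling {m : Type*} [Fintype m] (hJ : Function.Injective J) (hl : 0 < l) (hll : l ≤ l')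
    {U u : m → ι → ℝ → ℝ} (h : ∀ i e, Pot l l' (U i e) (u i e))
    (S : Set (m → EuclideanSpace ℝ ι)) (h0 : 0 ∈ S)
    (hS : ∀ g ∈ S, (∀ i, g i ∈ LinearMap.range J) → ∀ τ, 0 < τ → τ * l' ≤ 1 → ∀ z ∈ LinearMap.range J,
      (fun i => g i - τ • gradP J (edgewise (u i) (g i)) + z) ∈ S)
    {f : m → EuclideanSpace ℝ ι → ℝ} {L κ' : ℝ} (hf : ∀ i x y, |f i x - f i y| ≤ L * ‖x - y‖)
    (hfS : ∀ g ∈ S, (∀ i, g i ∈ LinearMap.range J) → ∑ i, f i (g i) ≤ κ') :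
    ∑ i, avg (fieldH J (U i)) (fun φ => f i (J φ)) ≤ κ' := by
  have hH := fun i => isHam_field (LinearMap.range J) hl hll (h i)
  have hc := coupling hH {x : m → LinearMap.range J | (fun i => (x i : EuclideanSpace ℝ ι)) ∈ S}
    h0 ?_ (f := fun i x => f i (x : EuclideanSpace ℝ ι)) (L := L) (κ := κ')
    (fun i x y => by simpa using hf i x y) ?_
  · refine le_of_eq_of_le (Finset.sum_congr rfl fun i _ => ?_) hc
    exact avg_comp_equiv (rangeEquiv J hJ) (fun g => ∑ e, U i e ((g : EuclideanSpace ℝ ι) e))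
      (fun g => f i (g : EuclideanSpace ℝ ι))
  · intro x hx τ hτ hτ' z
    have hl' := hl.trans_le hll
    have hτl : τ * l' ≤ 1 := by
      have := hτ'.trans (min_le_right _ _)
      rwa [le_div_iff₀ hl'] at this
    exact hS _ hx (fun i => (x i).2) τ hτ hτl z z.2
  · intro x hx
    exact hfS _ hx fun i => (x i).2

end Gradient

section Avg
variable {X : Type*} [MeasureSpace X]

theorem avg_add {H f g : X → ℝ} (hf : Integrable fun x => f x * Real.exp (-H x))
    (hg : Integrable fun x => g x * Real.exp (-H x)) :
    avg H (fun x => f x + g x) = avg H f + avg H g := by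
  simp only [avg, add_mul]; rw [integral_add hf hg, add_div]

theorem avg_sub {H f g : X → ℝ} (hf : Integrable fun x => f x * Real.exp (-H x))
    (hg : Integrable fun x => g x * Real.exp (-H x)) :
    avg H (fun x => f x - g x) = avg H f - avg H g := by
  simp only [avg, sub_mul]; rw [integral_sub hf hg, sub_div]

theorem avg_const_mul (H f : X → ℝ) (c : ℝ) : avg H (fun x => c * f x) = c * avg H f := by
  simp only [avg, mul_assoc]; rw [integral_const_mul, mul_div_assoc]

theorem avg_neg (H f : X → ℝ) : avg H (fun x => - f x) = - avg H f := by
  simp only [avg, neg_mul]; rw [integral_neg, neg_div]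

theorem avg_const {H : X → ℝ} (hZ : 0 < ∫ x, Real.exp (-H x)) (c : ℝ) : avg H (fun _ => c) = c := by
  simp only [avg]; rw [integral_const_mul, mul_div_cancel_right₀ _ hZ.ne']

theorem avg_sum {H : X → ℝ} {ι : Type*} (s : Finset ι) {f : ι → X → ℝ}
    (hf : ∀ i ∈ s, Integrable fun x => f i x * Real.exp (-H x)) :
    avg H (fun x => ∑ i ∈ s, f i x) = ∑ i ∈ s, avg H (f i) := by
  simp only [avg, Finset.sum_mul]; rw [integral_finsetSum _ hf, Finset.sum_div]

theorem avg_mono {H f g : X → ℝ} (hf : Integrable fun x => f x * Real.exp (-H x))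
    (hg : Integrable fun x => g x * Real.exp (-H x)) (h : ∀ x, f x ≤ g x) : avg H f ≤ avg H g := by
  unfold avg
  refine div_le_div_of_nonneg_right ?_ (integral_nonneg fun _ => (Real.exp_pos _).le)
  exact integral_mono hf hg fun x => mul_le_mul_of_nonneg_right (h x) (Real.exp_pos _).le

theorem avg_nonneg {H f : X → ℝ} (h : ∀ x, 0 ≤ f x) : 0 ≤ avg H f :=
  div_nonneg (integral_nonneg fun x => mul_nonneg (h x) (Real.exp_pos _).le)
    (integral_nonneg fun _ => (Real.exp_pos _).le)

/-- Gibbs variational inequality -/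
theorem gibbs_variational {A B : X → ℝ} (hA : Integrable fun x => Real.exp (-A x))
    (hB : Integrable fun x => Real.exp (-B x)) (hZB : 0 < ∫ x, Real.exp (-B x))
    (hAB : Integrable fun x => (B x - A x) * Real.exp (-B x)) :
    Real.log (∫ x, Real.exp (-B x)) + avg B (fun x => B x - A x) ≤ Real.log (∫ x, Real.exp (-A x)) := by
  set q := avg B (fun x => B x - A x) with hq
  have h1 : Real.exp q * ∫ x, Real.exp (-B x) ≤ ∫ x, Real.exp (-A x) := by
    have h2 : ∫ x, Real.exp q * ((1 - q) * Real.exp (-B x) + (B x - A x) * Real.exp (-B x))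
        = Real.exp q * ∫ x, Real.exp (-B x) := by
      rw [integral_const_mul, integral_add (hB.const_mul _) hAB, integral_const_mul]
      have : ∫ x, (B x - A x) * Real.exp (-B x) = q * ∫ x, Real.exp (-B x) := by
        rw [hq, avg]; field_simp
      rw [this]; ring
    rw [← h2]
    refine integral_mono (((hB.const_mul _).add hAB).const_mul _) hA fun x => ?_
    simp only
    have h3 := Real.add_one_le_exp (B x - A x - q)
    have h4 : Real.exp (-A x) = Real.exp q * Real.exp (-B x) * Real.exp (B x - A x - q) := by
      rw [← Real.exp_add, ← Real.exp_add]; congr 1; ring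
    rw [h4]
    have := mul_le_mul_of_nonneg_left h3 (mul_pos (Real.exp_pos q) (Real.exp_pos (-B x))).le
    nlinarith
  have h5 := Real.log_le_log (by positivity) h1
  rw [Real.log_mul (Real.exp_pos _).ne' hZB.ne', Real.log_exp] at h5
  linarith

end Avg

theorem Pot.tilt {l l' : ℝ} {U u : ℝ → ℝ} (h : Pot l l' U u) (q : ℝ) :
    Pot l l' (fun t => U t - q * t) (fun t => u t - q) where
  pos := h.pos
  hasDeriv t := by simpa using (h.hasDeriv t).fun_sub ((hasDerivAt_id t).const_mul q)
  lo s t hst := by simpa using h.lo s t hst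
  hi s t hst := by simpa using h.hi s t hst

section Gradient
variable {κ ι : Type*} [Fintype κ] [Fintype ι] (J : (κ → ℝ) →ₗ[ℝ] EuclideanSpace ℝ ι)
variable {l l' : ℝ} {U u : ι → ℝ → ℝ}

theorem gradP_of_mem {g : EuclideanSpace ℝ ι} (hg : g ∈ LinearMap.range J) : gradP J g = g :=
  Submodule.starProjection_eq_self_iff.2 hg

theorem gradP_mem (g : EuclideanSpace ℝ ι) : gradP J g ∈ LinearMap.range J :=
  Submodule.starProjection_apply_mem _ _

theorem gradP_norm_le (g : EuclideanSpace ℝ ι) : ‖gradP J g‖ ≤ ‖g‖ := by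
  rw [gradP, Submodule.starProjection_apply]
  exact orthP_norm_le _ g

theorem J_bound : ∃ q : ℝ, 0 ≤ q ∧ ∀ φ, ‖J φ‖ ≤ q * ‖φ‖ := by
  obtain ⟨q, hq, h⟩ := (LinearMap.toContinuousLinearMap J).bound
  exact ⟨q, hq.le, h⟩

theorem J_cont : Continuous J := (LinearMap.toContinuousLinearMap J).continuous

/-- difference of two coupled fields after one step -/
theorem coupled_step {u v : ι → ℝ → ℝ} {F : EuclideanSpace ℝ ι} (h : ∀ e, Pot l l' (U e) (u e))
    (hv : ∀ e t, v e t = u e t - F e) (hll : l ≤ l') {τ : ℝ} (hτ : 0 < τ) (hτl : τ * l' ≤ 1)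
    {g₀ g₁ z : EuclideanSpace ℝ ι} (h0 : g₀ ∈ LinearMap.range J) (h1 : g₁ ∈ LinearMap.range J) :
    ‖(g₁ - τ • gradP J (edgewise v g₁) + z) - (g₀ - τ • gradP J (edgewise u g₀) + z)‖
      ≤ (1 - l * τ) * ‖g₁ - g₀‖ + τ * ‖F‖ := by
  have hv' : edgewise v g₁ = edgewise u g₁ - F := by ext e; simp [hv]
  have e1 : (g₁ - τ • gradP J (edgewise v g₁) + z) - (g₀ - τ • gradP J (edgewise u g₀) + z)
      = gradP J ((g₁ - g₀) - τ • (edgewise u g₁ - edgewise u g₀)) + τ • gradP J F := by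
    rw [hv', map_sub, map_sub, map_sub, map_smul, map_sub, gradP_of_mem J h0, gradP_of_mem J h1]
    module
  rw [e1]
  refine (norm_add_le _ _).trans (add_le_add ((gradP_norm_le J _).trans ?_) ?_)
  · refine euclid_norm_le_of_sq ?_ fun e => ?_
    · nlinarith
    obtain ⟨q, hq1, hq2, hq3⟩ := (h e).secant (g₀ e) (g₁ e)
    simp only [PiLp.sub_apply, PiLp.smul_apply, edgewise_apply, smul_eq_mul, hq3]
    rw [← mul_assoc, ← one_sub_mul, abs_mul]
    refine mul_le_mul_of_nonneg_right ?_ (abs_nonneg _)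
    rw [abs_of_nonneg (by nlinarith)]
    nlinarith
  · rw [norm_smul, Real.norm_of_nonneg hτ.le]
    exact mul_le_mul_of_nonneg_left (gradP_norm_le J F) hτ.le

/-- response of the mean of `f` (1-Lipschitz up to `L`) to an external force `F` -/
theorem force_response (hJ : Function.Injective J) (hl : 0 < l) (hll : l ≤ l')
    {U u V v : ι → ℝ → ℝ} (h : ∀ e, Pot l l' (U e) (u e)) (hV : ∀ e, Pot l l' (V e) (v e))
    {F : EuclideanSpace ℝ ι} (hv : ∀ e t, v e t = u e t - F e)
    {f : EuclideanSpace ℝ ι → ℝ} {L : ℝ} (hL : 0 ≤ L) (hf : ∀ x y, |f x - f y| ≤ L * ‖x - y‖) :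
    avg (fieldH J V) (fun φ => f (J φ)) - avg (fieldH J U) (fun φ => f (J φ)) ≤ L * (‖F‖ / l) := by
  have key := field_coupling (m := Bool) J hJ hl hll (U := fun i => bif i then V else U)
    (u := fun i => bif i then v else u) (fun i e => by cases i; exacts [h e, hV e])
    {g | ‖g true - g false‖ ≤ ‖F‖ / l} (by simp; positivity) ?_
    (f := fun i => bif i then f else fun x => - f x) (L := L) (κ' := L * (‖F‖ / l)) ?_ ?_
  · rw [Fintype.sum_bool] at key
    simp only [cond_true, cond_false] at key
    rw [avg_neg] at key
    linarith
  · intro g hg hr τ hτ hτl z hz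
    simp only [Set.mem_ofPred_eq, cond_true, cond_false] at hg ⊢
    refine (coupled_step J h hv hll hτ hτl (hr false) (hr true)).trans ?_
    have : 0 ≤ 1 - l * τ := by nlinarith
    have h2 := mul_le_mul_of_nonneg_left hg this
    have : (1 - l * τ) * (‖F‖ / l) + τ * ‖F‖ = ‖F‖ / l := by field_simp; ring
    linarith
  · intro i x y
    cases i
    · simp only [cond_false]
      rw [neg_sub_neg, norm_sub_rev]; exact hf y x
    · exact hf x y
  · intro g hg _
    rw [Fintype.sum_bool]
    simp only [cond_true, cond_false]
    have h1 := (le_abs_self _).trans (hf (g true) (g false))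
    have h2 := mul_le_mul_of_nonneg_left hg hL
    linarith

theorem lin_growth (θ : EuclideanSpace ℝ ι) (k : ℕ) (hk : k ≤ 4) (m : ℝ) :
    ∃ C, ∀ φ : κ → ℝ, |inner ℝ θ (J φ) - m| ^ k ≤ C * (1 + ‖φ‖ ^ 4) := by
  obtain ⟨q, hq, hJb⟩ := J_bound J
  refine ⟨(1 + ‖θ‖ * q + |m|) ^ k * 2 ^ k * 2, fun φ => ?_⟩
  have h1 : |inner ℝ θ (J φ) - m| ≤ (1 + ‖θ‖ * q + |m|) * (1 + ‖φ‖) := by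
    refine (abs_sub _ _).trans ?_
    have h2 := abs_real_inner_le_norm θ (J φ)
    have h3 := mul_le_mul_of_nonneg_left (hJb φ) (norm_nonneg θ)
    have : 0 ≤ |m| * ‖φ‖ := by positivity
    have : 0 ≤ ‖θ‖ * q := by positivity
    nlinarith [norm_nonneg φ]
  refine (pow_le_pow_left₀ (abs_nonneg _) h1 k).trans ?_
  rw [mul_pow, mul_assoc, mul_assoc]
  refine mul_le_mul_of_nonneg_left ?_ (by positivity)
  have h4 : (1 + ‖φ‖) ^ k ≤ 2 ^ k * (1 + ‖φ‖ ^ k) := by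
    rcases Nat.eq_zero_or_pos k with rfl | hk0
    · simp
    have := add_pow_le (zero_le_one (α := ℝ)) (norm_nonneg φ) k
    rw [one_pow] at this
    refine this.trans (mul_le_mul_of_nonneg_right ?_ (by positivity))
    exact pow_le_pow_right₀ one_le_two (Nat.sub_le _ _)
  refine h4.trans (mul_le_mul_of_nonneg_left ?_ (by positivity))
  have h5 : ‖φ‖ ^ k ≤ 1 + ‖φ‖ ^ 4 := by
    rcases le_total ‖φ‖ 1 with h | h
    · have := pow_le_one₀ (n := k) (norm_nonneg φ) h
      have : 0 ≤ ‖φ‖ ^ 4 := by positivity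
      linarith
    · have := pow_le_pow_right₀ h hk
      linarith
  have : 0 ≤ ‖φ‖ ^ 4 := by positivity
  linarith

theorem lin_integrable (hJ : Function.Injective J) (hl : 0 < l) (hll : l ≤ l')
    (h : ∀ e, Pot l l' (U e) (u e)) (θ : EuclideanSpace ℝ ι) :
    Integrable (fun φ => inner ℝ θ (J φ) * Real.exp (-fieldH J U φ)) := by
  have hJc := J_cont J
  obtain ⟨C, hC⟩ := lin_growth J θ 1 (by norm_num) 0
  exact field_integrable J hJ hl hll h (by fun_prop) (fun φ => by simpa using hC φ)

theorem lin_pow_integrable (hJ : Function.Injective J) (hl : 0 < l) (hll : l ≤ l')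
    (h : ∀ e, Pot l l' (U e) (u e)) (θ : EuclideanSpace ℝ ι) (k : ℕ) (hk : k ≤ 4) (m : ℝ) :
    Integrable (fun φ => (inner ℝ θ (J φ) - m) ^ k * Real.exp (-fieldH J U φ)) := by
  have hJc := J_cont J
  obtain ⟨C, hC⟩ := lin_growth J θ k hk m
  exact field_integrable J hJ hl hll h (by fun_prop) (fun φ => by rw [abs_pow]; exact hC φ)

theorem exp_pointwise {y s : ℝ} (hs : 0 ≤ s) :
    s * y ^ 2 - s ^ 2 * |y| ^ 3 ≤ y * (Real.exp (s * y) - 1) := by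
  rcases le_total 0 y with hy | hy
  · have h1 := Real.add_one_le_exp (s * y)
    rw [abs_of_nonneg hy]
    have : 0 ≤ s ^ 2 * y ^ 3 := by positivity
    nlinarith
  · rw [abs_of_nonpos hy]
    have h2 : Real.exp (s * y) ≤ 1 + s * y + (s * y) ^ 2 := by
      have hx : 0 ≤ -(s * y) := by nlinarith
      have h3 := Real.quadratic_le_exp_of_nonneg hx
      have h4 : Real.exp (s * y) * Real.exp (-(s * y)) = 1 := by rw [← Real.exp_add]; simp
      set t := -(s * y)
      have h5 : s * y = -t := by simp [t]
      rw [h5] at h4 ⊢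
      have h6 := mul_le_mul_of_nonneg_left h3 (Real.exp_pos (-t)).le
      have h7 := Real.exp_pos (-t)
      by_contra hcon
      push Not at hcon
      have h8 : (1 + -t + (-t) ^ 2) * (1 + t + t ^ 2 / 2) < Real.exp (-t) * (1 + t + t ^ 2 / 2) :=
        mul_lt_mul_of_pos_right hcon (by positivity)
      nlinarith [pow_nonneg hx 3, pow_nonneg hx 4, pow_nonneg hx 2]
    nlinarith

/-- **Brascamp–Lieb** inequality for linear functionals of the gradient -/
theorem brascamp_lieb (hJ : Function.Injective J) (hl : 0 < l) (hll : l ≤ l')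
    (h : ∀ e, Pot l l' (U e) (u e)) (θ : EuclideanSpace ℝ ι) :
    avg (fieldH J U) (fun φ => (inner ℝ θ (J φ) - avg (fieldH J U) (fun φ => inner ℝ θ (J φ))) ^ 2)
      ≤ ‖θ‖ ^ 2 / l := by
  set m := avg (fieldH J U) (fun φ => inner ℝ θ (J φ)) with hm
  set K := ‖θ‖ ^ 2 / l with hK
  have hK0 : 0 ≤ K := by positivity
  have hJc := J_cont J
  set w : (κ → ℝ) → ℝ := fun φ => Real.exp (-fieldH J U φ) with hw
  set Y : (κ → ℝ) → ℝ := fun φ => inner ℝ θ (J φ) - m with hY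
  set Z := ∫ φ, w φ with hZ
  have hZp : 0 < Z := field_integral_pos J hJ hl hll h
  have hwi : Integrable w := field_integrable_one J hJ hl hll h
  have hYi : Integrable fun φ => Y φ * w φ := by
    simpa using lin_pow_integrable J hJ hl hll h θ 1 (by norm_num) m
  have hY2i : Integrable fun φ => (Y φ) ^ 2 * w φ := lin_pow_integrable J hJ hl hll h θ 2 (by norm_num) m
  have hY3i : Integrable fun φ => |Y φ| ^ 3 * w φ := by
    refine (lin_pow_integrable J hJ hl hll h θ 3 (by norm_num) m).norm.congr (ae_of_all _ fun φ => ?_)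
    show ‖(inner ℝ θ (J φ) - m) ^ 3 * Real.exp (-fieldH J U φ)‖
      = |inner ℝ θ (J φ) - m| ^ 3 * Real.exp (-fieldH J U φ)
    rw [norm_mul, norm_pow, Real.norm_eq_abs, Real.norm_of_nonneg (Real.exp_pos _).le]
  have hY0 : ∫ φ, Y φ * w φ = 0 := by
    have e1 : ∫ φ, Y φ * w φ = (∫ φ, inner ℝ θ (J φ) * w φ) - m * Z := by
      simp only [hY, sub_mul]
      rw [integral_sub (lin_integrable J hJ hl hll h θ) (hwi.const_mul _), integral_const_mul]
    rw [e1, hm, avg, ← hZ]; field_simp; ring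
  -- tilted models
  have htilt : ∀ s : ℝ, ∀ φ, Real.exp (-fieldH J (fun e t => U e t - s * θ e * t) φ)
      = w φ * Real.exp (s * Y φ) * Real.exp (s * m) := by
    intro s φ
    rw [hw, ← Real.exp_add, ← Real.exp_add]; congr 1
    simp only [fieldH, Finset.sum_sub_distrib, hY, PiLp.inner_apply]
    have : ∑ e, s * θ e * J φ e = s * ∑ e, inner ℝ (θ e) (J φ e) := by
      rw [Finset.mul_sum]; refine Finset.sum_congr rfl fun e _ => ?_
      simp; ring
    rw [this]; ring
  have hPs : ∀ s : ℝ, ∀ e, Pot l l' (fun t => U e t - s * θ e * t) (fun t => u e t - s * θ e) :=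
    fun s e => (h e).tilt _
  have hee : ∀ s : ℝ, Real.exp (s * m) * Real.exp (-(s * m)) = 1 := fun s => by
    rw [← Real.exp_add]; simp
  have hwsi : ∀ s : ℝ, Integrable fun φ => w φ * Real.exp (s * Y φ) := by
    intro s
    have := (field_integrable_one J hJ hl hll (hPs s)).mul_const (Real.exp (-(s * m)))
    refine this.congr (ae_of_all _ fun φ => ?_)
    simp only [htilt s φ]
    rw [mul_assoc _ (Real.exp (s * m)), hee, mul_one]
  have hYsi : ∀ s : ℝ, Integrable fun φ => Y φ * (w φ * Real.exp (s * Y φ)) := by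
    intro s
    have h1 := lin_pow_integrable J hJ hl hll (hPs s) θ 1 (by norm_num) m
    have := h1.mul_const (Real.exp (-(s * m)))
    refine this.congr (ae_of_all _ fun φ => ?_)
    simp only [htilt s φ, pow_one]
    rw [mul_assoc _ (_ * Real.exp (s * m)), mul_assoc _ (Real.exp (s * m)), hee, mul_one]
  have hresp : ∀ s : ℝ, 0 ≤ s → ∫ φ, Y φ * (w φ * Real.exp (s * Y φ))
      ≤ s * K * ∫ φ, w φ * Real.exp (s * Y φ) := by
    intro s hs
    have h1 := force_response J hJ hl hll h (hPs s) (F := s • θ) (fun e t => by simp)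
      (f := fun g => inner ℝ θ g) (L := ‖θ‖) (norm_nonneg _) (fun x y => by
        rw [← inner_sub_right]; exact abs_real_inner_le_norm _ _)
    rw [norm_smul, Real.norm_of_nonneg hs] at h1
    have h2 : avg (fieldH J fun e t => U e t - s * θ e * t) (fun φ => inner ℝ θ (J φ)) - m
        = (∫ φ, Y φ * (w φ * Real.exp (s * Y φ))) / ∫ φ, w φ * Real.exp (s * Y φ) := by
      have hpos : 0 < ∫ φ, w φ * Real.exp (s * Y φ) := by
        have := field_integral_pos J hJ hl hll (hPs s)
        simp only [htilt s] at this
        rw [integral_mul_const] at this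
        exact pos_of_mul_pos_left this (Real.exp_pos _).le
      have h3 : ∫ φ, Y φ * (w φ * Real.exp (s * Y φ))
          = (∫ φ, inner ℝ θ (J φ) * (w φ * Real.exp (s * Y φ))) - m * ∫ φ, w φ * Real.exp (s * Y φ) := by
        rw [← integral_const_mul, ← integral_sub]
        · congr 1; ext φ; simp only [hY]; ring
        · have := (hYsi s).add ((hwsi s).const_mul m)
          refine this.congr (ae_of_all _ fun φ => ?_)
          simp only [hY, Pi.add_apply]; ring
        · exact (hwsi s).const_mul m
      rw [h3, avg]
      simp only [htilt s, ← mul_assoc _ _ (Real.exp (s * m))]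
      rw [integral_mul_const, integral_mul_const, mul_div_mul_right _ _ (Real.exp_pos _).ne']
      field_simp
    have hpos : 0 < ∫ φ, w φ * Real.exp (s * Y φ) := by
      have := field_integral_pos J hJ hl hll (hPs s)
      simp only [htilt s] at this
      rw [integral_mul_const] at this
      exact pos_of_mul_pos_left this (Real.exp_pos _).le
    rw [← hm, h2, div_le_iff₀ hpos] at h1
    refine h1.trans (le_of_eq ?_)
    rw [hK]; field_simp
  have hfin : ∀ s : ℝ, 0 < s → s ^ 2 * K < 1 →
      (∫ φ, (Y φ) ^ 2 * w φ) ≤ K * (Z / (1 - s ^ 2 * K)) + s * ∫ φ, |Y φ| ^ 3 * w φ := by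
    intro s hs hsK
    have h1 := hresp s hs.le
    set M := ∫ φ, w φ * Real.exp (s * Y φ)
    have h2 : M ≤ Z + s * ∫ φ, Y φ * (w φ * Real.exp (s * Y φ)) := by
      rw [hZ, ← integral_const_mul, ← integral_add hwi ((hYsi s).const_mul s)]
      refine integral_mono (hwsi s) (hwi.add ((hYsi s).const_mul s)) fun φ => ?_
      simp only
      have h3 := Real.add_one_le_exp (-(s * Y φ))
      have h4 : Real.exp (s * Y φ) * Real.exp (-(s * Y φ)) = 1 := by rw [← Real.exp_add]; simp
      have h5 := mul_le_mul_of_nonneg_left h3 (mul_pos (Real.exp_pos (-fieldH J U φ)) (Real.exp_pos (s * Y φ))).le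
      change w φ * Real.exp (s * Y φ) * _ ≤ w φ * Real.exp (s * Y φ) * _ at h5
      rw [mul_assoc (w φ) _ (Real.exp (-(s * Y φ))), h4] at h5
      nlinarith
    have h6 : M * (1 - s ^ 2 * K) ≤ Z := by nlinarith
    have h7 : M ≤ Z / (1 - s ^ 2 * K) := by rwa [le_div_iff₀ (by linarith)]
    have h8 : s * (∫ φ, (Y φ) ^ 2 * w φ) - s ^ 2 * (∫ φ, |Y φ| ^ 3 * w φ)
        ≤ ∫ φ, Y φ * (w φ * Real.exp (s * Y φ)) := by
      have e1 : ∫ φ, Y φ * (w φ * Real.exp (s * Y φ))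
          = ∫ φ, (Y φ * (w φ * Real.exp (s * Y φ)) - Y φ * w φ) := by
        rw [integral_sub (hYsi s) hYi, hY0, sub_zero]
      rw [e1, ← integral_const_mul, ← integral_const_mul,
        ← integral_sub (hY2i.const_mul _) (hY3i.const_mul _)]
      refine integral_mono ((hY2i.const_mul _).sub (hY3i.const_mul _)) ((hYsi s).sub hYi) fun φ => ?_
      simp only
      have := mul_le_mul_of_nonneg_left (exp_pointwise (y := Y φ) hs.le) (Real.exp_pos (-fieldH J U φ)).le
      change w φ * _ ≤ w φ * _ at this
      linarith
    have h9 : s * K * M ≤ s * (K * (Z / (1 - s ^ 2 * K))) := by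
      rw [mul_assoc]; gcongr
    have h10 : s * (∫ φ, (Y φ) ^ 2 * w φ)
        ≤ s * (K * (Z / (1 - s ^ 2 * K)) + s * ∫ φ, |Y φ| ^ 3 * w φ) := by nlinarith
    exact le_of_mul_le_mul_left h10 hs
  have hlim : Tendsto (fun s : ℝ => K * (Z / (1 - s ^ 2 * K)) + s * ∫ φ, |Y φ| ^ 3 * w φ)
      (nhdsWithin 0 (Set.Ioi 0)) (nhds (K * (Z / (1 - 0 ^ 2 * K)) + 0 * ∫ φ, |Y φ| ^ 3 * w φ)) := by
    refine Tendsto.mono_left ?_ nhdsWithin_le_nhds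
    have hc : ContinuousAt (fun s : ℝ => 1 - s ^ 2 * K) 0 := by fun_prop
    exact ((continuousAt_const.mul (continuousAt_const.div hc (by norm_num))).add
      (continuousAt_id.mul continuousAt_const)).tendsto
  have hV : (∫ φ, (Y φ) ^ 2 * w φ) ≤ K * Z := by
    have : K * (Z / (1 - 0 ^ 2 * K)) + 0 * (∫ φ, |Y φ| ^ 3 * w φ) = K * Z := by simp
    rw [this] at hlim
    refine ge_of_tendsto hlim ?_
    have hev : ∀ᶠ s : ℝ in nhdsWithin 0 (Set.Ioi 0), s ^ 2 * K < 1 := by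
      refine Filter.Eventually.filter_mono nhdsWithin_le_nhds ?_
      have hc : ContinuousAt (fun s : ℝ => s ^ 2 * K) 0 := by fun_prop
      exact hc.eventually_lt continuousAt_const (by norm_num)
    filter_upwards [hev, self_mem_nhdsWithin] with s h1 h2
    exact hfin s h2 h1
  rw [avg, div_le_iff₀ hZp]
  exact hV

end Gradient

/-! ### A Bellman function and the discrete `L⁴` Helmholtz estimate -/

/-- the Bellman function in the variables `u` and `w = v^{1/3}` -/
def bellW (u w : ℝ) : ℝ := (if w ^ 2 ≤ u ^ 2 then u ^ 4 else 2 * u ^ 2 * w ^ 2 - w ^ 4) + 1000 * w ^ 4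

theorem bellW_ge (u w s : ℝ) (hs : w ^ 2 ≤ s) : 2 * u ^ 2 * s - s ^ 2 + 1000 * w ^ 4 ≤ bellW u w := by
  unfold bellW; split_ifs with h
  · nlinarith [sq_nonneg (u ^ 2 - s)]
  · push Not at h
    have : 0 ≤ (s - w ^ 2) * (s + w ^ 2 - 2 * u ^ 2) := mul_nonneg (by linarith) (by linarith)
    nlinarith

theorem bellW_nonneg (u w : ℝ) : 0 ≤ bellW u w := by
  have := bellW_ge u w (w ^ 2) le_rfl
  have h2 : 0 ≤ u ^ 2 * w ^ 2 := by positivity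
  have h3 : 0 ≤ w ^ 4 := by positivity
  nlinarith

theorem bellW_le (u w : ℝ) : bellW u w ≤ u ^ 4 + 1000 * w ^ 4 := by
  unfold bellW; split_ifs with h
  · linarith
  · nlinarith [sq_nonneg (u ^ 2 - w ^ 2)]

theorem amgm_aux {a b D m : ℝ} (hD : 0 ≤ D) (hm : 0 ≤ m) (hb : b ^ 2 ≤ 9 * D * m) :
    |a| * |b| ≤ m * a ^ 2 + 9 * D := by
  have h1 : (|a| * |b|) ^ 2 ≤ (m * a ^ 2 + 9 * D) ^ 2 := by
    rw [mul_pow, sq_abs, sq_abs]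
    have : a ^ 2 * b ^ 2 ≤ a ^ 2 * (9 * D * m) := mul_le_mul_of_nonneg_left hb (sq_nonneg _)
    nlinarith [sq_nonneg (m * a ^ 2 - 9 * D), mul_nonneg (mul_nonneg hm (sq_nonneg a)) hD]
  exact abs_le_of_sq_le_sq' h1 (by positivity) |>.2

theorem cube_rem (w w' : ℝ) : (w' - w) ^ 2 * (w ^ 2 + w' ^ 2) / 6
    ≤ w' ^ 4 - w ^ 4 - 4 / 3 * w * (w' ^ 3 - w ^ 3) := by
  have : w' ^ 4 - w ^ 4 - 4 / 3 * w * (w' ^ 3 - w ^ 3)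
      = (w' - w) ^ 2 * ((3 * w' ^ 2 + 2 * w * w' + w ^ 2) / 3) := by ring
  rw [this, mul_div_assoc]
  refine mul_le_mul_of_nonneg_left ?_ (sq_nonneg _)
  nlinarith [sq_nonneg (2 * w' + w), sq_nonneg (w' + w), sq_nonneg w, sq_nonneg w']

theorem cube_diff_sq (w w' : ℝ) : (w' ^ 3 - w ^ 3) ^ 2
    ≤ 9 / 4 * ((w' - w) ^ 2 * (w ^ 2 + w' ^ 2)) * (w ^ 2 + w' ^ 2) := by
  have h : (w' ^ 2 + w * w' + w ^ 2) ^ 2 ≤ (3 / 2 * (w ^ 2 + w' ^ 2)) ^ 2 := by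
    apply pow_le_pow_left₀ <;> nlinarith [sq_nonneg (w - w'), sq_nonneg (w + w')]
  have := mul_le_mul_of_nonneg_left h (sq_nonneg (w' - w))
  nlinarith

theorem sq_diff_sq (w w' : ℝ) : (w' ^ 2 - w ^ 2) ^ 2 ≤ 2 * ((w' - w) ^ 2 * (w ^ 2 + w' ^ 2)) := by
  have h : (w' + w) ^ 2 ≤ 2 * (w ^ 2 + w' ^ 2) := by nlinarith [sq_nonneg (w - w')]
  have := mul_le_mul_of_nonneg_left h (sq_nonneg (w' - w))
  nlinarith

set_option maxHeartbeats 1000000 in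
theorem bellW_subgrad (u w : ℝ) : ∃ p q : ℝ, ∀ u' w' : ℝ,
    bellW u w + p * (u' - u) + q * (w' ^ 3 - w ^ 3) + |u' - u| * |w' ^ 3 - w ^ 3| ≤ bellW u' w' := by
  by_cases hr : w ^ 2 ≤ u ^ 2
  · refine ⟨4 * u ^ 3, 1000 * (4 / 3 * w), fun u' w' => ?_⟩
    have hB : bellW u w = u ^ 4 + 1000 * w ^ 4 := by rw [bellW, if_pos hr]
    have hrem := cube_rem w w'
    have hb := cube_diff_sq w w'
    have hsq := sq_diff_sq w w'
    obtain ⟨a, rfl⟩ : ∃ a, u' = u + a := ⟨u' - u, by ring⟩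
    rw [add_sub_cancel_left, hB]
    set D := (w' - w) ^ 2 * (w ^ 2 + w' ^ 2) with hD
    have hD0 : 0 ≤ D := by positivity
    set b := w' ^ 3 - w ^ 3
    rcases le_or_gt (w' ^ 2) (u ^ 2) with h | h
    · have h1 := bellW_ge (u + a) w' (u ^ 2) h
      have h2 : |a| * |b| ≤ u ^ 2 * a ^ 2 + 9 * D := amgm_aux hD0 (sq_nonneg u) (by
        have := mul_le_mul_of_nonneg_left (add_le_add hr h) hD0
        nlinarith)
      nlinarith [sq_nonneg (u * a)]
    · have h1 := bellW_ge (u + a) w' (w' ^ 2) le_rfl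
      have h2 : |a| * |b| ≤ w' ^ 2 * a ^ 2 + 9 * D := amgm_aux hD0 (sq_nonneg w') (by
        have := mul_le_mul_of_nonneg_left (add_le_add (hr.trans h.le) le_rfl : w ^ 2 + w' ^ 2 ≤ _) hD0
        nlinarith)
      have h3 : (w' ^ 2 - u ^ 2) ^ 2 ≤ (w' ^ 2 - w ^ 2) ^ 2 :=
        pow_le_pow_left₀ (by linarith) (by linarith) 2
      have h4 : u ^ 2 * a ^ 2 ≤ w' ^ 2 * a ^ 2 := mul_le_mul_of_nonneg_right h.le (sq_nonneg a)
      nlinarith [sq_nonneg (u * a + 2 * (w' ^ 2 - u ^ 2))]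
  · push Not at hr
    have hw : w ≠ 0 := by
      rintro rfl; nlinarith [sq_nonneg u]
    obtain ⟨ν, hν⟩ : ∃ ν : ℝ, w * ν = 4 / 3 * (u ^ 2 - w ^ 2) :=
      ⟨4 / 3 * (u ^ 2 - w ^ 2) / w, by field_simp⟩
    refine ⟨4 * u * w ^ 2, 1000 * (4 / 3 * w) + ν, fun u' w' => ?_⟩
    have hB : bellW u w = 2 * u ^ 2 * w ^ 2 - w ^ 4 + 1000 * w ^ 4 := by
      rw [bellW, if_neg (by linarith)]
    have hrem := cube_rem w w'
    have hb := cube_diff_sq w w'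
    have hsq := sq_diff_sq w w'
    obtain ⟨a, rfl⟩ : ∃ a, u' = u + a := ⟨u' - u, by ring⟩
    rw [add_sub_cancel_left, hB]
    set D := (w' - w) ^ 2 * (w ^ 2 + w' ^ 2) with hD
    have hD0 : 0 ≤ D := by positivity
    have hw2 : 0 < w ^ 2 := by positivity
    rcases le_or_gt (w ^ 2) (2 * w' ^ 2) with h | h
    · have h1 := bellW_ge (u + a) w' (w' ^ 2) le_rfl
      have h2 : |a| * |w' ^ 3 - w ^ 3| ≤ w' ^ 2 * a ^ 2 + 9 * D := amgm_aux hD0 (sq_nonneg w') (by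
        have := mul_le_mul_of_nonneg_left (add_le_add h le_rfl : w ^ 2 + w' ^ 2 ≤ _) hD0
        nlinarith)
      -- second order Taylor term of `u² w²`
      have h3 : 2 * u ^ 2 * (w' ^ 2 - w ^ 2) - ν * (w' ^ 3 - w ^ 3)
          - (w' ^ 4 - w ^ 4) ≥ - (w' ^ 4 - w ^ 4 - 4 / 3 * w * (w' ^ 3 - w ^ 3)) - 3 * D := by
        have e1 : w ^ 2 * (2 * u ^ 2 * (w' ^ 2 - w ^ 2) - ν * (w' ^ 3 - w ^ 3)
          - 4 / 3 * w * (w' ^ 3 - w ^ 3)) = - (2 / 3) * u ^ 2 * ((w' - w) ^ 2 * (w * (2 * w' + w))) := by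
          have : w ^ 2 * (ν * (w' ^ 3 - w ^ 3)) = w * (4 / 3 * (u ^ 2 - w ^ 2)) * (w' ^ 3 - w ^ 3) := by
            rw [← hν]; ring
          linear_combination -this
        have e2 : (w' - w) ^ 2 * (w * (2 * w' + w)) ≤ 2 * D := by
          have : w * (2 * w' + w) ≤ 2 * (w ^ 2 + w' ^ 2) := by nlinarith [sq_nonneg (w - w')]
          have := mul_le_mul_of_nonneg_left this (sq_nonneg (w' - w)); nlinarith
        have e3 : u ^ 2 * ((w' - w) ^ 2 * (w * (2 * w' + w))) ≤ w ^ 2 * (2 * D) :=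
          (mul_le_mul_of_nonneg_left e2 (sq_nonneg u)).trans
            (mul_le_mul_of_nonneg_right hr.le (by positivity))
        have e4 : w ^ 2 * (2 * u ^ 2 * (w' ^ 2 - w ^ 2) - ν * (w' ^ 3 - w ^ 3)
          - 4 / 3 * w * (w' ^ 3 - w ^ 3)) ≥ w ^ 2 * (-3 * D) := by rw [e1]; nlinarith
        have := le_of_mul_le_mul_left e4 hw2
        linarith
      have h4 : 4 * u * a * (w' ^ 2 - w ^ 2) ≥ - (w' ^ 2 * a ^ 2) / 2 - 16 * (w' ^ 2 - w ^ 2) ^ 2 := by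
        have : u ^ 2 * a ^ 2 ≤ 2 * w' ^ 2 * a ^ 2 := mul_le_mul_of_nonneg_right (by linarith) (sq_nonneg a)
        linarith [sq_nonneg (u * a / 2 + 4 * (w' ^ 2 - w ^ 2)),
          (by ring : (u * a / 2 + 4 * (w' ^ 2 - w ^ 2)) ^ 2 = u ^ 2 * a ^ 2 / 4
            + 4 * u * a * (w' ^ 2 - w ^ 2) + 16 * (w' ^ 2 - w ^ 2) ^ 2)]
      linarith [mul_nonneg (sq_nonneg w') (sq_nonneg a)]
    · have h1 := bellW_ge (u + a) w' (w ^ 2) (by nlinarith [sq_nonneg w'])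
      have h2 : |a| * |w' ^ 3 - w ^ 3| ≤ w ^ 2 * a ^ 2 + 9 * D := amgm_aux hD0 (sq_nonneg w) (by
        have := mul_le_mul_of_nonneg_left (add_le_add le_rfl (by linarith [sq_nonneg w'] : w' ^ 2 ≤ w ^ 2) : w ^ 2 + w' ^ 2 ≤ _) hD0
        nlinarith)
      have h3 : w ^ 4 ≤ 16 * D := by
        have : w ^ 2 / 16 ≤ (w' - w) ^ 2 := by nlinarith [sq_nonneg (4 * w' - 3 * w)]
        have h4 := mul_le_mul this (by nlinarith [sq_nonneg w'] : w ^ 2 ≤ w ^ 2 + w' ^ 2) hw2.le (sq_nonneg _)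
        nlinarith
      have h5 : ν * (w' ^ 3 - w ^ 3) ≤ 40 * D := by
        have e1 : (w * ν) ^ 2 ≤ (4 / 3 * w ^ 2) ^ 2 := by
          rw [hν]; apply sq_le_sq'
          · nlinarith [sq_nonneg u]
          · nlinarith
        have e2 : ν ^ 2 ≤ 16 / 9 * w ^ 2 := by
          have : w ^ 2 * ν ^ 2 ≤ w ^ 2 * (16 / 9 * w ^ 2) := by nlinarith
          exact le_of_mul_le_mul_left this hw2
        have e3 : (ν * (w' ^ 3 - w ^ 3)) ^ 2 ≤ (40 * D) ^ 2 := by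
          rw [mul_pow]
          calc ν ^ 2 * (w' ^ 3 - w ^ 3) ^ 2 ≤ (16 / 9 * w ^ 2) * (9 / 4 * D * (2 * w ^ 2)) := by
                apply mul_le_mul e2 _ (sq_nonneg _) (by positivity)
                refine hb.trans (mul_le_mul_of_nonneg_left (by linarith [sq_nonneg w']) (by positivity))
            _ = 8 * D * w ^ 4 := by ring
            _ ≤ 8 * D * (16 * D) := mul_le_mul_of_nonneg_left h3 (by positivity)
            _ ≤ (40 * D) ^ 2 := by nlinarith [sq_nonneg D]
        exact (abs_le_of_sq_le_sq' e3 (by positivity)).2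
      linarith [mul_nonneg hw2.le (sq_nonneg a)]

/-- the real cube root -/
def cbrt (v : ℝ) : ℝ := Function.invFun (fun w : ℝ => w ^ 3) v

theorem cbrt_cube (v : ℝ) : cbrt v ^ 3 = v := by
  have hsurj : Function.Surjective (fun w : ℝ => w ^ 3) := by
    intro v
    rcases le_total 0 v with h | h
    · refine ⟨v ^ (1 / 3 : ℝ), ?_⟩
      simp only [← Real.rpow_natCast]
      rw [← Real.rpow_mul h]; norm_num
    · refine ⟨-((-v) ^ (1 / 3 : ℝ)), ?_⟩
      simp only
      rw [Odd.neg_pow (by decide), ← Real.rpow_natCast, ← Real.rpow_mul (by linarith)]; norm_num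
  exact Function.rightInverse_invFun hsurj v

theorem cbrt_pow (w : ℝ) : cbrt (w ^ 3) = w :=
  (Odd.strictMono_pow (by decide : Odd 3)).injective (cbrt_cube _)

/-- the Bellman function -/
def bell (u v : ℝ) : ℝ := bellW u (cbrt v)

theorem bell_subgrad (u v : ℝ) : ∃ p q : ℝ, ∀ u' v' : ℝ,
    bell u v + p * (u' - u) + q * (v' - v) + |u' - u| * |v' - v| ≤ bell u' v' := by
  obtain ⟨p, q, h⟩ := bellW_subgrad u (cbrt v)
  refine ⟨p, q, fun u' v' => ?_⟩
  have := h u' (cbrt v')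
  rwa [cbrt_cube, cbrt_cube] at this

section Heat
variable {G : Type*} [AddCommGroup G] [Fintype G] {d : ℕ} (e : Fin d → G)

/-- one step of the lazy random walk -/
def heat : (G → ℝ) →ₗ[ℝ] (G → ℝ) where
  toFun f x := f x / 2 + (1 / (4 * d)) * ∑ i, (f (x + e i) + f (x - e i))
  map_add' f g := by
    ext x; simp only [Pi.add_apply, Finset.sum_add_distrib]; ring
  map_smul' c f := by
    ext x; simp only [Pi.smul_apply, smul_eq_mul, ← mul_add, RingHom.id_apply]
    rw [← Finset.mul_sum]; ring

theorem heat_apply (f : G → ℝ) (x : G) :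
    heat e f x = f x / 2 + (1 / (4 * d)) * ∑ i, (f (x + e i) + f (x - e i)) := rfl

theorem sum_shift (f : G → ℝ) (a : G) : ∑ x, f (x + a) = ∑ x, f x :=
  Fintype.sum_equiv (Equiv.addRight a) _ _ fun _ => rfl

theorem sum_shift' (f : G → ℝ) (a : G) : ∑ x, f (x - a) = ∑ x, f x :=
  Fintype.sum_equiv (Equiv.subRight a) _ _ fun _ => rfl

theorem heat_const [NeZero d] (c : ℝ) (x : G) : heat e (fun _ => c) x = c := by
  have : (d : ℝ) ≠ 0 := NeZero.ne _
  rw [heat_apply]; simp; field_simp; ring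

theorem sum_heat [NeZero d] (f : G → ℝ) : ∑ x, heat e f x = ∑ x, f x := by
  have : (d : ℝ) ≠ 0 := NeZero.ne _
  simp only [heat_apply]
  rw [Finset.sum_add_distrib, ← Finset.mul_sum, Finset.sum_comm]
  simp only [Finset.sum_add_distrib, sum_shift, sum_shift', ← Finset.sum_div]
  simp; field_simp; ring

theorem heat_shift (f : G → ℝ) (a : G) (x : G) : heat e (fun y => f (y + a)) x = heat e f (x + a) := by
  simp only [heat_apply]
  congr 2
  refine Finset.sum_congr rfl fun i _ => ?_
  congr 2 <;> abel

theorem heat_symm (f g : G → ℝ) : ∑ x, heat e f x * g x = ∑ x, f x * heat e g x := by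
  simp only [heat_apply, add_mul, mul_add, Finset.sum_add_distrib, Finset.sum_mul, Finset.mul_sum]
  congr 1
  · refine Finset.sum_congr rfl fun x _ => by ring
  · rw [add_comm]
    congr 1
    · rw [Finset.sum_comm, Finset.sum_comm (s := (Finset.univ : Finset G))]
      refine Finset.sum_congr rfl fun i _ => ?_
      rw [← sum_shift _ (e i)]
      refine Finset.sum_congr rfl fun x _ => by simp; ring
    · rw [Finset.sum_comm, Finset.sum_comm (s := (Finset.univ : Finset G))]
      refine Finset.sum_congr rfl fun i _ => ?_
      rw [← sum_shift' _ (e i)]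
      refine Finset.sum_congr rfl fun x _ => by simp; ring

/-- forward difference -/
def fwd (a : G) : (G → ℝ) →ₗ[ℝ] (G → ℝ) where
  toFun f x := f (x + a) - f x
  map_add' f g := by ext x; simp only [Pi.add_apply]; ring
  map_smul' c f := by ext x; simp only [Pi.smul_apply, smul_eq_mul, RingHom.id_apply]; ring

/-- adjoint of the forward difference -/
def bwd (a : G) : (G → ℝ) →ₗ[ℝ] (G → ℝ) where
  toFun f x := f (x - a) - f x
  map_add' f g := by ext x; simp only [Pi.add_apply]; ring
  map_smul' c f := by ext x; simp only [Pi.smul_apply, smul_eq_mul, RingHom.id_apply]; ring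

theorem fwd_apply (a : G) (f : G → ℝ) (x : G) : fwd a f x = f (x + a) - f x := rfl
theorem bwd_apply (a : G) (f : G → ℝ) (x : G) : bwd a f x = f (x - a) - f x := rfl

theorem sum_bwd_mul (a : G) (f g : G → ℝ) : ∑ x, bwd a f x * g x = ∑ x, f x * fwd a g x := by
  simp only [fwd_apply, bwd_apply, sub_mul, mul_sub, Finset.sum_sub_distrib]
  congr 1
  rw [← sum_shift _ a]; simp

theorem heat_bwd (a : G) (f : G → ℝ) : heat e (bwd a f) = bwd a (heat e f) := by
  have h : bwd a f = (fun y => f (y + -a)) - f := by ext x; simp [bwd_apply, sub_eq_add_neg]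
  rw [h, map_sub]; ext x
  rw [Pi.sub_apply, heat_shift, bwd_apply, ← sub_eq_add_neg]

theorem heat_eq_sub [NeZero d] (f : G → ℝ) :
    heat e f = f - (1 / (4 * d) : ℝ) • ∑ i, bwd (e i) (fwd (e i) f) := by
  have : (d : ℝ) ≠ 0 := NeZero.ne _
  ext x
  rw [heat_apply]
  simp only [Pi.sub_apply, Pi.smul_apply, Finset.sum_apply, bwd_apply, fwd_apply, sub_add_cancel, smul_eq_mul]
  have : ∑ i, (f x - f (x - e i) - (f (x + e i) - f x))
      = 2 * d * f x - ∑ i, (f (x + e i) + f (x - e i)) := by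
    rw [eq_sub_iff_add_eq, ← Finset.sum_add_distrib]
    rw [Finset.sum_congr rfl (fun i _ => (by ring : _ = 2 * f x))]
    simp; ring
  rw [this]; field_simp; ring

/-- lower bound of the average of a nonnegative function by three sites -/
theorem heat_ge_three [NeZero d] {f : G → ℝ} (h : ∀ x, 0 ≤ f x) (x : G) (i j : Fin d) :
    (1 / (8 * d)) * (f x + f (x - e i) + f (x - e j)) ≤ heat e f x := by
  have hd : (1 : ℝ) ≤ d := by exact_mod_cast NeZero.one_le
  rw [heat_apply]
  have hs : ∀ i, f (x - e i) ≤ ∑ i, (f (x + e i) + f (x - e i)) := fun i => by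
    refine (le_add_of_nonneg_left (h (x + e i))).trans ?_
    exact Finset.single_le_sum (f := fun i => f (x + e i) + f (x - e i))
      (fun i _ => add_nonneg (h _) (h _)) (Finset.mem_univ i)
  have h1 := hs i
  have h2 := hs j
  set S := ∑ i, (f (x + e i) + f (x - e i))
  have h3 : 1 / (8 * (d : ℝ)) * f x ≤ f x / 2 := by
    rw [div_mul_eq_mul_div, one_mul, div_le_div_iff₀ (by positivity) (by norm_num)]
    nlinarith [h x]
  have h4 : 1 / (8 * (d : ℝ)) * (f (x - e i) + f (x - e j)) ≤ 1 / (8 * (d : ℝ)) * (2 * S) :=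
    mul_le_mul_of_nonneg_left (by linarith) (by positivity)
  have h5 : 1 / (8 * (d : ℝ)) * (2 * S) = 1 / (4 * d) * S := by field_simp; ring
  rw [h5] at h4
  linarith [mul_add (1 / (8 * (d : ℝ))) (f x) (f (x - e i) + f (x - e j))]

/-- abstract convexity gap for the averaging operator -/
theorem heat_gap [NeZero d] {B : ℝ → ℝ → ℝ}
    (hB : ∀ u v, ∃ p q : ℝ, ∀ u' v' : ℝ,
      B u v + p * (u' - u) + q * (v' - v) + |u' - u| * |v' - v| ≤ B u' v')
    (f g : G → ℝ) (x : G) (i j : Fin d) :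
    B (heat e f x) (heat e g x) + (1 / (64 * d)) * (|bwd (e i) f x| * |bwd (e j) g x|)
      ≤ heat e (fun y => B (f y) (g y)) x := by
  obtain ⟨p, q, hpq⟩ := hB (heat e f x) (heat e g x)
  set m := heat e f x
  set n := heat e g x
  set E : ℝ → ℝ → ℝ := fun u v => B u v - (B m n + p * (u - m) + q * (v - n)) with hE
  have hE0 : ∀ u v, 0 ≤ E u v := fun u v => by
    have := hpq u v
    have h2 : 0 ≤ |u - m| * |v - n| := by positivity
    simp only [hE]; linarith
  have hpair : ∀ u v u' v', 1 / 2 * (|u - u'| * |v - v'|) ≤ E u v + E u' v' := by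
    intro u v u' v'
    obtain ⟨p', q', h'⟩ := hB ((u + u') / 2) ((v + v') / 2)
    have h1 := h' u v
    have h2 := h' u' v'
    have h3 := hE0 ((u + u') / 2) ((v + v') / 2)
    rw [show u - (u + u') / 2 = (u - u') / 2 by ring, show v - (v + v') / 2 = (v - v') / 2 by ring,
      abs_div, abs_div, abs_two] at h1
    rw [show u' - (u + u') / 2 = -((u - u') / 2) by ring, show v' - (v + v') / 2 = -((v - v') / 2) by ring,
      abs_neg, abs_neg, abs_div, abs_div, abs_two] at h2
    simp only [hE] at h3 ⊢
    linarith
  have htriple : ∀ u0 v0 u1 v1 u2 v2, 1 / 8 * (|u1 - u0| * |v2 - v0|) ≤ E u0 v0 + E u1 v1 + E u2 v2 := by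
    intro u0 v0 u1 v1 u2 v2
    have h01 := hpair u0 v0 u1 v1
    have h02 := hpair u0 v0 u2 v2
    have h12 := hpair u1 v1 u2 v2
    have e0 := hE0 u0 v0
    have e1 := hE0 u1 v1
    have e2 := hE0 u2 v2
    rw [abs_sub_comm u0 u1] at h01
    rw [abs_sub_comm v0 v2] at h02
    have t1 : |v2 - v0| ≤ |v0 - v1| + |v1 - v2| := by
      rw [abs_sub_comm v2]; exact abs_sub_le _ _ _
    have t2 : |u1 - u0| ≤ |u1 - u2| + |u0 - u2| := by
      rw [abs_sub_comm u0]; exact abs_sub_le _ _ _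
    set P := |u1 - u0|
    set Q := |v2 - v0|
    have hP : 0 ≤ P := abs_nonneg _
    have hQ : 0 ≤ Q := abs_nonneg _
    rcases le_total (Q / 2) |v0 - v1| with h | h
    · have := mul_le_mul_of_nonneg_left h hP
      nlinarith [mul_nonneg hP hQ]
    rcases le_total (P / 2) |u0 - u2| with h' | h'
    · have := mul_le_mul_of_nonneg_right h' hQ
      nlinarith [mul_nonneg hP hQ]
    have := mul_le_mul (by linarith : P / 2 ≤ |u1 - u2|) (by linarith : Q / 2 ≤ |v1 - v2|) (by positivity) (abs_nonneg _)
    nlinarith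
  have hsum : heat e (fun y => E (f y) (g y)) x = heat e (fun y => B (f y) (g y)) x - B m n := by
    have : (fun y => E (f y) (g y)) = (fun y => B (f y) (g y)) - (fun _ => B m n - p * m - q * n)
        - p • f - q • g := by
      ext y; simp [hE]; ring
    rw [this, map_sub, map_sub, map_sub, map_smul, map_smul]
    simp only [Pi.sub_apply, heat_const, Pi.smul_apply, smul_eq_mul]
    change _ - _ - p * m - q * n = _
    ring
  have h1 := heat_ge_three e (f := fun y => E (f y) (g y)) (fun y => hE0 _ _) x i j
  have h2 := htriple (f x) (g x) (f (x - e i)) (g (x - e i)) (f (x - e j)) (g (x - e j))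
  have h3 := mul_le_mul_of_nonneg_left h2 (by positivity : (0 : ℝ) ≤ 1 / (8 * d))
  rw [hsum] at h1
  simp only [bwd_apply]
  have h4 : 1 / (8 * (d : ℝ)) * (1 / 8 * (|f (x - e i) - f x| * |g (x - e j) - g x|))
    = 1 / (64 * d) * (|f (x - e i) - f x| * |g (x - e j) - g x|) := by
    ring
  linarith

theorem heat_bell [NeZero d] {B : ℝ → ℝ → ℝ}
    (hB : ∀ u v, ∃ p q : ℝ, ∀ u' v' : ℝ,
      B u v + p * (u' - u) + q * (v' - v) + |u' - u| * |v' - v| ≤ B u' v')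
    (hB0 : ∀ u v, 0 ≤ B u v) (f g : G → ℝ) (i j : Fin d) (n : ℕ) :
    ∑ k ∈ Finset.range n, ∑ x, |bwd (e i) ((heat e ^ k) f) x| * |bwd (e j) ((heat e ^ k) g) x|
      ≤ 64 * d * ∑ x, B (f x) (g x) := by
  have hd : (0 : ℝ) < d := by exact_mod_cast NeZero.pos d
  suffices h : (∑ k ∈ Finset.range n, ∑ x, |bwd (e i) ((heat e ^ k) f) x| * |bwd (e j) ((heat e ^ k) g) x|)
      + 64 * d * ∑ x, B ((heat e ^ n) f x) ((heat e ^ n) g x) ≤ 64 * d * ∑ x, B (f x) (g x) by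
    have : 0 ≤ 64 * d * ∑ x, B ((heat e ^ n) f x) ((heat e ^ n) g x) :=
      mul_nonneg (by positivity) (Finset.sum_nonneg fun x _ => hB0 _ _)
    linarith
  induction n with
  | zero => simp
  | succ n ih =>
    rw [Finset.sum_range_succ]
    have h1 : ∑ x, (B ((heat e ^ (n + 1)) f x) ((heat e ^ (n + 1)) g x)
        + (1 / (64 * d)) * (|bwd (e i) ((heat e ^ n) f) x| * |bwd (e j) ((heat e ^ n) g) x|))
        ≤ ∑ x, B ((heat e ^ n) f x) ((heat e ^ n) g x) := by
      rw [← sum_heat e (fun x => B ((heat e ^ n) f x) ((heat e ^ n) g x))]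
      refine Finset.sum_le_sum fun x _ => ?_
      simp only [pow_succ', Module.End.mul_apply]
      exact heat_gap e hB _ _ x i j
    rw [Finset.sum_add_distrib, ← Finset.mul_sum] at h1
    have h2 := mul_le_mul_of_nonneg_left h1 (by positivity : (0 : ℝ) ≤ 64 * d)
    rw [mul_add, ← mul_assoc (64 * (d : ℝ)), mul_one_div_cancel (by positivity), one_mul] at h2
    linarith

theorem heat_sq_le [NeZero d] (f : G → ℝ) : ∑ x, (heat e f x) ^ 2 ≤ ∑ x, f x ^ 2 := by
  rw [← sum_heat e (fun x => f x ^ 2)]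
  refine Finset.sum_le_sum fun x _ => ?_
  have hB : ∀ u v : ℝ, ∃ p q : ℝ, ∀ u' v' : ℝ,
      (u ^ 2 + v ^ 2) + p * (u' - u) + q * (v' - v) + |u' - u| * |v' - v| ≤ u' ^ 2 + v' ^ 2 := by
    refine fun u v => ⟨2 * u, 2 * v, fun u' v' => ?_⟩
    nlinarith [sq_nonneg (|u' - u| - |v' - v|), sq_abs (u' - u), sq_abs (v' - v)]
  have := heat_gap e hB f 0 x (⟨0, NeZero.pos d⟩) (⟨0, NeZero.pos d⟩)
  simpa using this

theorem heat_pow_sq_le [NeZero d] (f : G → ℝ) (n : ℕ) : ∑ x, ((heat e ^ n) f x) ^ 2 ≤ ∑ x, f x ^ 2 := by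
  induction n with
  | zero => simp
  | succ n ih =>
    rw [pow_succ' (heat e)]
    simp only [Module.End.mul_apply]
    exact (heat_sq_le e _).trans ih

theorem heat_pow4_le [NeZero d] (f : G → ℝ) : ∑ x, (heat e f x) ^ 4 ≤ ∑ x, f x ^ 4 := by
  have h : ∀ x, heat e f x ^ 2 ≤ heat e (fun y => f y ^ 2) x := by
    intro x
    have hB : ∀ u v : ℝ, ∃ p q : ℝ, ∀ u' v' : ℝ,
        (u ^ 2 + v ^ 2) + p * (u' - u) + q * (v' - v) + |u' - u| * |v' - v| ≤ u' ^ 2 + v' ^ 2 := by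
      refine fun u v => ⟨2 * u, 2 * v, fun u' v' => ?_⟩
      nlinarith [sq_nonneg (|u' - u| - |v' - v|), sq_abs (u' - u), sq_abs (v' - v)]
    have := heat_gap e hB f 0 x (⟨0, NeZero.pos d⟩) (⟨0, NeZero.pos d⟩)
    simpa using this
  calc ∑ x, (heat e f x) ^ 4 ≤ ∑ x, (heat e (fun y => f y ^ 2) x) ^ 2 := by
        refine Finset.sum_le_sum fun x _ => ?_
        have := pow_le_pow_left₀ (sq_nonneg _) (h x) 2
        rwa [← pow_mul] at this
    _ ≤ ∑ x, (f x ^ 2) ^ 2 := heat_sq_le e _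
    _ = _ := by simp only [← pow_mul]

/-- gradients of the heat flow tend to zero -/
theorem heat_grad_tendsto [NeZero d] (f : G → ℝ) (i : Fin d) :
    Tendsto (fun n => ∑ x, (bwd (e i) ((heat e ^ n) f) x) ^ 2) atTop (nhds 0) := by
  have hB : ∀ u v : ℝ, ∃ p q : ℝ, ∀ u' v' : ℝ,
      (u ^ 2 + v ^ 2) + p * (u' - u) + q * (v' - v) + |u' - u| * |v' - v| ≤ u' ^ 2 + v' ^ 2 := by
    refine fun u v => ⟨2 * u, 2 * v, fun u' v' => ?_⟩
    nlinarith [sq_nonneg (|u' - u| - |v' - v|), sq_abs (u' - u), sq_abs (v' - v)]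
  refine Summable.tendsto_atTop_zero (summable_of_sum_range_le (fun n => Finset.sum_nonneg fun x _ => sq_nonneg _)
    (c := 64 * d * ∑ x, (f x ^ 2 + f x ^ 2)) fun n => ?_)
  have := heat_bell e hB (fun u v => by positivity) f f i i n
  simpa only [← sq, sq_abs] using this

theorem bilinear_bound [NeZero d] (Φ : G → ℝ) (F g : Fin d → G → ℝ)
    (hΦ : ∑ i, bwd (e i) (fwd (e i) Φ) = ∑ i, bwd (e i) (F i)) :
    ∑ i, ∑ x, g i x * fwd (e i) Φ x
      ≤ 16 * ∑ i, ∑ j, ∑ x, bell (heat e (F j) x + F j x) (g i x) := by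
  have hd : (0 : ℝ) < d := by exact_mod_cast NeZero.pos d
  set γ : G → ℝ := ∑ i, bwd (e i) (g i) with hγ
  set c : ℝ := 1 / (4 * d) with hc
  set T := heat e
  have hγΦ : ∀ (n : ℕ) (Ψ : G → ℝ), ∑ x, (T ^ n) γ x * Ψ x = ∑ i, ∑ x, (T ^ n) (g i) x * fwd (e i) Ψ x := by
    intro n Ψ
    have h1 : ∀ n : ℕ, (T ^ n) γ = ∑ i, bwd (e i) ((T ^ n) (g i)) := by
      intro n
      rw [hγ, map_sum]
      refine Finset.sum_congr rfl fun i _ => ?_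
      induction n with
      | zero => rfl
      | succ n ih => rw [pow_succ', Module.End.mul_apply, ih, heat_bwd]; rfl
    simp only [h1, Finset.sum_apply, Finset.sum_mul]
    rw [Finset.sum_comm]
    exact Finset.sum_congr rfl fun i _ => sum_bwd_mul _ _ _
  have hpow : ∀ (n : ℕ) (a : G) (f : G → ℝ), (T ^ n) (bwd a f) = bwd a ((T ^ n) f) := by
    intro n a f
    induction n with
    | zero => rfl
    | succ n ih => rw [pow_succ', Module.End.mul_apply, ih, heat_bwd]; rfl
  -- one-step identity
  have hstep : ∀ n : ℕ, ∑ x, (T ^ n) γ x * (T ^ n) Φ x - ∑ x, (T ^ (n + 1)) γ x * (T ^ (n + 1)) Φ x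
      = c * ∑ i, ∑ j, ∑ x, bwd (e j) ((T ^ n) (T (F j) + F j)) x * bwd (e i) ((T ^ n) (g i)) x := by
    intro n
    have e1 : (T ^ (n + 1)) γ = T ((T ^ n) γ) := by rw [pow_succ', Module.End.mul_apply]
    have e2 : T ((T ^ (n + 1)) Φ) = (T ^ n) Φ - c • ∑ j, bwd (e j) ((T ^ n) (T (F j) + F j)) := by
      have e3 : T Φ = Φ - c • ∑ j, bwd (e j) (F j) := by rw [← hΦ]; exact heat_eq_sub e Φ
      have e4 : T (T Φ) = Φ - c • ∑ j, bwd (e j) (T (F j) + F j) := by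
        conv_lhs => rw [e3, map_sub, e3, map_smul, map_sum]
        simp only [map_add, Finset.sum_add_distrib, smul_add]
        have : ∑ j, T (bwd (e j) (F j)) = ∑ j, bwd (e j) (T (F j)) :=
          Finset.sum_congr rfl fun j _ => heat_bwd e _ _
        rw [this]; abel
      have e5 : T ((T ^ (n + 1)) Φ) = (T ^ n) (T (T Φ)) := by
        rw [← Module.End.mul_apply, ← Module.End.mul_apply, ← Module.End.mul_apply]
        congr 1; rw [← pow_succ', ← pow_succ, ← pow_succ]
      rw [e5, e4, map_sub, map_smul, map_sum]
      simp only [hpow]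
    rw [e1, heat_symm, ← Finset.sum_sub_distrib]
    have : ∀ x, (T ^ n) γ x * (T ^ n) Φ x - (T ^ n) γ x * T ((T ^ (n + 1)) Φ) x
        = c * ∑ i, ∑ j, bwd (e j) ((T ^ n) (T (F j) + F j)) x * bwd (e i) ((T ^ n) (g i)) x := by
      intro x
      rw [e2, hγ, map_sum]
      simp only [hpow, Pi.sub_apply, Pi.smul_apply, Finset.sum_apply, smul_eq_mul]
      simp only [← Finset.sum_mul, ← Finset.mul_sum]
      ring
    simp only [T] at this ⊢
    rw [Finset.sum_congr rfl fun x _ => this x, ← Finset.mul_sum, Finset.sum_comm]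
    congr 1
    exact Finset.sum_congr rfl fun i _ => Finset.sum_comm
  have hn : ∀ n : ℕ, ∑ x, γ x * Φ x ≤ 16 * ∑ i, ∑ j, ∑ x, bell (T (F j) x + F j x) (g i x)
      + ∑ x, (T ^ n) γ x * (T ^ n) Φ x := by
    intro n
    have h1 : ∑ x, γ x * Φ x - ∑ x, (T ^ n) γ x * (T ^ n) Φ x
        = ∑ k ∈ Finset.range n, c * ∑ i, ∑ j, ∑ x,
          bwd (e j) ((T ^ k) (T (F j) + F j)) x * bwd (e i) ((T ^ k) (g i)) x := by
      simp only [← hstep]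
      rw [Finset.sum_range_sub' (fun n => ∑ x, (T ^ n) γ x * (T ^ n) Φ x)]
      simp
    have h2 : ∑ k ∈ Finset.range n, c * ∑ i, ∑ j, ∑ x,
          bwd (e j) ((T ^ k) (T (F j) + F j)) x * bwd (e i) ((T ^ k) (g i)) x
        ≤ 16 * ∑ i, ∑ j, ∑ x, bell (T (F j) x + F j x) (g i x) := by
      rw [← Finset.mul_sum, Finset.sum_comm]
      have : c * (64 * d) = 16 := by rw [hc]; field_simp; norm_num
      rw [← this, mul_assoc]
      refine mul_le_mul_of_nonneg_left ?_ (by positivity)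
      rw [Finset.mul_sum]
      refine Finset.sum_le_sum fun i _ => ?_
      rw [Finset.sum_comm, Finset.mul_sum]
      refine Finset.sum_le_sum fun j _ => ?_
      refine le_trans ?_ (heat_bell e bell_subgrad (fun u v => bellW_nonneg _ _) (T (F j) + F j) (g i) j i n)
      refine Finset.sum_le_sum fun k _ => Finset.sum_le_sum fun x _ => ?_
      rw [← abs_mul]; exact le_abs_self _
    linarith
  have hlim : Tendsto (fun n : ℕ => ∑ x, (T ^ n) γ x * (T ^ n) Φ x) atTop (nhds 0) := by
    have h0 : ∀ i, Tendsto (fun n : ℕ => ∑ x, (T ^ n) (g i) x * fwd (e i) ((T ^ n) Φ) x) atTop (nhds 0) := by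
      intro i
      have hb : ∀ n : ℕ, |∑ x, (T ^ n) (g i) x * fwd (e i) ((T ^ n) Φ) x|
          ≤ √(∑ x, g i x ^ 2) * √(∑ x, (bwd (e i) ((T ^ n) Φ) x) ^ 2) := by
        intro n
        have hcs := Finset.sum_mul_sq_le_sq_mul_sq Finset.univ ((T ^ n) (g i)) (fwd (e i) ((T ^ n) Φ))
        have e1 : ∑ x, (fwd (e i) ((T ^ n) Φ) x) ^ 2 = ∑ x, (bwd (e i) ((T ^ n) Φ) x) ^ 2 := by
          rw [← sum_shift _ (e i)]
          conv_rhs => rw [← sum_shift _ (e i), ← sum_shift _ (e i)]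
          refine Finset.sum_congr rfl fun x _ => ?_
          simp only [fwd_apply, bwd_apply, add_sub_cancel_right]; ring
        rw [e1] at hcs
        rw [← Real.sqrt_mul (Finset.sum_nonneg fun x _ => sq_nonneg _)]
        refine Real.abs_le_sqrt (hcs.trans ?_)
        exact mul_le_mul_of_nonneg_right (heat_pow_sq_le e (g i) n) (Finset.sum_nonneg fun x _ => sq_nonneg _)
      have ht := (heat_grad_tendsto e Φ i).sqrt.const_mul (√(∑ x, g i x ^ 2))
      rw [Real.sqrt_zero, mul_zero] at ht
      exact squeeze_zero_norm hb ht
    have := tendsto_finsetSum Finset.univ fun i _ => h0 i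
    simp only [Finset.sum_const_zero] at this
    refine this.congr fun n => ?_
    rw [hγΦ]
  have h1 := hγΦ 0 Φ
  simp only [pow_zero, Module.End.one_apply] at h1
  rw [← h1]
  have := ge_of_tendsto' (hlim.const_add (16 * ∑ i, ∑ j, ∑ x, bell (T (F j) x + F j x) (g i x))) hn
  simpa using this

/-- **Discrete `L⁴` Helmholtz (Calderón–Zygmund) estimate** on a finite abelian group -/
theorem helmholtz_L4 [NeZero d] : ∃ K : ℝ, 0 < K ∧
    ∀ (G : Type) [AddCommGroup G] [Fintype G] (e : Fin d → G) (Φ : G → ℝ) (F : Fin d → G → ℝ),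
      ∑ i, bwd (e i) (fwd (e i) Φ) = ∑ i, bwd (e i) (F i) →
      ∑ i, ∑ x, fwd (e i) Φ x ^ 4 ≤ K * ∑ i, ∑ x, F i x ^ 4 := by
  have hd : (0 : ℝ) < d := by exact_mod_cast NeZero.pos d
  set ρ : ℝ := 1 / (32000 * d) with hρ
  have hρ0 : 0 < ρ := by positivity
  refine ⟨512 * d / ρ ^ 3, by positivity, fun G _ _ e Φ F hΦ => ?_⟩
  set T := ∑ i, ∑ x, fwd (e i) Φ x ^ 4 with hT
  set S := ∑ i, ∑ x, F i x ^ 4 with hS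
  have h := bilinear_bound e Φ F (fun i x => (ρ * fwd (e i) Φ x) ^ 3) hΦ
  have h1 : ∑ i, ∑ x, (ρ * fwd (e i) Φ x) ^ 3 * fwd (e i) Φ x = ρ ^ 3 * T := by
    simp only [hT, Finset.mul_sum]
    refine Finset.sum_congr rfl fun i _ => Finset.sum_congr rfl fun x _ => by ring
  have hF : ∀ j, ∑ x, (heat e (F j) x + F j x) ^ 4 ≤ 16 * ∑ x, F j x ^ 4 := by
    intro j
    have h4 : ∀ a b : ℝ, (a + b) ^ 4 ≤ 8 * a ^ 4 + 8 * b ^ 4 := by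
      intro a b
      nlinarith [sq_nonneg (a ^ 2 - b ^ 2), sq_nonneg ((a - b) ^ 2), sq_nonneg (a - b), sq_nonneg (a + b),
        mul_nonneg (sq_nonneg (a - b)) (sq_nonneg (a + b)), mul_nonneg (sq_nonneg (a - b)) (sq_nonneg a), mul_nonneg (sq_nonneg (a - b)) (sq_nonneg b)]
    calc _ ≤ ∑ x, (8 * heat e (F j) x ^ 4 + 8 * F j x ^ 4) := Finset.sum_le_sum fun x _ => h4 _ _
      _ = 8 * ∑ x, heat e (F j) x ^ 4 + 8 * ∑ x, F j x ^ 4 := by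
        rw [Finset.sum_add_distrib, Finset.mul_sum, Finset.mul_sum]
      _ ≤ _ := by linarith [heat_pow4_le e (F j)]
  have h2 : ∑ i, ∑ j, ∑ x, bell (heat e (F j) x + F j x) ((ρ * fwd (e i) Φ x) ^ 3)
      ≤ d * (16 * S) + d * (1000 * ρ ^ 4 * T) := by
    calc _ ≤ ∑ i, ∑ j, (16 * (∑ x, F j x ^ 4) + 1000 * ρ ^ 4 * ∑ x, fwd (e i) Φ x ^ 4) := by
          refine Finset.sum_le_sum fun i _ => Finset.sum_le_sum fun j _ => ?_
          refine (Finset.sum_le_sum fun x _ => bellW_le _ _).trans ?_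
          rw [Finset.sum_add_distrib]
          refine add_le_add (hF j) (le_of_eq ?_)
          rw [Finset.mul_sum]
          refine Finset.sum_congr rfl fun x _ => ?_
          rw [cbrt_pow]; ring
      _ = _ := by
          simp only [Finset.sum_add_distrib, ← Finset.mul_sum, Finset.sum_const, Finset.card_univ,
            Fintype.card_fin, nsmul_eq_mul]
          ring
  rw [h1] at h
  have h3 : 16 * (d * (1000 * ρ ^ 4 * T)) = ρ ^ 3 * T / 2 := by
    rw [hρ]; field_simp; ring
  rw [div_mul_eq_mul_div, le_div_iff₀ (by positivity)]
  linarith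

end Heat

section Dec
variable {ι : Type*} [Fintype ι]

instance : Fact ((1 : ENNReal) ≤ 4) := ⟨by norm_num⟩

/-- the `ℓ⁴` norm of an edge field -/
def n4 (v : EuclideanSpace ℝ ι) : ℝ := ‖(WithLp.toLp 4 (fun e => v e) : PiLp 4 fun _ : ι => ℝ)‖

theorem n4_nonneg (v : EuclideanSpace ℝ ι) : 0 ≤ n4 v := norm_nonneg _

theorem n4_pow (v : EuclideanSpace ℝ ι) : n4 v ^ 4 = ∑ e, v e ^ 4 := by
  have h4 : (4 : ENNReal).toReal = 4 := by norm_num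
  rw [n4, PiLp.norm_eq_sum (by rw [h4]; norm_num), h4]
  have hs : 0 ≤ ∑ e, ‖v e‖ ^ (4 : ℝ) := Finset.sum_nonneg fun e _ => by positivity
  rw [← Real.rpow_natCast, ← Real.rpow_mul hs]
  norm_num
  refine Finset.sum_congr rfl fun e _ => ?_
  exact Even.pow_abs (by decide) _

theorem n4_add (v w : EuclideanSpace ℝ ι) : n4 (v + w) ≤ n4 v + n4 w :=
  norm_add_le (WithLp.toLp 4 (fun e => v e) : PiLp 4 fun _ : ι => ℝ) (WithLp.toLp 4 fun e => w e)

theorem n4_le_of_pow {v : EuclideanSpace ℝ ι} {q : ℝ} (hq : 0 ≤ q) (h : ∑ e, v e ^ 4 ≤ q ^ 4) : n4 v ≤ q :=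
  le_of_pow_le_pow_left₀ (n := 4) (by norm_num) hq (by rwa [n4_pow])

/-- pointwise product of edge fields -/
def pmul (b v : EuclideanSpace ℝ ι) : EuclideanSpace ℝ ι := WithLp.toLp 2 fun e => b e * v e

@[simp] theorem pmul_apply (b v : EuclideanSpace ℝ ι) (e : ι) : pmul b v e = b e * v e := rfl

theorem n4_pmul {b v : EuclideanSpace ℝ ι} {β : ℝ} (hβ : 0 ≤ β) (hb : ∀ e, |b e| ≤ β) :
    n4 (pmul b v) ≤ β * n4 v := by
  refine n4_le_of_pow (mul_nonneg hβ (n4_nonneg _)) ?_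
  rw [mul_pow, n4_pow, Finset.mul_sum]
  refine Finset.sum_le_sum fun e _ => ?_
  rw [pmul_apply, mul_pow]
  refine mul_le_mul_of_nonneg_right ?_ (by positivity)
  have := pow_le_pow_left₀ (abs_nonneg _) (hb e) 4
  rwa [← abs_pow, abs_of_nonneg (by positivity)] at this

theorem norm_pmul {b v : EuclideanSpace ℝ ι} {β : ℝ} (hβ : 0 ≤ β) (hb : ∀ e, |b e| ≤ β) :
    ‖pmul b v‖ ≤ β * ‖v‖ :=
  euclid_norm_le_of_sq hβ fun e => by
    rw [pmul_apply, abs_mul]; exact mul_le_mul_of_nonneg_right (hb e) (abs_nonneg _)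

theorem norm_pmul_n4 (b v : EuclideanSpace ℝ ι) : ‖pmul b v‖ ≤ n4 b * n4 v := by
  rw [← abs_of_nonneg (mul_nonneg (n4_nonneg b) (n4_nonneg v)), ← abs_of_nonneg (norm_nonneg (pmul b v))]
  rw [← sq_le_sq, EuclideanSpace.real_norm_sq_eq]
  have h := Finset.sum_mul_sq_le_sq_mul_sq Finset.univ (fun e => b e ^ 2) (fun e => v e ^ 2)
  simp only [← pow_mul] at h
  rw [show 2 * 2 = 4 by norm_num, ← n4_pow, ← n4_pow] at h
  have h2 : (∑ e, pmul b v e ^ 2) = ∑ e, b e ^ 2 * v e ^ 2 := by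
    refine Finset.sum_congr rfl fun e _ => by simp; ring
  rw [h2]
  refine le_of_sq_le_sq (a := _) ?_ (by positivity)
  calc _ ≤ _ := h
    _ = _ := by ring

/-- real interpolation class between `ℓ²` and `ℓ⁴`, normalized by the volume `ν⁴` -/
def Dec (ν s A : ℝ) (g : EuclideanSpace ℝ ι) : Prop :=
  ∀ t : ℝ, 0 < t → ∃ f₀ f₁ : EuclideanSpace ℝ ι, g = f₀ + f₁ ∧ ‖f₀‖ + t * ν * n4 f₁ ≤ A * ν ^ 2 * t ^ s

variable {ν s A B : ℝ} {g h : EuclideanSpace ℝ ι}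

theorem Dec.add (hν : 0 ≤ ν) (hg : Dec ν s A g) (hh : Dec ν s B h) : Dec ν s (A + B) (g + h) := by
  intro t ht
  obtain ⟨f0, f1, rfl, hf⟩ := hg t ht
  obtain ⟨k0, k1, rfl, hk⟩ := hh t ht
  refine ⟨f0 + k0, f1 + k1, by abel, ?_⟩
  have h1 := norm_add_le f0 k0
  have h2 := mul_le_mul_of_nonneg_left (n4_add f1 k1) (mul_nonneg ht.le hν)
  nlinarith

theorem Dec.mono (hAB : A ≤ B) (hg : Dec ν s A g) : Dec ν s B g := by
  intro t ht
  obtain ⟨f0, f1, h1, hf⟩ := hg t ht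
  refine ⟨f0, f1, h1, hf.trans ?_⟩
  have : 0 ≤ ν ^ 2 * t ^ s := by positivity
  nlinarith

theorem Dec.pmul (hν : 0 ≤ ν) {b : EuclideanSpace ℝ ι} {β : ℝ} (hβ : 0 ≤ β) (hb : ∀ e, |b e| ≤ β)
    (hg : Dec ν s A g) : Dec ν s (β * A) (pmul b g) := by
  intro t ht
  obtain ⟨f0, f1, rfl, hf⟩ := hg t ht
  refine ⟨_root_.pmul b f0, _root_.pmul b f1, by ext e; simp; ring, ?_⟩
  have h1 := norm_pmul (v := f0) hβ hb
  have h2 := mul_le_mul_of_nonneg_left (n4_pmul (v := f1) hβ hb) (mul_nonneg ht.le hν)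
  have h3 := mul_le_mul_of_nonneg_left hf hβ
  nlinarith

theorem Dec.smul (hν : 0 ≤ ν) {b : ℝ} (hb : 0 ≤ b) (hg : Dec ν s A g) : Dec ν s (b * A) (b • g) := by
  have := hg.pmul hν (b := WithLp.toLp 2 fun _ => b) hb (fun e => by simp [abs_of_nonneg hb])
  convert this using 1
  ext e; simp

theorem Dec.map {P : EuclideanSpace ℝ ι →L[ℝ] EuclideanSpace ℝ ι} (hP : ∀ v, ‖P v‖ ≤ ‖v‖) {k : ℝ} (hk : 0 < k)
    (hP4 : ∀ v, n4 (P v) ≤ k * n4 v) (hν : 0 ≤ ν) (hg : Dec ν s A g) : Dec ν s (k ^ s * A) (P g) := by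
  intro t ht
  obtain ⟨f0, f1, rfl, hf⟩ := hg (k * t) (by positivity)
  refine ⟨P f0, P f1, map_add _ _ _, ?_⟩
  have h2 := mul_le_mul_of_nonneg_left (hP4 f1) (mul_nonneg ht.le hν)
  rw [Real.mul_rpow hk.le ht.le] at hf
  have := hP f0
  nlinarith

theorem Dec.const (hν : 0 ≤ ν) (hN : (Fintype.card ι : ℝ) ≤ ν ^ 4) (hs0 : 0 ≤ s) (hs1 : s ≤ 1) {b : ℝ} (hb : 0 ≤ b)
    (hg : ∀ e, |g e| ≤ b) : Dec ν s b g := by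
  intro t ht
  rcases le_total 1 t with h1 | h1
  · refine ⟨g, 0, by simp, ?_⟩
    have hn : ‖g‖ ≤ b * ν ^ 2 := by
      rw [EuclideanSpace.norm_eq]
      refine Real.sqrt_le_iff.2 ⟨by positivity, ?_⟩
      calc ∑ e, ‖g e‖ ^ 2 ≤ ∑ _e : ι, b ^ 2 := Finset.sum_le_sum fun e _ =>
            pow_le_pow_left₀ (norm_nonneg _) (hg e) 2
        _ = Fintype.card ι * b ^ 2 := by simp
        _ ≤ ν ^ 4 * b ^ 2 := mul_le_mul_of_nonneg_right hN (sq_nonneg _)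
        _ = _ := by ring
    have h2 : n4 (0 : EuclideanSpace ℝ ι) ≤ 0 := n4_le_of_pow le_rfl (by simp)
    have h3 : (1 : ℝ) ≤ t ^ s := Real.one_le_rpow h1 hs0
    have h4 : b * ν ^ 2 ≤ b * ν ^ 2 * t ^ s := le_mul_of_one_le_right (by positivity) h3
    have h5 : n4 (0 : EuclideanSpace ℝ ι) = 0 := le_antisymm h2 (n4_nonneg _)
    rw [h5]; linarith
  · refine ⟨0, g, by simp, ?_⟩
    have hn : n4 g ≤ b * ν := by
      refine n4_le_of_pow (by positivity) ?_
      calc ∑ e, g e ^ 4 ≤ ∑ _e : ι, b ^ 4 := Finset.sum_le_sum fun e _ => by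
            have := pow_le_pow_left₀ (abs_nonneg _) (hg e) 4
            rwa [← abs_pow, abs_of_nonneg (by positivity)] at this
        _ = Fintype.card ι * b ^ 4 := by simp
        _ ≤ ν ^ 4 * b ^ 4 := mul_le_mul_of_nonneg_right hN (by positivity)
        _ = _ := by ring
    have h3 : t ≤ t ^ s := by
      conv_lhs => rw [← Real.rpow_one t]
      exact Real.rpow_le_rpow_of_exponent_ge ht h1 hs1
    rw [norm_zero, zero_add]
    calc t * ν * n4 g ≤ t * ν * (b * ν) := mul_le_mul_of_nonneg_left hn (by positivity)
      _ = b * ν ^ 2 * t := by ring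
      _ ≤ _ := mul_le_mul_of_nonneg_left h3 (by positivity)

/-- one step of the coupled dynamics preserves the interpolation class -/
theorem Dec.step {P : EuclideanSpace ℝ ι →L[ℝ] EuclideanSpace ℝ ι} (hP : ∀ v, ‖P v‖ ≤ ‖v‖) {k : ℝ} (hk : 0 < k)
    (hP4 : ∀ v, n4 (P v) ≤ k * n4 v) (hν : 0 ≤ ν) {l l' : ℝ} (hl : 0 < l) (hll : l ≤ l')
    (hks : k ^ s ≤ 1 + l / (2 * l')) {τ : ℝ} (hτ : 0 < τ) (hτl : τ * l' ≤ 1)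
    {a q δ : EuclideanSpace ℝ ι} (ha : ∀ e, l ≤ a e ∧ a e ≤ l') (hPq : P q = q)
    (hB : 0 ≤ B) (hδ : Dec ν s B δ) (hq : Dec ν s (4 * l' * B / l) q) :
    Dec ν s (4 * l' * B / l) (q - τ • P (_root_.pmul a (q - δ))) := by
  set b : EuclideanSpace ℝ ι := WithLp.toLp 2 fun e => l' - a e with hb
  have hl' : 0 < l' := hl.trans_le hll
  have e1 : q - τ • P (_root_.pmul a (q - δ))
      = (1 - τ * l') • q + τ • P (_root_.pmul b q + _root_.pmul a δ) := by
    have e2 : _root_.pmul a (q - δ) = l' • q - (_root_.pmul b q + _root_.pmul a δ) := by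
      ext e; simp [hb]; ring
    rw [e2, map_sub, map_smul, hPq]; module
  rw [e1]
  have h1 := hq.smul hν (b := 1 - τ * l') (by linarith)
  have h2 := hq.pmul hν (b := b) (β := l' - l) (by linarith) (fun e => by
    have := ha e; simp only [hb]; rw [abs_of_nonneg (by linarith)]; linarith)
  have h3 := hδ.pmul hν (b := a) (β := l') hl'.le (fun e => by
    have := ha e; rw [abs_of_nonneg (by linarith)]; linarith)
  refine (h1.add hν (((h2.add hν h3).map hP hk hP4 hν).smul hν hτ.le)).mono ?_
  set X := 4 * l' * B / l with hX
  have hX0 : 0 ≤ X := by positivity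
  have hXl : l * X = 4 * (l' * B) := by rw [hX]; field_simp
  have hY : 0 ≤ (l' - l) * X + l' * B := by
    have : 0 ≤ (l' - l) * X := mul_nonneg (by linarith) hX0
    positivity
  have h4 : k ^ s * ((l' - l) * X + l' * B) ≤ (1 + l / (2 * l')) * ((l' - l) * X + l' * B) :=
    mul_le_mul_of_nonneg_right hks hY
  have h5 : (1 + l / (2 * l')) * ((l' - l) * X + l' * B) ≤ l' * X := by
    have e3 : l / (2 * l') * ((l' - l) * X) ≤ l / 2 * X := by
      rw [← mul_assoc]; refine mul_le_mul_of_nonneg_right ?_ hX0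
      rw [div_mul_eq_mul_div, div_le_div_iff₀ (by positivity) (by norm_num)]; nlinarith
    have e4 : l / (2 * l') * (l' * B) ≤ l' * B := by
      refine mul_le_of_le_one_left (by positivity) ?_
      rw [div_le_one (by positivity)]; linarith
    nlinarith
  have h6 := mul_le_mul_of_nonneg_left (h4.trans h5) hτ.le
  nlinarith

/-- choice of the interpolation exponent -/
theorem exists_exponent (k ε : ℝ) (hk : 0 < k) (hε : 0 < ε) :
    ∃ s : ℝ, 0 < s ∧ s ≤ 1 / 2 ∧ k ^ s ≤ 1 + ε := by
  have h : Tendsto (fun s : ℝ => k ^ s) (nhds 0) (nhds (k ^ (0 : ℝ))) :=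
    (Real.continuous_const_rpow hk.ne').tendsto 0
  rw [Real.rpow_zero] at h
  have h2 : ∀ᶠ s in nhdsWithin (0 : ℝ) (Set.Ioi 0), k ^ s < 1 + ε :=
    (h.mono_left nhdsWithin_le_nhds).eventually (gt_mem_nhds (by linarith))
  have h3 : ∀ᶠ s in nhdsWithin (0 : ℝ) (Set.Ioi 0), s ∈ Set.Ioo (0 : ℝ) (1 / 2) :=
    Ioo_mem_nhdsGT (by norm_num)
  obtain ⟨s, hs1, hs2⟩ := (h2.and h3).exists
  exact ⟨s, hs2.1, hs2.2.le, hs1.le⟩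

end Dec

/-- uniformly convex potentials with Hölder second derivative -/
structure HPot (lam Lam M γ : ℝ) (V v v2 : ℝ → ℝ) : Prop where
  lam_pos : 0 < lam
  M_nonneg : 0 ≤ M
  γ_pos : 0 < γ
  γ_le : γ ≤ 1 / 4
  hasDeriv : ∀ t, HasDerivAt V (v t) t
  hasDeriv2 : ∀ t, HasDerivAt v (v2 t) t
  cont : Continuous v2
  lo : ∀ t, lam ≤ v2 t
  hi : ∀ t, v2 t ≤ Lam
  holder : ∀ s t, |v2 t - v2 s| ≤ M * |t - s| ^ γ

/-- the averaged second derivative along a segment -/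
def sec (v2 : ℝ → ℝ) (s t : ℝ) : ℝ := ∫ θ in (0 : ℝ)..1, v2 (s + θ * (t - s))

namespace HPot
variable {lam Lam M γ : ℝ} {V v v2 : ℝ → ℝ}

theorem sec_mul (h : HPot lam Lam M γ V v v2) (s t : ℝ) : v t - v s = sec v2 s t * (t - s) := by
  have hd : ∀ θ : ℝ, HasDerivAt (fun θ => v (s + θ * (t - s))) (v2 (s + θ * (t - s)) * (t - s)) θ := by
    intro θ
    have h0 : HasDerivAt (fun θ : ℝ => s + θ * (t - s)) (t - s) θ := by
      simpa using ((hasDerivAt_id θ).mul_const (t - s)).const_add s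
    exact (h.hasDeriv2 (s + θ * (t - s))).comp θ h0
  have hc := h.cont
  have := intervalIntegral.integral_eq_sub_of_hasDerivAt (a := 0) (b := 1) (fun θ _ => hd θ)
    (Continuous.intervalIntegrable (by fun_prop) _ _)
  rw [intervalIntegral.integral_mul_const] at this
  simpa [sec] using this.symm

theorem sec_int (h : HPot lam Lam M γ V v v2) (s t : ℝ) :
    IntervalIntegrable (fun θ : ℝ => v2 (s + θ * (t - s))) volume 0 1 := by
  have hc := h.cont
  exact Continuous.intervalIntegrable (by fun_prop) _ _

theorem sec_mem (h : HPot lam Lam M γ V v v2) (w : ℝ) {l l' : ℝ} (hlo : ∀ t, l ≤ w * v2 t) (hhi : ∀ t, w * v2 t ≤ l') (s t : ℝ) :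
    l ≤ w * sec v2 s t ∧ w * sec v2 s t ≤ l' := by
  rw [sec, ← intervalIntegral.integral_const_mul]
  have hi := (h.sec_int s t).const_mul w
  constructor
  · calc l = ∫ _θ in (0 : ℝ)..1, l := by simp
      _ ≤ _ := intervalIntegral.integral_mono_on zero_le_one (by simp) hi (fun θ _ => hlo _)
  · calc _ ≤ ∫ _θ in (0 : ℝ)..1, l' := intervalIntegral.integral_mono_on zero_le_one hi (by simp) (fun θ _ => hhi _)
      _ = l' := by simp

theorem sec_holder (h : HPot lam Lam M γ V v v2) (s t s' t' : ℝ) :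
    |sec v2 s t - sec v2 s' t'| ≤ M * (|s - s'| + |t - t'|) ^ γ := by
  rw [sec, sec, ← intervalIntegral.integral_sub (h.sec_int s t) (h.sec_int s' t')]
  have := intervalIntegral.norm_integral_le_of_norm_le_const (a := 0) (b := 1)
    (f := fun θ => v2 (s + θ * (t - s)) - v2 (s' + θ * (t' - s'))) (C := M * (|s - s'| + |t - t'|) ^ γ) ?_
  · simpa using this
  intro θ hθ
  rw [Set.uIoc_of_le zero_le_one] at hθ
  rw [Real.norm_eq_abs]
  refine (h.holder _ _).trans (mul_le_mul_of_nonneg_left ?_ h.M_nonneg)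
  refine Real.rpow_le_rpow (abs_nonneg _) ?_ h.γ_pos.le
  have e1 : s + θ * (t - s) - (s' + θ * (t' - s')) = (1 - θ) * (s - s') + θ * (t - t') := by ring
  rw [e1]
  refine (abs_add_le _ _).trans ?_
  rw [abs_mul, abs_mul, abs_of_nonneg (by linarith [hθ.2] : 0 ≤ 1 - θ), abs_of_nonneg hθ.1.le]
  have := abs_nonneg (s - s'); have := abs_nonneg (t - t')
  have := hθ.1; have := hθ.2
  nlinarith

theorem pot (h : HPot lam Lam M γ V v v2) {w l l' : ℝ} (hl : 0 < l) (hlo : ∀ t, l ≤ w * v2 t) (hhi : ∀ t, w * v2 t ≤ l') (c : ℝ) :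
    Pot l l' (fun t => w * V (t - c)) (fun t => w * v (t - c)) where
  pos := hl
  hasDeriv t := by
    have := ((h.hasDeriv (t - c)).comp t ((hasDerivAt_id t).sub_const c)).const_mul w
    simpa using this
  lo s t hst := by
    have h1 := h.sec_mul (s - c) (t - c)
    have h2 := (h.sec_mem w hlo hhi (s - c) (t - c)).1
    rw [← mul_sub, h1, ← mul_assoc]
    have := mul_le_mul_of_nonneg_right h2 (by linarith : 0 ≤ t - s)
    rwa [show t - c - (s - c) = t - s by ring]
  hi s t hst := by
    have h1 := h.sec_mul (s - c) (t - c)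
    have h2 := (h.sec_mem w hlo hhi (s - c) (t - c)).2
    rw [← mul_sub, h1, ← mul_assoc]
    have := mul_le_mul_of_nonneg_right h2 (by linarith : 0 ≤ t - s)
    rwa [show t - c - (s - c) = t - s by ring]

end HPot

section Four
variable {κ ι : Type*} [Fintype κ] [Fintype ι] (J : (κ → ℝ) →ₗ[ℝ] EuclideanSpace ℝ ι)

theorem norm_step {P : EuclideanSpace ℝ ι →L[ℝ] EuclideanSpace ℝ ι} (hP : ∀ v, ‖P v‖ ≤ ‖v‖)
    {l l' : ℝ} (hll : l ≤ l') {τ : ℝ} (hτ : 0 < τ) (hτl : τ * l' ≤ 1)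
    {a q r : EuclideanSpace ℝ ι} (ha : ∀ e, l ≤ a e ∧ a e ≤ l') (hPq : P q = q) :
    ‖q - τ • P (pmul a q + r)‖ ≤ (1 - l * τ) * ‖q‖ + τ * ‖r‖ := by
  have e1 : q - τ • P (pmul a q + r) = P (q - τ • pmul a q) + -(τ • P r) := by
    rw [map_add, map_sub, map_smul, hPq]; module
  rw [e1]
  refine (norm_add_le _ _).trans (add_le_add ((hP _).trans ?_) ?_)
  · refine euclid_norm_le_of_sq (by nlinarith) fun e => ?_
    have := ha e
    simp only [PiLp.sub_apply, PiLp.smul_apply, pmul_apply, smul_eq_mul]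
    rw [← mul_assoc, ← one_sub_mul, abs_mul]
    refine mul_le_mul_of_nonneg_right ?_ (abs_nonneg _)
    rw [abs_of_nonneg (by nlinarith)]
    nlinarith
  · rw [norm_neg, norm_smul, Real.norm_of_nonneg hτ.le]
    exact mul_le_mul_of_nonneg_left (hP r) hτ.le

theorem norm_le_of_card {ν b : ℝ} (hb : 0 ≤ b) (hN : (Fintype.card ι : ℝ) ≤ ν ^ 4) {g : EuclideanSpace ℝ ι}
    (hg : ∀ e, |g e| ≤ b) : ‖g‖ ≤ b * ν ^ 2 := by
  rw [EuclideanSpace.norm_eq]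
  refine Real.sqrt_le_iff.2 ⟨by positivity, ?_⟩
  calc ∑ e, ‖g e‖ ^ 2 ≤ ∑ _e : ι, b ^ 2 := Finset.sum_le_sum fun e _ =>
        pow_le_pow_left₀ (norm_nonneg _) (hg e) 2
    _ = Fintype.card ι * b ^ 2 := by simp
    _ ≤ ν ^ 4 * b ^ 2 := mul_le_mul_of_nonneg_right hN (sq_nonneg _)
    _ = _ := by ring

theorem rpow_le_one_add_sq {y p : ℝ} (hy : 0 ≤ y) (hp : 0 ≤ p) (hp2 : p ≤ 2) : y ^ p ≤ 1 + y ^ 2 := by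
  rcases le_total y 1 with h | h
  · exact (Real.rpow_le_one hy h hp).trans (by nlinarith [sq_nonneg y])
  · have := Real.rpow_le_rpow_of_exponent_le h hp2
    rw [Real.rpow_two] at this; linarith

/-- the constant in the four-point estimate -/
def fourC (l l' M : ℝ) : ℝ := (l' / l + 1) * ((l' + M * (2 * (l' / l + 1))) * (4 * l' / l + 1))

variable {lam Lam M γ : ℝ} {V v v2 : ℝ → ℝ}

/-- the difference of elastic coefficients between two shifted pairs -/
theorem secant_diff_bound (h : HPot lam Lam M γ V v v2) {l l' ν s A ρ : ℝ} (hl : 0 < l) (hll : l ≤ l') (hν : 0 ≤ ν)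
    (hN : (Fintype.card ι : ℝ) ≤ ν ^ 4) (hρ : 0 < ρ)
    {w : ι → ℝ} (hw0 : ∀ e, 0 ≤ w e) (hw1 : ∀ e, w e ≤ 1)
    (hlo : ∀ e t, l ≤ w e * v2 t) (hhi : ∀ e t, w e * v2 t ≤ l')
    {x y x' y' r b : EuclideanSpace ℝ ι} (hr : Dec ν s A r)
    (hb : ∀ e, b e = w e * sec v2 (x' e) (y' e) - w e * sec v2 (x e) (y e))
    (hx : ‖x' - x‖ ≤ (l' / l + 1) * ρ * ν ^ 2) (hy : ‖y' - y‖ ≤ (l' / l + 1) * ρ * ν ^ 2) :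
    ‖pmul b r‖ ≤ (l' + M * (2 * (l' / l + 1))) * A * ν ^ 2 * ρ ^ (γ * s) := by
  have hl' : 0 < l' := hl.trans_le hll
  have hM := h.M_nonneg
  set D := l' / l + 1 with hD
  have hD2 : 2 ≤ D := by
    have : 1 ≤ l' / l := by rwa [one_le_div hl]
    linarith
  obtain ⟨f0, f1, rfl, hf⟩ := hr (ρ ^ γ) (by positivity)
  have hb1 : ∀ e, |b e| ≤ l' := by
    intro e
    have h1 := h.sec_mem (w e) (hlo e) (hhi e) (x' e) (y' e)
    have h2 := h.sec_mem (w e) (hlo e) (hhi e) (x e) (y e)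
    rw [hb, abs_le]; constructor <;> linarith [h1.1, h1.2, h2.1, h2.2]
  have hb2 : n4 b ≤ M * (2 * D) * ρ ^ γ * ν := by
    refine n4_le_of_pow (by positivity) ?_
    have hpt : ∀ e, b e ^ 4 ≤ M ^ 4 * (ρ ^ γ) ^ 4 * (1 + 2 * ((x' - x) e ^ 2 + (y' - y) e ^ 2) / ρ ^ 2) := by
      intro e
      have h1 := h.sec_holder (x' e) (y' e) (x e) (y e)
      set Y := |x' e - x e| + |y' e - y e| with hY
      have hY0 : 0 ≤ Y := by positivity
      have h2 : |b e| ≤ M * Y ^ γ := by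
        rw [hb, ← mul_sub, abs_mul, abs_of_nonneg (hw0 e)]
        exact (mul_le_of_le_one_left (abs_nonneg _) (hw1 e)).trans h1
      have h3 : b e ^ 4 ≤ (M * Y ^ γ) ^ 4 := by
        have := pow_le_pow_left₀ (abs_nonneg _) h2 4
        rwa [Even.pow_abs (by decide)] at this
      have h4 : (Y ^ γ) ^ 4 = (ρ ^ γ) ^ 4 * (Y / ρ) ^ (γ * 4) := by
        rw [Real.rpow_mul (by positivity), show (4 : ℝ) = ((4 : ℕ) : ℝ) by norm_num, Real.rpow_natCast, ← mul_pow,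
          ← Real.mul_rpow hρ.le (by positivity)]
        congr 3; field_simp
      have h5 : (Y / ρ) ^ (γ * 4) ≤ 1 + (Y / ρ) ^ 2 :=
        rpow_le_one_add_sq (by positivity) (by linarith [h.γ_pos]) (by linarith [h.γ_le])
      have h6 : Y ^ 2 ≤ 2 * ((x' - x) e ^ 2 + (y' - y) e ^ 2) := by
        simp only [PiLp.sub_apply]
        rw [← sq_abs (x' e - x e), ← sq_abs (y' e - y e)]
        nlinarith [sq_nonneg (|x' e - x e| - |y' e - y e|)]
      refine h3.trans ?_
      rw [mul_pow, h4, ← mul_assoc]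
      refine mul_le_mul_of_nonneg_left (h5.trans ?_) (by positivity)
      rw [div_pow]
      gcongr
    refine (Finset.sum_le_sum fun e _ => hpt e).trans ?_
    rw [← Finset.mul_sum, Finset.sum_add_distrib, ← Finset.sum_div, ← Finset.mul_sum, Finset.sum_add_distrib,
      ← EuclideanSpace.real_norm_sq_eq, ← EuclideanSpace.real_norm_sq_eq]
    have h1 := pow_le_pow_left₀ (norm_nonneg _) hx 2
    have h2 := pow_le_pow_left₀ (norm_nonneg _) hy 2
    have h3 : 2 * (‖x' - x‖ ^ 2 + ‖y' - y‖ ^ 2) / ρ ^ 2 ≤ 4 * D ^ 2 * ν ^ 4 := by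
      rw [div_le_iff₀ (by positivity)]; nlinarith
    have h4 : (∑ _e : ι, (1 : ℝ)) ≤ ν ^ 4 := by simpa using hN
    calc _ ≤ M ^ 4 * (ρ ^ γ) ^ 4 * (ν ^ 4 + 4 * D ^ 2 * ν ^ 4) := by gcongr
      _ = M ^ 4 * (ρ ^ γ) ^ 4 * ν ^ 4 * (1 + 4 * D ^ 2) := by ring
      _ ≤ M ^ 4 * (ρ ^ γ) ^ 4 * ν ^ 4 * (2 * D) ^ 4 := by
          refine mul_le_mul_of_nonneg_left ?_ (by positivity)
          nlinarith [sq_nonneg D, mul_le_mul hD2 hD2 (by norm_num) (by linarith)]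
      _ = _ := by ring
  have e1 : pmul b (f0 + f1) = pmul b f0 + pmul b f1 := by ext e; simp; ring
  have e2 : ρ ^ (γ * s) = (ρ ^ γ) ^ s := Real.rpow_mul hρ.le _ _
  rw [e1, e2]
  have h1 := norm_pmul (v := f0) hl'.le hb1
  have h2 := (norm_pmul_n4 b f1).trans (mul_le_mul_of_nonneg_right hb2 (n4_nonneg f1))
  have h3 := norm_add_le (pmul b f0) (pmul b f1)
  have h4 := mul_le_mul_of_nonneg_left hf (by positivity : 0 ≤ l' + M * (2 * D))
  have h5 : 0 ≤ M * (2 * D) * ‖f0‖ := by positivity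
  have h6 : 0 ≤ l' * (ρ ^ γ * ν * n4 f1) := by have := n4_nonneg f1; positivity
  nlinarith

end Four

section Four
variable {κ ι : Type*} [Fintype κ] [Fintype ι] (J : (κ → ℝ) →ₗ[ℝ] EuclideanSpace ℝ ι)
variable {lam Lam M γ : ℝ} {V v v2 : ℝ → ℝ}

/-- the elastic coefficients between two edge fields -/
def secw (v2 : ℝ → ℝ) (w : ι → ℝ) (X Y : EuclideanSpace ℝ ι) : EuclideanSpace ℝ ι :=
  WithLp.toLp 2 fun e => w e * sec v2 (X e) (Y e)

/-- the shifted and weighted force -/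
def shiftF (v : ℝ → ℝ) (w : ι → ℝ) (c : EuclideanSpace ℝ ι) (e : ι) (t : ℝ) : ℝ := w e * v (t - c e)

theorem edgewise_sub (h : HPot lam Lam M γ V v v2) (w : ι → ℝ) (c c' g g' : EuclideanSpace ℝ ι) :
    edgewise (shiftF v w c') g' - edgewise (shiftF v w c) g
      = pmul (secw v2 w (g - c) (g' - c')) ((g' - g) - (c' - c)) := by
  ext e
  have := h.sec_mul (g e - c e) (g' e - c' e)
  simp only [PiLp.sub_apply, edgewise_apply, shiftF, secw, pmul_apply, ← mul_sub]
  rw [this]; ring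

theorem edgewise_lip {u : ι → ℝ → ℝ} {U : ι → ℝ → ℝ} {l l' : ℝ} (hl' : 0 ≤ l') (h : ∀ e, Pot l l' (U e) (u e))
    (x y : EuclideanSpace ℝ ι) : ‖edgewise u x - edgewise u y‖ ≤ l' * ‖x - y‖ :=
  euclid_norm_le_of_sq hl' fun e => (h e).lipu _ _

theorem n4_indicator_inner {S : Finset ι} {θ f : EuclideanSpace ℝ ι} (hθ : ∀ e, e ∉ S → θ e = 0) {p : ℝ} (hp : 0 ≤ p)
    (hS : (S.card : ℝ) ≤ p ^ 4) : inner ℝ θ f ≤ ‖θ‖ * (p * n4 f) := by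
  classical
  set χ : EuclideanSpace ℝ ι := WithLp.toLp 2 fun e => if e ∈ S then 1 else 0 with hχ
  have e1 : (inner ℝ θ f : ℝ) = inner ℝ θ (pmul χ f) := by
    simp only [PiLp.inner_apply]
    refine Finset.sum_congr rfl fun e _ => ?_
    by_cases he : e ∈ S
    · simp [hχ, he]
    · simp [hθ e he]
  have e2 : n4 χ ≤ p := by
    refine n4_le_of_pow hp (le_trans (le_of_eq ?_) hS)
    simp [hχ]
  rw [e1]
  refine (real_inner_le_norm _ _).trans (mul_le_mul_of_nonneg_left ?_ (norm_nonneg _))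
  exact (norm_pmul_n4 χ f).trans (mul_le_mul_of_nonneg_right e2 (n4_nonneg f))

variable {l l' ν s k : ℝ} {w : ι → ℝ}

theorem boundary_response (hJ : Function.Injective J) (h : HPot lam Lam M γ V v v2) (hl : 0 < l) (hll : l ≤ l')
    (hν : 0 < ν) (hN : (Fintype.card ι : ℝ) ≤ ν ^ 4) (hs0 : 0 ≤ s) (hs1 : s ≤ 1) (hk : 0 < k)
    (hP4 : ∀ g, n4 (gradP J g) ≤ k * n4 g) (hks : k ^ s ≤ 1 + l / (2 * l'))
    (hlo : ∀ e t, l ≤ w e * v2 t) (hhi : ∀ e t, w e * v2 t ≤ l')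
    (c δ : EuclideanSpace ℝ ι) {ρ : ℝ} (hρ : 0 ≤ ρ) (hδ : ∀ e, |δ e| ≤ ρ) {S : Finset ι} {θ : EuclideanSpace ℝ ι}
    (hθ : ∀ e, e ∉ S → θ e = 0) {p : ℝ} (hp : 0 < p) (hS : (S.card : ℝ) ≤ p ^ 4) :
    avg (fieldH J fun e t => w e * V (t - (c + δ) e)) (fun φ => inner ℝ θ (J φ))
      - avg (fieldH J fun e t => w e * V (t - c e)) (fun φ => inner ℝ θ (J φ))
      ≤ ‖θ‖ * (4 * l' * ρ / l * ν ^ 2 * (p / ν) ^ s) := by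
  have hl' : 0 < l' := hl.trans_le hll
  have hD : Dec ν s ρ δ := Dec.const hν.le hN hs0 hs1 hρ hδ
  have hz : Dec ν s (4 * l' * ρ / l) (0 : EuclideanSpace ℝ ι) := fun t ht =>
    ⟨0, 0, by simp, by
      have : n4 (0 : EuclideanSpace ℝ ι) ≤ 0 := n4_le_of_pow le_rfl (by simp)
      have h0 : n4 (0 : EuclideanSpace ℝ ι) = 0 := le_antisymm this (n4_nonneg _)
      rw [h0]; simp; positivity⟩
  have key := field_coupling (m := Bool) J hJ hl hll
    (U := fun i e t => w e * V (t - (bif i then c + δ else c) e))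
    (u := fun i => shiftF v w (bif i then c + δ else c))
    (fun i e => h.pot hl (hlo e) (hhi e) _)
    {g | Dec ν s (4 * l' * ρ / l) (g true - g false)} (by simpa using hz) ?_
    (f := fun i g => (bif i then (1 : ℝ) else -1) * inner ℝ θ g) (L := ‖θ‖)
    (κ' := ‖θ‖ * (4 * l' * ρ / l * ν ^ 2 * (p / ν) ^ s)) ?_ ?_
  · rw [Fintype.sum_bool] at key
    simp only [cond_true, cond_false, avg_const_mul] at key
    linarith
  · intro g hg hgJ τ hτ hτl z hz
    have e1 : (g true - τ • gradP J (edgewise (shiftF v w (c + δ)) (g true)) + z)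
        - (g false - τ • gradP J (edgewise (shiftF v w c) (g false)) + z)
        = (g true - g false) - τ • gradP J (pmul (secw v2 w (g false - c) (g true - (c + δ))) ((g true - g false) - δ)) := by
      have := edgewise_sub h w c (c + δ) (g false) (g true)
      rw [show c + δ - c = δ by abel] at this
      rw [← this, map_sub]; module
    simp only [Set.mem_ofPred_eq, cond_true, cond_false]
    rw [e1]
    exact Dec.step (gradP_norm_le J) hk hP4 hν.le hl hll hks hτ hτl
      (fun e => h.sec_mem (w e) (hlo e) (hhi e) _ _)
      (gradP_of_mem J (Submodule.sub_mem _ (hgJ true) (hgJ false))) hρ hD hg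
  · intro i x y
    have := abs_real_inner_le_norm θ (x - y)
    cases i <;> simp only [cond_true, cond_false, one_mul, neg_one_mul] <;> rw [inner_sub_right] at this
    · rw [abs_sub_comm]; convert this using 2; ring
    · exact this
  · intro g hg hgJ
    rw [Fintype.sum_bool]
    simp only [cond_true, cond_false]
    have e1 : 1 * (inner ℝ θ (g true) : ℝ) + -1 * inner ℝ θ (g false) = inner ℝ θ (g true - g false) := by
      rw [inner_sub_right]; ring
    rw [e1]
    obtain ⟨f0, f1, e2, hf⟩ := hg (p / ν) (by positivity)
    rw [e2, inner_add_right]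
    have h1 := real_inner_le_norm θ f0
    have h2 := n4_indicator_inner (f := f1) hθ hp.le hS
    rw [div_mul_cancel₀ _ hν.ne'] at hf
    have h3 := mul_le_mul_of_nonneg_left hf (norm_nonneg θ)
    linarith

theorem four_point (hJ : Function.Injective J) (h : HPot lam Lam M γ V v v2) (hl : 0 < l) (hll : l ≤ l')
    (hν : 0 ≤ ν) (hN : (Fintype.card ι : ℝ) ≤ ν ^ 4) (hs0 : 0 ≤ s) (hs1 : s ≤ 1) (hk : 0 < k)
    (hP4 : ∀ g, n4 (gradP J g) ≤ k * n4 g) (hks : k ^ s ≤ 1 + l / (2 * l'))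
    (hw0 : ∀ e, 0 ≤ w e) (hw1 : ∀ e, w e ≤ 1)
    (hlo : ∀ e t, l ≤ w e * v2 t) (hhi : ∀ e t, w e * v2 t ≤ l')
    (c δ₁ δ₂ η : EuclideanSpace ℝ ι) {ρ₁ ρ₂ ρ₃ : ℝ} (hρ₁ : 0 < ρ₁) (hρ₂ : 0 ≤ ρ₂) (hρ₃ : 0 ≤ ρ₃)
    (hδ₁ : ∀ e, |δ₁ e| ≤ ρ₁) (hδ₂ : ∀ e, |δ₂ e| ≤ ρ₂) (hη : ∀ e, |η e| ≤ ρ₃) :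
    let A := fun c : EuclideanSpace ℝ ι => avg (fieldH J fun e t => w e * V (t - c e))
      (fun φ => inner ℝ η (edgewise (shiftF v w c) (J φ)))
    A (c + δ₁ + δ₂) - A (c + δ₁) - A (c + δ₂) + A c
      ≤ fourC l l' M * ν ^ 4 * ρ₁ ^ (γ * s) * ρ₂ * ρ₃ := by
  intro A
  have hl' : 0 < l' := hl.trans_le hll
  have hM := h.M_nonneg
  have hD2 : Dec ν s ρ₂ δ₂ := Dec.const hν hN hs0 hs1 hρ₂ hδ₂
  have hn1 : ‖δ₁‖ ≤ ρ₁ * ν ^ 2 := norm_le_of_card hρ₁.le hN hδ₁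
  have hnη : ‖η‖ ≤ ρ₃ * ν ^ 2 := norm_le_of_card hρ₃ hN hη
  have hz : Dec ν s (4 * l' * ρ₂ / l) (0 : EuclideanSpace ℝ ι) := fun t ht =>
    ⟨0, 0, by simp, by
      have : n4 (0 : EuclideanSpace ℝ ι) ≤ 0 := n4_le_of_pow le_rfl (by simp)
      have h0 : n4 (0 : EuclideanSpace ℝ ι) = 0 := le_antisymm this (n4_nonneg _)
      rw [h0]; simp; positivity⟩
  set W := (l' + M * (2 * (l' / l + 1))) * (4 * l' * ρ₂ / l + ρ₂) * ν ^ 2 * ρ₁ ^ (γ * s) with hW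
  have hW0 : 0 ≤ W := by positivity
  set cc : Fin 4 → EuclideanSpace ℝ ι := ![c, c + δ₁, c + δ₂, c + δ₁ + δ₂] with hcc
  set sg : Fin 4 → ℝ := ![1, -1, -1, 1] with hsg
  have step10 : ∀ (c' : EuclideanSpace ℝ ι) (g g' z : EuclideanSpace ℝ ι), g ∈ LinearMap.range J → g' ∈ LinearMap.range J →
      ∀ τ, 0 < τ → τ * l' ≤ 1 → ‖g' - g‖ ≤ l' * ρ₁ * ν ^ 2 / l →
      ‖(g' - τ • gradP J (edgewise (shiftF v w (c' + δ₁)) g') + z) - (g - τ • gradP J (edgewise (shiftF v w c') g) + z)‖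
        ≤ l' * ρ₁ * ν ^ 2 / l := by
    intro c' g g' z hg hg' τ hτ hτl hgg
    set a := secw v2 w (g - c') (g' - (c' + δ₁)) with ha
    have haB : ∀ e, l ≤ a e ∧ a e ≤ l' := fun e => h.sec_mem (w e) (hlo e) (hhi e) _ _
    have e1 : (g' - τ • gradP J (edgewise (shiftF v w (c' + δ₁)) g') + z) - (g - τ • gradP J (edgewise (shiftF v w c') g) + z)
        = (g' - g) - τ • gradP J (pmul a (g' - g) + -pmul a δ₁) := by
      have := edgewise_sub h w c' (c' + δ₁) g g'
      rw [show c' + δ₁ - c' = δ₁ by abel, ← ha] at this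
      have e2 : pmul a (g' - g) + -pmul a δ₁ = pmul a (g' - g - δ₁) := by ext e; simp; ring
      rw [e2, ← this, map_sub]; module
    rw [e1]
    refine (norm_step (gradP_norm_le J) hll hτ hτl haB (gradP_of_mem J (Submodule.sub_mem _ hg' hg))).trans ?_
    rw [norm_neg]
    have h1 : ‖pmul a δ₁‖ ≤ l' * (ρ₁ * ν ^ 2) :=
      (norm_pmul hl'.le fun e => abs_le.2 ⟨by linarith [(haB e).1], (haB e).2⟩).trans (mul_le_mul_of_nonneg_left hn1 hl'.le)
    have h2 : 0 ≤ 1 - l * τ := by nlinarith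
    have h3 := mul_le_mul_of_nonneg_left hgg h2
    have h4 := mul_le_mul_of_nonneg_left h1 hτ.le
    have h5 : l * (l' * ρ₁ * ν ^ 2 / l) = l' * ρ₁ * ν ^ 2 := by field_simp
    have h6 : (1 - l * τ) * (l' * ρ₁ * ν ^ 2 / l) = l' * ρ₁ * ν ^ 2 / l - τ * (l' * (ρ₁ * ν ^ 2)) := by
      linear_combination (-τ) * h5
    linarith
  have bnd : ∀ (c' g g' : EuclideanSpace ℝ ι), ‖g' - g‖ ≤ l' * ρ₁ * ν ^ 2 / l →
      ‖(g' - (c' + δ₁)) - (g - c')‖ ≤ (l' / l + 1) * ρ₁ * ν ^ 2 := by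
    intro c' g g' hg
    rw [show (g' - (c' + δ₁)) - (g - c') = (g' - g) - δ₁ by abel]
    refine (norm_sub_le _ _).trans ((add_le_add hg hn1).trans (le_of_eq ?_))
    ring
  have main : ∀ g : Fin 4 → EuclideanSpace ℝ ι, ‖g 1 - g 0‖ ≤ l' * ρ₁ * ν ^ 2 / l → ‖g 3 - g 2‖ ≤ l' * ρ₁ * ν ^ 2 / l →
      Dec ν s (4 * l' * ρ₂ / l) (g 2 - g 0) →
      ‖pmul (secw v2 w (g 1 - (c + δ₁)) (g 3 - (c + δ₁ + δ₂)) - secw v2 w (g 0 - c) (g 2 - (c + δ₂))) ((g 2 - g 0) - δ₂)‖ ≤ W := by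
    intro g h1 h2 h3
    have hr : Dec ν s (4 * l' * ρ₂ / l + ρ₂) ((g 2 - g 0) - δ₂) := by
      rw [sub_eq_add_neg]
      refine h3.add hν ?_
      have := Dec.const (s := s) hν hN hs0 hs1 hρ₂ (g := -δ₂) (fun e => by simpa using hδ₂ e)
      exact this
    refine secant_diff_bound h hl hll hν hN hρ₁ hw0 hw1 hlo hhi hr (x := g 0 - c) (y := g 2 - (c + δ₂)) (x' := g 1 - (c + δ₁))
      (y' := g 3 - (c + δ₁ + δ₂)) (fun e => rfl) (bnd _ _ _ h1) ?_
    rw [show c + δ₁ + δ₂ = c + δ₂ + δ₁ by abel]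
    exact bnd _ _ _ h2
  have key := field_coupling (m := Fin 4) J hJ hl hll
    (U := fun i e t => w e * V (t - cc i e)) (u := fun i => shiftF v w (cc i))
    (fun i e => h.pot hl (hlo e) (hhi e) _)
    {g | ‖g 1 - g 0‖ ≤ l' * ρ₁ * ν ^ 2 / l ∧ ‖g 3 - g 2‖ ≤ l' * ρ₁ * ν ^ 2 / l ∧
      Dec ν s (4 * l' * ρ₂ / l) (g 2 - g 0) ∧ ‖(g 3 - g 1) - (g 2 - g 0)‖ ≤ W / l}
    (by
      have h1 : 0 ≤ l' * ρ₁ * ν ^ 2 / l := by positivity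
      have h2 : 0 ≤ W / l := by positivity
      simp only [Set.mem_ofPred_eq, Pi.zero_apply, sub_zero, norm_zero]
      exact ⟨h1, h1, hz, h2⟩) ?_
    (f := fun i g => sg i * inner ℝ η (edgewise (shiftF v w (cc i)) g)) (L := ‖η‖ * l')
    (κ' := fourC l l' M * ν ^ 4 * ρ₁ ^ (γ * s) * ρ₂ * ρ₃) ?_ ?_
  · rw [Fin.sum_univ_four] at key
    simp only [avg_const_mul] at key
    simp only [hsg, hcc, Matrix.cons_val, one_mul, neg_one_mul] at key
    simp only [A]
    linarith
  · rintro g ⟨h1, h2, h3, h4⟩ hgJ τ hτ hτl z hz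
    simp only [Set.mem_ofPred_eq, hcc, Matrix.cons_val]
    set a := secw v2 w (g 0 - c) (g 2 - (c + δ₂)) with ha
    set a' := secw v2 w (g 1 - (c + δ₁)) (g 3 - (c + δ₁ + δ₂)) with ha'
    have e20 : edgewise (shiftF v w (c + δ₂)) (g 2) - edgewise (shiftF v w c) (g 0) = pmul a (g 2 - g 0 - δ₂) := by
      have := edgewise_sub h w c (c + δ₂) (g 0) (g 2)
      rwa [show c + δ₂ - c = δ₂ by abel, ← ha] at this
    have e31 : edgewise (shiftF v w (c + δ₁ + δ₂)) (g 3) - edgewise (shiftF v w (c + δ₁)) (g 1) = pmul a' (g 3 - g 1 - δ₂) := by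
      have := edgewise_sub h w (c + δ₁) (c + δ₁ + δ₂) (g 1) (g 3)
      rwa [show c + δ₁ + δ₂ - (c + δ₁) = δ₂ by abel, ← ha'] at this
    have haB : ∀ e, l ≤ a e ∧ a e ≤ l' := fun e => h.sec_mem (w e) (hlo e) (hhi e) _ _
    have haB' : ∀ e, l ≤ a' e ∧ a' e ≤ l' := fun e => h.sec_mem (w e) (hlo e) (hhi e) _ _
    refine ⟨step10 _ _ _ _ (hgJ 0) (hgJ 1) τ hτ hτl h1, ?_, ?_, ?_⟩
    · rw [show c + δ₁ + δ₂ = c + δ₂ + δ₁ by abel]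
      exact step10 _ _ _ _ (hgJ 2) (hgJ 3) τ hτ hτl h2
    · have e1 : (g 2 - τ • gradP J (edgewise (shiftF v w (c + δ₂)) (g 2)) + z)
          - (g 0 - τ • gradP J (edgewise (shiftF v w c) (g 0)) + z)
          = (g 2 - g 0) - τ • gradP J (pmul a ((g 2 - g 0) - δ₂)) := by
        rw [← e20, map_sub]; module
      rw [e1]
      exact Dec.step (gradP_norm_le J) hk hP4 hν hl hll hks hτ hτl haB
        (gradP_of_mem J (Submodule.sub_mem _ (hgJ 2) (hgJ 0))) hρ₂ hD2 h3
    · have e1 : ((g 3 - τ • gradP J (edgewise (shiftF v w (c + δ₁ + δ₂)) (g 3)) + z)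
            - (g 1 - τ • gradP J (edgewise (shiftF v w (c + δ₁)) (g 1)) + z))
          - ((g 2 - τ • gradP J (edgewise (shiftF v w (c + δ₂)) (g 2)) + z)
            - (g 0 - τ • gradP J (edgewise (shiftF v w c) (g 0)) + z))
          = ((g 3 - g 1) - (g 2 - g 0)) - τ • gradP J (pmul a' ((g 3 - g 1) - (g 2 - g 0)) + pmul (a' - a) ((g 2 - g 0) - δ₂)) := by
        have e2 : pmul a' ((g 3 - g 1) - (g 2 - g 0)) + pmul (a' - a) ((g 2 - g 0) - δ₂)
            = pmul a' (g 3 - g 1 - δ₂) - pmul a (g 2 - g 0 - δ₂) := by ext e; simp; ring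
        rw [e2, ← e31, ← e20, map_sub, map_sub, map_sub]; module
      rw [e1]
      refine (norm_step (gradP_norm_le J) hll hτ hτl haB' (gradP_of_mem J (Submodule.sub_mem _
        (Submodule.sub_mem _ (hgJ 3) (hgJ 1)) (Submodule.sub_mem _ (hgJ 2) (hgJ 0))))).trans ?_
      have h5 := main g h1 h2 h3
      have h6 : 0 ≤ 1 - l * τ := by nlinarith
      have h7 := mul_le_mul_of_nonneg_left h4 h6
      have h8 := mul_le_mul_of_nonneg_left h5 hτ.le
      have h9 : l * (W / l) = W := by field_simp
      have h10 : (1 - l * τ) * (W / l) = W / l - τ * W := by linear_combination (-τ) * h9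
      linarith
  · intro i x y
    rw [← mul_sub, ← inner_sub_right, abs_mul]
    have h1 : |sg i| = 1 := by fin_cases i <;> simp [hsg]
    rw [h1, one_mul, mul_assoc]
    refine (abs_real_inner_le_norm _ _).trans (mul_le_mul_of_nonneg_left ?_ (norm_nonneg _))
    exact edgewise_lip hl'.le (fun e => h.pot hl (hlo e) (hhi e) (cc i e)) x y
  · rintro g ⟨h1, h2, h3, h4⟩ hgJ
    rw [Fin.sum_univ_four]
    simp only [hsg, hcc, Matrix.cons_val]
    have h5 := main g h1 h2 h3
    set a := secw v2 w (g 0 - c) (g 2 - (c + δ₂)) with ha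
    set a' := secw v2 w (g 1 - (c + δ₁)) (g 3 - (c + δ₁ + δ₂)) with ha'
    have e20 : edgewise (shiftF v w (c + δ₂)) (g 2) - edgewise (shiftF v w c) (g 0) = pmul a (g 2 - g 0 - δ₂) := by
      have := edgewise_sub h w c (c + δ₂) (g 0) (g 2)
      rwa [show c + δ₂ - c = δ₂ by abel, ← ha] at this
    have e31 : edgewise (shiftF v w (c + δ₁ + δ₂)) (g 3) - edgewise (shiftF v w (c + δ₁)) (g 1) = pmul a' (g 3 - g 1 - δ₂) := by
      have := edgewise_sub h w (c + δ₁) (c + δ₁ + δ₂) (g 1) (g 3)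
      rwa [show c + δ₁ + δ₂ - (c + δ₁) = δ₂ by abel, ← ha'] at this
    have haB' : ∀ e, l ≤ a' e ∧ a' e ≤ l' := fun e => h.sec_mem (w e) (hlo e) (hhi e) _ _
    have e2 : pmul a' ((g 3 - g 1) - (g 2 - g 0)) + pmul (a' - a) ((g 2 - g 0) - δ₂)
            = pmul a' (g 3 - g 1 - δ₂) - pmul a (g 2 - g 0 - δ₂) := by ext e; simp; ring
    have e3 : 1 * (inner ℝ η (edgewise (shiftF v w c) (g 0)) : ℝ) + -1 * inner ℝ η (edgewise (shiftF v w (c + δ₁)) (g 1))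
        + -1 * inner ℝ η (edgewise (shiftF v w (c + δ₂)) (g 2)) + 1 * inner ℝ η (edgewise (shiftF v w (c + δ₁ + δ₂)) (g 3))
        = inner ℝ η (pmul a' ((g 3 - g 1) - (g 2 - g 0)) + pmul (a' - a) ((g 2 - g 0) - δ₂)) := by
      rw [e2, ← e31, ← e20, inner_sub_right, inner_sub_right, inner_sub_right]; ring
    rw [e3]
    refine (real_inner_le_norm _ _).trans ?_
    have h6 : ‖pmul a' ((g 3 - g 1) - (g 2 - g 0))‖ ≤ l' * (W / l) :=
      (norm_pmul hl'.le fun e => abs_le.2 ⟨by linarith [(haB' e).1], (haB' e).2⟩).trans (mul_le_mul_of_nonneg_left h4 hl'.le)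
    have h7 := (norm_add_le (pmul a' ((g 3 - g 1) - (g 2 - g 0))) (pmul (a' - a) ((g 2 - g 0) - δ₂))).trans (add_le_add h6 h5)
    refine (mul_le_mul hnη h7 (norm_nonneg _) (by positivity)).trans (le_of_eq ?_)
    rw [hW, fourC]; field_simp
end Four

section Reflect
variable {L : ℕ} [NeZero (4 * L)]

/-- the sign of the odd reflection, vanishing on the mirrors -/
def rsg (a : ZMod (4 * L)) : ℝ := if a.val = 0 ∨ a.val = 2 * L then 0 else if a.val < 2 * L then 1 else -1

/-- the folding map of the circle onto the interval -/
def rfold (a : ZMod (4 * L)) : ℤ := if a.val < 2 * L then (a.val : ℤ) - L else 3 * L - a.val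

/-- the folding map on edges, returning the left end point -/
def rbase (a : ZMod (4 * L)) : ℤ := if a.val < 2 * L then (a.val : ℤ) - L else 3 * L - a.val - 1

theorem zval_add_one (a : ZMod (4 * L)) :
    (a.val + 1 < 4 * L ∧ (a + 1).val = a.val + 1) ∨ (a.val + 1 = 4 * L ∧ (a + 1).val = 0) := by
  have h0 := NeZero.pos (4 * L)
  have h1 : (1 : ZMod (4 * L)).val = 1 := ZMod.val_one'' (by omega)
  have h2 := ZMod.val_add a 1
  have h3 := ZMod.val_lt a
  rw [h1] at h2
  rcases lt_or_eq_of_le (by omega : a.val + 1 ≤ 4 * L) with h | h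
  · rw [Nat.mod_eq_of_lt h] at h2; exact Or.inl ⟨h, h2⟩
  · rw [h, Nat.mod_self] at h2; exact Or.inr ⟨h, h2⟩

theorem rbase_sub_one (a : ZMod (4 * L)) (h : ℤ → ℝ) :
    h (rbase (a - 1)) - h (rbase a) = rsg a * (h (rfold a - 1) - h (rfold a)) := by
  have h0 := NeZero.pos (4 * L)
  obtain ⟨b, rfl⟩ : ∃ b, a = b + 1 := ⟨a - 1, by ring⟩
  rw [add_sub_cancel_right]
  rcases zval_add_one b with ⟨h1, h2⟩ | ⟨h1, h2⟩
  · simp only [rbase, rsg, rfold, h2]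
    rcases lt_trichotomy (b.val + 1) (2 * L) with h3 | h3 | h3
    · rw [if_pos (by omega), if_pos h3, if_neg (by omega), if_pos h3, if_pos h3]
      push_cast; ring_nf
    · rw [if_pos (by omega), if_neg (by omega), if_pos (by omega)]
      rw [zero_mul, sub_eq_zero]; congr 1; push_cast; omega
    · rw [if_neg (by omega), if_neg (by omega), if_neg (by omega), if_neg (by omega), if_neg (by omega)]
      push_cast; ring_nf
  · simp only [rbase, rsg, rfold, h2]
    rw [if_neg (by omega), if_pos (by omega), if_pos (by simp), zero_mul, sub_eq_zero]
    congr 1; push_cast; omega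

theorem rsg_add_one (a : ZMod (4 * L)) (h : ℤ → ℝ) (hL : h L = 0) (hL' : h (-L) = 0) :
    rsg (a + 1) * h (rfold (a + 1)) - rsg a * h (rfold a) = h (rbase a + 1) - h (rbase a) := by
  have h0 := NeZero.pos (4 * L)
  have key : ∀ b : ZMod (4 * L), rsg b * h (rfold b) = (if b.val < 2 * L then 1 else -1) * h (rfold b) := by
    intro b
    simp only [rsg]
    rcases eq_or_ne b.val 0 with h1 | h1
    · have : rfold b = -L := by rw [rfold, if_pos (by omega), h1]; simp
      rw [this, hL']; simp
    · rcases eq_or_ne b.val (2 * L) with h2 | h2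
      · have : rfold b = L := by rw [rfold, if_neg (by omega), h2]; push_cast; ring
        rw [this, hL]; simp
      · rw [if_neg (by omega)]
  rw [key, key]
  rcases zval_add_one a with ⟨h1, h2⟩ | ⟨h1, h2⟩
  · simp only [rbase, rfold, h2]
    rcases lt_trichotomy (a.val + 1) (2 * L) with h3 | h3 | h3
    · rw [if_pos h3, if_pos h3, if_pos (by omega), if_pos (by omega), if_pos (by omega)]
      push_cast; ring_nf
    · rw [if_neg (by omega), if_neg (by omega), if_pos (by omega), if_pos (by omega), if_pos (by omega)]
      rw [show (3 * L - ((a.val + 1 : ℕ) : ℤ)) = L by push_cast; omega, show ((a.val : ℤ) - L + 1) = L by omega, hL]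
      ring
    · rw [if_neg (by omega), if_neg (by omega), if_neg (by omega), if_neg (by omega), if_neg (by omega)]
      push_cast; ring_nf
  · simp only [rbase, rfold, h2]
    rw [if_pos (by omega), if_pos (by omega), if_neg (by omega), if_neg (by omega), if_neg (by omega)]
    rw [show (((0 : ℕ) : ℤ) - L) = -L by simp, show (3 * L - (a.val : ℤ) - 1) = -L by omega, hL',
      show (3 * L - (a.val : ℤ)) = -L + 1 by omega]
    ring

theorem rsg_ne_zero {a : ZMod (4 * L)} (h : rsg a ≠ 0) : -(L : ℤ) < rfold a ∧ rfold a < L := by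
  have h3 := ZMod.val_lt a
  simp only [rsg] at h
  split_ifs at h with h1 h2
  · exact absurd rfl h
  · simp only [rfold]; rw [if_pos h2]; omega
  · simp only [rfold]; rw [if_neg h2]; omega

theorem rsg_abs_le (a : ZMod (4 * L)) : |rsg a| ≤ 1 := by
  simp only [rsg]; split_ifs <;> simp

theorem rfold_mem (a : ZMod (4 * L)) : rfold a ∈ Finset.Icc (-(L : ℤ)) L := by
  have h3 := ZMod.val_lt a
  simp only [rfold, Finset.mem_Icc]; split_ifs <;> omega

theorem rbase_mem (a : ZMod (4 * L)) : rbase a ∈ Finset.Icc (-(L : ℤ)) L := by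
  have h3 := ZMod.val_lt a
  simp only [rbase, Finset.mem_Icc]; split_ifs <;> omega

theorem rfold_inj {a b : ZMod (4 * L)} (h : rfold a = rfold b) (h' : decide (a.val < 2 * L) = decide (b.val < 2 * L)) :
    a = b := by
  apply ZMod.val_injective
  have h1 := ZMod.val_lt a; have h2 := ZMod.val_lt b
  rw [decide_eq_decide] at h'
  simp only [rfold] at h
  split_ifs at h <;> omega

theorem rbase_inj {a b : ZMod (4 * L)} (h : rbase a = rbase b) (h' : decide (a.val < 2 * L) = decide (b.val < 2 * L)) :
    a = b := by
  apply ZMod.val_injective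
  have h1 := ZMod.val_lt a; have h2 := ZMod.val_lt b
  rw [decide_eq_decide] at h'
  simp only [rbase] at h
  split_ifs at h <;> omega

theorem rlift {z : ℤ} (h : -(L : ℤ) ≤ z) (h' : z < L) : (((z + L : ℤ) : ZMod (4 * L))).val = (z + L).toNat := by
  have : ((z + L : ℤ) : ZMod (4 * L)) = (((z + L).toNat : ℕ) : ZMod (4 * L)) := by
    rw [← Int.cast_natCast (R := ZMod (4 * L)), Int.toNat_of_nonneg (by omega)]
  rw [this, ZMod.val_natCast_of_lt (by omega)]

end Reflect

section Cube
variable {d : ℕ}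

theorem mem_cube {L : ℤ} {x : Zd d} : x ∈ cube d L ↔ ∀ j, -L ≤ x j ∧ x j ≤ L := by
  simp [cube]

theorem adj_step (x : Zd d) (i : Fin d) (s : Bool) : adj x (step x i s) := by
  rw [adj, Finset.sum_eq_single i]
  · cases s <;> simp [step]
  · intro j _ hj; simp [step, hj]
  · simp

theorem adj_le {x y : Zd d} (h : adj x y) (j : Fin d) : |x j - y j| ≤ 1 := by
  rw [← h]
  exact Finset.single_le_sum (f := fun i => |x i - y i|) (fun i _ => abs_nonneg _) (Finset.mem_univ j)

theorem mem_intr {L : ℤ} {x : Zd d} : x ∈ intr (cube d L) ↔ ∀ j, -L < x j ∧ x j < L := by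
  simp only [intr, Finset.mem_filter, mem_cube]
  constructor
  · rintro ⟨_, h2⟩ j
    have h3 := (h2 _ (adj_step x j true) j).2
    have h4 := (h2 _ (adj_step x j false) j).1
    simp [step] at h3 h4
    omega
  · intro h
    refine ⟨fun j => by have := h j; omega, fun y hy j => ?_⟩
    have h1 := adj_le hy j
    have := h j
    rw [abs_le] at h1
    omega
end Cube

theorem sum_le_sum_of_injective {α β : Type*} [Fintype α] {T : α → β} (hT : Function.Injective T) {f : β → ℝ}
    (hf : ∀ b, 0 ≤ f b) (S : Finset β) (hS : ∀ a, T a ∈ S) : ∑ a, f (T a) ≤ ∑ b ∈ S, f b := by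
  classical
  rw [← Finset.sum_image (f := f) (s := Finset.univ) (g := T) fun _ _ _ _ h => hT h]
  exact Finset.sum_le_sum_of_subset_of_nonneg (fun b hb => by
    obtain ⟨a, _, rfl⟩ := Finset.mem_image.1 hb; exact hS a) fun b _ _ => hf b

section Torus
variable {d : ℕ} {L : ℕ} [NeZero (4 * L)]

/-- the odd reflection of an edge field to the torus -/
def reflF (w : Zd d → Fin d → ℝ) (i : Fin d) (X : Fin d → ZMod (4 * L)) : ℝ :=
  (∏ j ∈ Finset.univ.erase i, rsg (X j)) * w (Function.update (fun j => rfold (X j)) i (rbase (X i))) i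

/-- the odd reflection of a function to the torus -/
def reflV (f : Zd d → ℝ) (X : Fin d → ZMod (4 * L)) : ℝ := (∏ j, rsg (X j)) * f (fun j => rfold (X j))

theorem add_single (X : Fin d → ZMod (4 * L)) (i : Fin d) (a : ZMod (4 * L)) :
    X + Pi.single i a = Function.update X i (X i + a) := by
  ext j
  by_cases h : j = i
  · subst h; simp
  · simp [h]

theorem sub_single (X : Fin d → ZMod (4 * L)) (i : Fin d) (a : ZMod (4 * L)) :
    X - Pi.single i a = Function.update X i (X i - a) := by
  ext j
  by_cases h : j = i
  · subst h; simp
  · simp [h]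

theorem prod_rsg (X : Fin d → ZMod (4 * L)) (i : Fin d) :
    (∏ j, rsg (X j)) = (∏ j ∈ Finset.univ.erase i, rsg (X j)) * rsg (X i) :=
  (Finset.prod_erase_mul _ _ (Finset.mem_univ i)).symm

theorem prod_rsg_update (X : Fin d → ZMod (4 * L)) (i : Fin d) (a : ZMod (4 * L)) :
    (∏ j ∈ Finset.univ.erase i, rsg (Function.update X i a j)) = ∏ j ∈ Finset.univ.erase i, rsg (X j) :=
  Finset.prod_congr rfl fun j hj => by rw [Function.update_of_ne (Finset.ne_of_mem_erase hj)]

theorem update_rfold (X : Fin d → ZMod (4 * L)) (i : Fin d) (a : ZMod (4 * L)) :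
    (fun j => rfold (Function.update X i a j)) = Function.update (fun j => rfold (X j)) i (rfold a) := by
  ext j
  by_cases h : j = i
  · subst h; simp
  · simp [h]

theorem div_reflF (w : Zd d → Fin d → ℝ) (X : Fin d → ZMod (4 * L)) :
    ∑ i, bwd (Pi.single i 1) (reflF w i) X
      = (∏ j, rsg (X j)) * ∑ i, (w (step (fun j => rfold (X j)) i false) i - w (fun j => rfold (X j)) i) := by
  rw [Finset.mul_sum]
  refine Finset.sum_congr rfl fun i _ => ?_
  rw [bwd_apply, sub_single, reflF, reflF, prod_rsg_update, prod_rsg X i]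
  simp only [update_rfold, Function.update_self, Function.update_idem]
  have h := rbase_sub_one (X i) (fun t => w (Function.update (fun j => rfold (X j)) i t) i)
  simp only [Function.update_eq_self] at h
  have e : step (fun j => rfold (X j)) i false = Function.update (fun j => rfold (X j)) i (rfold (X i) - 1) := by
    simp [step, sub_eq_add_neg]
  have e2 : Function.update (fun j => rfold (X j)) i (rfold (X i)) = fun j => rfold (X j) := Function.update_eq_self i _
  rw [e, ← mul_sub, h, mul_assoc]

theorem fwd_reflV {f : Zd d → ℝ} (hf : ∀ x, x ∉ intr (cube d L) → f x = 0) (i : Fin d) (X : Fin d → ZMod (4 * L)) :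
    fwd (Pi.single i 1) (reflV f) X = reflF (fun x i => f (step x i true) - f x) i X := by
  rw [fwd_apply, add_single, reflF, reflV, reflV, prod_rsg _ i, prod_rsg_update, prod_rsg X i]
  simp only [update_rfold, Function.update_self]
  have h := rsg_add_one (X i) (fun t => f (Function.update (fun j => rfold (X j)) i t))
    (hf _ fun h => by have := (mem_intr.1 h i).2; simp at this)
    (hf _ fun h => by have := (mem_intr.1 h i).1; simp at this)
  have e2 : Function.update (fun j => rfold (X j)) i (rfold (X i)) = fun j => rfold (X j) := Function.update_eq_self i _
  rw [e2] at h
  have e : step (Function.update (fun j => rfold (X j)) i (rbase (X i))) i true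
      = Function.update (fun j => rfold (X j)) i (rbase (X i) + 1) := by
    simp [step]
  rw [e, ← h]; ring

theorem sum_refl_le {G : Zd d → ℝ} (hG : ∀ x, 0 ≤ G x) (i : Fin d) :
    ∑ X : Fin d → ZMod (4 * L), G (Function.update (fun j => rfold (X j)) i (rbase (X i)))
      ≤ 2 ^ d * ∑ x ∈ cube d L, G x := by
  classical
  have h1 : (2 : ℝ) ^ d * ∑ x ∈ cube d L, G x = ∑ p ∈ cube d L ×ˢ (Finset.univ : Finset (Fin d → Bool)), G p.1 := by
    rw [Finset.sum_product, Finset.mul_sum]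
    refine Finset.sum_congr rfl fun x _ => by simp
  rw [h1]
  set T : (Fin d → ZMod (4 * L)) → Zd d × (Fin d → Bool) := fun X =>
    (Function.update (fun j => rfold (X j)) i (rbase (X i)), fun j => decide ((X j).val < 2 * L)) with hT
  have hinj : Function.Injective T := by
    intro X Y h
    rw [hT, Prod.mk.injEq] at h
    ext j
    have h2 := congrFun h.1 j
    have h3 := congrFun h.2 j
    by_cases hj : j = i
    · subst hj
      simp only [Function.update_self] at h2
      exact rbase_inj h2 h3
    · simp only [Function.update_of_ne hj] at h2
      exact rfold_inj h2 h3
  refine sum_le_sum_of_injective hinj (f := fun p => G p.1) (fun p => hG _) _ fun X => ?_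
  simp only [Finset.mem_product, Finset.mem_univ, and_true]
  rw [mem_cube]
  intro j
  by_cases hj : j = i
  · subst hj; simpa [hT] using Finset.mem_Icc.1 (rbase_mem (X j))
  · simpa [hT, hj] using Finset.mem_Icc.1 (rfold_mem (X j))
end Torus

section Box
variable (d : ℕ) (L : ℤ)

/-- edges of the cube with at least one interior end point -/
def boxE : Finset (Zd d × Fin d) :=
  (cube d L ×ˢ Finset.univ).filter fun p => p.1 ∈ intr (cube d L) ∨ step p.1 p.2 true ∈ intr (cube d L)

variable {d L}

theorem extD_add (φ ψ : Conf d L) : extD (φ + ψ) = extD φ + extD ψ := by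
  ext x; simp only [extD, Pi.add_apply]; split_ifs <;> simp

theorem extD_smul (c : ℝ) (φ : Conf d L) : extD (c • φ) = c • extD φ := by
  ext x; simp only [extD, Pi.smul_apply]; split_ifs <;> simp

theorem extD_of_notMem (φ : Conf d L) {x : Zd d} (h : x ∉ intr (cube d L)) : extD φ x = 0 := by
  simp [extD, h]

variable (d L) in
/-- the gradient of the extension by zero -/
def boxJ : Conf d L →ₗ[ℝ] EuclideanSpace ℝ (boxE d L) where
  toFun φ := WithLp.toLp 2 fun e => extD φ (step e.1.1 e.1.2 true) - extD φ e.1.1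
  map_add' φ ψ := by ext e; simp [extD_add]; ring
  map_smul' c φ := by ext e; simp [extD_smul]; ring

@[simp] theorem boxJ_apply (φ : Conf d L) (e : boxE d L) :
    boxJ d L φ e = extD φ (step e.1.1 e.1.2 true) - extD φ e.1.1 := rfl

theorem intr_subset {x : Zd d} (h : x ∈ intr (cube d L)) : x ∈ cube d L := by
  simp only [intr, Finset.mem_filter] at h; exact h.1

theorem step_false_true (x : Zd d) (i : Fin d) : step (step x i false) i true = x := by
  simp [step]

theorem step_mem_cube {x : Zd d} (h : x ∈ intr (cube d L)) (i : Fin d) (s : Bool) : step x i s ∈ cube d L := by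
  simp only [intr, Finset.mem_filter] at h; exact h.2 _ (adj_step x i s)

theorem mem_boxE_self {x : Zd d} (h : x ∈ intr (cube d L)) (i : Fin d) : (x, i) ∈ boxE d L := by
  exact Finset.mem_filter.2 ⟨Finset.mem_product.2 ⟨intr_subset h, Finset.mem_univ i⟩, Or.inl h⟩

theorem mem_boxE_pred {x : Zd d} (h : x ∈ intr (cube d L)) (i : Fin d) : (step x i false, i) ∈ boxE d L := by
  exact Finset.mem_filter.2 ⟨Finset.mem_product.2 ⟨step_mem_cube h i false, Finset.mem_univ i⟩,
    Or.inr (by rwa [step_false_true])⟩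

theorem sum_boxE (g : Zd d × Fin d → ℝ) (hg : ∀ p, p ∉ boxE d L → g p = 0) :
    ∑ e : boxE d L, g e = ∑ i, ∑ x ∈ cube d L, g (x, i) := by
  have hs : boxE d L ⊆ cube d L ×ˢ Finset.univ := Finset.filter_subset _ _
  rw [Finset.sum_coe_sort (boxE d L) g, Finset.sum_subset hs (fun p _ hp => hg p hp), Finset.sum_product_right]

/-- extension of an edge field by zero -/
def extE (v : EuclideanSpace ℝ (boxE d L)) (x : Zd d) (i : Fin d) : ℝ :=
  if h : (x, i) ∈ boxE d L then v ⟨(x, i), h⟩ else 0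

theorem div_eq_of_orth {v : EuclideanSpace ℝ (boxE d L)} (hv : ∀ φ, inner ℝ v (boxJ d L φ) = 0)
    {x : Zd d} (hx : x ∈ intr (cube d L)) : ∑ i, (extE v (step x i false) i - extE v x i) = 0 := by
  classical
  have h := hv (Pi.single ⟨x, hx⟩ 1)
  have hext : ∀ y, extD (Pi.single (⟨x, hx⟩ : intr (cube d L)) 1) y = if y = x then 1 else 0 := by
    intro y
    simp only [extD, Pi.single_apply]
    split_ifs <;> simp_all
  have h1 : ∀ e : boxE d L, inner ℝ (v e) (boxJ d L (Pi.single ⟨x, hx⟩ 1) e)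
      = (fun p : Zd d × Fin d => extE v p.1 p.2 * ((if p.1 = step x p.2 false then 1 else 0) - if p.1 = x then 1 else 0)) e := by
    intro e
    have e1 : step e.1.1 e.1.2 true = x ↔ e.1.1 = step x e.1.2 false := by
      constructor
      · rintro rfl; simp [step]
      · intro h; rw [h, step_false_true]
    simp only [boxJ_apply, hext, e1]
    simp [extE, mul_comm]
  rw [PiLp.inner_apply, Finset.sum_congr rfl fun e _ => h1 e, sum_boxE (fun p : Zd d × Fin d =>
    extE v p.1 p.2 * ((if p.1 = step x p.2 false then 1 else 0) - if p.1 = x then 1 else 0))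
    (fun p hp => by simp [extE, hp])] at h
  rw [← h]
  refine Finset.sum_congr rfl fun i _ => ?_
  simp only [mul_sub, mul_ite, mul_one, mul_zero, Finset.sum_sub_distrib, Finset.sum_ite_eq']
  rw [if_pos (step_mem_cube hx i false), if_pos (intr_subset hx)]

set_option maxHeartbeats 1000000 in
theorem n4_gradP_box [NeZero d] : ∃ k : ℝ, 0 < k ∧ ∀ L : ℕ, 1 ≤ L → ∀ v, n4 (gradP (boxJ d L) v) ≤ k * n4 v := by
  classical
  obtain ⟨K, hK, hmain⟩ := helmholtz_L4 (d := d)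
  refine ⟨(K * 2 ^ d) ^ ((1 : ℝ) / 4), by positivity, fun L hL v => ?_⟩
  have : NeZero (4 * L) := ⟨by omega⟩
  have hk4 : ((K * 2 ^ d) ^ ((1 : ℝ) / 4)) ^ 4 = K * 2 ^ d := by
    rw [← Real.rpow_natCast, ← Real.rpow_mul (by positivity)]; norm_num
  refine n4_le_of_pow (mul_nonneg (by positivity) (n4_nonneg _)) ?_
  rw [mul_pow, hk4, n4_pow v]
  obtain ⟨φ, hφ⟩ := gradP_mem (boxJ d L) v
  have horth : ∀ ψ, inner ℝ (v - boxJ d L φ) (boxJ d L ψ) = 0 := by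
    intro ψ
    rw [hφ]
    have := Submodule.starProjection_inner_eq_zero (K := LinearMap.range (boxJ d L)) v (boxJ d L ψ) ⟨ψ, rfl⟩
    exact this
  have hfz : ∀ x, x ∉ intr (cube d L) → extD φ x = 0 := fun x hx => extD_of_notMem φ hx
  have hh := hmain (Fin d → ZMod (4 * L)) (fun i => Pi.single i 1) (reflV (extD φ)) (fun i => reflF (extE v) i) ?_
  · have hup : ∑ i, ∑ X : Fin d → ZMod (4 * L), reflF (extE v) i X ^ 4 ≤ 2 ^ d * ∑ e, v e ^ 4 := by
      have h1 : ∀ i, ∑ X : Fin d → ZMod (4 * L), reflF (extE v) i X ^ 4 ≤ 2 ^ d * ∑ x ∈ cube d L, extE v x i ^ 4 := by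
        intro i
        refine le_trans (Finset.sum_le_sum fun X _ => ?_)
          (sum_refl_le (L := L) (G := fun x => extE v x i ^ 4) (fun x => by positivity) i)
        rw [reflF, mul_pow]
        refine mul_le_of_le_one_left (by positivity) ?_
        rw [← Even.pow_abs (by decide), Finset.abs_prod]
        exact pow_le_one₀ (Finset.prod_nonneg fun _ _ => abs_nonneg _)
          (Finset.prod_le_one (fun _ _ => abs_nonneg _) fun _ _ => rsg_abs_le _)
      refine (Finset.sum_le_sum fun i _ => h1 i).trans (le_of_eq ?_)
      rw [← Finset.mul_sum]
      congr 1
      have h2 : ∑ e, v e ^ 4 = ∑ e : boxE d L, (fun p : Zd d × Fin d => extE v p.1 p.2 ^ 4) e :=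
        Finset.sum_congr rfl fun e _ => by simp [extE]
      rw [h2, sum_boxE (fun p : Zd d × Fin d => extE v p.1 p.2 ^ 4) (fun p hp => by simp [extE, hp])]
    have hlow : ∑ e, gradP (boxJ d L) v e ^ 4 ≤
        ∑ i, ∑ X : Fin d → ZMod (4 * L), fwd (Pi.single i 1) (reflV (extD φ)) X ^ 4 := by
      rw [← Finset.sum_product']
      set T : boxE d L → Fin d × (Fin d → ZMod (4 * L)) := fun e => (e.1.2, fun j => ((e.1.1 j + L : ℤ) : ZMod (4 * L))) with hT
      have hlim : ∀ e : boxE d L, (∀ j, j ≠ e.1.2 → -(L : ℤ) < e.1.1 j ∧ e.1.1 j < L) ∧ -(L : ℤ) ≤ e.1.1 e.1.2 ∧ e.1.1 e.1.2 < L := by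
        rintro ⟨⟨x, i⟩, he⟩
        simp only [boxE, Finset.mem_filter, Finset.mem_product, Finset.mem_univ, and_true] at he
        obtain ⟨h1, h2⟩ := he
        rcases h2 with h2 | h2
        · exact ⟨fun j _ => mem_intr.1 h2 j, (mem_intr.1 h2 i).1.le, (mem_intr.1 h2 i).2⟩
        · refine ⟨fun j hj => ?_, (mem_cube.1 h1 i).1, ?_⟩
          · have := mem_intr.1 h2 j
            simpa [step, hj] using this
          · have := (mem_intr.1 h2 i).2
            simp [step] at this
            simp only; omega
      have hlim' : ∀ (e : boxE d L) j, -(L : ℤ) ≤ e.1.1 j ∧ e.1.1 j < L := by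
        intro e j
        by_cases hj : j = e.1.2
        · rw [hj]; exact (hlim e).2
        · exact ⟨((hlim e).1 j hj).1.le, ((hlim e).1 j hj).2⟩
      have hval : ∀ (e : boxE d L) j, ((T e).2 j).val = (e.1.1 j + L).toNat := fun e j =>
        rlift (hlim' e j).1 (hlim' e j).2
      have hinj : Function.Injective T := by
        intro e e' h
        have h1 : e.1.2 = e'.1.2 := congrArg Prod.fst h
        have h2 : e.1.1 = e'.1.1 := by
          ext j
          have := hval e j
          rw [h, hval e' j] at this
          have h3 := hlim' e j; have h4 := hlim' e' j
          omega
        exact Subtype.ext (Prod.ext h2 h1)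
      have hterm : ∀ e : boxE d L, gradP (boxJ d L) v e = fwd (Pi.single (T e).1 1) (reflV (extD φ)) (T e).2 := by
        intro e
        have hb : ∀ j, rbase ((T e).2 j) = e.1.1 j := by
          intro j
          have h3 := hlim' e j
          rw [rbase, if_pos (by rw [hval]; omega), hval]; omega
        have hf : ∀ j, rfold ((T e).2 j) = e.1.1 j := by
          intro j
          have h3 := hlim' e j
          rw [rfold, if_pos (by rw [hval]; omega), hval]; omega
        rw [fwd_reflV hfz, ← hφ, reflF, Finset.prod_eq_one]
        · have hu : Function.update (fun j => rfold ((T e).2 j)) (T e).1 (rbase ((T e).2 (T e).1)) = e.1.1 := by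
            rw [hb]
            have : (fun j => rfold ((T e).2 j)) = e.1.1 := funext hf
            rw [this]; exact Function.update_eq_self _ _
          rw [hu, one_mul]; rfl
        · intro j hj
          have h3 := (hlim e).1 j (Finset.ne_of_mem_erase hj)
          rw [rsg, if_neg (by rw [hval]; omega), if_pos (by rw [hval]; omega)]
      rw [Finset.sum_congr rfl fun e _ => congrArg (· ^ 4) (hterm e)]
      exact sum_le_sum_of_injective hinj
        (f := fun p : Fin d × (Fin d → ZMod (4 * L)) => fwd (Pi.single p.1 1) (reflV (extD φ)) p.2 ^ 4)
        (fun p => by positivity) _ fun e => by simp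
    have h3 := mul_le_mul_of_nonneg_left hup hK.le
    linarith
  · ext X
    simp only [Finset.sum_apply]
    have e1 : ∀ i, fwd (Pi.single i 1) (reflV (L := L) (extD φ)) = reflF (fun x i => extD φ (step x i true) - extD φ x) i :=
      fun i => funext (fwd_reflV hfz i)
    simp only [e1]
    rw [div_reflF, div_reflF]
    by_cases hX : (∏ j, rsg (X j)) = 0
    · rw [hX, zero_mul, zero_mul]
    · congr 1
      have hx : (fun j => rfold (X j)) ∈ intr (cube d L) := mem_intr.2 fun j =>
        rsg_ne_zero (Finset.prod_ne_zero_iff.1 hX j (Finset.mem_univ j))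
      have h1 := div_eq_of_orth horth hx
      rw [← sub_eq_zero, ← neg_eq_zero, ← h1, ← Finset.sum_sub_distrib, ← Finset.sum_neg_distrib]
      refine Finset.sum_congr rfl fun i _ => ?_
      simp only [extE, dif_pos (mem_boxE_self hx i), dif_pos (mem_boxE_pred hx i), PiLp.sub_apply, boxJ_apply]
      ring
end Box

section BoxHam
variable {d : ℕ} {L : ℤ}

theorem step_true_false (x : Zd d) (i : Fin d) : step (step x i true) i false = x := by
  simp [step]

theorem notMem_of_notMem_boxE {x : Zd d} {i : Fin d} (h : (x, i) ∉ boxE d L) :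
    x ∉ intr (cube d L) ∧ step x i true ∉ intr (cube d L) := by
  refine ⟨fun h1 => h (mem_boxE_self h1 i), fun h1 => h ?_⟩
  have := mem_boxE_pred h1 i
  rwa [step_true_false] at this

theorem boxJ_injective [NeZero d] : Function.Injective (boxJ d L) := by
  rw [injective_iff_map_eq_zero]
  intro φ hφ
  have h1 : ∀ x i, extD φ (step x i true) = extD φ x := by
    intro x i
    by_cases h : (x, i) ∈ boxE d L
    · have := congrArg (fun v : EuclideanSpace ℝ (boxE d L) => v ⟨(x, i), h⟩) hφ
      simpa [sub_eq_zero] using this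
    · obtain ⟨h2, h3⟩ := notMem_of_notMem_boxE h
      rw [extD_of_notMem _ h2, extD_of_notMem _ h3]
  have h2 : ∀ (k : ℕ) x, extD φ (Function.update x 0 (x 0 + k)) = extD φ x := by
    intro k
    induction k with
    | zero => intro x; simp
    | succ k ih =>
      intro x
      rw [← ih x, ← h1 (Function.update x 0 (x 0 + k)) 0]
      congr 1
      simp [step, add_assoc]
  ext ⟨x, hx⟩
  have h3 : extD φ x = φ ⟨x, hx⟩ := by simp [extD, hx]
  rw [← h3, ← h2 (L - x 0).toNat x]
  apply extD_of_notMem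
  intro h
  have := (mem_intr.1 h 0).2
  have h5 := (mem_intr.1 hx 0).2
  simp at this
  omega

open Classical in
/-- half of the multiplicity of an edge in the Hamiltonian -/
def boxw (e : boxE d L) : ℝ :=
  ((if e.1.1 ∈ intr (cube d L) then 1 else 0) + if step e.1.1 e.1.2 true ∈ intr (cube d L) then 1 else 0) / 2

/-- the constant edge field of slope `ξ` -/
def boxc (d : ℕ) (L : ℤ) : EuclideanSpace ℝ (Fin d) →ₗ[ℝ] EuclideanSpace ℝ (boxE d L) where
  toFun ξ := WithLp.toLp 2 fun e => ξ e.1.2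
  map_add' _ _ := rfl
  map_smul' _ _ := rfl

@[simp] theorem boxc_apply (ξ : EuclideanSpace ℝ (Fin d)) (e : boxE d L) : boxc d L ξ e = ξ e.1.2 := rfl

theorem boxw_mem (e : boxE d L) : 1 / 2 ≤ boxw e ∧ boxw e ≤ 1 := by
  obtain ⟨⟨x, i⟩, he⟩ := e
  have h := (Finset.mem_filter.1 he).2
  simp only [boxw] at h ⊢
  split_ifs <;> simp_all <;> norm_num

theorem xiDot_step (ξ : EuclideanSpace ℝ (Fin d)) (x : Zd d) (i : Fin d) (s : Bool) :
    xiDot ξ x (step x i s) = if s then ξ i else -ξ i := by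
  rw [xiDot, Finset.sum_eq_single i]
  · cases s <;> simp [step]
  · intro j _ hj; simp [step, hj]
  · simp

theorem hamil_eq {V : ℝ → ℝ} (hV : ∀ t, V (-t) = V t) (ξ : EuclideanSpace ℝ (Fin d)) (φ : Conf d L) :
    hamil V L ξ (extD φ) = fieldH (boxJ d L) (fun e t => boxw e * (2 * V (t - boxc d L ξ e))) φ := by
  classical
  set f := extD φ with hf
  set G : Zd d → Fin d → ℝ := fun x i => V (f (step x i true) - f x - ξ i) with hG
  set m : Zd d → Fin d → ℝ := fun x i =>
    (if x ∈ intr (cube d L) then 1 else 0) + if step x i true ∈ intr (cube d L) then 1 else 0 with hm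
  have h1 : fieldH (boxJ d L) (fun e t => boxw e * (2 * V (t - boxc d L ξ e))) φ
      = ∑ e : boxE d L, (fun p : Zd d × Fin d => m p.1 p.2 * G p.1 p.2) e := by
    refine Finset.sum_congr rfl fun e _ => ?_
    simp only [boxJ_apply, boxc_apply, boxw, hm, hG, hf]
    ring
  rw [h1, sum_boxE (fun p : Zd d × Fin d => m p.1 p.2 * G p.1 p.2), hamil, Finset.sum_comm]
  · refine Finset.sum_congr rfl fun i _ => ?_
    have h2 : ∀ x ∈ intr (cube d L), ∑ s : Bool, V (f (step x i s) - f x - xiDot ξ x (step x i s))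
        = G x i + G (step x i false) i := by
      intro x _
      rw [Fintype.sum_bool]
      simp only [xiDot_step, hG, step_false_true]
      congr 1
      rw [← hV]; congr 1; simp; ring
    rw [Finset.sum_congr rfl h2, Finset.sum_add_distrib]
    simp only [hm, add_mul, Finset.sum_add_distrib, ite_mul, one_mul, zero_mul]
    congr 1
    · rw [← Finset.sum_filter]
      refine Finset.sum_congr ?_ fun _ _ => rfl
      ext x
      simp only [Finset.mem_filter]
      exact ⟨fun h => ⟨intr_subset h, h⟩, fun h => h.2⟩
    · rw [← Finset.sum_filter]
      refine Finset.sum_nbij' (fun x => step x i false) (fun x => step x i true) ?_ ?_ ?_ ?_ ?_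
      · intro x hx
        exact Finset.mem_filter.2 ⟨step_mem_cube hx i false, by rwa [step_false_true]⟩
      · intro x hx; exact (Finset.mem_filter.1 hx).2
      · intro x _; exact step_false_true x i
      · intro x _; exact step_true_false x i
      · intro x _; rfl
  · rintro ⟨x, i⟩ hp
    obtain ⟨h2, h3⟩ := notMem_of_notMem_boxE hp
    simp [hm, h2, h3]

theorem HPot.double {lam Lam M γ : ℝ} {V v v2 : ℝ → ℝ} (h : HPot lam Lam M γ V v v2) :
    HPot (2 * lam) (2 * Lam) (2 * M) γ (fun t => 2 * V t) (fun t => 2 * v t) (fun t => 2 * v2 t) where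
  lam_pos := by have := h.lam_pos; linarith
  M_nonneg := by have := h.M_nonneg; linarith
  γ_pos := h.γ_pos
  γ_le := h.γ_le
  hasDeriv t := (h.hasDeriv t).const_mul 2
  hasDeriv2 t := (h.hasDeriv2 t).const_mul 2
  cont := h.cont.const_mul 2
  lo t := by have := h.lo t; linarith
  hi t := by have := h.hi t; linarith
  holder s t := by
    rw [← mul_sub, abs_mul, abs_two, mul_assoc]
    exact mul_le_mul_of_nonneg_left (h.holder s t) (by norm_num)

theorem boxw_lo {lam Lam M γ : ℝ} {V v v2 : ℝ → ℝ} (h : HPot lam Lam M γ V v v2) (e : boxE d L) (t : ℝ) :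
    lam ≤ boxw e * (2 * v2 t) := by
  have h1 := boxw_mem e; have h2 := h.lo t; have h3 := h.lam_pos
  nlinarith

theorem boxw_hi {lam Lam M γ : ℝ} {V v v2 : ℝ → ℝ} (h : HPot lam Lam M γ V v v2) (e : boxE d L) (t : ℝ) :
    boxw e * (2 * v2 t) ≤ 2 * Lam := by
  have h1 := boxw_mem e; have h2 := h.lo t; have h3 := h.lam_pos; have h4 := h.hi t
  nlinarith

theorem card_boxE_le (L : ℕ) : Fintype.card (boxE d L) ≤ d * (2 * L + 1) ^ d := by
  rw [Fintype.card_coe]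
  refine (Finset.card_filter_le _ _).trans (le_of_eq ?_)
  rw [Finset.card_product, cube, Fintype.card_piFinset]
  simp
  rw [mul_comm]; congr 2; omega

theorem card_cube (L : ℕ) : (cube d L).card = (2 * L + 1) ^ d := by
  rw [cube, Fintype.card_piFinset]
  simp
  congr 1; omega

end BoxHam

section Param
variable {κ ι : Type*} [Fintype κ] [Fintype ι] (J : (κ → ℝ) →ₗ[ℝ] EuclideanSpace ℝ ι)

/-- Gaussian domination -/
def GDom (g : EuclideanSpace ℝ ι → ℝ) : Prop :=
  Continuous g ∧ ∃ C a : ℝ, 0 ≤ C ∧ 0 < a ∧ ∀ x, |g x| ≤ C * Real.exp (-(a * ‖x‖ ^ 2))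

theorem gauss_field_integrable (hJ : Function.Injective J) {a : ℝ} (ha : 0 < a) :
    Integrable fun φ => Real.exp (-(a * ‖J φ‖ ^ 2)) := by
  have h : ∀ e : ι, Pot (2 * a) (2 * a) (fun t => a * t ^ 2) (fun t => 2 * a * t) := fun e =>
    { pos := by positivity
      hasDeriv := fun t => by
        have := (hasDerivAt_pow 2 t).const_mul a
        exact this.congr_deriv (by norm_num; ring)
      lo := fun s t _ => by linarith
      hi := fun s t _ => by linarith }
  have := field_integrable_one J hJ (by positivity) le_rfl h
  simpa [fieldH, EuclideanSpace.norm_sq_eq, Finset.mul_sum] using this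

theorem shift_norm_sq (x c : EuclideanSpace ℝ ι) : ‖x‖ ^ 2 / 2 - ‖c‖ ^ 2 ≤ ‖x - c‖ ^ 2 := by
  have h : ‖x‖ ≤ ‖x - c‖ + ‖c‖ := by
    have := norm_add_le (x - c) c
    rwa [sub_add_cancel] at this
  have h2 : ‖x‖ ^ 2 ≤ (‖x - c‖ + ‖c‖) ^ 2 := pow_le_pow_left₀ (norm_nonneg _) h 2
  nlinarith [sq_nonneg (‖x - c‖ - ‖c‖)]

theorem GDom.bound {g : EuclideanSpace ℝ ι → ℝ} (hg : GDom g) (R : ℝ) (hJ : Function.Injective J) :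
    ∃ b : (κ → ℝ) → ℝ, Integrable b ∧ ∀ c, ‖c‖ ≤ R → ∀ φ, |g (J φ - c)| ≤ b φ := by
  obtain ⟨_, C, a, hC, ha, hb⟩ := hg
  refine ⟨fun φ => C * Real.exp (a * R ^ 2) * Real.exp (-(a / 2 * ‖J φ‖ ^ 2)),
    (gauss_field_integrable J hJ (by positivity)).const_mul _, fun c hc φ => (hb _).trans ?_⟩
  beta_reduce
  rw [mul_assoc, ← Real.exp_add]
  refine mul_le_mul_of_nonneg_left (Real.exp_le_exp.2 ?_) hC
  have h1 := mul_le_mul_of_nonneg_left (shift_norm_sq (J φ) c) ha.le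
  have h2 := mul_le_mul_of_nonneg_left (pow_le_pow_left₀ (norm_nonneg c) hc 2) ha.le
  linarith

theorem param_cont {g : EuclideanSpace ℝ ι → ℝ} (hg : GDom g) (hJ : Function.Injective J) :
    Continuous fun c => ∫ φ, g (J φ - c) := by
  have hJc := J_cont J
  have hgc := hg.1
  rw [continuous_iff_continuousAt]
  intro c
  obtain ⟨b, hb, hbd⟩ := hg.bound J (‖c‖ + 1) hJ
  refine continuousAt_of_dominated (bound := b) (.of_forall fun c => ?_) ?_ hb (.of_forall fun φ => ?_)
  · exact (by fun_prop : Continuous fun φ => g (J φ - c)).aestronglyMeasurable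
  · filter_upwards [Metric.ball_mem_nhds c one_pos] with c' hc'
    refine .of_forall fun φ => hbd c' ?_ φ
    rw [mem_ball_iff_norm] at hc'
    have := norm_add_le (c' - c) c
    rw [sub_add_cancel] at this; linarith
  · exact (by fun_prop : Continuous fun c => g (J φ - c)).continuousAt

theorem param_deriv {g : EuclideanSpace ℝ ι → ℝ} {g' : ι → EuclideanSpace ℝ ι → ℝ} (hg : GDom g)
    (hg' : ∀ e, GDom (g' e))
    (hd : ∀ x, HasFDerivAt g (∑ e, g' e x • (EuclideanSpace.proj e : EuclideanSpace ℝ ι →L[ℝ] ℝ)) x)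
    (hJ : Function.Injective J) (c : EuclideanSpace ℝ ι) :
    HasFDerivAt (fun c => ∫ φ, g (J φ - c))
      (∑ e, (-∫ φ, g' e (J φ - c)) • (EuclideanSpace.proj e : EuclideanSpace ℝ ι →L[ℝ] ℝ)) c := by
  have hJc := J_cont J
  have hgc := hg.1
  have hgc' := fun e => (hg' e).1
  choose b hb hbd using fun e => (hg' e).bound J (‖c‖ + 1) hJ
  obtain ⟨b0, hb0, hbd0⟩ := hg.bound J (‖c‖ + 1) hJ
  set G : EuclideanSpace ℝ ι → (κ → ℝ) → (EuclideanSpace ℝ ι →L[ℝ] ℝ) := fun c φ =>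
    ∑ e, (-g' e (J φ - c)) • (EuclideanSpace.proj e : EuclideanSpace ℝ ι →L[ℝ] ℝ) with hG
  have hint : ∀ e, Integrable fun φ => g' e (J φ - c) := fun e =>
    (hb e).mono' (by have := hgc' e; exact (by fun_prop : Continuous fun φ => g' e (J φ - c)).aestronglyMeasurable)
      (.of_forall fun φ => hbd e c (by linarith) φ)
  have h1 : (∫ φ, G c φ) = ∑ e, (-∫ φ, g' e (J φ - c)) • (EuclideanSpace.proj e : EuclideanSpace ℝ ι →L[ℝ] ℝ) := by
    simp only [hG]
    rw [integral_finsetSum _ fun e _ => Integrable.smul_const (f := fun φ => -g' e (J φ - c)) (hint e).neg _]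
    refine Finset.sum_congr rfl fun e _ => ?_
    rw [integral_smul_const, integral_neg]
  rw [← h1]
  refine hasFDerivAt_integral_of_dominated_of_fderiv_le (bound := fun φ => ∑ e, b e φ)
    (Metric.ball_mem_nhds c one_pos) (.of_forall fun c => ?_) ?_ ?_ (.of_forall fun φ c' hc' => ?_)
    (integrable_finsetSum _ fun e _ => hb e) (.of_forall fun φ c' _ => ?_)
  · exact (by fun_prop : Continuous fun φ => g (J φ - c)).aestronglyMeasurable
  · exact hb0.mono' ((by fun_prop : Continuous fun φ => g (J φ - c)).aestronglyMeasurable)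
      (.of_forall fun φ => hbd0 c (by linarith) φ)
  · have : Continuous (G c) := by
      simp only [hG]
      exact continuous_finsetSum _ fun e _ => by have := hgc' e; fun_prop
    exact this.aestronglyMeasurable
  · have hc2 : ‖c'‖ ≤ ‖c‖ + 1 := by
      rw [mem_ball_iff_norm] at hc'
      have := norm_add_le (c' - c) c
      rw [sub_add_cancel] at this; linarith
    simp only [hG]
    refine (norm_sum_le _ _).trans (Finset.sum_le_sum fun e _ => ?_)
    rw [norm_smul, norm_neg, Real.norm_eq_abs]
    have h3 : ‖(EuclideanSpace.proj e : EuclideanSpace ℝ ι →L[ℝ] ℝ)‖ ≤ 1 :=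
      ContinuousLinearMap.opNorm_le_bound _ zero_le_one fun x => by
        simpa using PiLp.norm_apply_le x e
    exact (mul_le_of_le_one_right (abs_nonneg _) h3).trans (hbd e c' hc2 φ)
  · have h4 : HasFDerivAt (fun c => J φ - c) (-ContinuousLinearMap.id ℝ (EuclideanSpace ℝ ι)) c' :=
      (hasFDerivAt_id c').const_sub (J φ)
    have h5 := (hd (J φ - c')).comp c' h4
    have h6 : G c' φ = (∑ e, g' e (J φ - c') • (EuclideanSpace.proj e : EuclideanSpace ℝ ι →L[ℝ] ℝ)).comp
        (-ContinuousLinearMap.id ℝ (EuclideanSpace ℝ ι)) := by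
      refine ContinuousLinearMap.ext fun x => ?_
      simp [hG]
    rw [h6]
    exact h5

variable {lam Lam M γ : ℝ} {V v v2 : ℝ → ℝ} {w : ι → ℝ}

/-- the product of a Gaussian dominated function and functions of at most linear growth -/
theorem GDom.mul_lin {g f : EuclideanSpace ℝ ι → ℝ} (hg : GDom g) (hf : Continuous f) {B : ℝ}
    (hB : ∀ x, |f x| ≤ B * (1 + ‖x‖)) : GDom fun x => g x * f x := by
  obtain ⟨hc, C, a, hC, ha, hb⟩ := hg
  have hB0 : 0 ≤ B := by have := (abs_nonneg _).trans (hB 0); simpa using this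
  refine ⟨hc.mul hf, C * (B * (2 + 2 / a)), a / 2, by positivity, by positivity, fun x => ?_⟩
  rw [abs_mul]
  refine (mul_le_mul (hb x) (hB x) (abs_nonneg _) (by positivity)).trans ?_
  have h1 : 1 + ‖x‖ ≤ (2 + 2 / a) * Real.exp (a / 2 * ‖x‖ ^ 2) := by
    have h2 := Real.add_one_le_exp (a / 2 * ‖x‖ ^ 2)
    have h3 : (2 + 2 / a) * (a / 2 * ‖x‖ ^ 2 + 1) ≤ (2 + 2 / a) * Real.exp (a / 2 * ‖x‖ ^ 2) :=
      mul_le_mul_of_nonneg_left h2 (by positivity)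
    have h4 : (2 + 2 / a) * (a / 2 * ‖x‖ ^ 2 + 1) = a * ‖x‖ ^ 2 + 2 + ‖x‖ ^ 2 + 2 / a := by field_simp; ring
    have h5 : 0 ≤ a * ‖x‖ ^ 2 := by positivity
    have h6 : 0 < 2 / a := by positivity
    nlinarith [sq_nonneg (‖x‖ - 1)]
  have e1 : Real.exp (-(a / 2 * ‖x‖ ^ 2)) = Real.exp (-(a * ‖x‖ ^ 2)) * Real.exp (a / 2 * ‖x‖ ^ 2) := by
    rw [← Real.exp_add]; congr 1; ring
  rw [e1]
  have h7 := mul_le_mul_of_nonneg_left h1 (by positivity : 0 ≤ C * B * Real.exp (-(a * ‖x‖ ^ 2)))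
  linarith

theorem GDom.sub {g f : EuclideanSpace ℝ ι → ℝ} (hg : GDom g) (hf : GDom f) : GDom fun x => g x - f x := by
  obtain ⟨hc, C, a, hC, ha, hb⟩ := hg
  obtain ⟨hc', C', a', hC', ha', hb'⟩ := hf
  refine ⟨hc.sub hc', C + C', min a a', by positivity, lt_min ha ha', fun x => (abs_sub _ _).trans ?_⟩
  have h1 : Real.exp (-(a * ‖x‖ ^ 2)) ≤ Real.exp (-(min a a' * ‖x‖ ^ 2)) :=
    Real.exp_le_exp.2 (neg_le_neg (mul_le_mul_of_nonneg_right (min_le_left _ _) (sq_nonneg _)))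
  have h2 : Real.exp (-(a' * ‖x‖ ^ 2)) ≤ Real.exp (-(min a a' * ‖x‖ ^ 2)) :=
    Real.exp_le_exp.2 (neg_le_neg (mul_le_mul_of_nonneg_right (min_le_right _ _) (sq_nonneg _)))
  rw [add_mul]
  exact add_le_add ((hb x).trans (mul_le_mul_of_nonneg_left h1 hC)) ((hb' x).trans (mul_le_mul_of_nonneg_left h2 hC'))

/-- the Boltzmann weight as a function of the gradient field -/
def boltz (V : ℝ → ℝ) (w : ι → ℝ) (x : EuclideanSpace ℝ ι) : ℝ := Real.exp (-∑ e, w e * V (x e))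

theorem boltz_gdom (h : HPot lam Lam M γ V v v2) {l : ℝ} (hl : 0 < l) (hlo : ∀ e t, l ≤ w e * v2 t)
    (hhi : ∀ e t, w e * v2 t ≤ Lam) : GDom (boltz V w) := by
  have hp := fun e => h.pot hl (hlo e) (hhi e) 0
  simp only [sub_zero] at hp
  have hVc : Continuous V := continuous_iff_continuousAt.2 fun t => (h.hasDeriv t).continuousAt
  set K := ∑ e, (w e * V 0 - 2 * (w e * v 0) ^ 2 / l) with hK
  refine ⟨by unfold boltz; fun_prop, Real.exp (-K), l / 8, (Real.exp_pos _).le, by positivity, fun x => ?_⟩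
  rw [boltz, abs_of_pos (Real.exp_pos _), ← Real.exp_add, Real.exp_le_exp, EuclideanSpace.norm_sq_eq, hK,
    Finset.mul_sum, ← neg_add, neg_le_neg_iff, ← Finset.sum_add_distrib]
  refine Finset.sum_le_sum fun e _ => ?_
  have h1 := (hp e).lower 0 (x e)
  have h2 : 0 ≤ 2 * (l / 4 * x e + w e * v 0) ^ 2 / l := by positivity
  have h3 : 2 * (l / 4 * x e + w e * v 0) ^ 2 / l = l / 8 * x e ^ 2 + (w e * v 0) * x e + 2 * (w e * v 0) ^ 2 / l := by
    field_simp; ring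
  simp only [sub_zero] at h1
  rw [Real.norm_eq_abs, sq_abs]
  linarith
end Param

section Param
variable {κ ι : Type*} [Fintype κ] [Fintype ι] (J : (κ → ℝ) →ₗ[ℝ] EuclideanSpace ℝ ι)
variable {lam Lam M γ l l' : ℝ} {V v v2 : ℝ → ℝ} {w : ι → ℝ}

theorem proj_hasFDerivAt (e : ι) (x : EuclideanSpace ℝ ι) :
    HasFDerivAt (fun x : EuclideanSpace ℝ ι => x e) (EuclideanSpace.proj e : EuclideanSpace ℝ ι →L[ℝ] ℝ) x :=
  (EuclideanSpace.proj e : EuclideanSpace ℝ ι →L[ℝ] ℝ).hasFDerivAt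

theorem boltz_deriv (h : HPot lam Lam M γ V v v2) (x : EuclideanSpace ℝ ι) :
    HasFDerivAt (boltz V w) (∑ e, (boltz V w x * (-(w e * v (x e)))) •
      (EuclideanSpace.proj e : EuclideanSpace ℝ ι →L[ℝ] ℝ)) x := by
  have h1 : HasFDerivAt (fun x : EuclideanSpace ℝ ι => ∑ e, w e * V (x e))
      (∑ e, (w e * v (x e)) • (EuclideanSpace.proj e : EuclideanSpace ℝ ι →L[ℝ] ℝ)) x :=
    HasFDerivAt.fun_sum fun e _ => by
      have := ((h.hasDeriv (x e)).comp_hasFDerivAt x (proj_hasFDerivAt e x)).const_mul (w e)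
      rwa [smul_smul] at this
  have h2 := h1.neg.exp
  refine h2.congr_fderiv ?_
  rw [smul_neg, Finset.smul_sum, ← Finset.sum_neg_distrib]
  refine Finset.sum_congr rfl fun e _ => ?_
  rw [smul_smul, mul_neg, neg_smul]; rfl

theorem force_growth (h : HPot lam Lam M γ V v v2) (a : ℝ) (e : ι) :
    ∃ B, ∀ x : EuclideanSpace ℝ ι, |(-(a * v (x e)))| ≤ B * (1 + ‖x‖) := by
  refine ⟨|a| * (|v 0| + Lam), fun x => ?_⟩
  have hLam : 0 < Lam := h.lam_pos.trans_le ((h.lo 0).trans (h.hi 0))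
  have h1 : |v (x e)| ≤ |v 0| + Lam * ‖x‖ := by
    have h2 := h.sec_mul 0 (x e)
    have h3 := h.sec_mem 1 (l := lam) (l' := Lam) (by simpa using h.lo) (by simpa using h.hi) 0 (x e)
    rw [one_mul, sub_zero] at *
    have h4 : |v (x e) - v 0| ≤ Lam * |x e| := by
      rw [h2, abs_mul]
      refine mul_le_mul_of_nonneg_right ?_ (abs_nonneg _)
      rw [abs_le]; constructor <;> linarith [h3.1, h3.2, h.lam_pos]
    have h5 : |x e| ≤ ‖x‖ := PiLp.norm_apply_le x e
    have h6 := abs_sub_abs_le_abs_sub (v (x e)) (v 0)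
    have h7 := mul_le_mul_of_nonneg_left h5 hLam.le
    linarith
  rw [abs_neg, abs_mul, mul_assoc]
  refine mul_le_mul_of_nonneg_left (h1.trans ?_) (abs_nonneg _)
  have : 0 ≤ |v 0| * ‖x‖ := by positivity
  nlinarith

/-- the logarithm of the partition function as a function of the shift -/
def logZ (V : ℝ → ℝ) (w : ι → ℝ) (c : EuclideanSpace ℝ ι) : ℝ :=
  Real.log (∫ φ, Real.exp (-fieldH J (fun e t => w e * V (t - c e)) φ))

theorem boltz_eq (c : EuclideanSpace ℝ ι) (φ : κ → ℝ) :
    boltz V w (J φ - c) = Real.exp (-fieldH J (fun e t => w e * V (t - c e)) φ) := rfl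

theorem partition_contDiff (hJ : Function.Injective J) (h : HPot lam Lam M γ V v v2) (hl : 0 < l)
    (hlo : ∀ e t, l ≤ w e * v2 t) (hhi : ∀ e t, w e * v2 t ≤ Lam) : ContDiff ℝ 2 (fun c => ∫ φ, boltz V w (J φ - c)) := by
  classical
  have hv : Continuous v := continuous_iff_continuousAt.2 fun t => (h.hasDeriv2 t).continuousAt
  have hv2 := h.cont
  have hb : GDom (boltz V w) := boltz_gdom h hl hlo hhi
  have hb1 : ∀ e, GDom fun x => boltz V w x * (-(w e * v (x e))) := fun e => by
    obtain ⟨B, hB⟩ := force_growth (ι := ι) h (w e) e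
    exact hb.mul_lin (by fun_prop) hB
  have hb2 : ∀ e e', GDom fun x => boltz V w x * (-(w e' * v (x e'))) * (-(w e * v (x e)))
      - boltz V w x * (if e' = e then w e * v2 (x e) else 0) := fun e e' => by
    obtain ⟨B, hB⟩ := force_growth (ι := ι) h (w e) e
    refine ((hb1 e').mul_lin (by fun_prop) hB).sub (hb.mul_lin ?_ (B := Lam) fun x => ?_)
    · split_ifs <;> fun_prop
    · have hLam : 0 < Lam := h.lam_pos.trans_le ((h.lo 0).trans (h.hi 0))
      have h3 : Lam ≤ Lam * (1 + ‖x‖) := le_mul_of_one_le_right hLam.le (by simp)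
      split_ifs
      · rw [abs_of_pos (hl.trans_le (hlo e _))]; exact (hhi e _).trans h3
      · simp; positivity
  have hd1 : ∀ e x, HasFDerivAt (fun x => boltz V w x * (-(w e * v (x e))))
      (∑ e', (boltz V w x * (-(w e' * v (x e'))) * (-(w e * v (x e)))
      - boltz V w x * (if e' = e then w e * v2 (x e) else 0)) •
        (EuclideanSpace.proj e' : EuclideanSpace ℝ ι →L[ℝ] ℝ)) x := by
    intro e x
    have h1 : HasFDerivAt (fun x : EuclideanSpace ℝ ι => -(w e * v (x e)))
        (-((w e * v2 (x e)) • (EuclideanSpace.proj e : EuclideanSpace ℝ ι →L[ℝ] ℝ))) x := by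
      have := (((h.hasDeriv2 (x e)).comp_hasFDerivAt x (proj_hasFDerivAt e x)).const_mul (w e)).fun_neg
      rwa [smul_smul] at this
    refine ((boltz_deriv (w := w) h x).mul h1).congr_fderiv ?_
    simp only [sub_smul, Finset.sum_sub_distrib, mul_ite, mul_zero, ite_smul, zero_smul, Finset.sum_ite_eq',
      Finset.mem_univ, if_true]
    rw [smul_neg, smul_smul, Finset.smul_sum, add_comm, sub_eq_add_neg]
    congr 1
    refine Finset.sum_congr rfl fun e' _ => ?_
    rw [smul_smul]; congr 1; ring
  have e2 : (2 : WithTop ℕ∞) = (1 : ℕ) + 1 := by norm_num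
  rw [e2, contDiff_succ_iff_hasFDerivAt]
  refine ⟨_, ?_, fun c => param_deriv J hb hb1 (fun x => boltz_deriv h x) hJ c⟩
  refine ContDiff.sum fun e _ => ContDiff.fun_smul ?_ contDiff_const
  refine ContDiff.neg ?_
  have e1 : ((1 : ℕ) : WithTop ℕ∞) = (0 : ℕ) + 1 := by norm_num
  rw [e1, contDiff_succ_iff_hasFDerivAt]
  refine ⟨_, ?_, fun c => param_deriv J (hb1 e) (hb2 e) (fun x => hd1 e x) hJ c⟩
  rw [Nat.cast_zero, contDiff_zero]
  refine continuous_finsetSum _ fun e' _ => ?_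
  exact (param_cont J (hb2 e e') hJ).neg.smul continuous_const

theorem partition_pos (hJ : Function.Injective J) (h : HPot lam Lam M γ V v v2) (hl : 0 < l)
    (hlo : ∀ e t, l ≤ w e * v2 t) (hhi : ∀ e t, w e * v2 t ≤ Lam)
    (hll : l ≤ Lam) (c : EuclideanSpace ℝ ι) : 0 < ∫ φ, boltz V w (J φ - c) :=
  field_integral_pos J hJ hl hll fun e => h.pot hl (hlo e) (hhi e) (c e)

theorem logZ_contDiff (hJ : Function.Injective J) (h : HPot lam Lam M γ V v v2) (hl : 0 < l)
    (hlo : ∀ e t, l ≤ w e * v2 t) (hhi : ∀ e t, w e * v2 t ≤ Lam)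
    (hll : l ≤ Lam) : ContDiff ℝ 2 (logZ J V w) := by
  have := partition_contDiff J hJ h hl hlo hhi
  exact this.log fun c => (partition_pos J hJ h hl hlo hhi hll c).ne'

theorem logZ_fderiv (hJ : Function.Injective J) (h : HPot lam Lam M γ V v v2) (hl : 0 < l)
    (hlo : ∀ e t, l ≤ w e * v2 t) (hhi : ∀ e t, w e * v2 t ≤ Lam)
    (hll : l ≤ Lam) (c η : EuclideanSpace ℝ ι) :
    fderiv ℝ (logZ J V w) c η = avg (fieldH J fun e t => w e * V (t - c e))
      (fun φ => inner ℝ η (edgewise (shiftF v w c) (J φ))) := by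
  have hv : Continuous v := continuous_iff_continuousAt.2 fun t => (h.hasDeriv2 t).continuousAt
  have hb : GDom (boltz V w) := boltz_gdom h hl hlo hhi
  have hb1 : ∀ e, GDom fun x => boltz V w x * (-(w e * v (x e))) := fun e => by
    obtain ⟨B, hB⟩ := force_growth (ι := ι) h (w e) e
    exact hb.mul_lin (by fun_prop) hB
  have hint : ∀ e, Integrable fun φ => boltz V w (J φ - c) * (-(w e * v ((J φ - c) e))) := fun e => by
    obtain ⟨b, hb, hbd⟩ := (hb1 e).bound J ‖c‖ hJ
    have h1 := (hb1 e).1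
    have h2 := J_cont J
    exact hb.mono' ((h1.comp (h2.sub continuous_const)).aestronglyMeasurable) (.of_forall fun φ => hbd c le_rfl φ)
  have hd := (param_deriv J hb hb1 (fun x => boltz_deriv h x) hJ c).log (partition_pos J hJ h hl hlo hhi hll c).ne'
  have hd' : HasFDerivAt (logZ J V w) _ c := hd
  rw [hd'.fderiv, avg]
  simp only [_root_.smul_apply, _root_.sum_apply, smul_eq_mul, PiLp.proj_apply]
  rw [inv_mul_eq_div]
  congr 1
  have e1 : ∀ φ, inner ℝ η (edgewise (shiftF v w c) (J φ)) * Real.exp (-fieldH J (fun e t => w e * V (t - c e)) φ)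
      = ∑ e, boltz V w (J φ - c) * (-(w e * v ((J φ - c) e))) * (-η e) := by
    intro φ
    rw [← boltz_eq, PiLp.inner_apply, Finset.sum_mul]
    refine Finset.sum_congr rfl fun e _ => ?_
    simp [shiftF]; ring
  simp only [e1]
  rw [integral_finsetSum _ fun e _ => (hint e).mul_const _]
  refine Finset.sum_congr rfl fun e _ => ?_
  rw [integral_mul_const]; ring
end Param

section HolderHessian
variable {E : Type*} [NormedAddCommGroup E] [NormedSpace ℝ E]

theorem iteratedFDeriv_two_sub_norm_le {F G : E → ℝ} {x y : E} {K : ℝ} (hK : 0 ≤ K)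
    (h : ∀ u v, |fderiv ℝ (fderiv ℝ F) x u v - fderiv ℝ (fderiv ℝ G) y u v| ≤ K * ‖u‖ * ‖v‖) :
    ‖iteratedFDeriv ℝ 2 F x - iteratedFDeriv ℝ 2 G y‖ ≤ K := by
  refine ContinuousMultilinearMap.opNorm_le_bound hK fun m => ?_
  have := h (m 0) (m 1)
  rw [sub_apply, iteratedFDeriv_two_apply, iteratedFDeriv_two_apply, Fin.prod_univ_two, ← mul_assoc]
  exact this

theorem le_iteratedFDeriv_two_sub_norm {F G : E → ℝ} (x y u v : E) :
    |fderiv ℝ (fderiv ℝ F) x u v - fderiv ℝ (fderiv ℝ G) y u v|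
      ≤ ‖iteratedFDeriv ℝ 2 F x - iteratedFDeriv ℝ 2 G y‖ * ‖u‖ * ‖v‖ := by
  have := (iteratedFDeriv ℝ 2 F x - iteratedFDeriv ℝ 2 G y).le_opNorm ![u, v]
  rw [sub_apply, iteratedFDeriv_two_apply, iteratedFDeriv_two_apply, Fin.prod_univ_two, ← mul_assoc] at this
  exact this

theorem ContDiff.hasFDerivAt_fderiv_apply {F : E → ℝ} (hF : ContDiff ℝ 2 F) (x v : E) :
    HasFDerivAt (fun x => fderiv ℝ F x v) ((fderiv ℝ (fderiv ℝ F) x).flip v) x := by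
  have h1 : ContDiff ℝ 1 (fderiv ℝ F) := hF.fderiv_right (by norm_num)
  have h2 := (h1.differentiable (by norm_num) x).hasFDerivAt
  exact (h2.clm_apply (hasFDerivAt_const v x)).congr_fderiv (by ext; simp)

theorem hasDerivAt_fderiv_line {F : E → ℝ} (hF : ContDiff ℝ 2 F) (x u v : E) (t : ℝ) :
    HasDerivAt (fun t : ℝ => fderiv ℝ F (x + t • u) v) (fderiv ℝ (fderiv ℝ F) (x + t • u) u v) t := by
  have h1 : HasDerivAt (fun t : ℝ => x + t • u) u t := by
    simpa using ((hasDerivAt_id t).smul_const u).const_add x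
  exact (hF.hasFDerivAt_fderiv_apply (x + t • u) v).comp_hasDerivAt t h1

theorem hessian_holder_of_four_point {F : E → ℝ} (hF : ContDiff ℝ 2 F) {K β : ℝ} (hK : 0 ≤ K)
    (h : ∀ x a b v : E, a ≠ 0 → fderiv ℝ F (x + a + b) v - fderiv ℝ F (x + a) v - fderiv ℝ F (x + b) v
      + fderiv ℝ F x v ≤ K * ‖a‖ ^ β * ‖b‖ * ‖v‖) (x y : E) :
    ‖iteratedFDeriv ℝ 2 F x - iteratedFDeriv ℝ 2 F y‖ ≤ K * ‖x - y‖ ^ β := by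
  rcases eq_or_ne x y with rfl | hxy
  · rw [sub_self, norm_zero]; positivity
  have hone : ∀ u v, fderiv ℝ (fderiv ℝ F) x u v - fderiv ℝ (fderiv ℝ F) y u v ≤ K * ‖x - y‖ ^ β * ‖u‖ * ‖v‖ := by
    intro u v
    have h1 := (hasDerivAt_fderiv_line hF x u v 0).sub (hasDerivAt_fderiv_line hF y u v 0)
    simp only [zero_smul, add_zero] at h1
    have h2 := h1.tendsto_slope_zero_right
    refine le_of_tendsto h2 ?_
    filter_upwards [self_mem_nhdsWithin] with t ht
    rw [Set.mem_Ioi] at ht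
    have h3 := h y (x - y) (t • u) v (sub_ne_zero.2 hxy)
    rw [add_sub_cancel, norm_smul, Real.norm_eq_abs, abs_of_pos ht] at h3
    simp only [Pi.sub_apply, zero_add, zero_smul, add_zero, smul_eq_mul]
    rw [inv_mul_le_iff₀ ht]
    linarith
  refine iteratedFDeriv_two_sub_norm_le (by positivity) fun u v => abs_le.2 ⟨?_, hone u v⟩
  have := hone (-u) v
  simp only [map_neg, _root_.neg_apply, norm_neg] at this
  linarith
end HolderHessian

section Sigma
variable {d : ℕ} {lam Lam M γ : ℝ} {V v v2 : ℝ → ℝ}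

theorem boxc_abs_le {L : ℤ} (ξ : EuclideanSpace ℝ (Fin d)) (e : boxE d L) : |boxc d L ξ e| ≤ ‖ξ‖ :=
  PiLp.norm_apply_le ξ e.1.2

/-- the logarithm of the finite volume partition function -/
def boxF (d : ℕ) (V : ℝ → ℝ) (L : ℤ) (ξ : EuclideanSpace ℝ (Fin d)) : ℝ :=
  logZ (boxJ d L) (fun t => 2 * V t) boxw (boxc d L ξ)

theorem boxF_eq (hV : ∀ t, V (-t) = V t) (L : ℤ) (ξ : EuclideanSpace ℝ (Fin d)) :
    boxF d V L ξ = Real.log (Zpart d V L ξ) := by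
  simp only [boxF, logZ, Zpart, hamil_eq hV]

theorem Zpart_pos [NeZero d] (hV : ∀ t, V (-t) = V t) (h : HPot lam Lam M γ V v v2) (L : ℤ) (ξ : EuclideanSpace ℝ (Fin d)) :
    0 < Zpart d V L ξ := by
  simp only [Zpart, hamil_eq hV]
  have h2 := h.double
  have hLam := (h.lo 0).trans (h.hi 0)
  exact field_integral_pos _ boxJ_injective h.lam_pos (l' := 2 * Lam) (by linarith [h.lam_pos]) fun e =>
    h2.pot h.lam_pos (boxw_lo h e) (boxw_hi h e) (boxc d L ξ e)

theorem sigmaL_eq [NeZero d] (hV : ∀ t, V (-t) = V t) (h : HPot lam Lam M γ V v v2) (L : ℕ) (ξ : EuclideanSpace ℝ (Fin d)) :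
    sigmaL d V L ξ = -(1 / (2 * L + 1 : ℝ) ^ d) * (boxF d V L ξ - boxF d V L 0) := by
  rw [sigmaL, Real.log_div (Zpart_pos hV h L ξ).ne' (Zpart_pos hV h L 0).ne', boxF_eq hV, boxF_eq hV, card_cube]
  push_cast; rfl

theorem boxF_contDiff [NeZero d] (h : HPot lam Lam M γ V v v2) (L : ℤ) : ContDiff ℝ 2 (boxF d V L) := by
  have hLam := (h.lo 0).trans (h.hi 0)
  have := logZ_contDiff (boxJ d L) boxJ_injective h.double h.lam_pos (boxw_lo h) (boxw_hi h) (by linarith [h.lam_pos])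
  exact this.comp (LinearMap.toContinuousLinearMap (boxc d L)).contDiff

theorem boxF_fderiv [NeZero d] (h : HPot lam Lam M γ V v v2) (L : ℤ) (ξ η : EuclideanSpace ℝ (Fin d)) :
    fderiv ℝ (boxF d V L) ξ η
      = avg (fieldH (boxJ d L) fun e t => boxw e * (2 * V (t - boxc d L ξ e)))
      (fun φ => inner ℝ (boxc d L η) (edgewise (shiftF (fun t => 2 * v t) boxw (boxc d L ξ)) (boxJ d L φ))) := by
  have hLam := (h.lo 0).trans (h.hi 0)
  have hc := logZ_contDiff (boxJ d L) boxJ_injective h.double h.lam_pos (boxw_lo h) (boxw_hi h) (by linarith [h.lam_pos])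
  have h1 : HasFDerivAt (boxF d V L) _ ξ := ((hc.differentiable (by norm_num) (boxc d L ξ)).hasFDerivAt).comp ξ
    (LinearMap.toContinuousLinearMap (boxc d L)).hasFDerivAt
  rw [h1.fderiv]
  exact logZ_fderiv (boxJ d L) boxJ_injective h.double h.lam_pos (boxw_lo h) (boxw_hi h) (by linarith [h.lam_pos]) _ _

theorem sigmaL_contDiff [NeZero d] (hV : ∀ t, V (-t) = V t) (h : HPot lam Lam M γ V v v2) (L : ℕ) :
    ContDiff ℝ 2 (sigmaL d V L) := by
  have : sigmaL d V L = fun ξ => -(1 / (2 * L + 1 : ℝ) ^ d) * (boxF d V L ξ - boxF d V L 0) := funext (sigmaL_eq hV h L)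
  rw [this]
  exact contDiff_const.mul ((boxF_contDiff h L).sub contDiff_const)

theorem sigmaL_fderiv [NeZero d] (hV : ∀ t, V (-t) = V t) (h : HPot lam Lam M γ V v v2) (L : ℕ) (ξ η : EuclideanSpace ℝ (Fin d)) :
    fderiv ℝ (sigmaL d V L) ξ η = -(1 / (2 * L + 1 : ℝ) ^ d) * fderiv ℝ (boxF d V L) ξ η := by
  have : sigmaL d V L = fun ξ => -(1 / (2 * L + 1 : ℝ) ^ d) * (boxF d V L ξ - boxF d V L 0) := funext (sigmaL_eq hV h L)
  rw [this]
  have h1 := (((boxF_contDiff (d := d) h L).differentiable (by norm_num) ξ).hasFDerivAt.sub_const (boxF d V L 0)).const_mul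
    (-(1 / (2 * L + 1 : ℝ) ^ d))
  rw [h1.fderiv]; rfl

/-- the size parameter of a box -/
def boxν (d L : ℕ) : ℝ := ((d : ℝ) * (2 * L + 1 : ℝ) ^ d) ^ ((1 : ℝ) / 4)

theorem boxν_pow (d L : ℕ) : boxν d L ^ 4 = d * (2 * L + 1 : ℝ) ^ d := by
  rw [boxν, ← Real.rpow_natCast, ← Real.rpow_mul (by positivity)]; norm_num

theorem boxν_pos (d : ℕ) [NeZero d] (L : ℕ) : 0 < boxν d L := by
  have : (0 : ℝ) < d := by exact_mod_cast NeZero.pos d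
  unfold boxν; positivity

theorem card_le_boxν (d L : ℕ) : (Fintype.card (boxE d (L : ℤ)) : ℝ) ≤ boxν d L ^ 4 := by
  rw [boxν_pow]; exact_mod_cast card_boxE_le L

theorem sigmaL_hessian_holder [NeZero d] {k s : ℝ} (hk : 0 < k) (hs0 : 0 ≤ s) (hs1 : s ≤ 1)
    (hP4 : ∀ L : ℕ, 1 ≤ L → ∀ g, n4 (gradP (boxJ d L) g) ≤ k * n4 g)
    (hks : k ^ s ≤ 1 + lam / (2 * (2 * Lam)))
    (hV : ∀ t, V (-t) = V t) (h : HPot lam Lam M γ V v v2) (hC : 0 ≤ fourC lam (2 * Lam) (2 * M))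
    {L : ℕ} (hL : 1 ≤ L) (ξ ξ' : EuclideanSpace ℝ (Fin d)) :
    ‖iteratedFDeriv ℝ 2 (sigmaL d V L) ξ - iteratedFDeriv ℝ 2 (sigmaL d V L) ξ'‖
      ≤ fourC lam (2 * Lam) (2 * M) * d * ‖ξ - ξ'‖ ^ (γ * s) := by
  have hLam := (h.lo 0).trans (h.hi 0)
  have hl := h.lam_pos
  have hγ := h.γ_pos
  refine hessian_holder_of_four_point (sigmaL_contDiff hV h L) (by positivity) (fun x a b η ha => ?_) ξ ξ'
  have := four_point (boxJ d L) boxJ_injective h.double hl (by linarith) (boxν_pos d L).le (card_le_boxν d L) hs0 hs1 hk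
    (hP4 L hL) hks (fun e => by linarith [(boxw_mem e).1]) (fun e => (boxw_mem e).2) (boxw_lo h) (boxw_hi h)
    (boxc d L x) (boxc d L a) (boxc d L b) (boxc d L (-η)) (norm_pos_iff.2 ha) (norm_nonneg b) (norm_nonneg η)
    (boxc_abs_le a) (boxc_abs_le b) (fun e => by simpa using boxc_abs_le η e)
  simp only [← map_add, ← boxF_fderiv h] at this
  simp only [sigmaL_fderiv hV h]
  simp only [map_neg] at this
  rw [boxν_pow] at this
  have hQ : (0 : ℝ) < (2 * L + 1 : ℝ) ^ d := by positivity
  have h2 := mul_le_mul_of_nonneg_left this (by positivity : 0 ≤ 1 / (2 * L + 1 : ℝ) ^ d)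
  have e : 1 / (2 * L + 1 : ℝ) ^ d * (fourC lam (2 * Lam) (2 * M) * (d * (2 * L + 1 : ℝ) ^ d) * ‖a‖ ^ (γ * s) * ‖b‖ * ‖η‖)
    = fourC lam (2 * Lam) (2 * M) * d * ‖a‖ ^ (γ * s) * ‖b‖ * ‖η‖ := by field_simp
  rw [e] at h2
  linarith
end Sigma

section Tiles
variable {K Q I α : Type*} [Fintype K] [Fintype Q] [Fintype I] [Fintype α]

/-- configurations on a tiled set -/
def tileEquiv (e : K ⊕ Q × I ≃ α) : ((Q → I → ℝ) × (K → ℝ)) ≃L[ℝ] (α → ℝ) :=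
  LinearEquiv.toContinuousLinearEquiv
    { toFun := fun p a => Sum.elim p.2 (fun x : Q × I => p.1 x.1 x.2) (e.symm a)
      invFun := fun φ => (fun q i => φ (e (Sum.inr (q, i))), fun k => φ (e (Sum.inl k)))
      map_add' := fun p p' => by
        ext a; simp only [Pi.add_apply]; rcases e.symm a with x | x <;> simp
      map_smul' := fun c p => by
        ext a; simp only [Pi.smul_apply]; rcases e.symm a with x | x <;> simp
      left_inv := fun p => by simp
      right_inv := fun φ => by
        ext a
        obtain ⟨b, rfl⟩ := e.surjective a
        rcases b with x | x <;> simp }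

@[simp] theorem tileEquiv_inr (e : K ⊕ Q × I ≃ α) (p : (Q → I → ℝ) × (K → ℝ)) (x : Q × I) :
    tileEquiv e p (e (Sum.inr x)) = p.1 x.1 x.2 := by
  change Sum.elim p.2 (fun x : Q × I => p.1 x.1 x.2) (e.symm (e (Sum.inr x))) = _
  simp

@[simp] theorem tileEquiv_inl (e : K ⊕ Q × I ≃ α) (p : (Q → I → ℝ) × (K → ℝ)) (x : K) :
    tileEquiv e p (e (Sum.inl x)) = p.2 x := by
  change Sum.elim p.2 (fun x : Q × I => p.1 x.1 x.2) (e.symm (e (Sum.inl x))) = _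
  simp

theorem integral_tiles_prod (g : Q → (I → ℝ) → ℝ) (h : K → ℝ → ℝ) :
    ∫ p : (Q → I → ℝ) × (K → ℝ), (∏ q, g q (p.1 q)) * ∏ k, h k (p.2 k)
      = (∏ q, ∫ ψ, g q ψ) * ∏ k, ∫ t, h k t := by
  have := integral_prod_mul (μ := (volume : Measure (Q → I → ℝ))) (ν := (volume : Measure (K → ℝ)))
    (fun a => ∏ q, g q (a q)) (fun b => ∏ k, h k (b k))
  rw [integral_fintype_prod_volume_eq_prod, integral_fintype_prod_volume_eq_prod] at this
  exact this

/-- Fubini for functions which factorise over tiles -/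
theorem integral_tiles (e : K ⊕ Q × I ≃ α) (g : Q → (I → ℝ) → ℝ) (h : K → ℝ → ℝ) :
    ∫ φ : α → ℝ, (∏ q, g q (fun i => φ (e (Sum.inr (q, i))))) * ∏ k, h k (φ (e (Sum.inl k)))
      = (∏ q, ∫ ψ, g q ψ) * ∏ k, ∫ t, h k t := by
  have h0 : (volume : Measure (I → ℝ)).IsAddHaarMeasure := inferInstance
  have h1 : (volume : Measure (Q → I → ℝ)).IsAddHaarMeasure :=
    Measure.pi.isAddHaarMeasure (fun (_ : Q) => (volume : Measure (I → ℝ)))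
  have h2 : (volume : Measure (K → ℝ)).IsAddHaarMeasure := inferInstance
  have h3 : (volume : Measure ((Q → I → ℝ) × (K → ℝ))).IsAddHaarMeasure :=
    Measure.prod.instIsAddHaarMeasure volume volume
  obtain ⟨c, hc, hG⟩ := linear_change (tileEquiv e)
  have key : ∀ (g : Q → (I → ℝ) → ℝ) (h : K → ℝ → ℝ),
      (∏ q, ∫ ψ, g q ψ) * ∏ k, ∫ t, h k t
        = c * ∫ φ : α → ℝ, (∏ q, g q (fun i => φ (e (Sum.inr (q, i))))) * ∏ k, h k (φ (e (Sum.inl k))) := by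
    intro g h
    rw [← (hG _).1]
    simp only [tileEquiv_inr, tileEquiv_inl]
    exact (integral_tiles_prod g h).symm
  have hc1 : c = 1 := by
    have h1 := key (fun _ ψ => ∏ i, Real.exp (-(ψ i) ^ 2)) (fun _ t => Real.exp (-t ^ 2))
    set q := ∫ t : ℝ, Real.exp (-t ^ 2) with hq
    have hq0 : 0 < q := by
      have := integral_gaussian 1
      simp only [neg_mul, one_mul] at this
      rw [hq, this]; positivity
    have h2 : ∀ φ : α → ℝ, (∏ q : Q, ∏ i : I, Real.exp (-(φ (e (Sum.inr (q, i)))) ^ 2))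
        * ∏ k : K, Real.exp (-(φ (e (Sum.inl k))) ^ 2) = ∏ a, Real.exp (-(φ a) ^ 2) := by
      intro φ
      rw [← e.prod_comp, Fintype.prod_sum_type, Fintype.prod_prod_type, mul_comm]
    simp only [h2] at h1
    rw [integral_fintype_prod_volume_eq_prod (fun (_ : α) t => Real.exp (-t ^ 2))] at h1
    simp only [integral_fintype_prod_volume_eq_prod (fun (_ : I) t => Real.exp (-t ^ 2)), ← hq, Finset.prod_const,
      Finset.card_univ] at h1
    have h3 : Fintype.card α = Fintype.card K + Fintype.card Q * Fintype.card I := by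
      rw [← Fintype.card_congr e, Fintype.card_sum, Fintype.card_prod]
    rw [← pow_mul, ← pow_add, h3, add_comm, mul_comm (Fintype.card I)] at h1
    have h4 : 0 < q ^ (Fintype.card K + Fintype.card Q * Fintype.card I) := by positivity
    exact (mul_right_cancel₀ h4.ne' (by rw [one_mul]; exact h1)).symm
  rw [key g h, hc1, one_mul]
end Tiles

section FieldGibbs
variable {κ ι ι' : Type*} [Fintype κ] [Fintype ι] [Fintype ι']

theorem fieldH_growth (J : (κ → ℝ) →ₗ[ℝ] EuclideanSpace ℝ ι) {l l' : ℝ} {U u : ι → ℝ → ℝ}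
    (h : ∀ e, Pot l l' (U e) (u e)) : ∃ C, ∀ φ, |fieldH J U φ| ≤ C * (1 + ‖φ‖ ^ 4) := by
  obtain ⟨q, hq, hJ⟩ := J_bound J
  have h1 : ∀ e, ∃ C, 0 ≤ C ∧ ∀ t, |U e t| ≤ C * (1 + t ^ 2) := by
    intro e
    have hl := (h e).pos
    have hl' := (h e).pos'
    refine ⟨|U e 0| + |u e 0| + l' + l, by positivity, fun t => ?_⟩
    have a1 := (h e).upper 0 t
    have a2 := (h e).tangent 0 t
    rw [sub_zero] at a1 a2
    have a3 : |u e 0 * t| ≤ |u e 0| * (1 + t ^ 2) := by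
      rw [abs_mul]; refine mul_le_mul_of_nonneg_left ?_ (abs_nonneg _)
      nlinarith [sq_abs t, sq_nonneg (|t| - 1)]
    have a4 := abs_le.1 a3
    have a5 := neg_abs_le (U e 0)
    have a6 := le_abs_self (U e 0)
    have a7 : 0 ≤ |U e 0| * t ^ 2 := by positivity
    have a8 : 0 ≤ l * t ^ 2 := by positivity
    have a9 : 0 ≤ l' * t ^ 2 := by positivity
    rw [abs_le]; constructor <;> linarith
  choose C hC0 hC using h1
  refine ⟨∑ e, C e * (1 + q ^ 2) * 2, fun φ => ?_⟩
  rw [fieldH, Finset.sum_mul]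
  refine (Finset.abs_sum_le_sum_abs _ _).trans (Finset.sum_le_sum fun e _ => (hC e _).trans ?_)
  have b1 : |J φ e| ≤ q * ‖φ‖ := (PiLp.norm_apply_le (J φ) e).trans (hJ φ)
  have b2 : (J φ e) ^ 2 ≤ q ^ 2 * ‖φ‖ ^ 2 := by
    rw [← sq_abs, ← mul_pow]; exact pow_le_pow_left₀ (abs_nonneg _) b1 2
  rw [mul_assoc, mul_assoc]
  refine mul_le_mul_of_nonneg_left ?_ (hC0 e)
  have b3 : ‖φ‖ ^ 2 ≤ 1 + ‖φ‖ ^ 4 := by nlinarith [sq_nonneg (‖φ‖ ^ 2 - 1), sq_nonneg (‖φ‖ ^ 2)]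
  have b4 : 0 ≤ ‖φ‖ ^ 4 := by positivity
  have b5 := mul_le_mul_of_nonneg_left b3 (sq_nonneg q)
  nlinarith [sq_nonneg q, mul_nonneg (sq_nonneg q) b4]

theorem fieldH_continuous (J : (κ → ℝ) →ₗ[ℝ] EuclideanSpace ℝ ι) {l l' : ℝ} {U u : ι → ℝ → ℝ}
    (h : ∀ e, Pot l l' (U e) (u e)) : Continuous (fieldH J U) := by
  have hJ := J_cont J
  refine continuous_finsetSum _ fun e _ => ?_
  have : Continuous (U e) := continuous_iff_continuousAt.2 fun t => ((h e).hasDeriv t).continuousAt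
  fun_prop

/-- comparison of two gradient models through a bound for the difference of their energies -/
theorem field_gibbs {J : (κ → ℝ) →ₗ[ℝ] EuclideanSpace ℝ ι} {J' : (κ → ℝ) →ₗ[ℝ] EuclideanSpace ℝ ι'}
    (hJ : Function.Injective J) (hJ' : Function.Injective J') {a a' b b' : ℝ} {A u : ι → ℝ → ℝ} {B v : ι' → ℝ → ℝ}
    (hA : ∀ e, Pot a a' (A e) (u e)) (hB : ∀ e, Pot b b' (B e) (v e)) (ha : 0 < a) (haa : a ≤ a')
    (hb : 0 < b) (hbb : b ≤ b') {f : (κ → ℝ) → ℝ} (hf : Continuous f) {C : ℝ}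
    (hfC : ∀ φ, |f φ| ≤ C * (1 + ‖φ‖ ^ 4)) (hle : ∀ φ, fieldH J A φ - fieldH J' B φ ≤ f φ) :
    Real.log (∫ φ, Real.exp (-fieldH J' B φ)) ≤ Real.log (∫ φ, Real.exp (-fieldH J A φ)) + avg (fieldH J' B) f := by
  obtain ⟨CA, hCA⟩ := fieldH_growth J hA
  obtain ⟨CB, hCB⟩ := fieldH_growth J' hB
  have hi : Integrable fun φ => (fieldH J' B φ - fieldH J A φ) * Real.exp (-fieldH J' B φ) :=
    field_integrable J' hJ' hb hbb hB ((fieldH_continuous J' hB).sub (fieldH_continuous J hA)) (C := CB + CA)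
      fun φ => (abs_sub _ _).trans (by rw [add_mul]; exact add_le_add (hCB φ) (hCA φ))
  have hif : Integrable fun φ => (-f φ) * Real.exp (-fieldH J' B φ) :=
    field_integrable J' hJ' hb hbb hB hf.neg (C := C) fun φ => by rw [abs_neg]; exact hfC φ
  have h1 := gibbs_variational (field_integrable_one J hJ ha haa hA) (field_integrable_one J' hJ' hb hbb hB)
    (field_integral_pos J' hJ' hb hbb hB) hi
  have h2 := avg_mono hif hi fun φ => by have := hle φ; linarith
  rw [avg_neg] at h2
  linarith
end FieldGibbs

section SecondMoment
variable {κ ι : Type*} [Fintype κ] [Fintype ι] (J : (κ → ℝ) →ₗ[ℝ] EuclideanSpace ℝ ι) {l l' : ℝ} {U u : ι → ℝ → ℝ}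

theorem avg_inner (hJ : Function.Injective J) (hl : 0 < l) (hll : l ≤ l')
    (h : ∀ e, Pot l l' (U e) (u e)) (θ : EuclideanSpace ℝ ι) :
    avg (fieldH J U) (fun φ => inner ℝ θ (J φ)) = ∑ e, θ e * avg (fieldH J U) (fun φ => J φ e) := by
  classical
  have h1 : ∀ φ, inner ℝ θ (J φ) = ∑ e, θ e * J φ e := fun φ => by
    rw [PiLp.inner_apply]; exact Finset.sum_congr rfl fun e _ => by simp [mul_comm]
  simp only [h1]
  rw [avg_sum]
  · exact Finset.sum_congr rfl fun e _ => avg_const_mul _ _ _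
  · intro e _
    have h2 := lin_integrable J hJ hl hll h (EuclideanSpace.single e 1)
    simp only [EuclideanSpace.inner_single_left, map_one, one_mul] at h2
    simp only [mul_assoc]
    exact h2.const_mul _

theorem second_moment (hJ : Function.Injective J) (hl : 0 < l) (hll : l ≤ l')
    (h : ∀ e, Pot l l' (U e) (u e)) (θ : EuclideanSpace ℝ ι) :
    avg (fieldH J U) (fun φ => (inner ℝ θ (J φ)) ^ 2)
      ≤ ‖θ‖ ^ 2 / l + avg (fieldH J U) (fun φ => inner ℝ θ (J φ)) ^ 2 := by
  have h0 := brascamp_lieb J hJ hl hll h θ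
  set m := avg (fieldH J U) (fun φ => inner ℝ θ (J φ)) with hm
  have h1 : ∀ φ, (inner ℝ θ (J φ)) ^ 2 = (inner ℝ θ (J φ) - m) ^ 2 + (2 * m * inner ℝ θ (J φ) - m ^ 2) :=
    fun φ => by ring
  have i1 := lin_pow_integrable J hJ hl hll h θ 2 (by norm_num) m
  have i2 := lin_integrable J hJ hl hll h θ
  have i3 := field_integrable_one J hJ hl hll h
  have i4 : Integrable fun φ => (2 * m * inner ℝ θ (J φ)) * Real.exp (-fieldH J U φ) := by
    simp only [mul_assoc]; exact (i2.const_mul _).const_mul _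
  have i5 : Integrable fun φ => m ^ 2 * Real.exp (-fieldH J U φ) := i3.const_mul _
  simp only [h1]
  rw [avg_add i1 (by simp only [sub_mul]; exact i4.sub i5), avg_sub i4 i5, avg_const_mul,
    avg_const (field_integral_pos J hJ hl hll h), ← hm]
  linarith

theorem avg_even_zero (hU : ∀ e t, U e (-t) = U e t) (θ : EuclideanSpace ℝ ι) :
    avg (fieldH J U) (fun φ => inner ℝ θ (J φ)) = 0 := by
  have h1 := avg_comp_equiv (ContinuousLinearEquiv.neg ℝ (M := κ → ℝ)) (fieldH J U) (fun φ => inner ℝ θ (J φ))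
  have h2 : (fun φ => fieldH J U (ContinuousLinearEquiv.neg ℝ (M := κ → ℝ) φ)) = fieldH J U := by
    ext φ; simp [fieldH, hU]
  rw [h2] at h1
  simp only [ContinuousLinearEquiv.coe_neg, Pi.neg_apply, map_neg, inner_neg_right, id] at h1
  rw [avg_neg] at h1
  linarith

variable {lam Lam M γ k s ν : ℝ} {V v v2 : ℝ → ℝ} {w : ι → ℝ}

theorem layer_second_moment (hJ : Function.Injective J) (h : HPot lam Lam M γ V v v2) (hl : 0 < l) (hll : l ≤ l')
    (hν : 0 < ν) (hN : (Fintype.card ι : ℝ) ≤ ν ^ 4) (hs0 : 0 ≤ s) (hs1 : s ≤ 1) (hk : 0 < k)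
    (hP4 : ∀ g, n4 (gradP J g) ≤ k * n4 g) (hks : k ^ s ≤ 1 + l / (2 * l'))
    (hlo : ∀ e t, l ≤ w e * v2 t) (hhi : ∀ e t, w e * v2 t ≤ l') (hV : ∀ t, V (-t) = V t)
    (δ : EuclideanSpace ℝ ι) {ρ : ℝ} (hρ : 0 ≤ ρ) (hδ : ∀ e, |δ e| ≤ ρ) (S : Finset ι)
    {p : ℝ} (hp : 0 < p) (hS : (S.card : ℝ) ≤ p ^ 4) :
    ∑ e ∈ S, avg (fieldH J fun e t => w e * V (t - δ e)) (fun φ => (J φ e) ^ 2)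
      ≤ S.card / l + (4 * l' * ρ / l * ν ^ 2 * (p / ν) ^ s) ^ 2 := by
  classical
  set B := 4 * l' * ρ / l * ν ^ 2 * (p / ν) ^ s with hB
  have hl' : 0 < l' := hl.trans_le hll
  have hB0 : 0 ≤ B := by positivity
  set H := fieldH J fun e t => w e * V (t - δ e) with hH
  have hpot : ∀ e, Pot l l' (fun t => w e * V (t - δ e)) (fun t => w e * v (t - δ e)) :=
    fun e => h.pot hl (hlo e) (hhi e) _
  set m : ι → ℝ := fun e => avg H (fun φ => J φ e) with hm
  have h1 : ∀ e, avg H (fun φ => (J φ e) ^ 2) ≤ 1 / l + m e ^ 2 := by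
    intro e
    have := second_moment J hJ hl hll hpot (EuclideanSpace.single e 1)
    simpa only [EuclideanSpace.inner_single_left, map_one, one_mul, PiLp.norm_single, norm_one, one_pow]
      using this
  set θ : EuclideanSpace ℝ ι := WithLp.toLp 2 fun e => if e ∈ S then m e else 0 with hθ
  have hθa : ∀ e, θ e = if e ∈ S then m e else 0 := fun e => rfl
  have h2 : ‖θ‖ ^ 2 = ∑ e ∈ S, m e ^ 2 := by
    rw [EuclideanSpace.norm_sq_eq]
    simp only [hθa, Real.norm_eq_abs, sq_abs, ite_pow]
    simp [Finset.sum_ite_mem]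
  have h3 : avg H (fun φ => inner ℝ θ (J φ)) = ‖θ‖ ^ 2 := by
    rw [h2, avg_inner J hJ hl hll hpot]
    simp only [hθa, ite_mul, zero_mul, ← hH, Finset.sum_ite_mem, Finset.univ_inter]
    exact Finset.sum_congr rfl fun e _ => by simp only [hm]; ring
  have h4 := boundary_response J hJ h hl hll hν hN hs0 hs1 hk hP4 hks hlo hhi 0 δ hρ hδ (θ := θ)
    (fun e he => by simp [hθa, he]) hp hS
  simp only [zero_add, PiLp.zero_apply, sub_zero] at h4
  rw [avg_even_zero J (U := fun e t => w e * V t) (fun e t => by simp only [hV]) θ, sub_zero] at h4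
  rw [← hH, h3, ← hB] at h4
  have h5 : ‖θ‖ ≤ B := by
    by_contra hcon
    push Not at hcon
    have : ‖θ‖ * B < ‖θ‖ * ‖θ‖ := mul_lt_mul_of_pos_left hcon (hB0.trans_lt hcon)
    nlinarith
  have h6 : ‖θ‖ ^ 2 ≤ B ^ 2 := pow_le_pow_left₀ (norm_nonneg _) h5 2
  refine (Finset.sum_le_sum fun e _ => h1 e).trans ?_
  rw [Finset.sum_add_distrib, ← h2, Finset.sum_const, nsmul_eq_mul, mul_one_div]
  linarith
end SecondMoment

section BoxBoundary
variable {d : ℕ} {lam Lam M γ k s : ℝ} {V v v2 : ℝ → ℝ}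

theorem box_pot (h : HPot lam Lam M γ V v v2) {L : ℤ} (ξ : EuclideanSpace ℝ (Fin d)) (e : boxE d L) :
    Pot lam (2 * Lam) (fun t => boxw e * (2 * V (t - boxc d L ξ e))) (fun t => boxw e * (2 * v (t - boxc d L ξ e))) :=
  h.double.pot h.lam_pos (boxw_lo h e) (boxw_hi h e) _

/-- the energy of the box with slope `ξ` -/
def boxH (d : ℕ) (V : ℝ → ℝ) (L : ℤ) (ξ : EuclideanSpace ℝ (Fin d)) : Conf d L → ℝ :=
  fieldH (boxJ d L) fun e t => boxw e * (2 * V (t - boxc d L ξ e))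

theorem box_layer [NeZero d] (hk : 0 < k) (hs0 : 0 ≤ s) (hs1 : s ≤ 1)
    (hP4 : ∀ L : ℕ, 1 ≤ L → ∀ g, n4 (gradP (boxJ d L) g) ≤ k * n4 g)
    (hks : k ^ s ≤ 1 + lam / (2 * (2 * Lam)))
    (hV : ∀ t, V (-t) = V t) (h : HPot lam Lam M γ V v v2) {L : ℕ} (hL : 1 ≤ L)
    {ξ : EuclideanSpace ℝ (Fin d)} {R : ℝ} (hξ : ‖ξ‖ ≤ R) (S : Finset (boxE d (L : ℤ)))
    {p : ℝ} (hp : 0 < p) (hS : (S.card : ℝ) ≤ p ^ 4) :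
    ∑ e ∈ S, avg (boxH d V L ξ) (fun φ => (boxJ d L φ e) ^ 2)
      ≤ S.card / lam + (4 * (2 * Lam) * R / lam * boxν d L ^ 2 * (p / boxν d L) ^ s) ^ 2 := by
  have hl := h.lam_pos
  have hLam := (h.lo 0).trans (h.hi 0)
  exact layer_second_moment (boxJ d L) boxJ_injective h.double hl (by linarith) (boxν_pos d L) (card_le_boxν d L) hs0 hs1
    hk (hP4 L hL) hks (boxw_lo h) (boxw_hi h) (fun t => by rw [hV]) (boxc d L ξ) ((norm_nonneg ξ).trans hξ)
    (fun e => (boxc_abs_le ξ e).trans hξ) S hp hS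
end BoxBoundary

section Tame
variable {κ : Type*} [Fintype κ]

/-- continuous observables of at most quartic growth -/
def Tame (f : (κ → ℝ) → ℝ) : Prop := Continuous f ∧ ∃ C, ∀ φ, |f φ| ≤ C * (1 + ‖φ‖ ^ 4)

theorem Tame.add {f g : (κ → ℝ) → ℝ} (hf : Tame f) (hg : Tame g) : Tame fun φ => f φ + g φ := by
  obtain ⟨hf, C, hC⟩ := hf
  obtain ⟨hg, D, hD⟩ := hg
  exact ⟨hf.add hg, C + D, fun φ => (abs_add_le _ _).trans (by rw [add_mul]; exact add_le_add (hC φ) (hD φ))⟩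

theorem Tame.const (c : ℝ) : Tame fun _ : κ → ℝ => c := by
  refine ⟨continuous_const, |c|, fun φ => ?_⟩
  have : 0 ≤ |c| * ‖φ‖ ^ 4 := by positivity
  rw [mul_add, mul_one]; linarith

theorem Tame.const_mul {f : (κ → ℝ) → ℝ} (hf : Tame f) (c : ℝ) : Tame fun φ => c * f φ := by
  obtain ⟨hf, C, hC⟩ := hf
  refine ⟨hf.const_mul c, |c| * C, fun φ => ?_⟩
  rw [abs_mul, mul_assoc]
  exact mul_le_mul_of_nonneg_left (hC φ) (abs_nonneg c)

theorem Tame.sum {ι : Type*} (s : Finset ι) {f : ι → (κ → ℝ) → ℝ} (hf : ∀ i ∈ s, Tame (f i)) :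
    Tame fun φ => ∑ i ∈ s, f i φ := by
  classical
  induction s using Finset.induction_on with
  | empty => simpa using Tame.const 0
  | insert a s ha ih =>
    simp only [Finset.sum_insert ha]
    exact (hf a (Finset.mem_insert_self a s)).add (ih fun i hi => hf i (Finset.mem_insert_of_mem hi))

theorem Tame.sq (ℓ : (κ → ℝ) →ₗ[ℝ] ℝ) : Tame fun φ => ℓ φ ^ 2 := by
  set T := LinearMap.toContinuousLinearMap ℓ
  have hT : ∀ φ, |ℓ φ| ≤ ‖T‖ * ‖φ‖ := fun φ => T.le_opNorm φ
  have hc : Continuous ℓ := T.continuous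
  refine ⟨hc.pow 2, ‖T‖ ^ 2, fun φ => ?_⟩
  rw [abs_pow]
  refine (pow_le_pow_left₀ (abs_nonneg _) (hT φ) 2).trans ?_
  rw [mul_pow]
  refine mul_le_mul_of_nonneg_left ?_ (by positivity)
  nlinarith [sq_nonneg (‖φ‖ ^ 2 - 1), sq_nonneg (‖φ‖ ^ 2)]

variable {ι ι' : Type*} [Fintype ι] [Fintype ι'] {J : (κ → ℝ) →ₗ[ℝ] EuclideanSpace ℝ ι}
  {l l' : ℝ} {U u : ι → ℝ → ℝ}

theorem Tame.integrable {f : (κ → ℝ) → ℝ} (hf : Tame f) (hJ : Function.Injective J) (hl : 0 < l) (hll : l ≤ l')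
    (h : ∀ e, Pot l l' (U e) (u e)) : Integrable fun φ => f φ * Real.exp (-fieldH J U φ) := by
  obtain ⟨hf, C, hC⟩ := hf
  exact field_integrable J hJ hl hll h hf hC
end Tame

section Energy
variable {d : ℕ} {lam Lam M γ k s : ℝ} {V v v2 : ℝ → ℝ}

theorem HPot.v_zero (h : HPot lam Lam M γ V v v2) (hV : ∀ t, V (-t) = V t) : v 0 = 0 := by
  have h1 := h.hasDeriv 0
  have h2 : HasDerivAt (fun t => V (-t)) (v (-0) * -1) 0 :=
    HasDerivAt.comp (0 : ℝ) (h.hasDeriv (-0)) ((hasDerivAt_id (0 : ℝ)).neg)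
  simp only [hV, neg_zero] at h2
  have := h1.unique h2
  linarith

theorem HPot.v_abs (h : HPot lam Lam M γ V v v2) (hV : ∀ t, V (-t) = V t) (t : ℝ) : |v t| ≤ Lam * |t| := by
  have hp : Pot lam Lam (fun t => 1 * V (t - 0)) (fun t => 1 * v (t - 0)) :=
    h.pot h.lam_pos (fun t => by rw [one_mul]; exact h.lo t) (fun t => by rw [one_mul]; exact h.hi t) 0
  have := hp.lipu 0 t
  simpa [h.v_zero hV] using this

theorem HPot.shift_le (h : HPot lam Lam M γ V v v2) (hV : ∀ t, V (-t) = V t) {R a b t : ℝ} (ha : |a| ≤ R) (hb : |b| ≤ R) :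
    V (t - a) - V (t - b) ≤ Lam * (t ^ 2 + 7 * R ^ 2) := by
  have hp : Pot lam Lam (fun t => 1 * V (t - 0)) (fun t => 1 * v (t - 0)) :=
    h.pot h.lam_pos (fun t => by rw [one_mul]; exact h.lo t) (fun t => by rw [one_mul]; exact h.hi t) 0
  have h1 := hp.upper (t - b) (t - a)
  simp only [one_mul, sub_zero] at h1
  have h2 := h.v_abs hV (t - b)
  have hL := hp.pos'
  have h3 : v (t - b) * (t - a - (t - b)) ≤ Lam * (|t - b| * |b - a|) := by
    refine (le_abs_self _).trans ?_
    rw [abs_mul, show t - a - (t - b) = b - a by ring, ← mul_assoc]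
    exact mul_le_mul_of_nonneg_right h2 (abs_nonneg _)
  have ha2 : a ^ 2 ≤ R ^ 2 := by rw [← sq_abs]; exact pow_le_pow_left₀ (abs_nonneg _) ha 2
  have hb2 : b ^ 2 ≤ R ^ 2 := by rw [← sq_abs]; exact pow_le_pow_left₀ (abs_nonneg _) hb 2
  have h4 : |t - b| * |b - a| ≤ ((t - b) ^ 2 + (b - a) ^ 2) / 2 := by
    have := two_mul_le_add_sq |t - b| |b - a|
    rw [sq_abs, sq_abs] at this; linarith
  have h5 : (t - b) ^ 2 ≤ 2 * t ^ 2 + 2 * b ^ 2 := by nlinarith [sq_nonneg (t + b)]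
  have h6 : (b - a) ^ 2 ≤ 2 * b ^ 2 + 2 * a ^ 2 := by nlinarith [sq_nonneg (a + b)]
  have h7 : |t - b| * |b - a| + (t - a - (t - b)) ^ 2 ≤ t ^ 2 + 7 * R ^ 2 := by
    rw [show t - a - (t - b) = b - a by ring]; linarith
  have h8 := mul_le_mul_of_nonneg_left h7 hL.le
  linarith

theorem boxF_eq_boxH (d : ℕ) (V : ℝ → ℝ) (L : ℤ) (ξ : EuclideanSpace ℝ (Fin d)) :
    boxF d V L ξ = Real.log (∫ φ, Real.exp (-boxH d V L ξ φ)) := rfl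

theorem boxF_le [NeZero d] (hk : 0 < k) (hs0 : 0 ≤ s) (hs1 : s ≤ 1)
    (hP4 : ∀ L : ℕ, 1 ≤ L → ∀ g, n4 (gradP (boxJ d L) g) ≤ k * n4 g)
    (hks : k ^ s ≤ 1 + lam / (2 * (2 * Lam)))
    (hV : ∀ t, V (-t) = V t) (h : HPot lam Lam M γ V v v2) {L : ℕ} (hL : 1 ≤ L)
    {ξ ξ' : EuclideanSpace ℝ (Fin d)} {R : ℝ} (hξ : ‖ξ‖ ≤ R) (hξ' : ‖ξ'‖ ≤ R) :
    boxF d V L ξ ≤ boxF d V L ξ'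
      + 2 * Lam * (1 / lam + (4 * (2 * Lam) * R / lam) ^ 2 + 7 * R ^ 2) * (d * (2 * L + 1 : ℝ) ^ d) := by
  have hl := h.lam_pos
  have hLam := (h.lo 0).trans (h.hi 0)
  have hν := boxν_pos d L
  have hcard := card_le_boxν d L
  set f : Conf d (L : ℤ) → ℝ := fun φ => ∑ e, (2 * Lam * (boxJ d L φ e) ^ 2 + 2 * Lam * (7 * R ^ 2)) with hf
  have hsq : ∀ e, Tame fun φ : Conf d (L : ℤ) => (boxJ d L φ e) ^ 2 := fun e =>
    Tame.sq ((EuclideanSpace.proj e : EuclideanSpace ℝ (boxE d (L : ℤ)) →L[ℝ] ℝ).toLinearMap ∘ₗ boxJ d L)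
  have hterm : ∀ e, Tame fun φ : Conf d (L : ℤ) => 2 * Lam * (boxJ d L φ e) ^ 2 + 2 * Lam * (7 * R ^ 2) := fun e =>
    ((hsq e).const_mul _).add (Tame.const _)
  have htame : Tame f := Tame.sum _ fun e _ => hterm e
  have hg := field_gibbs (J := boxJ d L) (J' := boxJ d L) boxJ_injective boxJ_injective (box_pot h ξ') (box_pot h ξ)
    hl (by linarith) hl (by linarith) htame.1 htame.2.choose_spec (fun φ => by
      rw [fieldH, fieldH, ← Finset.sum_sub_distrib, hf]
      refine Finset.sum_le_sum fun e _ => ?_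
      have h1 := h.shift_le hV (t := boxJ d L φ e) ((boxc_abs_le ξ' e).trans hξ') ((boxc_abs_le ξ e).trans hξ)
      have h2 := boxw_mem e
      have h3 : 0 ≤ Lam * ((boxJ d L φ e) ^ 2 + 7 * R ^ 2) := mul_nonneg (by linarith) (by positivity)
      rw [show ∀ A B : ℝ, boxw e * (2 * A) - boxw e * (2 * B) = 2 * (boxw e * (A - B)) by intros; ring]
      have h4 := mul_le_mul_of_nonneg_left h1 (by linarith : 0 ≤ boxw e)
      have h5 := mul_le_mul_of_nonneg_right h2.2 h3
      linarith)
  have hlayer := box_layer hk hs0 hs1 hP4 hks hV h hL hξ Finset.univ hν (by simpa using hcard)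
  rw [div_self hν.ne', Real.one_rpow, mul_one] at hlayer
  have hav : avg (boxH d V L ξ) f = 2 * Lam * ∑ e, avg (boxH d V L ξ) (fun φ => (boxJ d L φ e) ^ 2)
      + (Fintype.card (boxE d (L : ℤ))) * (2 * Lam * (7 * R ^ 2)) := by
    have hll : lam ≤ 2 * Lam := by linarith
    have hi : ∀ g, Tame g → Integrable fun φ => g φ * Real.exp (-boxH d V L ξ φ) := fun g hg =>
      hg.integrable boxJ_injective hl hll (box_pot h ξ)
    rw [hf, avg_sum _ (fun e _ => hi _ (hterm e)), Finset.mul_sum, ← nsmul_eq_mul, ← Finset.card_univ,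
      ← Finset.sum_const, ← Finset.sum_add_distrib]
    refine Finset.sum_congr rfl fun e _ => ?_
    rw [avg_add (hi _ ((hsq e).const_mul _)) (hi _ (Tame.const _)), avg_const_mul,
      avg_const (H := boxH d V L ξ) (field_integral_pos _ boxJ_injective hl hll (box_pot h ξ))]
  change boxF d V L ξ ≤ boxF d V L ξ' + avg (boxH d V L ξ) f at hg
  rw [hav] at hg
  refine hg.trans (add_le_add le_rfl ?_)
  rw [← boxν_pow]
  rw [Finset.card_univ] at hlayer
  have e1 : (4 * (2 * Lam) * R / lam * boxν d L ^ 2) ^ 2 = (4 * (2 * Lam) * R / lam) ^ 2 * boxν d L ^ 4 := by ring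
  rw [e1] at hlayer
  have h1 : (Fintype.card (boxE d (L : ℤ)) : ℝ) / lam ≤ 1 / lam * boxν d L ^ 4 := by
    rw [div_eq_mul_one_div, mul_comm]
    exact mul_le_mul_of_nonneg_left hcard (by positivity)
  have h2 : (Fintype.card (boxE d (L : ℤ)) : ℝ) * (2 * Lam * (7 * R ^ 2)) ≤ boxν d L ^ 4 * (2 * Lam * (7 * R ^ 2)) :=
    mul_le_mul_of_nonneg_right hcard (mul_nonneg (by linarith) (by positivity))
  have h3 := mul_le_mul_of_nonneg_left (hlayer.trans (add_le_add h1 le_rfl)) (by linarith : 0 ≤ 2 * Lam)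
  linarith
end Energy

section TorusField
variable {d N : ℕ} [NeZero N]

/-- non-zero sites of the discrete torus -/
@[ext] structure TorA (d N : ℕ) where
  /-- the site -/
  val : Fin d → ZMod N
  ne_zero : val ≠ 0

instance : Finite (TorA d N) := Finite.of_injective TorA.val fun _ _ => TorA.ext

instance : Fintype (TorA d N) := Fintype.ofFinite _

open Classical in
/-- extension by `0` at the origin -/
def extT (φ : TorA d N → ℝ) (X : Fin d → ZMod N) : ℝ := if h : X ≠ 0 then φ ⟨X, h⟩ else 0

@[simp] theorem extT_zero (φ : TorA d N → ℝ) : extT φ 0 = 0 := by simp [extT]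

@[simp] theorem extT_coe (φ : TorA d N → ℝ) (a : TorA d N) : extT φ a.1 = φ a := by simp [extT, a.ne_zero]

theorem extT_add (φ ψ : TorA d N → ℝ) (X : Fin d → ZMod N) : extT (φ + ψ) X = extT φ X + extT ψ X := by
  simp only [extT, Pi.add_apply]; split_ifs <;> simp

theorem extT_smul (c : ℝ) (φ : TorA d N → ℝ) (X : Fin d → ZMod N) : extT (c • φ) X = c * extT φ X := by
  simp only [extT, Pi.smul_apply]; split_ifs <;> simp

attribute [irreducible] extT

/-- evaluation at a site -/
def evT (X : Fin d → ZMod N) : (TorA d N → ℝ) →ₗ[ℝ] ℝ where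
  toFun φ := extT φ X
  map_add' φ ψ := extT_add φ ψ X
  map_smul' c φ := extT_smul c φ X

variable (d N) in
/-- gradients on the torus -/
def torJ : (TorA d N → ℝ) →ₗ[ℝ] EuclideanSpace ℝ ((Fin d → ZMod N) × Fin d) where
  toFun φ := WithLp.toLp 2 fun e => extT φ (e.1 + Pi.single e.2 1) - extT φ e.1
  map_add' φ ψ := by ext e; simp [extT_add]; ring
  map_smul' c φ := by ext e; simp [extT_smul]; ring

@[simp] theorem torJ_apply (φ : TorA d N → ℝ) (e : (Fin d → ZMod N) × Fin d) :
    torJ d N φ e = extT φ (e.1 + Pi.single e.2 1) - extT φ e.1 := rfl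

theorem extT_path (φ : TorA d N → ℝ) (Y : Fin d → ZMod N) (i : Fin d) (l : ℕ) :
    extT φ (Y + Pi.single i (l : ZMod N)) - extT φ Y
      = ∑ j ∈ Finset.range l, torJ d N φ (Y + Pi.single i (j : ZMod N), i) := by
  induction l with
  | zero => simp
  | succ l ih =>
    rw [Finset.sum_range_succ, ← ih, torJ_apply]
    simp only
    rw [add_assoc, ← Pi.single_add]
    push_cast
    ring

theorem torus_eq_sum (X : Fin d → ZMod N) : X = ∑ i, Pi.single i (((X i).val : ℕ) : ZMod N) := by
  simp only [ZMod.natCast_val, ZMod.cast_id', id]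
  exact (Finset.univ_sum_single X).symm

theorem torJ_injective : Function.Injective (torJ d N) := by
  rw [injective_iff_map_eq_zero]
  intro φ hφ
  have h1 : ∀ (l : ℕ) Y i, extT φ (Y + Pi.single i (l : ZMod N)) = extT φ Y := fun l Y i => by
    have := extT_path φ Y i l
    rw [hφ] at this
    simpa [sub_eq_zero] using this
  have h2 : ∀ (X : Fin d → ZMod N) (s : Finset (Fin d)),
      extT φ (∑ i ∈ s, Pi.single i (((X i).val : ℕ) : ZMod N)) = 0 := by
    intro X s
    induction s using Finset.induction_on with
    | empty => simp
    | insert a s ha ih => rw [Finset.sum_insert ha, add_comm, h1, ih]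
  ext a
  have h3 := h2 a.1 Finset.univ
  rw [← torus_eq_sum a.1, extT_coe] at h3
  exact h3

/-- translation of configurations -/
def transT (a : Fin d → ZMod N) : (TorA d N → ℝ) →ₗ[ℝ] (TorA d N → ℝ) where
  toFun φ := fun X => extT φ (X.1 + a) - extT φ a
  map_add' φ ψ := by ext e; simp [extT_add]; ring
  map_smul' c φ := by ext e; simp [extT_smul]; ring

theorem extT_transT (a X : Fin d → ZMod N) (φ : TorA d N → ℝ) :
    extT (transT a φ) X = extT φ (X + a) - extT φ a := by
  by_cases h : X = 0
  · simp [h]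
  · exact extT_coe (transT a φ) ⟨X, h⟩

theorem transT_neg (a : Fin d → ZMod N) (φ : TorA d N → ℝ) : transT (-a) (transT a φ) = φ := by
  ext X
  rw [← extT_coe (transT (-a) (transT a φ)) X, ← extT_coe φ X, extT_transT, extT_transT, extT_transT]
  simp

/-- translation as an equivalence -/
def transE (a : Fin d → ZMod N) : (TorA d N → ℝ) ≃L[ℝ] (TorA d N → ℝ) :=
  LinearEquiv.toContinuousLinearEquiv (LinearEquiv.ofLinearMap (transT a) (transT (-a))
    (LinearMap.ext fun φ => by simpa using transT_neg (-a) φ) (LinearMap.ext fun φ => transT_neg a φ))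

theorem transE_apply (a : Fin d → ZMod N) (φ : TorA d N → ℝ) : transE a φ = transT a φ := rfl

variable {lam Lam M γ : ℝ} {V v v2 : ℝ → ℝ}

/-- energy on the torus -/
def torH (N : ℕ) [NeZero N] (V : ℝ → ℝ) (ξ : EuclideanSpace ℝ (Fin d)) : (TorA d N → ℝ) → ℝ :=
  fieldH (torJ d N) fun e t => 2 * V (t - ξ e.2)

theorem tor_pot (h : HPot lam Lam M γ V v v2) (ξ : EuclideanSpace ℝ (Fin d)) (e : (Fin d → ZMod N) × Fin d) :
    Pot (2 * lam) (2 * Lam) (fun t => 2 * V (t - ξ e.2)) (fun t => 2 * v (t - ξ e.2)) :=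
  h.pot (by linarith [h.lam_pos]) (fun t => by linarith [h.lo t]) (fun t => by linarith [h.hi t]) _

theorem torH_trans (ξ : EuclideanSpace ℝ (Fin d)) (a : Fin d → ZMod N) (φ : TorA d N → ℝ) :
    torH N V ξ (transT a φ) = torH N V ξ φ := by
  simp only [torH, fieldH, torJ_apply, extT_transT]
  refine Eq.trans ?_ (Equiv.sum_comp ((Equiv.addRight a).prodCongr (Equiv.refl (Fin d)))
    (fun e : (Fin d → ZMod N) × Fin d => 2 * V (extT φ (e.1 + Pi.single e.2 1) - extT φ e.1 - ξ e.2)))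
  refine Finset.sum_congr rfl fun e _ => ?_
  simp only [Equiv.prodCongr_apply, Prod.map_fst, Prod.map_snd, Equiv.coe_addRight, Equiv.refl_apply]
  rw [add_right_comm e.1 a]
  congr 2
  ring

theorem tor_integrable_lin (h : HPot lam Lam M γ V v v2) (ξ : EuclideanSpace ℝ (Fin d)) (e : (Fin d → ZMod N) × Fin d)
    {f : (TorA d N → ℝ) → ℝ} (hf : ∀ φ, f φ = torJ d N φ e) : Integrable fun φ => f φ * Real.exp (-torH N V ξ φ) := by
  have hLam := (h.lo 0).trans (h.hi 0)
  have hl := h.lam_pos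
  have := lin_integrable (torJ d N) torJ_injective (by linarith) (by linarith) (tor_pot h ξ) (EuclideanSpace.single e 1)
  simp only [EuclideanSpace.inner_single_left, map_one, one_mul, ← hf] at this
  exact this

theorem tor_mean_trans (ξ : EuclideanSpace ℝ (Fin d)) (Y : Fin d → ZMod N) (i : Fin d) :
    avg (torH N V ξ) (fun φ => torJ d N φ (Y, i)) = avg (torH N V ξ) (fun φ => torJ d N φ (0, i)) := by
  have := avg_comp_equiv (transE Y) (torH N V ξ) (fun φ => torJ d N φ (0, i))
  simp only [transE_apply, torH_trans] at this
  rw [← this]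
  congr 1
  funext φ
  simp only [torJ_apply, extT_transT]
  rw [zero_add, zero_add, add_comm Y]; ring

theorem avg_eq_zero_of_sum {X : Type*} [MeasureSpace X] {H : X → ℝ} {n : ℕ} (hn : n ≠ 0) {f : ℕ → X → ℝ} {c : ℝ}
    (hf : ∀ j, Integrable fun x => f j x * Real.exp (-H x)) (hc : ∀ j, avg H (f j) = c)
    (h0 : ∀ x, ∑ j ∈ Finset.range n, f j x = 0) : c = 0 := by
  have h2 := avg_sum (H := H) (Finset.range n) (fun j _ => hf j)
  have h3 : avg H (fun _ => (0 : ℝ)) = 0 := by simp only [avg, zero_mul, integral_zero, zero_div]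
  rw [funext h0, h3, Finset.sum_congr rfl fun j _ => hc j, Finset.sum_const, Finset.card_range, nsmul_eq_mul] at h2
  exact (mul_eq_zero.1 h2.symm).resolve_left (by exact_mod_cast hn)

theorem tor_mean (h : HPot lam Lam M γ V v v2) (ξ : EuclideanSpace ℝ (Fin d)) (e : (Fin d → ZMod N) × Fin d) :
    avg (torH N V ξ) (fun φ => torJ d N φ e) = 0 := by
  obtain ⟨X, i⟩ := e
  rw [tor_mean_trans]
  obtain ⟨f, hf⟩ : ∃ f : ℕ → (TorA d N → ℝ) → ℝ,
      ∀ j, f j = fun φ => torJ d N φ ((0 : Fin d → ZMod N) + Pi.single i ((j : ℕ) : ZMod N), i) := ⟨_, fun _ => rfl⟩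
  refine avg_eq_zero_of_sum (H := torH N V ξ) (NeZero.ne N) (f := f) (fun j => ?_) (fun j => ?_) fun φ => ?_
  · exact tor_integrable_lin h ξ _ fun φ => congrFun (hf j) φ
  · rw [hf]
    exact tor_mean_trans ξ ((0 : Fin d → ZMod N) + Pi.single i ((j : ℕ) : ZMod N)) i
  · simp only [hf]
    rw [← extT_path φ 0 i N, ZMod.natCast_self, Pi.single_zero, add_zero, sub_self]

theorem tor_second_moment (h : HPot lam Lam M γ V v v2) (ξ : EuclideanSpace ℝ (Fin d))
    (θ : EuclideanSpace ℝ ((Fin d → ZMod N) × Fin d)) :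
    avg (torH N V ξ) (fun φ => (inner ℝ θ (torJ d N φ)) ^ 2) ≤ ‖θ‖ ^ 2 / (2 * lam) := by
  have hLam := (h.lo 0).trans (h.hi 0)
  have hl := h.lam_pos
  have h1 := second_moment (torJ d N) torJ_injective (by linarith) (by linarith) (tor_pot h ξ) θ
  rw [avg_inner (torJ d N) torJ_injective (by linarith) (by linarith) (tor_pot h ξ)] at h1
  have h2 : ∀ e, avg (fieldH (torJ d N) fun e t => 2 * V (t - ξ e.2)) (fun φ => torJ d N φ e) = 0 := tor_mean h ξ
  simp only [h2, mul_zero, Finset.sum_const_zero] at h1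
  simp only [ne_eq, OfNat.ofNat_ne_zero, not_false_eq_true, zero_pow, add_zero] at h1
  exact h1

theorem tor_tame_sq (X Y : Fin d → ZMod N) : Tame fun φ : TorA d N → ℝ => (extT φ X - extT φ Y) ^ 2 :=
  Tame.sq (evT X - evT Y)

theorem tor_integrable (h : HPot lam Lam M γ V v v2) (ξ : EuclideanSpace ℝ (Fin d)) {f : (TorA d N → ℝ) → ℝ} (hf : Tame f) :
    Integrable fun φ => f φ * Real.exp (-torH N V ξ φ) := by
  have hLam := (h.lo 0).trans (h.hi 0)
  have hl := h.lam_pos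
  exact hf.integrable torJ_injective (by linarith) (by linarith) (tor_pot h ξ)

theorem tor_path (h : HPot lam Lam M γ V v v2) (ξ : EuclideanSpace ℝ (Fin d)) (Y : Fin d → ZMod N) (i : Fin d)
    {l : ℕ} (hlN : l ≤ N) :
    avg (torH N V ξ) (fun φ => (extT φ (Y + Pi.single i (l : ZMod N)) - extT φ Y) ^ 2) ≤ l / (2 * lam) := by
  classical
  set T := (Finset.range l).image fun j : ℕ => ((Y + Pi.single i (j : ZMod N), i) : (Fin d → ZMod N) × Fin d) with hT
  set θ : EuclideanSpace ℝ ((Fin d → ZMod N) × Fin d) := WithLp.toLp 2 fun e => if e ∈ T then 1 else 0 with hθ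
  have hθa : ∀ e, θ e = if e ∈ T then 1 else 0 := fun e => rfl
  have hinj : ∀ j ∈ Finset.range l, ∀ j' ∈ Finset.range l,
      ((Y + Pi.single i (j : ZMod N), i) : (Fin d → ZMod N) × Fin d) = (Y + Pi.single i (j' : ZMod N), i) → j = j' := by
    intro j hj j' hj' he
    have h1 := congrFun (Prod.ext_iff.1 he).1 i
    simp only [Pi.add_apply, Pi.single_eq_same, add_right_inj] at h1
    rw [ZMod.natCast_eq_natCast_iff', Nat.mod_eq_of_lt ((Finset.mem_range.1 hj).trans_le hlN),
      Nat.mod_eq_of_lt ((Finset.mem_range.1 hj').trans_le hlN)] at h1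
    exact h1
  have h1 : ∀ φ, inner ℝ θ (torJ d N φ) = extT φ (Y + Pi.single i (l : ZMod N)) - extT φ Y := by
    intro φ
    rw [extT_path, PiLp.inner_apply]
    have : ∀ e, inner ℝ (θ e) (torJ d N φ e) = if e ∈ T then torJ d N φ e else 0 := fun e => by
      rw [hθa]; split_ifs <;> simp
    simp only [this, Finset.sum_ite_mem, Finset.univ_inter]
    rw [hT, Finset.sum_image hinj]
  have h2 : ‖θ‖ ^ 2 ≤ l := by
    rw [EuclideanSpace.norm_sq_eq]
    simp only [hθa]
    have : ∀ e, ‖(if e ∈ T then (1 : ℝ) else 0)‖ ^ 2 = if e ∈ T then 1 else 0 := fun e => by split_ifs <;> simp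
    simp only [this, Finset.sum_ite_mem, Finset.univ_inter, Finset.sum_const, nsmul_eq_mul, mul_one]
    exact_mod_cast Finset.card_image_le.trans (Finset.card_range l).le
  have h3 := tor_second_moment h ξ θ
  simp only [h1] at h3
  exact h3.trans (div_le_div_of_nonneg_right h2 (by linarith [h.lam_pos]))

theorem tor_displacement (h : HPot lam Lam M γ V v v2) (ξ : EuclideanSpace ℝ (Fin d)) (Y : Fin d → ZMod N)
    (l : Fin d → ℕ) {D : ℕ} (hD : D ≤ N) (hl : ∀ i, l i ≤ D) :
    avg (torH N V ξ) (fun φ => (extT φ (Y + ∑ i, Pi.single i (l i : ZMod N)) - extT φ Y) ^ 2) ≤ 2 ^ d * D / lam := by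
  have hlam := h.lam_pos
  have key : ∀ s : Finset (Fin d), avg (torH N V ξ)
      (fun φ => (extT φ (Y + ∑ i ∈ s, Pi.single i (l i : ZMod N)) - extT φ Y) ^ 2) ≤ (2 ^ s.card - 1) * D / lam := by
    intro s
    induction s using Finset.induction_on with
    | empty => simp [avg]
    | insert a s ha ih =>
      rw [Finset.sum_insert ha, Finset.card_insert_of_notMem ha]
      set Z := Y + ∑ i ∈ s, Pi.single i (l i : ZMod N) with hZ
      have e1 : Y + (Pi.single a (l a : ZMod N) + ∑ i ∈ s, Pi.single i (l i : ZMod N))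
        = Z + Pi.single a (l a : ZMod N) := by rw [hZ]; abel
      rw [e1]
      have t1 := tor_tame_sq (Z + Pi.single a (l a : ZMod N)) Z
      have t2 := tor_tame_sq Z Y
      have h1 := avg_mono (tor_integrable h ξ (tor_tame_sq (Z + Pi.single a (l a : ZMod N)) Y))
        (tor_integrable h ξ ((t1.const_mul 2).add (t2.const_mul 2)))
        (fun φ => by nlinarith [sq_nonneg (extT φ (Z + Pi.single a (l a : ZMod N)) - 2 * extT φ Z + extT φ Y)])
      rw [avg_add (tor_integrable h ξ (t1.const_mul 2)) (tor_integrable h ξ (t2.const_mul 2)), avg_const_mul,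
        avg_const_mul] at h1
      have h2 := tor_path h ξ Z a ((hl a).trans hD)
      have h3 : (l a : ℝ) / (2 * lam) ≤ D / (2 * lam) :=
        div_le_div_of_nonneg_right (by exact_mod_cast hl a) (by linarith)
      have h4 : (2 ^ (s.card + 1) - 1 : ℝ) * D / lam = 2 * (D / (2 * lam)) + 2 * ((2 ^ s.card - 1) * D / lam) := by
        field_simp; ring
      rw [h4]
      linarith
  refine (key Finset.univ).trans ?_
  rw [Finset.card_univ, Fintype.card_fin]
  refine div_le_div_of_nonneg_right (mul_le_mul_of_nonneg_right (by linarith) (by positivity)) hlam.le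
end TorusField

section Tiles
variable {d n k N : ℕ} [NeZero N]

/-- the site of the torus at position `x` relative to the centre of the tile `q` -/
def tpos (N n : ℕ) (q : Fin d → Fin k) (x : Zd d) : Fin d → ZMod N :=
  fun i => ((2 * n * (q i : ℕ) + n + x i : ℤ) : ZMod N)

variable (d n) in
/-- the half-open cube -/
def halfC : Finset (Zd d) := Fintype.piFinset fun _ => Finset.Ico (-(n : ℤ)) n

theorem mem_halfC {x : Zd d} : x ∈ halfC d n ↔ ∀ j, -(n : ℤ) ≤ x j ∧ x j < n := by simp [halfC]

theorem intr_subset_halfC {x : Zd d} (hx : x ∈ intr (cube d (n : ℤ))) : x ∈ halfC d n :=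
  mem_halfC.2 fun j => ⟨(mem_intr.1 hx j).1.le, (mem_intr.1 hx j).2⟩

/-- sites on the walls of the tiles -/
def Wall (N n k : ℕ) (X : Fin d → ZMod N) : Prop :=
  ¬ ∃ q : Fin d → Fin k, ∃ x ∈ intr (cube d (n : ℤ)), tpos N n q x = X

theorem tpos_dvd {q q' : Fin d → Fin k} {x x' : Zd d} (he : tpos N n q x = tpos N n q' x') (i : Fin d) :
    (N : ℤ) ∣ (2 * n * (q' i : ℕ) + n + x' i) - (2 * n * (q i : ℕ) + n + x i) :=
  (ZMod.intCast_eq_intCast_iff_dvd_sub _ _ _).1 (congrFun he i)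

theorem tpos_dvd_sub (hN : N = 2 * n * k) {q q' : Fin d → Fin k} {x x' : Zd d} (he : tpos N n q x = tpos N n q' x')
    (i : Fin d) : (2 * n : ℤ) ∣ x' i - x i := by
  have h1 := tpos_dvd he i
  have h2 : (2 * n : ℤ) ∣ N := by rw [hN]; push_cast; exact Dvd.intro _ rfl
  have h3 := h2.trans h1
  have h4 : (2 * n * (q' i : ℕ) + n + x' i : ℤ) - (2 * n * (q i : ℕ) + n + x i)
      = 2 * n * ((q' i : ℕ) - (q i : ℕ)) + (x' i - x i) := by ring
  rw [h4] at h3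
  exact (Int.dvd_add_right (Dvd.intro _ rfl)).1 h3

theorem tpos_inj (hn : 0 < n) (hN : N = 2 * n * k) {q q' : Fin d → Fin k} {x x' : Zd d} (hx : x ∈ halfC d n)
    (hx' : x' ∈ halfC d n) (he : tpos N n q x = tpos N n q' x') : q = q' ∧ x = x' := by
  have h1 : x = x' := by
    ext i
    have h2 := Int.eq_zero_of_abs_lt_dvd (tpos_dvd_sub hN he i) (by
      have a := mem_halfC.1 hx i
      have b := mem_halfC.1 hx' i
      rw [abs_lt]; constructor <;> omega)
    omega
  refine ⟨?_, h1⟩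
  ext i
  have h2 := tpos_dvd he i
  rw [h1] at h2
  have h3 : (2 * n * (q' i : ℕ) + n + x' i : ℤ) - (2 * n * (q i : ℕ) + n + x' i)
      = 2 * n * ((q' i : ℕ) - (q i : ℕ)) := by ring
  rw [h3, hN] at h2
  push_cast at h2
  have h4 : (k : ℤ) ∣ ((q' i : ℕ) : ℤ) - (q i : ℕ) :=
    Int.dvd_of_mul_dvd_mul_left (by positivity) h2
  have h5 := Int.eq_zero_of_abs_lt_dvd h4 (by
    have a := (q i).2
    have b := (q' i).2
    rw [abs_lt]; constructor <;> omega)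
  omega

theorem exists_tpos (hn : 0 < n) (hN : N = 2 * n * k) (X : Fin d → ZMod N) :
    ∃ q : Fin d → Fin k, ∃ x ∈ halfC d n, tpos N n q x = X := by
  have hlt : ∀ i, (X i).val / (2 * n) < k := fun i =>
    Nat.div_lt_of_lt_mul (by rw [← hN]; exact ZMod.val_lt _)
  refine ⟨fun i => ⟨(X i).val / (2 * n), hlt i⟩, fun i => (((X i).val % (2 * n) : ℕ) : ℤ) - n, ?_, ?_⟩
  · refine mem_halfC.2 fun j => ?_
    have := Nat.mod_lt (X j).val (show 0 < 2 * n by omega)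
    constructor <;> omega
  · ext i
    simp only [tpos]
    have h1 : (2 * n * (((X i).val / (2 * n) : ℕ) : ℤ) + n + ((((X i).val % (2 * n) : ℕ) : ℤ) - n)) = ((X i).val : ℤ) := by
      have := Nat.div_add_mod (X i).val (2 * n)
      have h2 : ((2 * n * ((X i).val / (2 * n)) + (X i).val % (2 * n) : ℕ) : ℤ) = ((X i).val : ℤ) := by rw [this]
      push_cast at h2 ⊢
      linarith
    rw [h1]
    simp

theorem tpos_step (q : Fin d → Fin k) (x : Zd d) (i : Fin d) :
    tpos N n q (step x i true) = tpos N n q x + Pi.single i 1 := by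
  ext j
  by_cases h : j = i
  · subst h; simp [tpos, step]; ring
  · simp [tpos, step, h]

theorem not_wall_tpos (q : Fin d → Fin k) {x : Zd d} (hx : x ∈ intr (cube d (n : ℤ))) : ¬ Wall N n k (tpos N n q x) :=
  fun h => h ⟨q, x, hx, rfl⟩

theorem wall_tpos (hN : N = 2 * n * k) (q : Fin d → Fin k) {y : Zd d} (hy : y ∈ cube d (n : ℤ))
    (hy' : y ∉ intr (cube d (n : ℤ))) : Wall N n k (tpos N n q y) := by
  rintro ⟨q', x, hx, he⟩
  apply hy'
  refine mem_intr.2 fun j => ?_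
  have a := mem_cube.1 hy j
  have b := mem_intr.1 hx j
  have c := tpos_dvd_sub hN he j
  refine ⟨lt_of_le_of_ne a.1 fun h => ?_, lt_of_le_of_ne a.2 fun h => ?_⟩
  · have := Int.eq_zero_of_abs_lt_dvd c (by rw [abs_lt]; constructor <;> omega)
    omega
  · have := Int.eq_zero_of_abs_lt_dvd c (by rw [abs_lt]; constructor <;> omega)
    omega

theorem wall_tpos_iff (hN : N = 2 * n * k) (q : Fin d → Fin k) {y : Zd d} (hy : y ∈ cube d (n : ℤ)) :
    Wall N n k (tpos N n q y) ↔ y ∉ intr (cube d (n : ℤ)) :=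
  ⟨fun h hy' => not_wall_tpos q hy' h, wall_tpos hN q hy⟩

theorem wall_zero [NeZero d] [NeZero k] (hN : N = 2 * n * k) : Wall N n k (0 : Fin d → ZMod N) := by
  have h1 : tpos N n (fun _ : Fin d => (0 : Fin k)) (fun _ => -(n : ℤ)) = 0 := by ext i; simp [tpos]
  rw [← h1]
  refine wall_tpos hN _ (mem_cube.2 fun j => ⟨le_rfl, by omega⟩) fun h => ?_
  exact lt_irrefl _ (mem_intr.1 h 0).1

theorem halfC_subset_cube {x : Zd d} (hx : x ∈ halfC d n) : x ∈ cube d (n : ℤ) :=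
  mem_cube.2 fun j => ⟨(mem_halfC.1 hx j).1, (mem_halfC.1 hx j).2.le⟩

theorem step_halfC {x : Zd d} (hx : x ∈ halfC d n) (i : Fin d) : step x i true ∈ cube d (n : ℤ) := by
  refine mem_cube.2 fun j => ?_
  have := mem_halfC.1 hx j
  by_cases h : j = i
  · subst h; simp [step]; omega
  · simp [step, h]; omega

theorem boxE_fst_halfC {e : Zd d × Fin d} (he : e ∈ boxE d (n : ℤ)) : e.1 ∈ halfC d n := by
  rcases (Finset.mem_filter.1 he).2 with h | h
  · exact intr_subset_halfC h
  · refine mem_halfC.2 fun j => ?_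
    have h1 := mem_intr.1 h j
    by_cases hj : j = e.2
    · subst hj
      have h2 := mem_cube.1 (Finset.mem_product.1 (Finset.mem_filter.1 he).1).1 e.2
      simp [step] at h1; omega
    · simp [step, hj] at h1; omega

theorem sum_tiles (hn : 0 < n) (hN : N = 2 * n * k) (F : (Fin d → ZMod N) → ℝ) :
    ∑ X, F X = ∑ q : Fin d → Fin k, ∑ x ∈ halfC d n, F (tpos N n q x) := by
  classical
  rw [← Finset.sum_product']
  symm
  refine Finset.sum_bij (fun p _ => tpos N n p.1 p.2) (fun _ _ => Finset.mem_univ _) ?_ ?_ (fun _ _ => rfl)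
  · intro p hp p' hp' he
    have h := tpos_inj hn hN (Finset.mem_product.1 hp).2 (Finset.mem_product.1 hp').2 he
    exact Prod.ext h.1 h.2
  · intro X _
    obtain ⟨q, x, hx, he⟩ := exists_tpos hn hN X
    exact ⟨(q, x), Finset.mem_product.2 ⟨Finset.mem_univ _, hx⟩, he⟩

variable (d n k N) in
/-- non-zero wall sites -/
abbrev WallA := {a : TorA d N // Wall N n k a.val}

instance : Finite (WallA d n k N) := Subtype.finite

instance : Fintype (WallA d n k N) := Fintype.ofFinite _

variable (d n k) in
/-- interior sites of the tiles -/
abbrev TileI := (Fin d → Fin k) × ↥(intr (cube d (n : ℤ)))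

/-- splitting of the torus into walls and tiles -/
def tileMap [NeZero d] [NeZero k] (hN : N = 2 * n * k) : WallA d n k N ⊕ TileI d n k → TorA d N :=
  Sum.elim (fun a => a.1) fun p => ⟨tpos N n p.1 p.2.1, fun h => not_wall_tpos p.1 p.2.2 (h ▸ wall_zero hN)⟩

theorem tileMap_bijective [NeZero d] [NeZero k] (hn : 0 < n) (hN : N = 2 * n * k) :
    Function.Bijective (tileMap (d := d) hN) := by
  constructor
  · rintro (a | p) (a' | p') he
    · exact congrArg Sum.inl (Subtype.ext he)
    · have h1 := congrArg TorA.val he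
      exact absurd a.2 (by
        have : a.1.val = tpos N n p'.1 p'.2.1 := h1
        rw [this]; exact not_wall_tpos _ p'.2.2)
    · have h1 := congrArg TorA.val he
      exact absurd a'.2 (by
        have : tpos N n p.1 p.2.1 = a'.1.val := h1
        rw [← this]; exact not_wall_tpos _ p.2.2)
    · have h1 : tpos N n p.1 p.2.1 = tpos N n p'.1 p'.2.1 := congrArg TorA.val he
      have h2 := tpos_inj hn hN (intr_subset_halfC p.2.2) (intr_subset_halfC p'.2.2) h1
      exact congrArg Sum.inr (Prod.ext h2.1 (Subtype.ext h2.2))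
  · intro a
    by_cases h : Wall N n k a.val
    · exact ⟨Sum.inl ⟨a, h⟩, rfl⟩
    · obtain ⟨q, x, hx, he⟩ := not_not.1 h
      exact ⟨Sum.inr (q, ⟨x, hx⟩), TorA.ext he⟩

/-- splitting of the torus into walls and tiles -/
def tileE [NeZero d] [NeZero k] (hn : 0 < n) (hN : N = 2 * n * k) : WallA d n k N ⊕ TileI d n k ≃ TorA d N :=
  Equiv.ofBijective _ (tileMap_bijective hn hN)

theorem tileE_inl [NeZero d] [NeZero k] (hn : 0 < n) (hN : N = 2 * n * k) (a : WallA d n k N) :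
    tileE hn hN (Sum.inl a) = a.1 := rfl

theorem tileE_inr [NeZero d] [NeZero k] (hn : 0 < n) (hN : N = 2 * n * k) (p : TileI d n k) :
    (tileE hn hN (Sum.inr p)).val = tpos N n p.1 p.2.1 := rfl

/-- sites of the cube close to its boundary -/
def nearB (d n l : ℕ) : Finset (Zd d) :=
  (cube d (n : ℤ)).filter fun x => ∃ j, (n : ℤ) - l ≤ |x j|

theorem card_nearB (l : ℕ) : (nearB d n l).card ≤ d * ((2 * n + 1) ^ (d - 1) * (2 * l + 2)) := by
  classical
  have hsub : nearB d n l ⊆ Finset.univ.biUnion fun j : Fin d => Fintype.piFinset fun i =>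
      if i = j then Finset.Icc (-(n : ℤ)) (-n + l) ∪ Finset.Icc (n - l : ℤ) n else Finset.Icc (-(n : ℤ)) n := by
    intro x hx
    obtain ⟨h1, j, hj⟩ := Finset.mem_filter.1 hx
    refine Finset.mem_biUnion.2 ⟨j, Finset.mem_univ _, Fintype.mem_piFinset.2 fun i => ?_⟩
    have h2 := mem_cube.1 h1 i
    by_cases h : i = j
    · subst h
      rw [if_pos rfl, Finset.mem_union, Finset.mem_Icc, Finset.mem_Icc]
      rcases abs_cases (x i) with h3 | h3 <;> omega
    · rw [if_neg h, Finset.mem_Icc]; exact h2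
  refine (Finset.card_le_card hsub).trans (Finset.card_biUnion_le.trans ?_)
  refine (Finset.sum_le_card_nsmul _ _ ((2 * n + 1) ^ (d - 1) * (2 * l + 2)) fun j _ => ?_).trans (by simp)
  rw [Fintype.card_piFinset, ← Finset.mul_prod_erase _ _ (Finset.mem_univ j), if_pos rfl, mul_comm]
  refine Nat.mul_le_mul ?_ ?_
  · rw [Finset.prod_congr rfl fun i hi => by rw [if_neg (Finset.ne_of_mem_erase hi)], Finset.prod_const,
      Finset.card_erase_of_mem (Finset.mem_univ j)]
    simp only [Int.card_Icc, Finset.card_univ, Fintype.card_fin]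
    apply le_of_eq; congr 1; omega
  · refine (Finset.card_union_le _ _).trans ?_
    simp only [Int.card_Icc]; omega

theorem card_WallA (hn : 0 < n) (hN : N = 2 * n * k) :
    Fintype.card (WallA d n k N) ≤ k ^ d * (d * ((2 * n + 1) ^ (d - 1) * 2)) := by
  classical
  have h1 : ∀ a : WallA d n k N, ∃ p : (Fin d → Fin k) × Zd d, p.2 ∈ nearB d n 0 ∧ tpos N n p.1 p.2 = a.1.val := by
    intro a
    obtain ⟨q, x, hx, he⟩ := exists_tpos (k := k) hn hN a.1.val
    refine ⟨(q, x), Finset.mem_filter.2 ⟨halfC_subset_cube hx, ?_⟩, he⟩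
    have h2 := (wall_tpos_iff hN q (halfC_subset_cube hx)).1 (he ▸ a.2)
    rw [mem_intr] at h2
    push Not at h2
    obtain ⟨j, hj⟩ := h2
    refine ⟨j, ?_⟩
    have h3 := mem_halfC.1 hx j
    by_cases h4 : -(n : ℤ) < x j
    · have := hj h4; omega
    · have : x j = -n := by omega
      change (n : ℤ) - (0 : ℕ) ≤ |x j|
      rw [this]; simp
  choose g hg using h1
  have h2 : Fintype.card (WallA d n k N) ≤ ((Finset.univ : Finset (Fin d → Fin k)) ×ˢ nearB d n 0).card := by
    rw [← Finset.card_univ]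
    refine Finset.card_le_card_of_injOn g (fun a _ => Finset.mem_coe.2 (Finset.mem_product.2 ⟨Finset.mem_univ _, (hg a).1⟩)) ?_
    intro a _ a' _ he
    refine Subtype.ext (TorA.ext ?_)
    rw [← (hg a).2, ← (hg a').2, he]
  refine h2.trans ?_
  rw [Finset.card_product]
  refine Nat.mul_le_mul (by simp) ?_
  simpa using card_nearB (d := d) (n := n) 0

end Tiles

section Product
variable {K Q I α : Type*} [Fintype K] [Fintype Q] [Fintype I] [Fintype α]

theorem integral_exp_tiles (e : K ⊕ Q × I ≃ α) (H : (I → ℝ) → ℝ) (h : ℝ → ℝ) :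
    ∫ φ : α → ℝ, Real.exp (-(∑ q, H (fun i => φ (e (Sum.inr (q, i)))) + ∑ a, h (φ (e (Sum.inl a)))))
      = (∫ ψ, Real.exp (-H ψ)) ^ Fintype.card Q * (∫ t, Real.exp (-h t)) ^ Fintype.card K := by
  have := integral_tiles e (fun _ ψ => Real.exp (-H ψ)) (fun _ t => Real.exp (-h t))
  simp only [Finset.prod_const, Finset.card_univ] at this
  rw [← this]
  congr 1
  funext φ
  rw [neg_add, Real.exp_add, ← Finset.sum_neg_distrib, ← Finset.sum_neg_distrib, Real.exp_sum, Real.exp_sum]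

theorem prod_ite_single [DecidableEq Q] (q : Q) (A Z : ℝ) :
    (∏ q', if q' = q then A else Z) = A * ∏ _q' ∈ Finset.univ.erase q, Z := by
  rw [← Finset.mul_prod_erase _ (fun q' => if q' = q then A else Z) (Finset.mem_univ q), if_pos rfl]
  congr 1
  exact Finset.prod_congr rfl fun q' hq' => if_neg (Finset.ne_of_mem_erase hq')

theorem integral_ite_mul {X : Type*} [MeasureSpace X] (p : Prop) [Decidable p] (g f : X → ℝ) :
    ∫ x, (if p then g x else 1) * f x = if p then ∫ x, g x * f x else ∫ x, f x := by
  split_ifs <;> simp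

theorem avg_tiles_inr (e : K ⊕ Q × I ≃ α) {H : (I → ℝ) → ℝ} {h : ℝ → ℝ} (hH : 0 < ∫ ψ, Real.exp (-H ψ))
    (hh : 0 < ∫ t, Real.exp (-h t)) (q : Q) (g : (I → ℝ) → ℝ) :
    avg (fun φ : α → ℝ => ∑ q, H (fun i => φ (e (Sum.inr (q, i)))) + ∑ a, h (φ (e (Sum.inl a))))
      (fun φ => g (fun i => φ (e (Sum.inr (q, i))))) = avg H g := by
  classical
  have h1 := integral_tiles e (fun q' ψ => (if q' = q then g ψ else 1) * Real.exp (-H ψ)) (fun _ t => Real.exp (-h t))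
  have h2 := integral_tiles e (fun _ ψ => Real.exp (-H ψ)) (fun _ t => Real.exp (-h t))
  rw [Finset.prod_congr rfl fun q' _ => integral_ite_mul (q' = q) g fun ψ => Real.exp (-H ψ), prod_ite_single] at h1
  rw [← Finset.mul_prod_erase _ (fun q' => ∫ ψ, Real.exp (-H ψ)) (Finset.mem_univ q)] at h2
  simp only [mul_assoc] at h1 h2
  have h3 : ∀ φ : α → ℝ, Real.exp (-(∑ q, H (fun i => φ (e (Sum.inr (q, i)))) + ∑ a, h (φ (e (Sum.inl a)))))
      = (∏ q, Real.exp (-H fun i => φ (e (Sum.inr (q, i))))) * ∏ a, Real.exp (-h (φ (e (Sum.inl a)))) := fun φ => by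
    rw [neg_add, Real.exp_add, ← Finset.sum_neg_distrib, ← Finset.sum_neg_distrib, Real.exp_sum, Real.exp_sum]
  simp only [Finset.prod_mul_distrib, Finset.prod_ite_eq', Finset.mem_univ, if_true, mul_assoc, ← h3] at h1 h2
  unfold avg
  rw [h1, h2, mul_div_mul_right]
  simp only [Finset.prod_const]
  exact (mul_pos (pow_pos hH _) (pow_pos hh _)).ne'

theorem avg_tiles_inl (e : K ⊕ Q × I ≃ α) {H : (I → ℝ) → ℝ} {h : ℝ → ℝ} (hH : 0 < ∫ ψ, Real.exp (-H ψ))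
    (hh : 0 < ∫ t, Real.exp (-h t)) (a : K) (g : ℝ → ℝ) :
    avg (fun φ : α → ℝ => ∑ q, H (fun i => φ (e (Sum.inr (q, i)))) + ∑ a, h (φ (e (Sum.inl a))))
      (fun φ => g (φ (e (Sum.inl a)))) = avg h g := by
  classical
  have h1 := integral_tiles e (fun _ ψ => Real.exp (-H ψ)) (fun a' t => (if a' = a then g t else 1) * Real.exp (-h t))
  have h2 := integral_tiles e (fun _ ψ => Real.exp (-H ψ)) (fun _ t => Real.exp (-h t))
  rw [Finset.prod_congr (f := fun a' => ∫ t, (if a' = a then g t else 1) * Real.exp (-h t)) rfl fun a' _ =>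
    integral_ite_mul (a' = a) g fun t => Real.exp (-h t), prod_ite_single] at h1
  rw [← Finset.mul_prod_erase _ (fun a' => ∫ t, Real.exp (-h t)) (Finset.mem_univ a)] at h2
  have h3 : ∀ φ : α → ℝ, Real.exp (-(∑ q, H (fun i => φ (e (Sum.inr (q, i)))) + ∑ a, h (φ (e (Sum.inl a)))))
      = (∏ q, Real.exp (-H fun i => φ (e (Sum.inr (q, i))))) * ∏ a, Real.exp (-h (φ (e (Sum.inl a)))) := fun φ => by
    rw [neg_add, Real.exp_add, ← Finset.sum_neg_distrib, ← Finset.sum_neg_distrib, Real.exp_sum, Real.exp_sum]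
  simp only [Finset.prod_mul_distrib, Finset.prod_ite_eq', Finset.mem_univ, if_true, mul_left_comm _ (g _), ← h3] at h1
  simp only [← h3] at h2
  unfold avg
  rw [h1, h2, mul_left_comm, mul_left_comm _ (∫ t, Real.exp (-h t)), mul_div_mul_right]
  simp only [Finset.prod_const]
  exact (mul_pos (pow_pos hH _) (pow_pos hh _)).ne'
end Product

section TileField
variable {d n k N : ℕ} [NeZero N] {lam Lam M γ : ℝ} {V v v2 : ℝ → ℝ}

/-- the configuration inside the tile `q` -/
def restr (n : ℕ) (q : Fin d → Fin k) : (TorA d N → ℝ) →ₗ[ℝ] Conf d (n : ℤ) where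
  toFun φ x := extT φ (tpos N n q x.1)
  map_add' φ ψ := by ext x; simp [extT_add]
  map_smul' c φ := by ext x; simp [extT_smul]

theorem restr_apply (q : Fin d → Fin k) (φ : TorA d N → ℝ) (x) : restr n q φ x = extT φ (tpos N n q x.1) := rfl

variable (d n k N) in
/-- gradients inside the tiles, and the values on the walls -/
def tileJ : (TorA d N → ℝ) →ₗ[ℝ] EuclideanSpace ℝ (WallA d n k N ⊕ (Fin d → Fin k) × boxE d (n : ℤ)) where
  toFun φ := WithLp.toLp 2 (Sum.elim (fun a => φ a.1) fun p => boxJ d n (restr n p.1 φ) p.2)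
  map_add' φ ψ := by ext e; rcases e with e | e <;> simp [-boxJ_apply]
  map_smul' c φ := by ext e; rcases e with e | e <;> simp [-boxJ_apply]

theorem tileJ_inl (φ : TorA d N → ℝ) (a : WallA d n k N) : tileJ d n k N φ (Sum.inl a) = φ a.1 := rfl

theorem tileJ_inr (φ : TorA d N → ℝ) (p : (Fin d → Fin k) × boxE d (n : ℤ)) :
    tileJ d n k N φ (Sum.inr p) = boxJ d n (restr n p.1 φ) p.2 := rfl

/-- potentials inside the tiles and on the walls -/
def tileU (V : ℝ → ℝ) (S : ℝ) (ξ : EuclideanSpace ℝ (Fin d)) :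
    WallA d n k N ⊕ (Fin d → Fin k) × boxE d (n : ℤ) → ℝ → ℝ :=
  Sum.elim (fun _ t => t ^ 2 / (2 * S)) fun p t => boxw p.2 * (2 * V (t - boxc d n ξ p.2))

/-- derivatives of the potentials inside the tiles and on the walls -/
def tileu (v : ℝ → ℝ) (S : ℝ) (ξ : EuclideanSpace ℝ (Fin d)) :
    WallA d n k N ⊕ (Fin d → Fin k) × boxE d (n : ℤ) → ℝ → ℝ :=
  Sum.elim (fun _ t => t / S) fun p t => boxw p.2 * (2 * v (t - boxc d n ξ p.2))

theorem Pot.weaken {l l' m m' : ℝ} {U u : ℝ → ℝ} (h : Pot l l' U u) (hm : 0 < m) (hl : m ≤ l) (hl' : l' ≤ m') :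
    Pot m m' U u :=
  ⟨hm, h.hasDeriv, fun s t hst => (mul_le_mul_of_nonneg_right hl (by linarith)).trans (h.lo s t hst),
    fun s t hst => (h.hi s t hst).trans (mul_le_mul_of_nonneg_right hl' (by linarith))⟩

theorem pot_sq {S : ℝ} (hS : 0 < S) : Pot (1 / S) (1 / S) (fun t => t ^ 2 / (2 * S)) (fun t => t / S) := by
  refine ⟨by positivity, fun t => ?_, fun s t _ => le_of_eq (by ring), fun s t _ => le_of_eq (by ring)⟩
  exact (((hasDerivAt_id t).pow 2).div_const (2 * S)).congr_deriv (by simp; field_simp)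

theorem tile_pot (h : HPot lam Lam M γ V v v2) {S : ℝ} (hS : 0 < S) (ξ : EuclideanSpace ℝ (Fin d))
    (e : WallA d n k N ⊕ (Fin d → Fin k) × boxE d (n : ℤ)) :
    Pot (min lam (1 / S)) (max (2 * Lam) (1 / S)) (tileU V S ξ e) (tileu v S ξ e) := by
  have h0 : 0 < min lam (1 / S) := lt_min h.lam_pos (by positivity)
  rcases e with a | p
  · exact (pot_sq hS).weaken h0 (min_le_right _ _) (le_max_right _ _)
  · exact (box_pot h ξ p.2).weaken h0 (min_le_left _ _) (le_max_left _ _)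

variable (n k) in
/-- the energy of independent tiles -/
def tileH (N : ℕ) [NeZero N] (V : ℝ → ℝ) (S : ℝ) (ξ : EuclideanSpace ℝ (Fin d)) : (TorA d N → ℝ) → ℝ :=
  fieldH (tileJ d n k N) (tileU V S ξ)

theorem tileH_eq (S : ℝ) (ξ : EuclideanSpace ℝ (Fin d)) (φ : TorA d N → ℝ) :
    tileH n k N V S ξ φ = ∑ q : Fin d → Fin k, boxH d V n ξ (restr n q φ) + ∑ a : WallA d n k N, φ a.1 ^ 2 / (2 * S) := by
  simp only [tileH, fieldH, boxH]
  rw [Fintype.sum_sum_type, Fintype.sum_prod_type, add_comm]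
  rfl

variable [NeZero d] [NeZero k]

theorem restr_eq (hn : 0 < n) (hN : N = 2 * n * k) (q : Fin d → Fin k) (φ : TorA d N → ℝ) :
    restr n q φ = fun x => φ (tileE hn hN (Sum.inr (q, x))) := by
  funext x
  rw [restr_apply, ← tileE_inr hn hN (q, x), extT_coe]

theorem tileJ_injective (hn : 0 < n) (hN : N = 2 * n * k) : Function.Injective (tileJ d n k N) := by
  rw [injective_iff_map_eq_zero]
  intro φ hφ
  funext X
  obtain ⟨a | p, rfl⟩ := (tileE hn hN).surjective X
  · exact (tileJ_inl φ a).symm.trans (by rw [hφ]; rfl)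
  · have h1 : boxJ d n (restr n p.1 φ) = 0 := by
      ext e
      exact (tileJ_inr φ (p.1, e)).symm.trans (by rw [hφ]; rfl)
    have h2 := (injective_iff_map_eq_zero _).1 boxJ_injective _ h1
    have h3 := congrFun (restr_eq hn hN p.1 φ) p.2
    rw [h2] at h3
    exact h3.symm

theorem tileH_eq' (hn : 0 < n) (hN : N = 2 * n * k) (S : ℝ) (ξ : EuclideanSpace ℝ (Fin d)) :
    tileH n k N V S ξ = fun φ => ∑ q, boxH d V n ξ (fun x => φ (tileE hn hN (Sum.inr (q, x))))
      + ∑ a, (fun t => t ^ 2 / (2 * S)) (φ (tileE hn hN (Sum.inl a))) := by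
  funext φ
  rw [tileH_eq]
  simp only [restr_eq hn hN, tileE_inl]

theorem integral_exp_sq {S : ℝ} (hS : 0 < S) : ∫ t : ℝ, Real.exp (-(t ^ 2 / (2 * S))) = √(2 * π * S) := by
  have := integral_gaussian (1 / (2 * S))
  rw [show π / (1 / (2 * S)) = 2 * π * S by field_simp] at this
  rw [← this]
  congr 1; funext t; congr 1; field_simp

theorem boxH_integral_pos (h : HPot lam Lam M γ V v v2) (ξ : EuclideanSpace ℝ (Fin d)) :
    0 < ∫ ψ, Real.exp (-boxH d V n ξ ψ) := by
  have hLam := (h.lo 0).trans (h.hi 0)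
  have hl := h.lam_pos
  exact field_integral_pos (boxJ d n) boxJ_injective hl (by linarith) (box_pot h ξ)

theorem tileH_log (hn : 0 < n) (hN : N = 2 * n * k) (h : HPot lam Lam M γ V v v2) {S : ℝ} (hS : 0 < S)
    (ξ : EuclideanSpace ℝ (Fin d)) : Real.log (∫ φ, Real.exp (-tileH n k N V S ξ φ))
      = k ^ d * boxF d V n ξ + Fintype.card (WallA d n k N) * Real.log (√(2 * π * S)) := by
  rw [tileH_eq' hn hN, integral_exp_tiles (tileE hn hN) (boxH d V n ξ) fun t => t ^ 2 / (2 * S), integral_exp_sq hS,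
    Real.log_mul (pow_pos (boxH_integral_pos h ξ) _).ne' (by positivity), Real.log_pow, Real.log_pow, boxF_eq_boxH]
  simp

theorem tile_avg_box (hn : 0 < n) (hN : N = 2 * n * k) (h : HPot lam Lam M γ V v v2) {S : ℝ} (hS : 0 < S)
    (ξ : EuclideanSpace ℝ (Fin d)) (q : Fin d → Fin k) (g : Conf d (n : ℤ) → ℝ) :
    avg (tileH n k N V S ξ) (fun φ => g (restr n q φ)) = avg (boxH d V n ξ) g := by
  rw [tileH_eq' hn hN]
  simp only [restr_eq hn hN]
  refine avg_tiles_inr (tileE hn hN) (h := fun t => t ^ 2 / (2 * S)) (boxH_integral_pos h ξ) ?_ q g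
  rw [integral_exp_sq hS]; positivity

theorem tile_avg_wall (hn : 0 < n) (hN : N = 2 * n * k) (h : HPot lam Lam M γ V v v2) {S : ℝ} (hS : 0 < S)
    (ξ : EuclideanSpace ℝ (Fin d)) (a : WallA d n k N) (g : ℝ → ℝ) :
    avg (tileH n k N V S ξ) (fun φ => g (φ a.1)) = avg (fun t => t ^ 2 / (2 * S)) g := by
  rw [tileH_eq' hn hN]
  have := avg_tiles_inl (tileE hn hN) (h := fun t => t ^ 2 / (2 * S)) (boxH_integral_pos (V := V) h ξ) (by
    rw [integral_exp_sq hS]; positivity) a g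
  exact this

theorem tile_integrable (hn : 0 < n) (hN : N = 2 * n * k) (h : HPot lam Lam M γ V v v2) {S : ℝ} (hS : 0 < S)
    (ξ : EuclideanSpace ℝ (Fin d)) {f : (TorA d N → ℝ) → ℝ} (hf : Tame f) :
    Integrable fun φ => f φ * Real.exp (-tileH n k N V S ξ φ) :=
  hf.integrable (tileJ_injective hn hN) (lt_min h.lam_pos (by positivity)) 
    (le_max_of_le_right (min_le_right _ _)) (tile_pot h hS ξ)
end TileField

section Energy
variable {lam Lam M γ : ℝ} {V v v2 : ℝ → ℝ}

theorem HPot.potOne (h : HPot lam Lam M γ V v v2) : Pot lam Lam V v := by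
  have hp : Pot lam Lam (fun t => 1 * V (t - 0)) (fun t => 1 * v (t - 0)) :=
    h.pot h.lam_pos (fun t => by rw [one_mul]; exact h.lo t) (fun t => by rw [one_mul]; exact h.hi t) 0
  simpa using hp

theorem HPot.le_sq (h : HPot lam Lam M γ V v v2) (hV : ∀ t, V (-t) = V t) (hV0 : V 0 = 0) (t : ℝ) :
    V t ≤ Lam * t ^ 2 := by
  have := h.potOne.upper 0 t
  rw [hV0, h.v_zero hV] at this
  simpa using this

theorem HPot.nonneg (h : HPot lam Lam M γ V v v2) (hV : ∀ t, V (-t) = V t) (hV0 : V 0 = 0) (t : ℝ) : 0 ≤ V t := by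
  obtain ⟨q, -, -, h1, h2⟩ := h.potOne.mvt 0 t
  obtain ⟨r, h3, -, h4⟩ := h.potOne.secant 0 q
  rw [h.v_zero hV, sub_zero, sub_zero] at h4
  rw [hV0, sub_zero, sub_zero, zero_add, h4] at h2
  rw [h2, mul_assoc]
  rw [sub_zero] at h1
  exact mul_nonneg (h.lam_pos.le.trans h3) h1
end Energy

section TileEdges
variable {d n k N : ℕ} {lam Lam M γ : ℝ} {V v v2 : ℝ → ℝ}

/-- half the number of interior endpoints of an edge -/
def boxm (n : ℕ) (p : Zd d × Fin d) : ℝ :=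
  ((if p.1 ∈ intr (cube d (n : ℤ)) then 1 else 0) + if step p.1 p.2 true ∈ intr (cube d (n : ℤ)) then 1 else 0) / 2

/-- gradient of the extension by zero along an edge -/
def boxG (ψ : Conf d (n : ℤ)) (p : Zd d × Fin d) : ℝ := extD ψ (step p.1 p.2 true) - extD ψ p.1

variable (d n) in
/-- edges starting in the half-open cube -/
def halfE : Finset (Zd d × Fin d) := halfC d n ×ˢ Finset.univ

theorem boxE_subset_halfE : boxE d (n : ℤ) ⊆ halfE d n := fun _ he =>
  Finset.mem_product.2 ⟨boxE_fst_halfC he, Finset.mem_univ _⟩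

theorem notMem_boxE {p : Zd d × Fin d} (hp : p ∈ halfE d n) (h : p ∉ boxE d (n : ℤ)) :
    p.1 ∉ intr (cube d (n : ℤ)) ∧ step p.1 p.2 true ∉ intr (cube d (n : ℤ)) := by
  by_contra h2
  refine h (Finset.mem_filter.2 ⟨Finset.mem_product.2 ⟨halfC_subset_cube (Finset.mem_product.1 hp).1, Finset.mem_univ _⟩, ?_⟩)
  tauto

theorem sum_boxE_half (g : Zd d × Fin d → ℝ) (hg : ∀ p ∈ halfE d n, p ∉ boxE d (n : ℤ) → g p = 0) :
    ∑ e : boxE d (n : ℤ), g e = ∑ p ∈ halfE d n, g p := by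
  rw [Finset.sum_coe_sort (boxE d (n : ℤ)) g, Finset.sum_subset boxE_subset_halfE fun p hp hp' => hg p hp hp']

theorem boxG_eq_zero (ψ : Conf d (n : ℤ)) {p : Zd d × Fin d} (hp : p ∈ halfE d n) (h : p ∉ boxE d (n : ℤ)) : boxG ψ p = 0 := by
  obtain ⟨h1, h2⟩ := notMem_boxE hp h
  rw [boxG, extD_of_notMem _ h1, extD_of_notMem _ h2, sub_zero]

theorem boxH_eq_sum (ξ : EuclideanSpace ℝ (Fin d)) (ψ : Conf d (n : ℤ)) :
    boxH d V n ξ ψ = ∑ p ∈ halfE d n, boxm n p * (2 * V (boxG ψ p - ξ p.2)) := by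
  rw [← sum_boxE_half]
  · rfl
  · intro p hp hp'
    obtain ⟨h1, h2⟩ := notMem_boxE hp hp'
    simp [boxm, h1, h2]

theorem boxm_nonneg (p : Zd d × Fin d) : 0 ≤ boxm n p := by
  unfold boxm; split_ifs <;> norm_num

theorem boxm_le_one (p : Zd d × Fin d) : boxm n p ≤ 1 := by
  unfold boxm; split_ifs <;> norm_num

variable (d n) in
open Classical in
/-- edges with an endpoint outside the interior -/
def badE : Finset (Zd d × Fin d) :=
  (halfE d n).filter fun p => ¬ (p.1 ∈ intr (cube d (n : ℤ)) ∧ step p.1 p.2 true ∈ intr (cube d (n : ℤ)))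

theorem card_badE : (badE d n).card ≤ (nearB d n 1).card * d := by
  have h : badE d n ⊆ nearB d n 1 ×ˢ Finset.univ := by
    intro p hp
    obtain ⟨h1, h2⟩ := Finset.mem_filter.1 hp
    have h3 := (Finset.mem_product.1 h1).1
    refine Finset.mem_product.2 ⟨Finset.mem_filter.2 ⟨halfC_subset_cube h3, ?_⟩, Finset.mem_univ _⟩
    rw [mem_intr, mem_intr] at h2
    by_contra h4
    push Not at h4
    apply h2
    have h5 : ∀ j, -(n : ℤ) + 1 < p.1 j ∧ p.1 j < n - 1 := fun j => by
      have := abs_lt.1 (h4 j); push_cast at this; omega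
    refine ⟨fun j => ⟨by have := h5 j; omega, by have := h5 j; omega⟩, fun j => ?_⟩
    have := h5 j
    by_cases hj : j = p.2
    · subst hj; simp [step]; omega
    · simp [step, hj]; omega
  refine (Finset.card_le_card h).trans ?_
  rw [Finset.card_product, Finset.card_univ, Fintype.card_fin]

variable [NeZero N]

open Classical in
/-- restriction to the walls -/
def wallV (n k : ℕ) (φ : TorA d N → ℝ) (X : Fin d → ZMod N) : ℝ := if Wall N n k X then extT φ X else 0

theorem sum_wallV_sq (φ : TorA d N → ℝ) : ∑ X, wallV n k φ X ^ 2 = ∑ a : WallA d n k N, φ a.1 ^ 2 := by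
  symm
  refine Fintype.sum_of_injective (fun a : WallA d n k N => a.1.val) (fun a b hab => Subtype.ext (TorA.ext hab)) _ _ ?_ ?_
  · intro X hX
    by_cases h : Wall N n k X
    · by_cases h0 : X = 0
      · simp [wallV, h0]
      · exact absurd ⟨⟨⟨X, h0⟩, h⟩, rfl⟩ hX
    · simp [wallV, h]
  · intro a
    rw [wallV, if_pos a.2, extT_coe]

theorem extT_split (hN : N = 2 * n * k) (φ : TorA d N → ℝ) (q : Fin d → Fin k) {y : Zd d} (hy : y ∈ cube d (n : ℤ)) :
    extT φ (tpos N n q y) = extD (restr n q φ) y + wallV n k φ (tpos N n q y) := by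
  by_cases h : y ∈ intr (cube d (n : ℤ))
  · rw [wallV, if_neg (not_wall_tpos q h), extD, dif_pos h, restr_apply, add_zero]
  · rw [wallV, if_pos (wall_tpos hN q hy h), extD, dif_neg h, zero_add]

theorem torJ_split (hN : N = 2 * n * k) (φ : TorA d N → ℝ) (q : Fin d → Fin k) {p : Zd d × Fin d} (hp : p ∈ halfE d n) :
    torJ d N φ (tpos N n q p.1, p.2)
      = boxG (restr n q φ) p + (wallV n k φ (tpos N n q p.1 + Pi.single p.2 1) - wallV n k φ (tpos N n q p.1)) := by
  have h1 := (Finset.mem_product.1 hp).1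
  rw [torJ_apply, ← tpos_step, extT_split hN φ q (step_halfC h1 _), extT_split hN φ q (halfC_subset_cube h1), boxG]
  ring

theorem sum_tile_edges (hn : 0 < n) (hN : N = 2 * n * k) (F : (Fin d → ZMod N) × Fin d → ℝ) :
    ∑ e, F e = ∑ q : Fin d → Fin k, ∑ p ∈ halfE d n, F (tpos N n q p.1, p.2) := by
  rw [Fintype.sum_prod_type, sum_tiles hn hN]
  refine Finset.sum_congr rfl fun q _ => ?_
  rw [halfE, Finset.sum_product]

theorem torH_eq_sum (hn : 0 < n) (hN : N = 2 * n * k) (ξ : EuclideanSpace ℝ (Fin d)) (φ : TorA d N → ℝ) :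
    torH N V ξ φ = ∑ q : Fin d → Fin k, ∑ p ∈ halfE d n, 2 * V (torJ d N φ (tpos N n q p.1, p.2) - ξ p.2) := by
  rw [torH, fieldH, sum_tile_edges hn hN]

theorem sum_wall_edges (hn : 0 < n) (hN : N = 2 * n * k) (φ : TorA d N → ℝ) :
    ∑ q : Fin d → Fin k, ∑ p ∈ halfE d n,
      (wallV n k φ (tpos N n q p.1 + Pi.single p.2 1) ^ 2 + wallV n k φ (tpos N n q p.1) ^ 2)
      = 2 * d * ∑ a : WallA d n k N, φ a.1 ^ 2 := by
  have h0 := sum_tile_edges hn hN fun e => wallV n k φ (e.1 + Pi.single e.2 1) ^ 2 + wallV n k φ e.1 ^ 2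
  simp only at h0
  rw [← h0, Fintype.sum_prod_type_right]
  simp only [Finset.sum_add_distrib]
  have : ∀ i : Fin d, ∑ X : Fin d → ZMod N, wallV n k φ (X + Pi.single i 1) ^ 2 = ∑ X, wallV n k φ X ^ 2 := fun i =>
    Equiv.sum_comp (Equiv.addRight (Pi.single i 1)) fun X => wallV n k φ X ^ 2
  simp only [this, sum_wallV_sq, Finset.sum_const, Finset.card_univ, Fintype.card_fin, nsmul_eq_mul]
  ring

open Classical in
/-- the edges of the box having an endpoint outside the interior -/
def badB (d n : ℕ) : Finset (boxE d (n : ℤ)) := Finset.univ.filter fun e => e.1 ∈ badE d n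

theorem card_badB : (badB d n).card ≤ (badE d n).card := by
  classical
  refine Finset.card_le_card_of_injOn (fun e => e.1) (fun e he => ?_) fun e _ e' _ h => Subtype.ext h
  exact (Finset.mem_filter.1 he).2

theorem sum_badE (ψ : Conf d (n : ℤ)) : ∑ p ∈ badE d n, boxG ψ p ^ 2 = ∑ e ∈ badB d n, (boxJ d n ψ e) ^ 2 := by
  classical
  rw [badB, Finset.sum_filter]
  refine Eq.trans ?_ (sum_boxE_half (n := n) (fun p => if p ∈ badE d n then boxG ψ p ^ 2 else 0) fun p hp hp' => by
    rw [boxG_eq_zero ψ hp hp']; simp).symm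
  have hs : badE d n ⊆ halfE d n := Finset.filter_subset _ _
  rw [← Finset.sum_filter, Finset.filter_mem_eq_inter, Finset.inter_eq_right.2 hs]

theorem abs_coord_le {R : ℝ} {ξ : EuclideanSpace ℝ (Fin d)} (hξ : ‖ξ‖ ≤ R) (i : Fin d) : ξ i ^ 2 ≤ R ^ 2 := by
  have h1 := (PiLp.norm_apply_le ξ i).trans hξ
  rw [Real.norm_eq_abs] at h1
  exact sq_le_sq.2 (h1.trans (le_abs_self R))

theorem tile_energy_le (hN : N = 2 * n * k) (h : HPot lam Lam M γ V v v2) (hV : ∀ t, V (-t) = V t)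
    (hV0 : V 0 = 0) {ξ : EuclideanSpace ℝ (Fin d)} {R : ℝ} (hξ : ‖ξ‖ ≤ R) (φ : TorA d N → ℝ) (q : Fin d → Fin k) :
    ∑ p ∈ halfE d n, 2 * V (torJ d N φ (tpos N n q p.1, p.2) - ξ p.2) ≤ boxH d V n ξ (restr n q φ)
      + 8 * Lam * (∑ e ∈ badB d n, (boxJ d n (restr n q φ) e) ^ 2
        + ∑ p ∈ halfE d n, (wallV n k φ (tpos N n q p.1 + Pi.single p.2 1) ^ 2 + wallV n k φ (tpos N n q p.1) ^ 2)
        + (badE d n).card * R ^ 2) := by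
  classical
  have hLam : 0 < Lam := h.lam_pos.trans_le ((h.lo 0).trans (h.hi 0))
  rw [boxH_eq_sum, ← sum_badE]
  have h1 : ((badE d n).card : ℝ) * R ^ 2 = ∑ p ∈ badE d n, R ^ 2 := by simp
  have h2 : badE d n = (halfE d n).filter fun p => ¬ (p.1 ∈ intr (cube d (n : ℤ)) ∧ step p.1 p.2 true ∈ intr (cube d (n : ℤ))) := by
    unfold badE; congr
  rw [h1, h2, Finset.sum_filter, Finset.sum_filter, ← Finset.sum_add_distrib, ← Finset.sum_add_distrib, Finset.mul_sum,
    ← Finset.sum_add_distrib]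
  refine Finset.sum_le_sum fun p hp => ?_
  rw [torJ_split hN φ q hp]
  set G := boxG (restr n q φ) p
  set b := wallV n k φ (tpos N n q p.1) with hb
  set b' := wallV n k φ (tpos N n q p.1 + Pi.single p.2 1) with hb'
  by_cases hg : p.1 ∈ intr (cube d (n : ℤ)) ∧ step p.1 p.2 true ∈ intr (cube d (n : ℤ))
  · have e1 : b = 0 := by rw [hb, wallV, if_neg (not_wall_tpos q hg.1)]
    have e2 : b' = 0 := by rw [hb', ← tpos_step, wallV, if_neg (not_wall_tpos q hg.2)]
    have e3 : boxm n p = 1 := by rw [boxm, if_pos hg.1, if_pos hg.2]; norm_num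
    rw [if_neg (not_not.2 hg), if_neg (not_not.2 hg), e1, e2, e3]
    simp
  · rw [if_pos hg, if_pos hg]
    have e1 := h.le_sq hV hV0 (G + (b' - b) - ξ p.2)
    have e2 : 0 ≤ boxm n p * (2 * V (G - ξ p.2)) :=
      mul_nonneg (boxm_nonneg p) (mul_nonneg zero_le_two (h.nonneg hV hV0 _))
    have e3 := abs_coord_le hξ p.2
    have e4 : (G + (b' - b) - ξ p.2) ^ 2 ≤ 4 * (G ^ 2 + (b' ^ 2 + b ^ 2) + R ^ 2) := by
      linarith [sq_nonneg (G - b'), sq_nonneg (G + b), sq_nonneg (G + ξ p.2), sq_nonneg (b' + b),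
        sq_nonneg (b' + ξ p.2), sq_nonneg (b - ξ p.2)]
    have e5 := mul_le_mul_of_nonneg_left e4 hLam.le
    linarith

theorem tile_tame_box (q : Fin d → Fin k) (e : boxE d (n : ℤ)) :
    Tame fun φ : TorA d N → ℝ => (boxJ d n (restr n q φ) e) ^ 2 :=
  Tame.sq ((PiLp.projₗ 2 (fun _ : boxE d (n : ℤ) => ℝ) e : EuclideanSpace ℝ (boxE d (n : ℤ)) →ₗ[ℝ] ℝ) ∘ₗ (boxJ d n ∘ₗ restr n q))

theorem tame_site (a : TorA d N) : Tame fun φ : TorA d N → ℝ => φ a ^ 2 :=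
  Tame.sq (LinearMap.proj a)

variable [NeZero d] [NeZero k]

/-- second moment of the standard Gaussian -/
def gaussC : ℝ := avg (fun t : ℝ => t ^ 2 / (2 * 1)) fun t => t ^ 2

theorem gaussC_nonneg : 0 ≤ gaussC := avg_nonneg fun t => sq_nonneg t

theorem torus_lower (hn : 0 < n) (hN : N = 2 * n * k) (h : HPot lam Lam M γ V v v2) (hV : ∀ t, V (-t) = V t)
    (hV0 : V 0 = 0) {ξ : EuclideanSpace ℝ (Fin d)} {R : ℝ} (hξ : ‖ξ‖ ≤ R) :
    k ^ d * boxF d V n ξ ≤ Real.log (∫ φ, Real.exp (-torH N V ξ φ))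
      + 8 * Lam * (k ^ d * ∑ e ∈ badB d n, avg (boxH d V n ξ) (fun ψ => (boxJ d n ψ e) ^ 2)
        + 2 * d * (Fintype.card (WallA d n k N) * gaussC) + k ^ d * ((badE d n).card * R ^ 2)) := by
  have hLam : lam ≤ Lam := (h.lo 0).trans (h.hi 0)
  have hlam := h.lam_pos
  set f : (TorA d N → ℝ) → ℝ := fun φ => 8 * Lam * (∑ q : Fin d → Fin k, ∑ e ∈ badB d n, (boxJ d n (restr n q φ) e) ^ 2
        + 2 * d * ∑ a : WallA d n k N, φ a.1 ^ 2 + k ^ d * ((badE d n).card * R ^ 2)) with hf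
  have t1 : Tame fun φ : TorA d N → ℝ => ∑ q : Fin d → Fin k, ∑ e ∈ badB d n, (boxJ d n (restr n q φ) e) ^ 2 :=
    Tame.sum _ fun q _ => Tame.sum _ fun e _ => tile_tame_box q e
  have t2 : Tame fun φ : TorA d N → ℝ => ∑ a : WallA d n k N, φ a.1 ^ 2 := Tame.sum _ fun a _ => tame_site a.1
  have t3 := (Tame.const (κ := TorA d N) (k ^ d * ((badE d n).card * R ^ 2)))
  have t : Tame f := ((t1.add (t2.const_mul (2 * d))).add t3).const_mul (8 * Lam)
  obtain ⟨hc, C, hC⟩ := t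
  have hle : ∀ φ, torH N V ξ φ - tileH n k N V 1 ξ φ ≤ f φ := by
    intro φ
    rw [torH_eq_sum hn hN, tileH_eq]
    have h1 := Finset.sum_le_sum fun q (_ : q ∈ Finset.univ) => tile_energy_le hN h hV hV0 hξ φ q
    rw [Finset.sum_add_distrib, ← Finset.mul_sum, Finset.sum_add_distrib, Finset.sum_add_distrib,
      sum_wall_edges hn hN, Finset.sum_const] at h1
    have h2 : 0 ≤ ∑ a : WallA d n k N, φ a.1 ^ 2 / (2 * 1) := Finset.sum_nonneg fun a _ => by positivity
    simp only [Finset.card_univ, Fintype.card_pi, Fintype.card_fin, Finset.prod_const, nsmul_eq_mul, Nat.cast_pow] at h1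
    simp only [hf]
    linarith
  have h1 := field_gibbs torJ_injective (tileJ_injective hn hN) (tor_pot h ξ) (tile_pot h one_pos ξ) (by linarith)
    (by linarith) (lt_min h.lam_pos (by positivity)) (le_max_of_le_right (min_le_right _ _)) hc hC hle
  have h2 := tileH_log hn hN h one_pos ξ
  have h3 : avg (tileH n k N V 1 ξ) f = 8 * Lam * (k ^ d * ∑ e ∈ badB d n, avg (boxH d V n ξ) (fun ψ => (boxJ d n ψ e) ^ 2)
        + 2 * d * (Fintype.card (WallA d n k N) * gaussC) + k ^ d * ((badE d n).card * R ^ 2)) := by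
    have i1 := fun {g : (TorA d N → ℝ) → ℝ} (hg : Tame g) => tile_integrable hn hN h one_pos ξ hg
    simp only [hf]
    rw [avg_const_mul, avg_add (i1 (t1.add (t2.const_mul (2 * d)))) (i1 t3), avg_add (i1 t1) (i1 (t2.const_mul (2 * d))),
      avg_const_mul, avg_const (H := tileH n k N V 1 ξ), avg_sum (f := fun (q : Fin d → Fin k) (φ : TorA d N → ℝ) =>
        ∑ e ∈ badB d n, (boxJ d n (restr n q φ) e) ^ 2) _ fun q _ => i1 (Tame.sum _ fun e _ => tile_tame_box q e),
      avg_sum (f := fun (a : WallA d n k N) (φ : TorA d N → ℝ) => φ a.1 ^ 2) _ fun a _ => i1 (tame_site a.1)]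
    · have e1 : ∀ q : Fin d → Fin k, avg (tileH n k N V 1 ξ) (fun φ : TorA d N → ℝ => ∑ e ∈ badB d n, (boxJ d n (restr n q φ) e) ^ 2)
          = ∑ e ∈ badB d n, avg (boxH d V n ξ) (fun ψ => (boxJ d n ψ e) ^ 2) := fun q => by
        rw [avg_sum (f := fun (e : boxE d (n : ℤ)) (φ : TorA d N → ℝ) => (boxJ d n (restr n q φ) e) ^ 2) _
          fun e _ => i1 (tile_tame_box q e)]
        exact Finset.sum_congr rfl fun e _ => tile_avg_box hn hN h one_pos ξ q fun ψ => (boxJ d n ψ e) ^ 2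
      have e2 : ∀ a : WallA d n k N, avg (tileH n k N V 1 ξ) (fun φ => φ a.1 ^ 2) = gaussC := fun a =>
        tile_avg_wall hn hN h one_pos ξ a fun t => t ^ 2
      simp only [e1, e2, Finset.sum_const, Finset.card_univ, nsmul_eq_mul, Fintype.card_pi, Fintype.card_fin, Finset.prod_const,
        Nat.cast_pow]
    · exact field_integral_pos _ (tileJ_injective hn hN) (lt_min h.lam_pos (by positivity))
        (le_max_of_le_right (min_le_right _ _)) (tile_pot h one_pos ξ)
  have h4 : 0 ≤ Real.log (√(2 * π * 1)) := by
    refine Real.log_nonneg ?_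
    rw [Real.one_le_sqrt]
    have := Real.pi_gt_three
    linarith
  have h5 : 0 ≤ (Fintype.card (WallA d n k N) : ℝ) * Real.log (√(2 * π * 1)) := mul_nonneg (by positivity) h4
  have h6 : Real.log (∫ φ, Real.exp (-tileH n k N V 1 ξ φ))
    ≤ Real.log (∫ φ, Real.exp (-torH N V ξ φ)) + avg (tileH n k N V 1 ξ) f := h1
  rw [h2, h3] at h6
  linarith
end TileEdges

section Cutoff
variable {d n ℓ : ℕ}

/-- cutoff function equal to `1` inside the box and vanishing at its boundary -/
def cutoff (n ℓ : ℕ) (x : Zd d) : ℝ := min 1 ((n - ‖x‖) / ℓ)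

theorem cutoff_nonneg {x : Zd d} (hx : x ∈ cube d (n : ℤ)) : 0 ≤ cutoff n ℓ x := by
  refine le_min zero_le_one (div_nonneg (sub_nonneg.2 ?_) (Nat.cast_nonneg _))
  refine (pi_norm_le_iff_of_nonneg (Nat.cast_nonneg _)).2 fun j => ?_
  have := mem_cube.1 hx j
  rw [Int.norm_eq_abs]
  have h2 : |x j| ≤ n := abs_le.2 this
  exact_mod_cast h2

theorem cutoff_le_one (x : Zd d) : cutoff n ℓ x ≤ 1 := min_le_left _ _

theorem cutoff_intr (hn : 0 < n) (hl : 0 < ℓ) {x : Zd d} (hx : x ∈ intr (cube d (n : ℤ))) : 1 / (ℓ : ℝ) ≤ cutoff n ℓ x := by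
  have hl' : (1 : ℝ) ≤ ℓ := by exact_mod_cast hl
  have hn' : (1 : ℝ) ≤ n := by exact_mod_cast hn
  refine le_min ((div_le_one (by linarith)).2 hl') (div_le_div_of_nonneg_right ?_ (by linarith))
  have : ‖x‖ ≤ n - 1 := by
    refine (pi_norm_le_iff_of_nonneg (by linarith)).2 fun j => ?_
    have := mem_intr.1 hx j
    rw [Int.norm_eq_abs]
    have h2 : |x j| ≤ n - 1 := abs_le.2 ⟨by omega, by omega⟩
    exact_mod_cast h2
  linarith

theorem cutoff_bdry [NeZero d] {x : Zd d} (hx : x ∈ cube d (n : ℤ)) (h : x ∉ intr (cube d (n : ℤ))) : cutoff n ℓ x = 0 := by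
  refine le_antisymm ?_ (cutoff_nonneg hx)
  refine (min_le_right _ _).trans (div_nonpos_of_nonpos_of_nonneg ?_ (Nat.cast_nonneg _))
  rw [mem_intr] at h
  push Not at h
  obtain ⟨j, hj⟩ := h
  have h1 : (n : ℤ) ≤ |x j| := by
    have := mem_cube.1 hx j
    by_cases h4 : -(n : ℤ) < x j
    · exact (hj h4).trans (le_abs_self _)
    · exact le_trans (by omega) (neg_le_abs _)
  have h2 := norm_le_pi_norm x j
  rw [Int.norm_eq_abs] at h2
  have h3 : (n : ℝ) ≤ |(x j : ℝ)| := by exact_mod_cast h1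
  linarith

theorem cutoff_deep (hl : 0 < ℓ) {x : Zd d} (h : ∀ j, |x j| < (n : ℤ) - ℓ) (hln : ℓ ≤ n) : cutoff n ℓ x = 1 := by
  have hl' : (0 : ℝ) < ℓ := by exact_mod_cast hl
  have hln' : (ℓ : ℝ) ≤ n := by exact_mod_cast hln
  refine min_eq_left ((one_le_div hl').2 ?_)
  have : ‖x‖ ≤ n - ℓ := by
    refine (pi_norm_le_iff_of_nonneg (by linarith)).2 fun j => ?_
    rw [Int.norm_eq_abs]
    have := (h j).le
    exact_mod_cast this
  linarith

theorem cutoff_step (hl : 0 < ℓ) (x : Zd d) (i : Fin d) : |cutoff n ℓ (step x i true) - cutoff n ℓ x| ≤ 1 / ℓ := by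
  have hl' : (0 : ℝ) < ℓ := by exact_mod_cast hl
  have h1 : ‖step x i true - x‖ ≤ 1 := by
    refine (pi_norm_le_iff_of_nonneg zero_le_one).2 fun j => ?_
    by_cases h : j = i
    · subst h; simp [step]
    · simp [step, h]
  have h2 := (abs_norm_sub_norm_le (step x i true) x).trans h1
  unfold cutoff
  refine (abs_min_sub_min_le_max _ _ _ _).trans ?_
  rw [sub_self, abs_zero, ← sub_div, abs_div, abs_of_pos hl']
  refine max_le (by positivity) (div_le_div_of_nonneg_right ?_ hl'.le)
  rw [abs_le] at h2 ⊢
  constructor <;> linarith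
end Cutoff

section Change
variable {d n k N : ℕ} [NeZero N] [NeZero d] [NeZero k]

/-- the corner of a tile -/
def corner (N n : ℕ) (q : Fin d → Fin k) : Fin d → ZMod N := tpos N n q fun _ => -(n : ℤ)

theorem wall_corner (hN : N = 2 * n * k) (q : Fin d → Fin k) : Wall N n k (corner N n q) :=
  wall_tpos hN q (mem_cube.2 fun _ => ⟨le_rfl, by omega⟩) fun h => lt_irrefl _ (mem_intr.1 h 0).1

/-- localisation to the tiles -/
def localize (hn : 0 < n) (hN : N = 2 * n * k) (ℓ : ℕ) : (TorA d N → ℝ) →ₗ[ℝ] (TorA d N → ℝ) where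
  toFun φ X := Sum.elim (fun a => φ a.1)
    (fun p => cutoff n ℓ p.2.1 * (φ (tileE hn hN (Sum.inr p)) - extT φ (corner N n p.1))) ((tileE hn hN).symm X)
  map_add' φ ψ := by
    ext X
    simp only [Pi.add_apply]
    rcases (tileE hn hN).symm X with a | p
    · simp
    · simp [extT_add]; ring
  map_smul' c φ := by
    ext X
    simp only [Pi.smul_apply]
    rcases (tileE hn hN).symm X with a | p
    · simp
    · simp [extT_smul]; ring

theorem localize_inl (hn : 0 < n) (hN : N = 2 * n * k) (ℓ : ℕ) (φ : TorA d N → ℝ) (a : WallA d n k N) :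
    localize hn hN ℓ φ (tileE hn hN (Sum.inl a)) = φ a.1 := by
  change Sum.elim _ _ ((tileE hn hN).symm _) = _
  rw [Equiv.symm_apply_apply]; rfl

theorem localize_inr (hn : 0 < n) (hN : N = 2 * n * k) (ℓ : ℕ) (φ : TorA d N → ℝ) (p : TileI d n k) :
    localize hn hN ℓ φ (tileE hn hN (Sum.inr p))
      = cutoff n ℓ p.2.1 * (φ (tileE hn hN (Sum.inr p)) - extT φ (corner N n p.1)) := by
  change Sum.elim _ _ ((tileE hn hN).symm _) = _
  rw [Equiv.symm_apply_apply]; rfl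

theorem localize_extD (hn : 0 < n) (hN : N = 2 * n * k) (ℓ : ℕ) (φ : TorA d N → ℝ) (q : Fin d → Fin k) {y : Zd d}
    (hy : y ∈ cube d (n : ℤ)) : extD (restr n q (localize hn hN ℓ φ)) y
      = cutoff n ℓ y * (extT φ (tpos N n q y) - extT φ (corner N n q)) := by
  by_cases h : y ∈ intr (cube d (n : ℤ))
  · rw [extD, dif_pos h, restr_eq hn hN]
    simp only
    rw [localize_inr]
    have := tileE_inr hn hN (q, (⟨y, h⟩ : ↥(intr (cube d (n : ℤ)))))
    rw [← extT_coe φ, this]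
  · rw [extD, dif_neg h, cutoff_bdry hy h, zero_mul]

theorem extT_single_corner (hn : 0 < n) (hN : N = 2 * n * k) [DecidableEq (TorA d N)] (q : Fin d → Fin k) (p : TileI d n k) :
    extT (Pi.single (tileE hn hN (Sum.inr p)) (1 : ℝ)) (corner N n q) = 0 := by
  by_cases h : corner N n q = (0 : Fin d → ZMod N)
  · rw [h, extT_zero]
  · have h1 := extT_coe (Pi.single (tileE hn hN (Sum.inr p)) (1 : ℝ)) (⟨corner N n q, h⟩ : TorA d N)
    rw [h1]
    refine Pi.single_eq_of_ne ?_ _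
    intro h2
    have h3 : corner N n q = tpos N n p.1 p.2.1 := (congrArg TorA.val h2).trans (tileE_inr hn hN p)
    have h4 := wall_corner hN q
    rw [h3] at h4
    exact not_wall_tpos p.1 p.2.2 h4

theorem localize_det (hn : 0 < n) (hN : N = 2 * n * k) (ℓ : ℕ) :
    LinearMap.det (localize (d := d) hn hN ℓ) = ∏ p : TileI d n k, cutoff n ℓ p.2.1 := by
  classical
  rw [← LinearMap.det_toMatrix', ← Matrix.det_submatrix_equiv_self (tileE hn hN)]
  set A := (LinearMap.toMatrix' (localize (d := d) hn hN ℓ)).submatrix (tileE hn hN) (tileE hn hN) with hA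
  have h1 : ∀ a b, A a b = localize hn hN ℓ (Pi.single (tileE hn hN b) 1) (tileE hn hN a) := fun a b => by
    rw [hA, Matrix.submatrix_apply, LinearMap.toMatrix'_apply]
  have h2 : A = Matrix.fromBlocks 1 0 A.toBlocks₂₁ (Matrix.diagonal fun p : TileI d n k => cutoff n ℓ p.2.1) := by
    conv_lhs => rw [← Matrix.fromBlocks_toBlocks A]
    congr 1
    · ext a b
      rw [Matrix.toBlocks₁₁, Matrix.of_apply, h1, localize_inl, Matrix.one_apply, tileE_inl, Pi.single_apply]
      simp only [Subtype.ext_iff]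
    · ext a b
      rw [Matrix.toBlocks₁₂, Matrix.of_apply, h1, localize_inl, Matrix.zero_apply, ← tileE_inl hn hN]
      exact Pi.single_eq_of_ne (fun h => by simpa using (tileE hn hN).injective h) _
    · ext a b
      rw [Matrix.toBlocks₂₂, Matrix.of_apply, h1, localize_inr, extT_single_corner, sub_zero, Matrix.diagonal_apply,
        Pi.single_apply]
      by_cases h : a = b
      · simp [h]
      · rw [if_neg h, if_neg fun h' => h (by simpa using (tileE hn hN).injective h'), mul_zero]
  rw [h2, Matrix.det_fromBlocks_zero₁₂, Matrix.det_one, one_mul, Matrix.det_diagonal]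

theorem localize_det_pos (hn : 0 < n) (hN : N = 2 * n * k) {ℓ : ℕ} (hl : 0 < ℓ) :
    0 < LinearMap.det (localize (d := d) hn hN ℓ) := by
  rw [localize_det]
  have hl' : (0 : ℝ) < ℓ := by exact_mod_cast hl
  exact Finset.prod_pos fun p _ => lt_of_lt_of_le (by positivity) (cutoff_intr hn hl p.2.2)

theorem localize_log_det (hn : 0 < n) (hN : N = 2 * n * k) {ℓ : ℕ} (hl : 0 < ℓ) (hln : ℓ ≤ n) :
    -Real.log (LinearMap.det (localize (d := d) hn hN ℓ)) ≤ k ^ d * ((nearB d n ℓ).card * Real.log ℓ) := by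
  classical
  have hl' : (1 : ℝ) ≤ ℓ := by exact_mod_cast hl
  have h0 := Real.log_nonneg hl'
  have hp : ∀ x ∈ intr (cube d (n : ℤ)), 0 < cutoff n ℓ x := fun x hx =>
    lt_of_lt_of_le (by positivity) (cutoff_intr hn hl hx)
  rw [localize_det, Real.log_prod (fun p _ => (hp _ p.2.2).ne'), ← Finset.sum_neg_distrib, Fintype.sum_prod_type]
  have h1 : ∑ x : ↥(intr (cube d (n : ℤ))), -Real.log (cutoff n ℓ x.1) ≤ (nearB d n ℓ).card * Real.log ℓ := by
    rw [Finset.sum_coe_sort (intr (cube d (n : ℤ))) fun x => -Real.log (cutoff n ℓ x)]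
    have h2 : ∀ x ∈ intr (cube d (n : ℤ)), -Real.log (cutoff n ℓ x) ≤ if x ∈ nearB d n ℓ then Real.log ℓ else 0 := by
      intro x hx
      split_ifs with h
      · have := Real.log_le_log (by positivity) (cutoff_intr hn hl hx)
        rw [one_div, Real.log_inv] at this
        linarith
      · rw [cutoff_deep hl ?_ hln, Real.log_one, neg_zero]
        intro j
        by_contra h3
        exact h (Finset.mem_filter.2 ⟨intr_subset hx, j, not_lt.1 h3⟩)
    refine (Finset.sum_le_sum h2).trans ?_
    rw [← Finset.sum_filter, Finset.sum_const, nsmul_eq_mul]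
    refine mul_le_mul_of_nonneg_right ?_ h0
    exact_mod_cast Finset.card_le_card fun x hx => (Finset.mem_filter.1 hx).2
  refine (Finset.sum_le_sum fun q _ => h1).trans (le_of_eq ?_)
  simp

theorem localize_injective (hn : 0 < n) (hN : N = 2 * n * k) {ℓ : ℕ} (hl : 0 < ℓ) :
    Function.Injective (localize (d := d) hn hN ℓ) := by
  exact (LinearMap.equivOfDetNeZero (localize (d := d) hn hN ℓ) (localize_det_pos hn hN hl).ne').injective

theorem integral_comp_det {κ : Type*} [Fintype κ] (T : (κ → ℝ) →ₗ[ℝ] (κ → ℝ)) (hT : 0 < LinearMap.det T)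
    (g : (κ → ℝ) → ℝ) : ∫ φ, g φ = LinearMap.det T * ∫ φ, g (T φ) := by
  have hb := (LinearMap.equivOfDetNeZero T hT.ne').bijective
  have h := integral_image_eq_integral_abs_det_fderiv_smul (volume : Measure (κ → ℝ)) MeasurableSet.univ
    (fun x _ => ((LinearMap.toContinuousLinearMap T).hasFDerivAt (x := x)).hasFDerivWithinAt)
    (fun a _ b _ hab => hb.1 hab) g
  have h2 : (⇑(LinearMap.toContinuousLinearMap T)) '' Set.univ = Set.univ := by
    rw [Set.image_univ]; exact hb.2.range_eq
  rw [h2, setIntegral_univ, setIntegral_univ] at h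
  rw [h, ← integral_const_mul]
  congr 1; funext φ
  rw [smul_eq_mul, LinearMap.det_toContinuousLinearMap, abs_of_pos hT]; rfl
end Change

section Upper
variable {d n k N : ℕ} {lam Lam M γ : ℝ} {V v v2 : ℝ → ℝ}

open Classical in
/-- edges close to the boundary of the box -/
def layE (d n ℓ : ℕ) : Finset (Zd d × Fin d) := (halfE d n).filter fun p => p.1 ∈ nearB d n (ℓ + 1)

theorem card_layE (ℓ : ℕ) : (layE d n ℓ).card ≤ (nearB d n (ℓ + 1)).card * d := by
  classical
  have h : layE d n ℓ ⊆ nearB d n (ℓ + 1) ×ˢ Finset.univ := fun p hp =>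
    Finset.mem_product.2 ⟨(Finset.mem_filter.1 hp).2, Finset.mem_univ _⟩
  refine (Finset.card_le_card h).trans ?_
  rw [Finset.card_product, Finset.card_univ, Fintype.card_fin]

variable [NeZero N] [NeZero d] [NeZero k]

theorem localize_edge_le (hn : 0 < n) (hN : N = 2 * n * k) (h : HPot lam Lam M γ V v v2) (hV : ∀ t, V (-t) = V t)
    (hV0 : V 0 = 0) {ξ : EuclideanSpace ℝ (Fin d)} {R : ℝ} (hξ : ‖ξ‖ ≤ R) {ℓ : ℕ} (hl : 0 < ℓ) (hln : ℓ ≤ n)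
    (φ : TorA d N → ℝ) (q : Fin d → Fin k) {p : Zd d × Fin d} (hp : p ∈ halfE d n) :
    boxm n p * (2 * V (boxG (restr n q (localize hn hN ℓ φ)) p - ξ p.2))
      ≤ 2 * V (torJ d N φ (tpos N n q p.1, p.2) - ξ p.2) + if p ∈ layE d n ℓ then
        6 * Lam * ((extT φ (tpos N n q p.1 + Pi.single p.2 1) - extT φ (tpos N n q p.1)) ^ 2
          + (1 / (ℓ : ℝ)) ^ 2 * (extT φ (tpos N n q p.1) - extT φ (corner N n q)) ^ 2 + R ^ 2) else 0 := by
  classical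
  have hLam : 0 < Lam := h.lam_pos.trans_le ((h.lo 0).trans (h.hi 0))
  have hx := (Finset.mem_product.1 hp).1
  have hG : boxG (restr n q (localize hn hN ℓ φ)) p
      = cutoff n ℓ (step p.1 p.2 true) * (extT φ (tpos N n q p.1 + Pi.single p.2 1) - extT φ (corner N n q))
        - cutoff n ℓ p.1 * (extT φ (tpos N n q p.1) - extT φ (corner N n q)) := by
    rw [boxG, localize_extD hn hN ℓ φ q (step_halfC hx _), localize_extD hn hN ℓ φ q (halfC_subset_cube hx), tpos_step]
  have hb0 := boxm_nonneg (n := n) p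
  have hb1 := boxm_le_one (n := n) p
  rw [hG, torJ_apply]
  simp only
  generalize extT φ (tpos N n q p.1 + Pi.single p.2 1) = u'
  generalize extT φ (tpos N n q p.1) = u
  generalize extT φ (corner N n q) = c
  split_ifs with hg
  · have e1 : |cutoff n ℓ (step p.1 p.2 true)| ≤ 1 := by
      rw [abs_of_nonneg (cutoff_nonneg (step_halfC hx _))]; exact cutoff_le_one _
    have e2 := cutoff_step (n := n) hl p.1 p.2
    generalize cutoff n ℓ (step p.1 p.2 true) = η' at *
    generalize cutoff n ℓ p.1 = η at *
    have e3 := abs_coord_le hξ p.2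
    generalize ξ p.2 = z at *
    set t := η' * (u' - c) - η * (u - c) - z with ht
    have h1 := h.le_sq hV hV0 t
    have h2 := h.nonneg hV hV0 t
    have h3 := h.nonneg hV hV0 (u' - u - z)
    have h4 : (η' * (u' - u)) ^ 2 ≤ (u' - u) ^ 2 := by
      rw [mul_pow]
      exact mul_le_of_le_one_left (sq_nonneg _) ((sq_le_one_iff_abs_le_one _).2 e1)
    have h5 : ((η' - η) * (u - c)) ^ 2 ≤ (1 / (ℓ : ℝ)) ^ 2 * (u - c) ^ 2 := by
      rw [mul_pow]
      refine mul_le_mul_of_nonneg_right (sq_le_sq.2 (e2.trans (le_abs_self _))) (sq_nonneg _)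
    have h6 : t ^ 2 ≤ 3 * ((u' - u) ^ 2 + (1 / (ℓ : ℝ)) ^ 2 * (u - c) ^ 2 + R ^ 2) := by
      have : t = η' * (u' - u) + (η' - η) * (u - c) - z := by rw [ht]; ring
      rw [this]
      generalize η' * (u' - u) = a at *
      generalize (η' - η) * (u - c) = b at *
      linarith [sq_nonneg (a - b), sq_nonneg (a + z), sq_nonneg (b + z)]
    have h7 : boxm n p * (2 * V t) ≤ 2 * V t := mul_le_of_le_one_left (by linarith) hb1
    have h8 := mul_le_mul_of_nonneg_left h6 hLam.le
    linarith
  · have hs : ∀ j, |p.1 j| < (n : ℤ) - (ℓ + 1) := by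
      intro j
      by_contra h3
      refine hg (Finset.mem_filter.2 ⟨hp, Finset.mem_filter.2 ⟨halfC_subset_cube hx, j, ?_⟩⟩)
      push_cast
      exact not_lt.1 h3
    have e1 : cutoff n ℓ p.1 = 1 := cutoff_deep hl (fun j => by have := hs j; linarith) hln
    have e2 : cutoff n ℓ (step p.1 p.2 true) = 1 := by
      refine cutoff_deep hl (fun j => ?_) hln
      have := hs j
      rw [abs_lt] at this ⊢
      by_cases hj : j = p.2
      · subst hj; simp [step]; constructor <;> linarith
      · simp [step, hj]; constructor <;> linarith
    rw [e1, e2, one_mul, one_mul, sub_sub_sub_cancel_right, add_zero]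
    exact mul_le_of_le_one_left (by linarith [h.nonneg hV hV0 (u' - u - ξ p.2)]) hb1

theorem tor_edge_avg (h : HPot lam Lam M γ V v v2) (ξ : EuclideanSpace ℝ (Fin d)) (X : Fin d → ZMod N) (i : Fin d) :
    avg (torH N V ξ) (fun φ => (extT φ (X + Pi.single i 1) - extT φ X) ^ 2) ≤ 1 / (2 * lam) := by
  have := tor_path h ξ X i (l := 1) (Nat.one_le_iff_ne_zero.2 (NeZero.ne N))
  rw [Nat.cast_one] at this
  simpa using this

theorem tor_corner_avg (hN : N = 2 * n * k) (h : HPot lam Lam M γ V v v2) (ξ : EuclideanSpace ℝ (Fin d)) (q : Fin d → Fin k)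
    {x : Zd d} (hx : x ∈ halfC d n) :
    avg (torH N V ξ) (fun φ => (extT φ (tpos N n q x) - extT φ (corner N n q)) ^ 2) ≤ 2 ^ d * (2 * n) / lam := by
  have hD : 2 * n ≤ N := by
    rw [hN]; exact Nat.le_mul_of_pos_right _ (NeZero.pos k)
  have h0 := tor_displacement h ξ (corner N n q) (fun i => (x i + n).toNat) hD fun i => by
    have := mem_halfC.1 hx i; omega
  have h1 : corner N n q + ∑ i, Pi.single i (((x i + n).toNat : ℕ) : ZMod N) = tpos N n q x := by
    rw [Finset.univ_sum_single (fun i => (((x i + n).toNat : ℕ) : ZMod N))]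
    ext i
    have h2 : ((x i + n).toNat : ℤ) = x i + n := Int.toNat_of_nonneg (by have := mem_halfC.1 hx i; omega)
    have h3 : (((x i + n).toNat : ℕ) : ZMod N) = ((x i + n : ℤ) : ZMod N) := by
      rw [← h2]; simp
    simp only [Pi.add_apply, h3, corner, tpos]
    push_cast
    ring
  rw [h1] at h0
  refine h0.trans (le_of_eq ?_)
  push_cast; ring

theorem tor_site_avg (h : HPot lam Lam M γ V v v2) (ξ : EuclideanSpace ℝ (Fin d)) (a : TorA d N) :
    avg (torH N V ξ) (fun φ => φ a ^ 2) ≤ 2 ^ d * N / lam := by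
  have h0 := tor_displacement h ξ 0 (fun i => (a.1 i).val) le_rfl fun i => (ZMod.val_lt _).le
  rw [zero_add, ← torus_eq_sum a.1] at h0
  simpa using h0

theorem torus_upper (hn : 0 < n) (hN : N = 2 * n * k) (h : HPot lam Lam M γ V v v2) (hV : ∀ t, V (-t) = V t)
    (hV0 : V 0 = 0) {ξ : EuclideanSpace ℝ (Fin d)} {R : ℝ} (hξ : ‖ξ‖ ≤ R) {ℓ : ℕ} (hl : 0 < ℓ) (hln : ℓ ≤ n) :
    Real.log (∫ φ, Real.exp (-torH N V ξ φ)) ≤ k ^ d * boxF d V n ξ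
      + Fintype.card (WallA d n k N) * (Real.log (√(2 * π * N)) + 2 ^ d / (2 * lam))
      + k ^ d * ((nearB d n ℓ).card * Real.log ℓ)
      + k ^ d * (6 * Lam * ((layE d n ℓ).card * (1 / (2 * lam) + (1 / (ℓ : ℝ)) ^ 2 * (2 ^ d * (2 * n) / lam) + R ^ 2))) := by
  classical
  have hLam : lam ≤ Lam := (h.lo 0).trans (h.hi 0)
  have hlam := h.lam_pos
  have hS : (0 : ℝ) < N := Nat.cast_pos.2 (NeZero.pos N)
  set T := localize (d := d) hn hN ℓ with hT
  have hdet := localize_det_pos (d := d) hn hN hl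
  set g : (Fin d → Fin k) → Zd d × Fin d → (TorA d N → ℝ) → ℝ := fun q p φ =>
    (extT φ (tpos N n q p.1 + Pi.single p.2 1) - extT φ (tpos N n q p.1)) ^ 2
      + (1 / (ℓ : ℝ)) ^ 2 * (extT φ (tpos N n q p.1) - extT φ (corner N n q)) ^ 2 + R ^ 2 with hg
  set f : (TorA d N → ℝ) → ℝ := fun φ => 6 * Lam * (∑ q : Fin d → Fin k, ∑ p ∈ layE d n ℓ, g q p φ)
    + (1 / (2 * (N : ℝ))) * ∑ a : WallA d n k N, φ a.1 ^ 2 with hf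
  have tg : ∀ q p, Tame (g q p) := fun q p =>
    ((tor_tame_sq _ _).add ((tor_tame_sq _ _).const_mul _)).add (Tame.const _)
  have tq : ∀ q, Tame fun φ : TorA d N → ℝ => ∑ p ∈ layE d n ℓ, g q p φ := fun q => Tame.sum _ fun p _ => tg q p
  have t1 : Tame fun φ : TorA d N → ℝ => ∑ q : Fin d → Fin k, ∑ p ∈ layE d n ℓ, g q p φ := Tame.sum _ fun q _ => tq q
  have t2 : Tame fun φ : TorA d N → ℝ => ∑ a : WallA d n k N, φ a.1 ^ 2 := Tame.sum _ fun a _ => tame_site a.1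
  have t : Tame f := (t1.const_mul (6 * Lam)).add (t2.const_mul _)
  obtain ⟨hc, C, hC⟩ := t
  have hfH : ∀ φ, fieldH (tileJ d n k N ∘ₗ T) (tileU V N ξ) φ = tileH n k N V N ξ (T φ) := fun φ => rfl
  have hle : ∀ φ, fieldH (tileJ d n k N ∘ₗ T) (tileU V N ξ) φ - torH N V ξ φ ≤ f φ := by
    intro φ
    rw [hfH, torH_eq_sum hn hN, tileH_eq]
    have h1 := Finset.sum_le_sum fun q (_ : q ∈ Finset.univ) => Finset.sum_le_sum fun p (hp : p ∈ halfE d n) =>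
      localize_edge_le (k := k) hn hN h hV hV0 hξ hl hln φ q hp
    have hs : layE d n ℓ ⊆ halfE d n := Finset.filter_subset _ _
    have h2 : ∀ q : Fin d → Fin k, (∑ p ∈ halfE d n, if p ∈ layE d n ℓ then 6 * Lam * g q p φ else 0)
        = 6 * Lam * ∑ p ∈ layE d n ℓ, g q p φ := fun q => by
      rw [← Finset.sum_filter, Finset.filter_mem_eq_inter, Finset.inter_eq_right.2 hs, Finset.mul_sum]
    simp only [Finset.sum_add_distrib] at h1
    have h3 : ∑ a : WallA d n k N, (T φ) a.1 ^ 2 / (2 * (N : ℝ)) = (1 / (2 * (N : ℝ))) * ∑ a : WallA d n k N, φ a.1 ^ 2 := by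
      rw [Finset.mul_sum]
      refine Finset.sum_congr rfl fun a _ => ?_
      have := localize_inl hn hN ℓ φ a
      rw [tileE_inl] at this
      rw [hT, this]; ring
    rw [h3]
    have h4 : ∀ q : Fin d → Fin k, boxH d V n ξ (restr n q (T φ))
        = ∑ p ∈ halfE d n, boxm n p * (2 * V (boxG (restr n q (T φ)) p - ξ p.2)) := fun q => boxH_eq_sum ξ _
    simp only [h4, hf]
    have h5 : ∑ q : Fin d → Fin k, (∑ p ∈ halfE d n, if p ∈ layE d n ℓ then 6 * Lam * g q p φ else 0)
      = 6 * Lam * ∑ q : Fin d → Fin k, ∑ p ∈ layE d n ℓ, g q p φ := by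
      rw [Finset.mul_sum]; exact Finset.sum_congr rfl fun q _ => h2 q
    simp only [hg] at h5 ⊢
    rw [h5] at h1
    linarith
  have hinj : Function.Injective (tileJ d n k N ∘ₗ T) := (tileJ_injective hn hN).comp (localize_injective hn hN hl)
  have h1 := field_gibbs hinj torJ_injective (tile_pot h hS ξ) (tor_pot h ξ)
    (lt_min h.lam_pos (by positivity)) (le_max_of_le_right (min_le_right _ _)) (by linarith) (by linarith) hc hC hle
  have h2 := tileH_log hn hN h hS ξ
  have h3 : avg (torH N V ξ) f ≤ 6 * Lam * (k ^ d * ((layE d n ℓ).card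
      * (1 / (2 * lam) + (1 / (ℓ : ℝ)) ^ 2 * (2 ^ d * (2 * n) / lam) + R ^ 2)))
      + (1 / (2 * (N : ℝ))) * (Fintype.card (WallA d n k N) * (2 ^ d * N / lam)) := by
    have i1 := fun {g : (TorA d N → ℝ) → ℝ} (hg : Tame g) => tor_integrable h ξ hg
    have hI : 0 < ∫ φ, Real.exp (-torH N V ξ φ) := field_integral_pos _ torJ_injective (by linarith) (by linarith) (tor_pot h ξ)
    simp only [hf]
    rw [avg_add (i1 (t1.const_mul (6 * Lam))) (i1 (t2.const_mul _)), avg_const_mul, avg_const_mul,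
      avg_sum (f := fun (q : Fin d → Fin k) (φ : TorA d N → ℝ) => ∑ p ∈ layE d n ℓ, g q p φ) _ fun q _ => i1 (tq q),
      avg_sum (f := fun (a : WallA d n k N) (φ : TorA d N → ℝ) => φ a.1 ^ 2) _ fun a _ => i1 (tame_site a.1)]
    refine add_le_add (mul_le_mul_of_nonneg_left ?_ (by linarith)) (mul_le_mul_of_nonneg_left ?_ (by positivity))
    · have e1 : ∀ q : Fin d → Fin k, avg (torH N V ξ) (fun φ : TorA d N → ℝ => ∑ p ∈ layE d n ℓ, g q p φ)
          ≤ (layE d n ℓ).card * (1 / (2 * lam) + (1 / (ℓ : ℝ)) ^ 2 * (2 ^ d * (2 * n) / lam) + R ^ 2) := fun q => by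
        rw [avg_sum (f := fun (p : Zd d × Fin d) (φ : TorA d N → ℝ) => g q p φ) _ fun p _ => i1 (tg q p), ← nsmul_eq_mul]
        refine Finset.sum_le_card_nsmul _ _ _ fun p hp => ?_
        have hx := (Finset.mem_product.1 (Finset.mem_filter.1 hp).1).1
        simp only [hg]
        rw [avg_add (i1 ((tor_tame_sq _ _).add ((tor_tame_sq _ _).const_mul _))) (i1 (Tame.const _)),
          avg_add (i1 (tor_tame_sq _ _)) (i1 ((tor_tame_sq _ _).const_mul _)), avg_const_mul,
          avg_const (H := torH N V ξ) hI]
        exact add_le_add (add_le_add (tor_edge_avg h ξ _ _)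
          (mul_le_mul_of_nonneg_left (tor_corner_avg hN h ξ q hx) (sq_nonneg _))) le_rfl
      refine (Finset.sum_le_sum fun q _ => e1 q).trans (le_of_eq ?_)
      simp only [Finset.sum_const, Finset.card_univ, nsmul_eq_mul, Fintype.card_pi, Fintype.card_fin, Finset.prod_const,
        Nat.cast_pow]
    · rw [← nsmul_eq_mul, ← Finset.card_univ]
      exact Finset.sum_le_card_nsmul _ _ _ fun a _ => tor_site_avg h ξ a.1
  have h4 : ∫ φ, Real.exp (-fieldH (tileJ d n k N ∘ₗ T) (tileU V N ξ) φ)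
      = (LinearMap.det T)⁻¹ * ∫ φ, Real.exp (-tileH n k N V N ξ φ) := by
    rw [integral_comp_det T hdet fun φ => Real.exp (-tileH n k N V N ξ φ), inv_mul_cancel_left₀ hdet.ne']
    rfl
  have h5 : 0 < ∫ φ, Real.exp (-tileH n k N V N ξ φ) := field_integral_pos _ (tileJ_injective hn hN)
    (lt_min h.lam_pos (by positivity)) (le_max_of_le_right (min_le_right _ _)) (tile_pot h hS ξ)
  rw [h4, Real.log_mul (inv_pos.2 hdet).ne' h5.ne', Real.log_inv, h2] at h1
  have h6 := localize_log_det (d := d) hn hN hl hln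
  have h7 : (1 / (2 * (N : ℝ))) * (Fintype.card (WallA d n k N) * (2 ^ d * N / lam))
      = Fintype.card (WallA d n k N) * (2 ^ d / (2 * lam)) := by
    field_simp
  rw [h7] at h3
  change Real.log (∫ φ, Real.exp (-torH N V ξ φ)) ≤ _ + avg (torH N V ξ) f at h1
  linarith
end Upper

section Rate
variable {d n k N : ℕ} {lam Lam M γ : ℝ} {V v v2 : ℝ → ℝ}

/-- constant for comparing the torus with its tiles -/
def rateC (d : ℕ) (lam Lam R : ℝ) : ℝ :=
  8 * Lam * (4 * d ^ 2 / lam + (4 * (2 * Lam) * R / lam) ^ 2 * (4 * d ^ 2) + 4 * d ^ 2 * gaussC + 4 * d ^ 2 * R ^ 2)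
    + (2 * d * (6 + 2 ^ d / (2 * lam)) + 32 * d + 6 * Lam * (8 * d ^ 2 * (1 / (2 * lam) + 2 ^ d * 2 / lam + R ^ 2)))

theorem rateC_parts {R : ℝ} (hlam : 0 < lam) (hLam : 0 < Lam) :
    0 ≤ 8 * Lam * (4 * d ^ 2 / lam + (4 * (2 * Lam) * R / lam) ^ 2 * (4 * d ^ 2) + 4 * d ^ 2 * gaussC + 4 * d ^ 2 * R ^ 2)
    ∧ 0 ≤ 2 * d * (6 + 2 ^ d / (2 * lam)) + 32 * d + 6 * Lam * (8 * d ^ 2 * (1 / (2 * lam) + 2 ^ d * 2 / lam + R ^ 2)) := by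
  have := gaussC_nonneg
  constructor <;> positivity

theorem rpow_split {W κ : ℝ} (hW : 1 ≤ W) (hd : 1 ≤ d) (hκ : κ ≤ 1 / 4) :
    W ^ (d - 1) * (W ^ (1 / 2 : ℝ) * W ^ (1 / 4 : ℝ)) ≤ W ^ d * W ^ (-κ) := by
  have h0 : 0 < W := by linarith
  have h1 : W ^ d = W ^ (d - 1) * W ^ (1 : ℝ) := by rw [Real.rpow_one, ← pow_succ, Nat.sub_add_cancel hd]
  rw [h1, mul_assoc, ← Real.rpow_add h0, ← Real.rpow_add h0]
  exact mul_le_mul_of_nonneg_left (Real.rpow_le_rpow_of_exponent_le hW (by linarith)) (by positivity)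

theorem rpow_split' {W κ : ℝ} (hW : 1 ≤ W) (hd : 1 ≤ d) (hκ : κ ≤ 1 / 4) : W ^ (d - 1) ≤ W ^ d * W ^ (-κ) := by
  refine le_trans ?_ (rpow_split hW hd hκ)
  exact le_mul_of_one_le_right (by positivity)
    (one_le_mul_of_one_le_of_one_le (Real.one_le_rpow hW (by norm_num)) (Real.one_le_rpow hW (by norm_num)))

theorem card_badE_real : ((badE d n).card : ℝ) ≤ 4 * d ^ 2 * (2 * n + 1 : ℝ) ^ (d - 1) := by
  have h := (card_badE (d := d) (n := n)).trans (Nat.mul_le_mul_right d (card_nearB 1))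
  have h2 : ((badE d n).card : ℝ) ≤ ((d * ((2 * n + 1) ^ (d - 1) * (2 * 1 + 2)) * d : ℕ) : ℝ) := by exact_mod_cast h
  refine h2.trans (le_of_eq ?_)
  push_cast; ring

variable [NeZero N] [NeZero d] [NeZero k]

theorem card_wall_real (hn : 0 < n) (hN : N = 2 * n * k) :
    (Fintype.card (WallA d n k N) : ℝ) ≤ k ^ d * (2 * d * (2 * n + 1 : ℝ) ^ (d - 1)) := by
  have h : ((Fintype.card (WallA d n k N) : ℕ) : ℝ) ≤ ((k ^ d * (d * ((2 * n + 1) ^ (d - 1) * 2)) : ℕ) : ℝ) := by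
    exact_mod_cast card_WallA hn hN
  refine h.trans (le_of_eq ?_)
  push_cast; ring

theorem torus_lower_rate {kk s : ℝ} (hk : 0 < kk) (hs0 : 0 ≤ s) (hs1 : s ≤ 1 / 2)
    (hP4 : ∀ L : ℕ, 1 ≤ L → ∀ g, n4 (gradP (boxJ d L) g) ≤ kk * n4 g)
    (hks : kk ^ s ≤ 1 + lam / (2 * (2 * Lam))) (hn : 0 < n) (hN : N = 2 * n * k) (h : HPot lam Lam M γ V v v2)
    (hV : ∀ t, V (-t) = V t) (hV0 : V 0 = 0) {ξ : EuclideanSpace ℝ (Fin d)} {R : ℝ} (hξ : ‖ξ‖ ≤ R) :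
    k ^ d * boxF d V n ξ ≤ Real.log (∫ φ, Real.exp (-torH N V ξ φ))
      + 8 * Lam * (4 * d ^ 2 / lam + (4 * (2 * Lam) * R / lam) ^ 2 * (4 * d ^ 2) + 4 * d ^ 2 * gaussC + 4 * d ^ 2 * R ^ 2)
        * (k ^ d * ((2 * n + 1 : ℝ) ^ d * (2 * n + 1 : ℝ) ^ (-(s / 2)))) := by
  have hlam := h.lam_pos
  have hLam : 0 < Lam := h.lam_pos.trans_le ((h.lo 0).trans (h.hi 0))
  have hd : 1 ≤ d := NeZero.one_le
  have hd' : (1 : ℝ) ≤ d := by exact_mod_cast hd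
  have h0 := torus_lower hn hN h hV hV0 hξ
  have hW : (1 : ℝ) ≤ 2 * n + 1 := by have : (0 : ℝ) ≤ n := Nat.cast_nonneg n; linarith
  have hνp := boxν_pow d n
  have hν := boxν_pos d n
  have hbad := card_badE_real (d := d) (n := n)
  have hwall := card_wall_real (d := d) hn hN
  have hsp := rpow_split' hW hd (show s / 2 ≤ 1 / 4 by linarith)
  set W : ℝ := 2 * n + 1 with hWdef
  have hW0 : 0 < W := by linarith
  set Y := W ^ d * W ^ (-(s / 2)) with hY
  have hY0 : 0 ≤ Y := by positivity
  set p : ℝ := (4 * d ^ 2 * W ^ (d - 1)) ^ (1 / 4 : ℝ) with hp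
  have hp0 : 0 < p := by positivity
  have hp4 : p ^ 4 = 4 * d ^ 2 * W ^ (d - 1) := by
    rw [hp, ← Real.rpow_natCast, ← Real.rpow_mul (by positivity)]; norm_num
  have hB : ((badB d n).card : ℝ) ≤ p ^ 4 := by
    rw [hp4]
    exact le_trans (by exact_mod_cast card_badB) hbad
  have h1 := box_layer hk hs0 (by linarith) hP4 hks hV h hn hξ (badB d n) hp0 hB
  have h2 : (boxν d n ^ 2 * (p / boxν d n) ^ s) ^ 2 ≤ 4 * d ^ 2 * Y := by
    have e1 : (p / boxν d n) ^ 4 = 4 * d / W := by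
      rw [div_pow, hp4, hνp, show W ^ d = W ^ (d - 1) * W by rw [← pow_succ, Nat.sub_add_cancel hd]]
      field_simp
    have hq : 0 < p / boxν d n := div_pos hp0 hν
    have e2 : ((p / boxν d n) ^ s) ^ 2 = (4 * d / W) ^ (s / 2) := by
      rw [← e1, ← Real.rpow_natCast, ← Real.rpow_natCast, ← Real.rpow_mul hq.le, ← Real.rpow_mul hq.le]
      congr 1; push_cast; ring
    have e3 : (4 * d / W) ^ (s / 2) ≤ 4 * d * W ^ (-(s / 2)) := by
      rw [Real.div_rpow (by positivity) hW0.le, Real.rpow_neg hW0.le, div_eq_mul_inv]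
      refine mul_le_mul_of_nonneg_right ?_ (by positivity)
      calc (4 * d : ℝ) ^ (s / 2) ≤ (4 * d : ℝ) ^ (1 : ℝ) :=
            Real.rpow_le_rpow_of_exponent_le (by linarith) (by linarith)
        _ = 4 * d := Real.rpow_one _
    rw [mul_pow, e2, ← pow_mul, hνp]
    calc d * W ^ d * (4 * d / W) ^ (s / 2) ≤ d * W ^ d * (4 * d * W ^ (-(s / 2))) :=
          mul_le_mul_of_nonneg_left e3 (by positivity)
      _ = 4 * d ^ 2 * Y := by rw [hY]; ring
  have h3 : (4 * (2 * Lam) * R / lam * boxν d n ^ 2 * (p / boxν d n) ^ s) ^ 2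
      ≤ (4 * (2 * Lam) * R / lam) ^ 2 * (4 * d ^ 2) * Y := by
    rw [mul_assoc, mul_pow _ (boxν d n ^ 2 * _), mul_assoc _ (4 * (d : ℝ) ^ 2)]
    exact mul_le_mul_of_nonneg_left h2 (sq_nonneg _)
  have hbad' : ((badE d n).card : ℝ) ≤ 4 * d ^ 2 * Y := hbad.trans (mul_le_mul_of_nonneg_left hsp (by positivity))
  have h4 : ((badB d n).card : ℝ) / lam ≤ 4 * d ^ 2 / lam * Y := by
    rw [div_mul_eq_mul_div]
    exact div_le_div_of_nonneg_right (le_trans (by exact_mod_cast card_badB) hbad') hlam.le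
  have h5 : (Fintype.card (WallA d n k N) : ℝ) * gaussC ≤ k ^ d * (2 * d * Y) * gaussC :=
    mul_le_mul_of_nonneg_right (hwall.trans (mul_le_mul_of_nonneg_left (mul_le_mul_of_nonneg_left hsp (by positivity))
      (by positivity))) gaussC_nonneg
  have h6 : (k : ℝ) ^ d * ((badE d n).card * R ^ 2) ≤ k ^ d * (4 * d ^ 2 * Y * R ^ 2) :=
    mul_le_mul_of_nonneg_left (mul_le_mul_of_nonneg_right hbad' (sq_nonneg _)) (by positivity)
  have h7 := mul_le_mul_of_nonneg_left (h1.trans (add_le_add h4 h3)) (show (0 : ℝ) ≤ (k : ℝ) ^ d by positivity)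
  have h8 := mul_le_mul_of_nonneg_left h5 (show (0 : ℝ) ≤ 2 * d by positivity)
  have h9 := mul_le_mul_of_nonneg_left (add_le_add (add_le_add h7 h8) h6) (show (0 : ℝ) ≤ 8 * Lam by positivity)
  refine h0.trans ((add_le_add le_rfl h9).trans (le_of_eq ?_))
  ring

theorem torus_upper_rate {s : ℝ} (hs1 : s ≤ 1 / 2) (hn : 2 ≤ n) (hk : k ≤ 2 * n)
    (hN : N = 2 * n * k) (h : HPot lam Lam M γ V v v2)
    (hV : ∀ t, V (-t) = V t) (hV0 : V 0 = 0) {ξ : EuclideanSpace ℝ (Fin d)} {R : ℝ} (hξ : ‖ξ‖ ≤ R) :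
    Real.log (∫ φ, Real.exp (-torH N V ξ φ)) ≤ k ^ d * boxF d V n ξ
      + (2 * d * (6 + 2 ^ d / (2 * lam)) + 32 * d + 6 * Lam * (8 * d ^ 2 * (1 / (2 * lam) + 2 ^ d * 2 / lam + R ^ 2)))
        * (k ^ d * ((2 * n + 1 : ℝ) ^ d * (2 * n + 1 : ℝ) ^ (-(s / 2)))) := by
  have hlam := h.lam_pos
  have hLam : 0 < Lam := h.lam_pos.trans_le ((h.lo 0).trans (h.hi 0))
  have hd : 1 ≤ d := NeZero.one_le
  have hn0 : 0 < n := by omega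
  have hn2 : (2 : ℝ) ≤ n := by exact_mod_cast hn
  have hl0 : 0 < Nat.sqrt n + 1 := Nat.succ_pos _
  have hln : Nat.sqrt n + 1 ≤ n := Nat.sqrt_lt_self (by omega)
  have hr1 : 1 ≤ Nat.sqrt n := Nat.sqrt_pos.2 hn0
  have hr2 : Nat.sqrt n * Nat.sqrt n ≤ n := Nat.sqrt_le n
  have hr3 : n < (Nat.sqrt n + 1) * (Nat.sqrt n + 1) := Nat.lt_succ_sqrt n
  have h0 := torus_upper hn0 hN h hV hV0 hξ hl0 hln
  have hnear : ((nearB d n (Nat.sqrt n + 1)).card : ℝ)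
      ≤ ((d * ((2 * n + 1) ^ (d - 1) * (2 * (Nat.sqrt n + 1) + 2)) : ℕ) : ℝ) := by exact_mod_cast card_nearB _
  have hlay : ((layE d n (Nat.sqrt n + 1)).card : ℝ)
      ≤ ((d * ((2 * n + 1) ^ (d - 1) * (2 * (Nat.sqrt n + 1 + 1) + 2)) * d : ℕ) : ℝ) := by
    exact_mod_cast (card_layE _).trans (Nat.mul_le_mul_right d (card_nearB _))
  have hwall := card_wall_real (d := d) hn0 hN
  have hNn : (N : ℝ) ≤ (2 * n) ^ 2 := by
    rw [hN]
    have : (k : ℝ) ≤ 2 * n := by exact_mod_cast hk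
    push_cast
    rw [sq]
    exact mul_le_mul_of_nonneg_left this (by positivity)
  have hN1 : (1 : ℝ) ≤ N := by exact_mod_cast (NeZero.one_le : 1 ≤ N)
  push_cast at hnear hlay h0
  generalize hr : (Nat.sqrt n : ℝ) = r at *
  have hr1' : (1 : ℝ) ≤ r := by rw [← hr]; exact_mod_cast hr1
  have hr2' : r ^ 2 ≤ n := by rw [← hr, sq]; exact_mod_cast hr2
  have hr3' : (n : ℝ) < (r + 1) ^ 2 := by rw [← hr, sq]; exact_mod_cast hr3
  have hlln : r + 1 ≤ n := by rw [← hr]; exact_mod_cast hln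
  set W : ℝ := 2 * n + 1 with hWdef
  have hW : 1 ≤ W := by linarith
  have hW0 : 0 < W := by linarith
  have hsp := rpow_split hW hd (show s / 2 ≤ 1 / 4 by linarith)
  set Y := W ^ d * W ^ (-(s / 2)) with hY
  have hY0 : 0 ≤ Y := by positivity
  have hA1 : 1 ≤ W ^ (1 / 2 : ℝ) := Real.one_le_rpow hW (by norm_num)
  have hB1 : 1 ≤ W ^ (1 / 4 : ℝ) := Real.one_le_rpow hW (by norm_num)
  have hrA : r ≤ W ^ (1 / 2 : ℝ) := by
    rw [← Real.sqrt_eq_rpow]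
    exact Real.le_sqrt_of_sq_le (by linarith)
  have hlogW : Real.log W ≤ 4 * W ^ (1 / 4 : ℝ) := by
    have := Real.log_le_rpow_div hW0.le (show (0 : ℝ) < 1 / 4 by norm_num)
    linarith
  generalize hA : W ^ (1 / 2 : ℝ) = A at *
  generalize hB : W ^ (1 / 4 : ℝ) = B at *
  have hlog : Real.log (r + 1) ≤ 4 * B := (Real.log_le_log (by linarith) (by linarith)).trans hlogW
  have hlog0 : 0 ≤ Real.log (r + 1) := Real.log_nonneg (by linarith)
  have hlogN : Real.log (√(2 * π * N)) ≤ 6 * B := by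
    have e1 : √(2 * π * N) ≤ 3 * W := by
      refine Real.sqrt_le_iff.2 ⟨by linarith, ?_⟩
      have := Real.pi_lt_d2
      have e2 : 2 * π * N ≤ 6.3 * N := mul_le_mul_of_nonneg_right (by linarith) (by linarith)
      have e3 : (2 * (n : ℝ)) ^ 2 ≤ W ^ 2 := pow_le_pow_left₀ (by positivity) (by linarith) 2
      have e4 : 0 ≤ W ^ 2 := sq_nonneg _
      rw [mul_pow]; linarith
    have e5 : 0 < √(2 * π * N) := Real.sqrt_pos.2 (by positivity)
    refine (Real.log_le_log e5 e1).trans ?_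
    rw [Real.log_mul (by norm_num) hW0.ne']
    have := Real.log_le_sub_one_of_pos (show (0 : ℝ) < 3 by norm_num)
    linarith
  have hP0 : 0 ≤ W ^ (d - 1) := by positivity
  have hk0 : (0 : ℝ) ≤ (k : ℝ) ^ d := by positivity
  have hsp1 : W ^ (d - 1) * B ≤ Y :=
    (mul_le_mul_of_nonneg_left (le_mul_of_one_le_left (by linarith) hA1) hP0).trans hsp
  have hsp2 : W ^ (d - 1) * A ≤ Y :=
    (mul_le_mul_of_nonneg_left (le_mul_of_one_le_right (by linarith) hB1) hP0).trans hsp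
  have b1 : (Fintype.card (WallA d n k N) : ℝ) * (Real.log (√(2 * π * N)) + 2 ^ d / (2 * lam))
      ≤ k ^ d * (2 * d * (6 + 2 ^ d / (2 * lam)) * Y) := by
    have e0 : 0 ≤ (2 : ℝ) ^ d / (2 * lam) := by positivity
    have e1 : Real.log (√(2 * π * N)) + 2 ^ d / (2 * lam) ≤ (6 + 2 ^ d / (2 * lam)) * B := by
      have := le_mul_of_one_le_right e0 hB1
      linarith
    calc (Fintype.card (WallA d n k N) : ℝ) * (Real.log (√(2 * π * N)) + 2 ^ d / (2 * lam))
        ≤ Fintype.card (WallA d n k N) * ((6 + 2 ^ d / (2 * lam)) * B) := mul_le_mul_of_nonneg_left e1 (by positivity)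
      _ ≤ (k ^ d * (2 * d * W ^ (d - 1))) * ((6 + 2 ^ d / (2 * lam)) * B) := mul_le_mul_of_nonneg_right hwall (by positivity)
      _ = k ^ d * (2 * d * (6 + 2 ^ d / (2 * lam))) * (W ^ (d - 1) * B) := by ring
      _ ≤ k ^ d * (2 * d * (6 + 2 ^ d / (2 * lam))) * Y := mul_le_mul_of_nonneg_left hsp1 (by positivity)
      _ = _ := by ring
  have b2 : ((nearB d n (Nat.sqrt n + 1)).card : ℝ) * Real.log (r + 1) ≤ 32 * d * Y := by
    calc ((nearB d n (Nat.sqrt n + 1)).card : ℝ) * Real.log (r + 1)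
        ≤ (d * (W ^ (d - 1) * (2 * (r + 1) + 2))) * (4 * B) := mul_le_mul hnear hlog hlog0 (by positivity)
      _ = d * (W ^ (d - 1) * (4 * B)) * (2 * (r + 1) + 2) := by ring
      _ ≤ d * (W ^ (d - 1) * (4 * B)) * (8 * A) := mul_le_mul_of_nonneg_left (by linarith) (by positivity)
      _ = 32 * d * (W ^ (d - 1) * (A * B)) := by ring
      _ ≤ 32 * d * Y := mul_le_mul_of_nonneg_left hsp (by positivity)
  have b3 : ((layE d n (Nat.sqrt n + 1)).card : ℝ) * (1 / (2 * lam) + (1 / (r + 1)) ^ 2 * (2 ^ d * (2 * n) / lam) + R ^ 2)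
      ≤ 8 * d ^ 2 * (1 / (2 * lam) + 2 ^ d * 2 / lam + R ^ 2) * Y := by
    have e1 : (1 / (r + 1)) ^ 2 * (2 ^ d * (2 * n) / lam) ≤ 2 ^ d * 2 / lam := by
      have : (1 / (r + 1)) ^ 2 * n ≤ 1 := by
        rw [div_pow, one_pow, one_div, inv_mul_le_one₀ (by positivity)]; exact hr3'.le
      calc (1 / (r + 1)) ^ 2 * (2 ^ d * (2 * n) / lam) = ((1 / (r + 1)) ^ 2 * n) * (2 ^ d * 2 / lam) := by ring
        _ ≤ 1 * (2 ^ d * 2 / lam) := mul_le_mul_of_nonneg_right this (by positivity)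
        _ = _ := one_mul _
    calc ((layE d n (Nat.sqrt n + 1)).card : ℝ) * (1 / (2 * lam) + (1 / (r + 1)) ^ 2 * (2 ^ d * (2 * n) / lam) + R ^ 2)
        ≤ (d * (W ^ (d - 1) * (2 * (r + 1 + 1) + 2)) * d) * (1 / (2 * lam) + 2 ^ d * 2 / lam + R ^ 2) :=
          mul_le_mul hlay (by linarith) (by positivity) (by positivity)
      _ = d ^ 2 * (1 / (2 * lam) + 2 ^ d * 2 / lam + R ^ 2) * W ^ (d - 1) * (2 * (r + 1 + 1) + 2) := by ring
      _ ≤ d ^ 2 * (1 / (2 * lam) + 2 ^ d * 2 / lam + R ^ 2) * W ^ (d - 1) * (8 * A) :=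
          mul_le_mul_of_nonneg_left (by linarith) (by positivity)
      _ = 8 * d ^ 2 * (1 / (2 * lam) + 2 ^ d * 2 / lam + R ^ 2) * (W ^ (d - 1) * A) := by ring
      _ ≤ _ := mul_le_mul_of_nonneg_left hsp2 (by positivity)
  have c2 := mul_le_mul_of_nonneg_left b2 hk0
  have c3 := mul_le_mul_of_nonneg_left (mul_le_mul_of_nonneg_left b3 (show (0 : ℝ) ≤ 6 * Lam by positivity)) hk0
  refine h0.trans ((add_le_add (add_le_add (add_le_add le_rfl b1) c2) c3).trans (le_of_eq ?_))
  ring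
end Rate

section Dyadic

theorem dyadic_cauchy {b : ℕ → ℝ} {D κ : ℝ} (hD : 0 ≤ D) (hκ : 0 < κ)
    (h : ∀ n m : ℕ, 2 ≤ n → n ≤ m → m ≤ 2 * n → |b n - b m| ≤ D * (n : ℝ) ^ (-κ)) :
    ∀ n m : ℕ, 2 ≤ n → n ≤ m → |b n - b m| ≤ D / (1 - 2 ^ (-κ)) * (n : ℝ) ^ (-κ) := by
  have h2 : (2 : ℝ) ^ (-κ) < 1 := Real.rpow_lt_one_of_one_lt_of_neg (by norm_num) (by linarith)
  have h2' : (0 : ℝ) < 2 ^ (-κ) := by positivity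
  have hD' : D ≤ D / (1 - 2 ^ (-κ)) := by
    rw [le_div_iff₀ (by linarith)]
    exact mul_le_of_le_one_right hD (by linarith)
  have key : ∀ j n m : ℕ, m - n ≤ j → 2 ≤ n → n ≤ m → |b n - b m| ≤ D / (1 - 2 ^ (-κ)) * (n : ℝ) ^ (-κ) := by
    intro j
    induction j with
    | zero =>
      intro n m hj hn hnm
      have : m = n := by omega
      subst this
      rw [sub_self, abs_zero]
      exact mul_nonneg (hD.trans hD') (by positivity)
    | succ j ih =>
      intro n m hj hn hnm
      by_cases hm : m ≤ 2 * n
      · exact (h n m hn hnm hm).trans (mul_le_mul_of_nonneg_right hD' (by positivity))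
      · have e1 := h n (2 * n) hn (by omega) le_rfl
        have e2 := ih (2 * n) m (by omega) (by omega) (by omega)
        have e3 := abs_sub_le (b n) (b (2 * n)) (b m)
        push_cast at e2
        rw [Real.mul_rpow (by norm_num) (Nat.cast_nonneg n)] at e2
        have e4 : D * (n : ℝ) ^ (-κ) + D / (1 - 2 ^ (-κ)) * (2 ^ (-κ) * (n : ℝ) ^ (-κ))
            = D / (1 - 2 ^ (-κ)) * (n : ℝ) ^ (-κ) := by
          field_simp [show (1 : ℝ) - 2 ^ (-κ) ≠ 0 by linarith]
          ring
        linarith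
  exact fun n m => key (m - n) n m le_rfl

theorem abs_pow_sub_pow_le_mul {x y : ℝ} (hx : |x| ≤ 1) (hy : |y| ≤ 1) (d : ℕ) : |x ^ d - y ^ d| ≤ d * |x - y| := by
  induction d with
  | zero => simp
  | succ d ih =>
    have e : x ^ (d + 1) - y ^ (d + 1) = x ^ d * (x - y) + (x ^ d - y ^ d) * y := by ring
    rw [e]
    refine (abs_add_le _ _).trans ?_
    rw [abs_mul, abs_mul, abs_pow]
    have h1 := mul_le_of_le_one_left (abs_nonneg (x - y)) (pow_le_one₀ (abs_nonneg x) hx : |x| ^ d ≤ 1)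
    have h2 := mul_le_of_le_one_right (abs_nonneg (x ^ d - y ^ d)) hy
    push_cast
    linarith
end Dyadic

section PairRate
variable {d n m N : ℕ} {lam Lam M γ kk s : ℝ} {V v v2 : ℝ → ℝ} [NeZero d]

theorem torus_rate [NeZero N] {k : ℕ} [NeZero k] (hk : 0 < kk) (hs0 : 0 ≤ s) (hs1 : s ≤ 1 / 2)
    (hP4 : ∀ L : ℕ, 1 ≤ L → ∀ g, n4 (gradP (boxJ d L) g) ≤ kk * n4 g)
    (hks : kk ^ s ≤ 1 + lam / (2 * (2 * Lam))) (hn : 2 ≤ n) (hkn : k ≤ 2 * n) (hN : N = 2 * n * k)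
    (h : HPot lam Lam M γ V v v2)
    (hV : ∀ t, V (-t) = V t) (hV0 : V 0 = 0) {ξ : EuclideanSpace ℝ (Fin d)} {R : ℝ} (hξ : ‖ξ‖ ≤ R) :
    |Real.log (∫ φ, Real.exp (-torH N V ξ φ)) - k ^ d * boxF d V n ξ|
      ≤ rateC d lam Lam R * (k ^ d * ((2 * n + 1 : ℝ) ^ d * (2 * n + 1 : ℝ) ^ (-(s / 2)))) := by
  have hLam : 0 < Lam := h.lam_pos.trans_le ((h.lo 0).trans (h.hi 0))
  have h1 := torus_lower_rate hk hs0 hs1 hP4 hks (by omega) hN h hV hV0 hξ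
  have h2 := torus_upper_rate hs1 hn hkn hN h hV hV0 hξ
  obtain ⟨p1, p2⟩ := rateC_parts (d := d) (R := R) h.lam_pos hLam
  have hY : 0 ≤ (k : ℝ) ^ d * ((2 * n + 1 : ℝ) ^ d * (2 * n + 1 : ℝ) ^ (-(s / 2))) := by positivity
  have q1 := mul_nonneg p1 hY
  have q2 := mul_nonneg p2 hY
  rw [rateC, add_mul, abs_le]
  constructor <;> linarith

/-- increments of the log partition function per tile -/
def boxb (d : ℕ) (V : ℝ → ℝ) (ξ : EuclideanSpace ℝ (Fin d)) (n : ℕ) : ℝ := (boxF d V n ξ - boxF d V n 0) / (n : ℝ) ^ d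

theorem rateC_nonneg {R : ℝ} (hlam : 0 < lam) (hLam : 0 < Lam) : 0 ≤ rateC d lam Lam R :=
  add_nonneg (rateC_parts hlam hLam).1 (rateC_parts hlam hLam).2

theorem boxb_pair (hk : 0 < kk) (hs0 : 0 ≤ s) (hs1 : s ≤ 1 / 2)
    (hP4 : ∀ L : ℕ, 1 ≤ L → ∀ g, n4 (gradP (boxJ d L) g) ≤ kk * n4 g)
    (hks : kk ^ s ≤ 1 + lam / (2 * (2 * Lam))) (h : HPot lam Lam M γ V v v2)
    (hV : ∀ t, V (-t) = V t) (hV0 : V 0 = 0) {ξ : EuclideanSpace ℝ (Fin d)} {R : ℝ} (hξ : ‖ξ‖ ≤ R)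
    (hn : 2 ≤ n) (hnm : n ≤ m) (hm : m ≤ 2 * n) :
    |boxb d V ξ n - boxb d V ξ m| ≤ 4 * 3 ^ d * rateC d lam Lam R * (n : ℝ) ^ (-(s / 2)) := by
  have hLam : 0 < Lam := h.lam_pos.trans_le ((h.lo 0).trans (h.hi 0))
  have hR : ‖(0 : EuclideanSpace ℝ (Fin d))‖ ≤ R := by rw [norm_zero]; exact (norm_nonneg _).trans hξ
  have : NeZero n := ⟨by omega⟩
  have : NeZero m := ⟨by omega⟩
  have : NeZero (2 * n * m) := ⟨(Nat.mul_pos (by omega) (by omega)).ne'⟩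
  have hN2 : 2 * n * m = 2 * m * n := by ring
  have a1 := torus_rate (N := 2 * n * m) hk hs0 hs1 hP4 hks hn hm rfl h hV hV0 hξ
  have a2 := torus_rate (N := 2 * n * m) hk hs0 hs1 hP4 hks hn hm rfl h hV hV0 hR
  have a3 := torus_rate (N := 2 * n * m) hk hs0 hs1 hP4 hks (hn.trans hnm) (by omega : n ≤ 2 * m) hN2 h hV hV0 hξ
  have a4 := torus_rate (N := 2 * n * m) hk hs0 hs1 hP4 hks (hn.trans hnm) (by omega : n ≤ 2 * m) hN2 h hV hV0 hR
  have hC := rateC_nonneg (d := d) (R := R) h.lam_pos hLam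
  have hn2 : (2 : ℝ) ≤ n := by exact_mod_cast hn
  have hnm' : (n : ℝ) ≤ m := by exact_mod_cast hnm
  have hW : ∀ j : ℕ, n ≤ j → (2 * j + 1 : ℝ) ^ d * (2 * j + 1 : ℝ) ^ (-(s / 2)) ≤ 3 ^ d * (j : ℝ) ^ d * (n : ℝ) ^ (-(s / 2)) := by
    intro j hj
    have hj' : (n : ℝ) ≤ j := by exact_mod_cast hj
    refine mul_le_mul ?_ ?_ (by positivity) (by positivity)
    · rw [← mul_pow]; exact pow_le_pow_left₀ (by positivity) (by linarith) d
    · exact Real.rpow_le_rpow_of_nonpos (by linarith) (by linarith) (by linarith)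
  have w1 := mul_le_mul_of_nonneg_left (mul_le_mul_of_nonneg_left (hW n le_rfl) (show (0 : ℝ) ≤ (m : ℝ) ^ d by positivity)) hC
  have w2 := mul_le_mul_of_nonneg_left (mul_le_mul_of_nonneg_left (hW m hnm) (show (0 : ℝ) ≤ (n : ℝ) ^ d by positivity)) hC
  have b1 := a1.trans w1
  have b2 := a2.trans w1
  have b3 := a3.trans w2
  have b4 := a4.trans w2
  have hn0 : (0 : ℝ) < (n : ℝ) ^ d := by positivity
  have hm0 : (0 : ℝ) < (m : ℝ) ^ d := pow_pos (by linarith) d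
  have e : boxb d V ξ n - boxb d V ξ m
      = ((m : ℝ) ^ d * boxF d V n ξ - m ^ d * boxF d V n 0 - (n ^ d * boxF d V m ξ - n ^ d * boxF d V m 0)) / (n ^ d * m ^ d) := by
    unfold boxb; field_simp
  rw [e, abs_div, abs_of_pos (mul_pos hn0 hm0), div_le_iff₀ (mul_pos hn0 hm0)]
  rw [abs_le] at b1 b2 b3 b4 ⊢
  constructor <;> linarith

/-- bound for the increments of the log partition function -/
def growC (d : ℕ) (lam Lam R : ℝ) : ℝ :=
  2 * Lam * (1 / lam + (4 * (2 * Lam) * R / lam) ^ 2 + 7 * R ^ 2) * (d * 3 ^ d)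

theorem abs_boxb_le (hk : 0 < kk) (hs0 : 0 ≤ s) (hs1 : s ≤ 1 / 2)
    (hP4 : ∀ L : ℕ, 1 ≤ L → ∀ g, n4 (gradP (boxJ d L) g) ≤ kk * n4 g)
    (hks : kk ^ s ≤ 1 + lam / (2 * (2 * Lam))) (h : HPot lam Lam M γ V v v2)
    (hV : ∀ t, V (-t) = V t) {ξ : EuclideanSpace ℝ (Fin d)} {R : ℝ} (hξ : ‖ξ‖ ≤ R) (hn : 1 ≤ n) :
    |boxb d V ξ n| ≤ growC d lam Lam R := by
  have hLam : 0 < Lam := h.lam_pos.trans_le ((h.lo 0).trans (h.hi 0))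
  have hlam := h.lam_pos
  have hR : ‖(0 : EuclideanSpace ℝ (Fin d))‖ ≤ R := by rw [norm_zero]; exact (norm_nonneg _).trans hξ
  have h1 := boxF_le hk hs0 (by linarith) hP4 hks hV h hn hξ hR
  have h2 := boxF_le hk hs0 (by linarith) hP4 hks hV h hn hR hξ
  have hn1 : (1 : ℝ) ≤ n := by exact_mod_cast hn
  have hn0 : (0 : ℝ) < (n : ℝ) ^ d := by positivity
  have h3 : (2 * n + 1 : ℝ) ^ d ≤ 3 ^ d * (n : ℝ) ^ d := by
    rw [← mul_pow]; exact pow_le_pow_left₀ (by positivity) (by linarith) d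
  have h4 : 2 * Lam * (1 / lam + (4 * (2 * Lam) * R / lam) ^ 2 + 7 * R ^ 2) * (d * (2 * n + 1 : ℝ) ^ d)
      ≤ growC d lam Lam R * (n : ℝ) ^ d := by
    calc _ ≤ 2 * Lam * (1 / lam + (4 * (2 * Lam) * R / lam) ^ 2 + 7 * R ^ 2) * (d * (3 ^ d * (n : ℝ) ^ d)) := by gcongr
      _ = _ := by rw [growC]; ring
  rw [boxb, abs_div, abs_of_pos hn0, div_le_iff₀ hn0, abs_le]
  constructor <;> linarith

/-- rate constant for the surface tension -/
def tensC (d : ℕ) (lam Lam R s : ℝ) : ℝ :=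
  4 * 3 ^ d * rateC d lam Lam R / (1 - 2 ^ (-(s / 2))) + growC d lam Lam R * d

theorem sigmaL_cauchy (hk : 0 < kk) (hs0 : 0 < s) (hs1 : s ≤ 1 / 2)
    (hP4 : ∀ L : ℕ, 1 ≤ L → ∀ g, n4 (gradP (boxJ d L) g) ≤ kk * n4 g)
    (hks : kk ^ s ≤ 1 + lam / (2 * (2 * Lam))) (h : HPot lam Lam M γ V v v2)
    (hV : ∀ t, V (-t) = V t) (hV0 : V 0 = 0) {ξ : EuclideanSpace ℝ (Fin d)} {R : ℝ} (hξ : ‖ξ‖ ≤ R)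
    (hn : 2 ≤ n) (hnm : n ≤ m) :
    |sigmaL d V n ξ - sigmaL d V m ξ| ≤ tensC d lam Lam R s * (n : ℝ) ^ (-(s / 2)) := by
  have hLam : 0 < Lam := h.lam_pos.trans_le ((h.lo 0).trans (h.hi 0))
  have hC := rateC_nonneg (d := d) (R := R) h.lam_pos hLam
  have h1 := dyadic_cauchy (b := boxb d V ξ) (D := 4 * 3 ^ d * rateC d lam Lam R) (κ := s / 2) (by positivity) (by linarith)
    (fun n m hn hnm hm => boxb_pair hk hs0.le hs1 hP4 hks h hV hV0 hξ hn hnm hm) n m hn hnm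
  have h2 := abs_boxb_le (n := m) hk hs0.le hs1 hP4 hks h hV hξ (by omega)
  have hn2 : (2 : ℝ) ≤ n := by exact_mod_cast hn
  have hnm' : (n : ℝ) ≤ m := by exact_mod_cast hnm
  have hsig : ∀ j : ℕ, 2 ≤ j → sigmaL d V j ξ = -(boxb d V ξ j * ((j : ℝ) / (2 * j + 1)) ^ d) := by
    intro j hj
    have hj2 : (2 : ℝ) ≤ j := by exact_mod_cast hj
    have : (0 : ℝ) < (j : ℝ) ^ d := by positivity
    rw [sigmaL_eq hV h, boxb, div_pow]
    field_simp
  set r : ℝ := n / (2 * n + 1) with hr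
  set r' : ℝ := m / (2 * m + 1) with hr'
  have hm0 : (0 : ℝ) < 2 * m + 1 := by linarith
  have hn0 : (0 : ℝ) < 2 * n + 1 := by linarith
  have r0 : 0 ≤ r := by positivity
  have r0' : 0 ≤ r' := by positivity
  have r1 : r ≤ 1 := (div_le_one hn0).2 (by linarith)
  have r1' : r' ≤ 1 := (div_le_one hm0).2 (by linarith)
  have hrr : |r - r'| ≤ (n : ℝ) ^ (-(s / 2)) := by
    have e1 : r' - r = (m - n) / ((2 * m + 1) * (2 * n + 1)) := by rw [hr, hr']; field_simp; ring
    have e2 : r' - r ≤ 1 / n := by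
      rw [e1, div_le_div_iff₀ (by positivity) (by linarith)]
      nlinarith
    have e3 : 0 ≤ r' - r := by rw [e1]; exact div_nonneg (by linarith) (by positivity)
    rw [abs_sub_comm, abs_of_nonneg e3]
    refine e2.trans ?_
    rw [one_div, ← Real.rpow_neg_one]
    exact Real.rpow_le_rpow_of_exponent_le (by linarith) (by linarith)
  have h3 := abs_pow_sub_pow_le_mul (by rwa [abs_of_nonneg r0]) (by rwa [abs_of_nonneg r0'] : |r'| ≤ 1) d
  rw [hsig n hn, hsig m (hn.trans hnm)]
  have e : -(boxb d V ξ n * r ^ d) - -(boxb d V ξ m * r' ^ d)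
      = -((boxb d V ξ n - boxb d V ξ m) * r ^ d + boxb d V ξ m * (r ^ d - r' ^ d)) := by ring
  rw [e, abs_neg]
  refine (abs_add_le _ _).trans ?_
  rw [abs_mul, abs_mul, abs_of_nonneg (pow_nonneg r0 d)]
  have h4 : |boxb d V ξ n - boxb d V ξ m| * r ^ d ≤ 4 * 3 ^ d * rateC d lam Lam R / (1 - 2 ^ (-(s / 2))) * (n : ℝ) ^ (-(s / 2)) :=
    (mul_le_of_le_one_right (abs_nonneg _) (pow_le_one₀ r0 r1)).trans h1
  have h5 : |boxb d V ξ m| * |r ^ d - r' ^ d| ≤ growC d lam Lam R * (d * (n : ℝ) ^ (-(s / 2))) :=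
    mul_le_mul h2 (h3.trans (mul_le_mul_of_nonneg_left hrr (Nat.cast_nonneg d))) (abs_nonneg _) ((abs_nonneg _).trans h2)
  rw [tensC]
  linarith
end PairRate

section Interpolation
variable {E : Type*} [NormedAddCommGroup E] [NormedSpace ℝ E]

theorem exists_limit_of_rate {W : Type*} [NormedAddCommGroup W] [CompleteSpace W] {F : ℕ → E → W} {T : ℝ → ℝ} {a : ℕ → ℝ}
    (ha : Tendsto a atTop (nhds 0))
    (h : ∀ (R : ℝ) (n m : ℕ) (x : E), 2 ≤ n → n ≤ m → ‖x‖ ≤ R → ‖F n x - F m x‖ ≤ T R * a n) :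
    ∃ G : E → W, (∀ x, Tendsto (fun n => F n x) atTop (nhds (G x))) ∧
      (∀ (R : ℝ) (n : ℕ) (x : E), 2 ≤ n → ‖x‖ ≤ R → ‖F n x - G x‖ ≤ T R * a n) ∧
      TendstoLocallyUniformlyOn F G atTop Set.univ := by
  have hT : ∀ R, Tendsto (fun n => T R * a n) atTop (nhds 0) := fun R => by simpa using ha.const_mul (T R)
  have hc : ∀ x, CauchySeq fun n => F n x := by
    refine fun x => Metric.cauchySeq_iff'.2 fun ε hε => ?_
    obtain ⟨N, hN, hN2⟩ := (((hT ‖x‖).eventually (gt_mem_nhds hε)).and (eventually_ge_atTop 2)).exists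
    refine ⟨N, fun n hn => ?_⟩
    rw [dist_comm, dist_eq_norm]
    exact (h _ N n x hN2 hn le_rfl).trans_lt hN
  choose G hG using fun x => cauchySeq_tendsto_of_complete (hc x)
  have hrate : ∀ (R : ℝ) (n : ℕ) (x : E), 2 ≤ n → ‖x‖ ≤ R → ‖F n x - G x‖ ≤ T R * a n := fun R n x hn hx =>
    le_of_tendsto ((tendsto_const_nhds.sub (hG x)).norm) ((eventually_ge_atTop n).mono fun m hm => h R n m x hn hm hx)
  refine ⟨G, hG, hrate, Metric.tendstoLocallyUniformlyOn_iff.2 fun ε hε x _ => ?_⟩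
  refine ⟨Metric.ball x 1, mem_nhdsWithin_of_mem_nhds (Metric.ball_mem_nhds x one_pos), ?_⟩
  filter_upwards [(hT (‖x‖ + 1)).eventually (gt_mem_nhds hε), eventually_ge_atTop 2] with n hn hn2 y hy
  rw [dist_comm, dist_eq_norm]
  refine (hrate (‖x‖ + 1) n y hn2 ?_).trans_lt hn
  have h1 := norm_sub_norm_le y x
  rw [Metric.mem_ball, dist_eq_norm] at hy
  linarith

theorem holder_limit {W : Type*} [NormedAddCommGroup W] {F : ℕ → E → W} {G : E → W} {H b : ℝ} (hb : 0 < b)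
    (hG : ∀ x, Tendsto (fun n => F n x) atTop (nhds (G x)))
    (hol : ∀ n, 2 ≤ n → ∀ x y, ‖F n x - F n y‖ ≤ H * ‖x - y‖ ^ b) :
    (∀ x y, ‖G x - G y‖ ≤ H * ‖x - y‖ ^ b) ∧ Continuous G := by
  have hh : ∀ x y, ‖G x - G y‖ ≤ H * ‖x - y‖ ^ b := fun x y =>
    le_of_tendsto ((hG x).sub (hG y)).norm ((eventually_ge_atTop 2).mono fun n hn => hol n hn x y)
  refine ⟨hh, continuous_iff_continuousAt.2 fun x => tendsto_iff_norm_sub_tendsto_zero.2 ?_⟩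
  have h0 : Tendsto (fun y => H * ‖y - x‖ ^ b) (nhds x) (nhds 0) := by
    have : Continuous fun y => H * ‖y - x‖ ^ b :=
      continuous_const.mul ((continuous_id.sub continuous_const).norm.rpow_const fun _ => Or.inr hb.le)
    simpa [Real.zero_rpow hb.ne'] using this.tendsto x
  exact squeeze_zero (fun _ => norm_nonneg _) (fun y => hh y x) h0

theorem hasDerivAt_line {F : E → ℝ} (hF : ContDiff ℝ 2 F) (x u : E) (t : ℝ) :
    HasDerivAt (fun t : ℝ => F (x + t • u)) (fderiv ℝ F (x + t • u) u) t := by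
  have h1 : HasDerivAt (fun t : ℝ => x + t • u) u t := by
    simpa using ((hasDerivAt_id t).smul_const u).const_add x
  exact ((hF.differentiable (by norm_num) _).hasFDerivAt).comp_hasDerivAt t h1

theorem exists_slope {g g' : ℝ → ℝ} (h : ∀ t, HasDerivAt g (g' t) t) :
    ∃ t ∈ Set.Ioo (0 : ℝ) 1, g 1 - g 0 = g' t := by
  obtain ⟨t, ht, e⟩ := exists_hasDerivAt_eq_slope g g' one_pos
    (fun t _ => (h t).continuousAt.continuousWithinAt) fun t _ => h t
  exact ⟨t, ht, by rw [e]; norm_num⟩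

theorem exists_second_difference {F : E → ℝ} (hF : ContDiff ℝ 2 F) (x a b : E) :
    ∃ y, ‖x - y‖ ≤ ‖a‖ + ‖b‖ ∧
      F (x + a + b) - F (x + a) - F (x + b) + F x = fderiv ℝ (fderiv ℝ F) y b a := by
  obtain ⟨t, ht, e⟩ := exists_slope fun t => (hasDerivAt_line hF (x + b) a t).sub (hasDerivAt_line hF x a t)
  obtain ⟨r, hr, e'⟩ := exists_slope fun r => hasDerivAt_fderiv_line hF (x + t • a) b a r
  refine ⟨x + t • a + r • b, ?_, ?_⟩
  · have : x - (x + t • a + r • b) = -(t • a + r • b) := by abel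
    rw [this, norm_neg]
    refine (norm_add_le _ _).trans (add_le_add ?_ ?_)
    · rw [norm_smul, Real.norm_of_nonneg ht.1.le]
      exact mul_le_of_le_one_left (norm_nonneg _) ht.2.le
    · rw [norm_smul, Real.norm_of_nonneg hr.1.le]
      exact mul_le_of_le_one_left (norm_nonneg _) hr.2.le
  · rw [← e']
    simp only [Pi.sub_apply, one_smul, zero_smul, add_zero] at e ⊢
    rw [add_right_comm x (t • a) b, ← e, add_right_comm x b a]
    ring

theorem hessian_interpolation {F : E → ℝ} (hF : ContDiff ℝ 2 F) {H b ε r : ℝ} (hH : 0 ≤ H) (hb : 0 ≤ b)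
    (hr0 : 0 < r) (hr1 : r ≤ 1) (hε : 0 ≤ ε)
    (hol : ∀ x y, ‖fderiv ℝ (fderiv ℝ F) x - fderiv ℝ (fderiv ℝ F) y‖ ≤ H * ‖x - y‖ ^ b) {x : E}
    (hsup : ∀ y, ‖y - x‖ ≤ 2 → |F y| ≤ ε) :
    ‖fderiv ℝ (fderiv ℝ F) x‖ ≤ 4 * ε / r ^ 2 + H * (2 * r) ^ b := by
  refine ContinuousLinearMap.opNorm_le_bound₂ _ (by positivity) fun u v => ?_
  rcases eq_or_ne u 0 with rfl | hu
  · simp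
  rcases eq_or_ne v 0 with rfl | hv
  · simp
  have hu' := norm_pos_iff.2 hu
  have hv' := norm_pos_iff.2 hv
  have hn : ∀ w : E, w ≠ 0 → ‖(r / ‖w‖) • w‖ = r := fun w hw => by
    rw [norm_smul, Real.norm_of_nonneg (by positivity), div_mul_cancel₀ _ (norm_pos_iff.2 hw).ne']
  obtain ⟨y, hy, e⟩ := exists_second_difference hF x ((r / ‖v‖) • v) ((r / ‖u‖) • u)
  rw [hn u hu, hn v hv] at hy
  have hB : |fderiv ℝ (fderiv ℝ F) y u v| ≤ 4 * ε / r ^ 2 * ‖u‖ * ‖v‖ := by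
    simp only [map_smul, _root_.smul_apply, smul_eq_mul] at e
    have e2 : fderiv ℝ (fderiv ℝ F) y u v = (F (x + (r / ‖v‖) • v + (r / ‖u‖) • u) - F (x + (r / ‖v‖) • v)
        - F (x + (r / ‖u‖) • u) + F x) / r ^ 2 * ‖u‖ * ‖v‖ := by
      rw [e]; field_simp
    rw [e2, abs_mul, abs_mul, abs_norm, abs_norm, abs_div, abs_of_pos (by positivity : (0 : ℝ) < r ^ 2)]
    gcongr
    have b1 := abs_le.1 (hsup (x + (r / ‖v‖) • v + (r / ‖u‖) • u) (by
      rw [add_assoc, add_sub_cancel_left]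
      refine (norm_add_le _ _).trans ?_
      rw [hn u hu, hn v hv]; linarith))
    have b2 := abs_le.1 (hsup (x + (r / ‖v‖) • v) (by rw [add_sub_cancel_left, hn v hv]; linarith))
    have b3 := abs_le.1 (hsup (x + (r / ‖u‖) • u) (by rw [add_sub_cancel_left, hn u hu]; linarith))
    have b4 := abs_le.1 (hsup x (by simp))
    exact abs_le.2 ⟨by linarith [b1.1, b2.2, b3.2, b4.1], by linarith [b1.2, b2.1, b3.1, b4.2]⟩
  have hD : |fderiv ℝ (fderiv ℝ F) x u v - fderiv ℝ (fderiv ℝ F) y u v| ≤ H * (2 * r) ^ b * ‖u‖ * ‖v‖ := by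
    refine ((fderiv ℝ (fderiv ℝ F) x - fderiv ℝ (fderiv ℝ F) y).le_opNorm₂ u v).trans ?_
    gcongr
    refine (hol x y).trans ?_
    gcongr
    linarith
  rw [Real.norm_eq_abs, add_mul, add_mul]
  have := abs_add_le (fderiv ℝ (fderiv ℝ F) y u v) (fderiv ℝ (fderiv ℝ F) x u v - fderiv ℝ (fderiv ℝ F) y u v)
  rw [add_sub_cancel] at this
  linarith

theorem gradient_interpolation {F : E → ℝ} (hF : ContDiff ℝ 2 F) {ε K : ℝ} (hε : 0 ≤ ε) {x : E}
    (hsup : ∀ y, ‖y - x‖ ≤ 1 → |F y| ≤ ε) (hK : ∀ y, ‖y - x‖ ≤ 1 → ‖fderiv ℝ (fderiv ℝ F) y‖ ≤ K) :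
    ‖fderiv ℝ F x‖ ≤ 2 * ε + K := by
  have hK0 : 0 ≤ K := (norm_nonneg (fderiv ℝ (fderiv ℝ F) x)).trans (hK x (by simp))
  refine ContinuousLinearMap.opNorm_le_of_unit_norm (by positivity) fun v hv => ?_
  obtain ⟨t, ht, e⟩ := exists_slope fun t => hasDerivAt_line hF x v t
  obtain ⟨r, hr, e'⟩ := exists_slope fun r => hasDerivAt_fderiv_line hF x (t • v) v r
  have hn : ∀ q : ℝ, q ∈ Set.Icc (0 : ℝ) 1 → ‖x + q • v - x‖ ≤ 1 := fun q hq => by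
    rw [add_sub_cancel_left, norm_smul, hv, mul_one, Real.norm_of_nonneg hq.1]; exact hq.2
  simp only [one_smul, zero_smul, add_zero] at e e'
  have b1 := abs_le.1 (hsup (x + v) (by simpa using hn 1 (by norm_num)))
  have b2 := abs_le.1 (hsup x (by simp))
  have b3 : |fderiv ℝ (fderiv ℝ F) (x + r • t • v) (t • v) v| ≤ K := by
    refine ((fderiv ℝ (fderiv ℝ F) (x + r • t • v)).le_opNorm₂ _ _).trans ?_
    have h1 := hK (x + r • t • v) (by
      rw [smul_smul]
      exact hn _ ⟨mul_nonneg hr.1.le ht.1.le, mul_le_one₀ hr.2.le ht.1.le ht.2.le⟩)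
    have h2 : ‖t • v‖ ≤ 1 := by rw [norm_smul, hv, mul_one, Real.norm_of_nonneg ht.1.le]; exact ht.2.le
    rw [hv, mul_one]
    exact (mul_le_of_le_one_right (norm_nonneg (fderiv ℝ (fderiv ℝ F) (x + r • t • v))) h2).trans h1
  rw [← e'] at b3
  have b4 := abs_le.1 b3
  rw [Real.norm_eq_abs]
  exact abs_le.2 ⟨by linarith [b1.1, b2.2, b4.2], by linarith [b1.2, b2.1, b4.1]⟩

/-- Functions with uniformly Hölder Hessians which converge at an algebraic rate converge in `C²`. -/
theorem exists_C2_limit {f : ℕ → E → ℝ} (hf : ∀ n, ContDiff ℝ 2 (f n)) {H b κ : ℝ} {T : ℝ → ℝ} (hH : 0 ≤ H) (hb : 0 < b)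
    (hκ : 0 < κ)
    (hol : ∀ n, 2 ≤ n → ∀ x y, ‖fderiv ℝ (fderiv ℝ (f n)) x - fderiv ℝ (fderiv ℝ (f n)) y‖ ≤ H * ‖x - y‖ ^ b)
    (hrate : ∀ (R : ℝ) (n m : ℕ) (x : E), 2 ≤ n → n ≤ m → ‖x‖ ≤ R → |f n x - f m x| ≤ T R * (n : ℝ) ^ (-κ)) :
    ∃ σ : E → ℝ, (∀ x, Tendsto (fun n => f n x) atTop (nhds (σ x))) ∧ ContDiff ℝ 2 σ ∧
      (∀ x y, ‖fderiv ℝ (fderiv ℝ σ) x - fderiv ℝ (fderiv ℝ σ) y‖ ≤ H * ‖x - y‖ ^ b) ∧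
      ∀ (R : ℝ) (n : ℕ) (x : E), 2 ≤ n → ‖x‖ ≤ R → ‖fderiv ℝ (fderiv ℝ (f n)) x - fderiv ℝ (fderiv ℝ σ) x‖
        ≤ (4 * |T (R + 2)| + 2 * H * 2 ^ b) * (n : ℝ) ^ (-(κ * b / (2 + b))) := by
  have hd1 : ∀ n, Differentiable ℝ (f n) := fun n => (hf n).differentiable (by norm_num)
  have hd2 : ∀ n, Differentiable ℝ (fderiv ℝ (f n)) := fun n =>
    ((hf n).fderiv_right (m := 1) (by norm_num)).differentiable (by norm_num)
  have e1 : ∀ n m, fderiv ℝ (fun x => f n x - f m x) = fun x => fderiv ℝ (f n) x - fderiv ℝ (f m) x := fun n m =>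
    funext fun x => fderiv_fun_sub (hd1 n x) (hd1 m x)
  have e2 : ∀ n m x, fderiv ℝ (fderiv ℝ (fun x => f n x - f m x)) x
      = fderiv ℝ (fderiv ℝ (f n)) x - fderiv ℝ (fderiv ℝ (f m)) x := fun n m x => by
    rw [e1]; exact fderiv_fun_sub (hd2 n x) (hd2 m x)
  have hT : ∀ (R : ℝ) (n m : ℕ) (x : E), 2 ≤ n → n ≤ m → ‖x‖ ≤ R → |f n x - f m x| ≤ |T R| * (n : ℝ) ^ (-κ) :=
    fun R n m x h1 h2 h3 => (hrate R n m x h1 h2 h3).trans (by gcongr; exact le_abs_self _)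
  have hnorm : ∀ x y : E, ∀ c R : ℝ, ‖x‖ ≤ R → ‖y - x‖ ≤ c → ‖y‖ ≤ R + c := fun x y c R hx hy => by
    have := norm_sub_norm_le y x
    linarith
  set ρ := κ * b / (2 + b) with hρ
  have hρ0 : 0 < ρ := by positivity
  have hρκ : ρ ≤ κ := by rw [hρ, div_le_iff₀ (by linarith)]; nlinarith
  have h2rate : ∀ (R : ℝ) (n m : ℕ) (x : E), 2 ≤ n → n ≤ m → ‖x‖ ≤ R →
      ‖fderiv ℝ (fderiv ℝ (f n)) x - fderiv ℝ (fderiv ℝ (f m)) x‖ ≤ (4 * |T (R + 2)| + 2 * H * 2 ^ b) * (n : ℝ) ^ (-ρ) := by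
    intro R n m x hn hnm hx
    have hn0 : (0 : ℝ) < n := by exact_mod_cast (by omega : 0 < n)
    have hn1 : (1 : ℝ) ≤ n := by exact_mod_cast (by omega : 1 ≤ n)
    have key := hessian_interpolation ((hf n).sub (hf m)) (H := 2 * H) (b := b) (ε := |T (R + 2)| * (n : ℝ) ^ (-κ))
      (r := (n : ℝ) ^ (-(κ / (2 + b)))) (x := x) (by positivity) hb.le (by positivity)
      (Real.rpow_le_one_of_one_le_of_nonpos hn1 (by rw [neg_nonpos]; positivity)) (by positivity) (fun x y => by
        rw [e2, e2]
        have h1 := hol n hn x y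
        have h2 := hol m (hn.trans hnm) x y
        have h3 : ∀ p q p' q' : E →L[ℝ] E →L[ℝ] ℝ, p - q - (p' - q') = (p - p') - (q - q') := fun _ _ _ _ => by abel
        rw [h3]
        refine (norm_sub_le (E := E →L[ℝ] E →L[ℝ] ℝ) _ _).trans ?_
        linarith) (fun y hy => hT _ n m y hn hnm (hnorm x y 2 R hx hy))
    rw [e2] at key
    refine key.trans (le_of_eq ?_)
    have p1 : ((n : ℝ) ^ (-(κ / (2 + b)))) ^ 2 = (n : ℝ) ^ (-(2 * κ / (2 + b))) := by
      rw [← Real.rpow_mul_natCast hn0.le]; congr 1; push_cast; ring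
    have p2 : (n : ℝ) ^ (-κ) = (n : ℝ) ^ (-ρ) * (n : ℝ) ^ (-(2 * κ / (2 + b))) := by
      rw [← Real.rpow_add hn0]; congr 1; rw [hρ]; field_simp; ring
    have p3 : (2 * (n : ℝ) ^ (-(κ / (2 + b)))) ^ b = 2 ^ b * (n : ℝ) ^ (-ρ) := by
      rw [Real.mul_rpow (by norm_num) (by positivity), ← Real.rpow_mul hn0.le]; congr 2; rw [hρ]; ring
    have p4 : (0 : ℝ) < (n : ℝ) ^ (-(2 * κ / (2 + b))) := by positivity
    rw [p1, p2, p3]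
    field_simp
  have h1rate : ∀ (R : ℝ) (n m : ℕ) (x : E), 2 ≤ n → n ≤ m → ‖x‖ ≤ R → ‖fderiv ℝ (f n) x - fderiv ℝ (f m) x‖
      ≤ (2 * |T (R + 1)| + (4 * |T (R + 1 + 2)| + 2 * H * 2 ^ b)) * (n : ℝ) ^ (-ρ) := by
    intro R n m x hn hnm hx
    have hn1 : (1 : ℝ) ≤ n := by exact_mod_cast (by omega : 1 ≤ n)
    have key := gradient_interpolation ((hf n).sub (hf m)) (ε := |T (R + 1)| * (n : ℝ) ^ (-ρ)) (x := x) (by positivity)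
      (fun y hy => (hT _ n m y hn hnm (hnorm x y 1 R hx hy)).trans
        (by gcongr))
      (fun y hy => by rw [e2]; exact h2rate _ n m y hn hnm (hnorm x y 1 R hx hy))
    rw [e1] at key
    exact key.trans (le_of_eq (by ring))
  have ht : ∀ q : ℝ, 0 < q → Tendsto (fun n : ℕ => (n : ℝ) ^ (-q)) atTop (nhds 0) := fun q hq =>
    (tendsto_rpow_neg_atTop hq).comp tendsto_natCast_atTop_atTop
  obtain ⟨σ, hσ, -, -⟩ := exists_limit_of_rate (F := f) (ht κ hκ) hrate
  obtain ⟨σ1, hσ1, -, hu1⟩ := exists_limit_of_rate (W := E →L[ℝ] ℝ) (ht ρ hρ0) h1rate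
  obtain ⟨σ2, hσ2, hr2, hu2⟩ := exists_limit_of_rate (W := E →L[ℝ] E →L[ℝ] ℝ) (ht ρ hρ0) h2rate
  have D1 : ∀ x, HasFDerivAt σ (σ1 x) x := fun x => hasFDerivAt_of_tendstoLocallyUniformlyOn isOpen_univ hu1
    (fun n x _ => (hd1 n x).hasFDerivAt) (fun x _ => hσ x) (Set.mem_univ x)
  have D2 : ∀ x, HasFDerivAt σ1 (σ2 x) x := fun x => hasFDerivAt_of_tendstoLocallyUniformlyOn isOpen_univ hu2
    (fun n x _ => (hd2 n x).hasFDerivAt) (fun x _ => hσ1 x) (Set.mem_univ x)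
  have g1 : fderiv ℝ σ = σ1 := funext fun x => (D1 x).fderiv
  have g2 : fderiv ℝ (fderiv ℝ σ) = σ2 := by rw [g1]; exact funext fun x => (D2 x).fderiv
  obtain ⟨hh, hcont⟩ := holder_limit (W := E →L[ℝ] E →L[ℝ] ℝ) hb hσ2 hol
  refine ⟨σ, hσ, ?_, fun x y => by rw [g2]; exact hh x y, fun R n x hn hx => by rw [g2]; exact hr2 R n x hn hx⟩
  rw [show (2 : WithTop ℕ∞) = 1 + 1 by norm_num, contDiff_succ_iff_fderiv]
  refine ⟨fun x => (D1 x).differentiableAt, by simp, ?_⟩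
  rw [contDiff_one_iff_fderiv, g2, g1]
  exact ⟨fun x => (D2 x).differentiableAt, hcont⟩

end Interpolation

section Normalize
variable {d : ℕ}

theorem sigmaL_sub_const (V : ℝ → ℝ) (c : ℝ) (L : ℕ) (ξ : EuclideanSpace ℝ (Fin d)) :
    sigmaL d (fun t => V t - c) L ξ = sigmaL d V L ξ := by
  obtain ⟨K, hK⟩ : ∃ K : ℝ, ∀ ξ, Zpart d (fun t => V t - c) L ξ = rexp K * Zpart d V L ξ := by
    refine ⟨∑ _x ∈ intr (cube d (L : ℤ)), ∑ _i : Fin d, ∑ _s : Bool, c, fun ξ => ?_⟩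
    rw [Zpart, Zpart, ← integral_const_mul]
    congr 1 with φ
    rw [← Real.exp_add]
    simp only [hamil, Finset.sum_sub_distrib]
    congr 1; ring
  rw [sigmaL, sigmaL, hK, hK, mul_div_mul_left _ _ (Real.exp_pos K).ne']

end Normalize

theorem HPot.of_contDiff {V : ℝ → ℝ} {lam Lam M γ : ℝ} (hlam : 0 < lam) (hγ : γ ∈ Set.Ioc (0 : ℝ) (1 / 4))
    (hV : ContDiff ℝ 2 V) (hb : ∀ t, lam ≤ iteratedDeriv 2 V t ∧ iteratedDeriv 2 V t ≤ Lam)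
    (hH : ∀ s t, |iteratedDeriv 2 V t - iteratedDeriv 2 V s| ≤ M * |t - s| ^ γ) (c : ℝ) :
    HPot lam Lam (max M 0) γ (fun t => V t - c) (deriv V) (iteratedDeriv 2 V) where
  lam_pos := hlam
  M_nonneg := le_max_right _ _
  γ_pos := hγ.1
  γ_le := hγ.2
  hasDeriv t := (hV.differentiable (by norm_num) t).hasDerivAt.sub_const c
  hasDeriv2 t := by
    have h1 : ContDiff ℝ 1 (deriv V) := by
      rw [show (2 : WithTop ℕ∞) = 1 + 1 by norm_num, contDiff_succ_iff_deriv] at hV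
      exact hV.2.2
    have e : iteratedDeriv 2 V = deriv (deriv V) := by rw [iteratedDeriv_succ, iteratedDeriv_one]
    rw [e]
    exact (h1.differentiable (by norm_num) t).hasDerivAt
  cont := hV.continuous_iteratedDeriv 2 le_rfl
  lo t := (hb t).1
  hi t := (hb t).2
  holder s t := (hH s t).trans (by gcongr; exact le_max_left _ _)

theorem fourC_nonneg {l l' M : ℝ} (hl : 0 < l) (hl' : 0 < l') (hM : 0 ≤ M) : 0 ≤ fourC l l' M := by
  rw [fourC]; positivity

theorem surface_tension_C2_regularity
    (d : ℕ) (hd : 2 ≤ d) (gam lam Lam : ℝ)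
    (hgam : gam ∈ Set.Ioc (0 : ℝ) (1 / 4)) (hlam : 0 < lam) (hlamLam : lam ≤ Lam) :
    ∃ β ∈ Set.Ioo (0 : ℝ) (1 / 2),
      ∀ (M R : ℝ), 1 ≤ R → ∃ C : ℝ,
        ∀ V : ℝ → ℝ,
          ContDiff ℝ 2 V → (∀ t, V (-t) = V t) →
          (∀ t, lam ≤ iteratedDeriv 2 V t ∧ iteratedDeriv 2 V t ≤ Lam) →
          (∀ s t, |iteratedDeriv 2 V t - iteratedDeriv 2 V s| ≤ M * |t - s| ^ gam) →
          ∃ σ : EuclideanSpace ℝ (Fin d) → ℝ,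
            (∀ ξ, Tendsto (fun L : ℕ => sigmaL d V L ξ) atTop (nhds (σ ξ))) ∧
            ContDiff ℝ 2 σ ∧
            ∀ ξ ξ' : EuclideanSpace ℝ (Fin d), ‖ξ‖ ≤ R → ‖ξ'‖ ≤ R →
              ‖iteratedFDeriv ℝ 2 σ ξ - iteratedFDeriv ℝ 2 σ ξ'‖ ≤ C * ‖ξ - ξ'‖ ^ β ∧
              ∀ L : ℕ, 2 ≤ L →
                ‖iteratedFDeriv ℝ 2 (sigmaL d V L) ξ - iteratedFDeriv ℝ 2 σ ξ‖
                  ≤ C * (L : ℝ) ^ (-β) := by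
  have : NeZero d := ⟨by omega⟩
  have hLam : 0 < Lam := hlam.trans_le hlamLam
  obtain ⟨kk, hk, hP4⟩ := n4_gradP_box (d := d)
  obtain ⟨s, hs0, hs1, hks⟩ := exists_exponent kk (lam / (2 * (2 * Lam))) hk (by positivity)
  have hb : 0 < gam * s := mul_pos hgam.1 hs0
  have hβ0 : 0 < s / 2 * (gam * s) / (2 + gam * s) := by positivity
  have hββ : s / 2 * (gam * s) / (2 + gam * s) ≤ gam * s := by
    rw [div_le_iff₀ (by linarith)]
    nlinarith
  refine ⟨s / 2 * (gam * s) / (2 + gam * s), ⟨hβ0, ?_⟩, fun M R hR => ?_⟩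
  · rw [div_lt_iff₀ (by linarith)]
    nlinarith
  set β := s / 2 * (gam * s) / (2 + gam * s)
  set H := fourC lam (2 * Lam) (2 * max M 0) * d
  have hfour : 0 ≤ fourC lam (2 * Lam) (2 * max M 0) :=
    fourC_nonneg hlam (by positivity) (mul_nonneg (by norm_num) (le_max_right _ _))
  have hH0 : 0 ≤ H := by positivity
  refine ⟨H * (2 * R) ^ (gam * s - β) + (4 * |tensC d lam Lam (R + 2) s| + 2 * H * 2 ^ (gam * s)), ?_⟩
  intro V hV heven hbound hhol
  have h := HPot.of_contDiff hlam hgam hV hbound hhol (V 0)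
  have heven' : ∀ t, (fun t => V t - V 0) (-t) = (fun t => V t - V 0) t := fun t => by simp only [heven t]
  have e : ∀ L : ℕ, sigmaL d V L = sigmaL d (fun t => V t - V 0) L := fun L =>
    funext fun ξ => (sigmaL_sub_const V (V 0) L ξ).symm
  have hC2 : ∀ L : ℕ, ContDiff ℝ 2 (sigmaL d V L) := fun L => by rw [e]; exact sigmaL_contDiff heven' h L
  obtain ⟨σ, hσ, hσ2, hσH, hσr⟩ := exists_C2_limit (f := sigmaL d V) hC2 (H := H) (b := gam * s) (κ := s / 2)
    (T := fun R => tensC d lam Lam R s) hH0 hb (by linarith)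
    (fun n hn x y => ContinuousLinearMap.opNorm_le_bound₂ _ (by positivity) fun u v => by
      refine (le_iteratedFDeriv_two_sub_norm x y u v).trans ?_
      gcongr
      rw [e]
      exact sigmaL_hessian_holder hk hs0.le (by linarith) hP4 hks heven' h hfour (by omega) x y)
    (fun R n m x hn hnm hx => by
      rw [e, e]
      exact sigmaL_cauchy hk hs0 hs1 hP4 hks h heven' (sub_self _) hx hn hnm)
  refine ⟨σ, hσ, hσ2, fun ξ ξ' hξ hξ' => ⟨?_, fun L hL => ?_⟩⟩
  · refine iteratedFDeriv_two_sub_norm_le (by positivity) fun u v => ?_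
    refine ((fderiv ℝ (fderiv ℝ σ) ξ - fderiv ℝ (fderiv ℝ σ) ξ').le_opNorm₂ u v).trans ?_
    gcongr
    refine (hσH ξ ξ').trans ?_
    have h1 : ‖ξ - ξ'‖ ≤ 2 * R := (norm_sub_le _ _).trans (by linarith)
    have h2 : ‖ξ - ξ'‖ ^ (gam * s) = ‖ξ - ξ'‖ ^ (gam * s - β) * ‖ξ - ξ'‖ ^ β := by
      rw [← Real.rpow_add_of_nonneg (norm_nonneg _) (by linarith) hβ0.le, sub_add_cancel]
    rw [h2, ← mul_assoc]
    gcongr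
    have h3 : ‖ξ - ξ'‖ ^ (gam * s - β) ≤ (2 * R) ^ (gam * s - β) :=
      Real.rpow_le_rpow (norm_nonneg _) h1 (by linarith)
    have h4 := mul_le_mul_of_nonneg_left h3 hH0
    have h5 : 0 ≤ 4 * |tensC d lam Lam (R + 2) s| + 2 * H * 2 ^ (gam * s) := by positivity
    linarith
  · refine iteratedFDeriv_two_sub_norm_le (by positivity) fun u v => ?_
    refine ((fderiv ℝ (fderiv ℝ (sigmaL d V L)) ξ - fderiv ℝ (fderiv ℝ σ) ξ).le_opNorm₂ u v).trans ?_
    gcongr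
    refine (hσr R L ξ hL hξ).trans ?_
    have h3 : 0 ≤ H * (2 * R) ^ (gam * s - β) := by positivity
    exact mul_le_mul_of_nonneg_right (le_add_of_nonneg_left h3) (by positivity)

end
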